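/- Let δ ∈ (0.713611, 0.713614) be a real number satisfying 0 = 1 + ∫₀^∞ (ξ(v) − (v+2)e^{−2γ}) (v+1)^{−δ−1} dv + e^{−2γ}/δ + e^{−2γ}/(δ−1), and let a be a constant with a < (1−δ)/(2−δ). Suppose θ : ℕ → ℝ satisfies max(2, n) ≤ θ(n) for all n ≥ 1 and θ(n) ≤ K n exp((log n)^a) for all n ≥ 1 and some constant K. Then there is a positive constant ν_θ such that Σ_{n ∈ B_θ, n ≤ x} τ(n) = ν_θ x (log x)^δ + O(x) for x ≥ 2, where the implied constant may depend on θ and a. -/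

import Mathlib

open Real MeasureTheory

/-- The set `B_θ`: `1 ∈ B_θ`, and `n = p₁^{α₁}⋯p_k^{α_k}` (with `p₁ < ⋯ < p_k`) belongs to
`B_θ` iff `p_i ≤ θ(p₁^{α₁}⋯p_{i-1}^{α_{i-1}})` for all `i`. -/
def Bset (θ : ℕ → ℝ) : Set ℕ :=
  {n | 0 < n ∧ ∀ p : ℕ, p.Prime → p ∣ n →
    (p : ℝ) ≤ θ (∏ q ∈ n.primeFactors.filter (· < p), q ^ n.factorization q)}

open Classical in
/-- `T x = ∑_{n ∈ B_θ, n ≤ x} τ(n)`. -/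
noncomputable def T (θ : ℕ → ℝ) (x : ℝ) : ℝ :=
  ∑ n ∈ (Finset.Icc 1 ⌊x⌋₊).filter (fun n => n ∈ Bset θ), (n.divisors.card : ℝ)

notation "lI" => (by linarith)
notation "nN" => (by norm_num)
notation "pV" => (by positivity)
notation "fP" => (by fun_prop)
notation "sI" => (by simp)
notation "oM" => (by omega)
notation "o0" => (0 : ℝ)
notation "o1" => (1 : ℝ)
notation "o2" => (2 : ℝ)
notation "oq" => (1/4 : ℝ)
notation "o8" => (-0.8 : ℝ)
notation "o7" => (-1.72 : ℝ)
notation "o3" => (1.003 : ℝ)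
notation "o5" => (0.2 : ℝ)
notation "o72" => (-0.72 : ℝ)
notation "o27" => (-2.72 : ℝ)
notation "o01" => (-0.1 : ℝ)

open Real MeasureTheory
noncomputable section PNT
namespace PN
open Complex Filter Topology
def gz (n : ℕ) (s : ℂ) : ℂ :=
  (s - 1) * ((n : ℂ) + 2) ^ (-s) + ((n : ℂ) + 2) ^ (1 - s) - ((n : ℂ) + 1) ^ (1 - s)
lemma gz_diff (n : ℕ) : Differentiable ℂ (gz n) := by
  have h1 : ((n : ℂ) + 2) ≠ 0 := by exact_mod_cast (by omega : n + 2 ≠ 0)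
  have h2 : ((n : ℂ) + 1) ≠ 0 := by exact_mod_cast (by omega : n + 1 ≠ 0)
  unfold gz
  refine ((((differentiable_id.sub_const 1).mul ?_).add ?_).sub ?_)
  · exact fun s => (differentiableAt_id.neg).const_cpow (Or.inl h1)
  · exact fun s => ((differentiableAt_const _).sub differentiableAt_id).const_cpow (Or.inl h1)
  · exact fun s => ((differentiableAt_const _).sub differentiableAt_id).const_cpow (Or.inl h2)
lemma cpow_diff_bd {a : ℝ} (ha : 0 < a) {s : ℂ} (hs : 0 ≤ s.re) {x y : ℝ} (hx : a ≤ x) (hy : a ≤ y)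
    (hxy : |y - x| ≤ 1) :
    ‖(y : ℂ) ^ (-s) - (x : ℂ) ^ (-s)‖ ≤ ‖s‖ * a ^ (-s.re - 1) := by
  have hd : ∀ u ∈ Set.Ici a, HasDerivWithinAt (fun u : ℝ => (u : ℂ) ^ (-s))
      ((-s) * (u : ℂ) ^ (-s - 1)) (Set.Ici a) u := by
    intro u hu
    have hu0 : 0 < u := lt_of_lt_of_le ha hu
    by_cases h0 : s = 0
    · subst h0; simpa using hasDerivWithinAt_const u (Set.Ici a) (1:ℂ)
    exact (hasDerivAt_ofReal_cpow_const hu0.ne' (neg_ne_zero.mpr h0)).hasDerivWithinAt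
  have := (convex_Ici a).norm_image_sub_le_of_norm_hasDerivWithin_le (C := ‖s‖ * a ^ (-s.re - 1)) hd
    (by
      intro u hu
      have hu0 : 0 < u := lt_of_lt_of_le ha hu
      rw [norm_mul, norm_neg, norm_cpow_eq_rpow_re_of_pos hu0]
      gcongr
      simp
      exact Real.rpow_le_rpow_of_nonpos ha hu lI) hx hy
  refine this.trans ?_
  rw [Real.norm_eq_abs]
  exact mul_le_of_le_one_right pV hxy
lemma gz_bd (n : ℕ) {s : ℂ} (hs : 0 ≤ s.re) :
    ‖gz n s‖ ≤ ‖s - 1‖ * ‖s‖ * ((n : ℝ) + 1) ^ (-s.re - 1) := by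
  by_cases h1 : s = 1
  · subst h1; simp [gz]
  have hn : o0 < n + 1 := pV
  have hd : ∀ u ∈ Set.Icc ((n : ℝ) + 1) (n + 2), HasDerivWithinAt
      (fun u : ℝ => (s - 1) * ((n : ℂ) + 2) ^ (-s) * (u : ℂ) + (u : ℂ) ^ (1 - s))
      ((s - 1) * ((n : ℂ) + 2) ^ (-s) * 1 + (1 - s) * (u : ℂ) ^ (1 - s - 1))
      (Set.Icc ((n : ℝ) + 1) (n + 2)) u := by
    intro u hu
    have hu0 : 0 < u := lt_of_lt_of_le hn hu.1
    exact ((ofRealCLM.hasDerivAt.const_mul _).add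
      (hasDerivAt_ofReal_cpow_const hu0.ne' (by
        intro h; exact h1 (sub_eq_zero.mp h).symm))).hasDerivWithinAt
  have := (convex_Icc ((n : ℝ) + 1) (n + 2)).norm_image_sub_le_of_norm_hasDerivWithin_le
    (C := ‖s - 1‖ * (‖s‖ * ((n : ℝ) + 1) ^ (-s.re - 1))) hd
    (by
      intro u hu
      have e : (s - 1) * ((n : ℂ) + 2) ^ (-s) * 1 + (1 - s) * (u : ℂ) ^ (1 - s - 1)
        = (s - 1) * ((((n : ℝ) + 2 : ℝ) : ℂ) ^ (-s) - (u : ℂ) ^ (-s)) := by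
        push_cast
        rw [show (1 - s - 1) = -s by ring]; ring
      rw [e, norm_mul]
      gcongr
      apply cpow_diff_bd hn hs hu.1 lI
      rw [abs_le]; constructor <;> linarith [hu.1, hu.2]) (x := (n:ℝ)+1) (y := (n:ℝ)+2) sI sI
  have e2 : gz n s = ((s - 1) * ((n : ℂ) + 2) ^ (-s) * (((n : ℝ) + 2 : ℝ) : ℂ) + (((n : ℝ) + 2 : ℝ) : ℂ) ^ (1 - s)) -
    ((s - 1) * ((n : ℂ) + 2) ^ (-s) * (((n : ℝ) + 1 : ℝ) : ℂ) + (((n : ℝ) + 1 : ℝ) : ℂ) ^ (1 - s)) := by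
    unfold gz; push_cast; ring
  rw [e2]
  refine this.trans (le_of_eq ?_)
  rw [show (n : ℝ) + 2 - (n + 1) = 1 by ring]; simp; ring
lemma sum_pow (a : ℝ) (ha : a < -1) : Summable (fun n : ℕ => ((n : ℝ) + 1) ^ a) := by
  have := (summable_nat_add_iff 1).mpr (Real.summable_nat_rpow.mpr ha)
  simpa using this
lemma gz_summable {s : ℂ} (hs : 0 < s.re) : Summable (fun n => gz n s) :=
  Summable.of_norm_bounded ((sum_pow (-s.re - 1) lI).mul_left (‖s - 1‖ * ‖s‖))
    (fun n => gz_bd n hs.le)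
lemma gz_sum_range (N : ℕ) (s : ℂ) : ∑ n ∈ Finset.range N, gz n s =
    (s - 1) * (∑ n ∈ Finset.range N, ((n : ℂ) + 2) ^ (-s)) + ((N : ℂ) + 1) ^ (1 - s) - 1 := by
  induction N with
  | zero => simp
  | succ N ih =>
    rw [Finset.sum_range_succ, ih, Finset.sum_range_succ]
    unfold gz; push_cast
    rw [show (N : ℂ) + 1 + 1 = N + 2 by ring]; ring
lemma gz_diffOn : DifferentiableOn ℂ (fun s => ∑' n, gz n s) {s | 0 < s.re} := by
  intro s hs
  have hs' : 0 < s.re := hs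
  set U : Set ℂ := {w | s.re / 2 < w.re ∧ ‖w‖ < ‖s‖ + 1} with hU
  have hUo : IsOpen U := (isOpen_lt continuous_const continuous_re).inter
    (isOpen_lt continuous_norm continuous_const)
  have : DifferentiableOn ℂ (fun s => ∑' n, gz n s) U := by
    refine differentiableOn_tsum_of_summable_norm (u := fun n : ℕ =>
      ((‖s‖ + 1 + 1) * (‖s‖ + 1)) * ((n : ℝ) + 1) ^ (-(s.re / 2) - 1))
      ((sum_pow _ lI).mul_left _) (fun n => (gz_diff n).differentiableOn) hUo ?_
    intro n w hw
    refine (gz_bd n (by linarith [hw.1])).trans ?_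
    have h1 : ‖w - 1‖ ≤ ‖w‖ + 1 := by simpa using norm_sub_le w 1
    gcongr
    · linarith [hw.2]
    · exact hw.2.le
    · linarith
    · exact hw.1.le
  exact (this.differentiableAt (hUo.mem_nhds ⟨lI, lI⟩)).differentiableWithinAt
lemma zeta1_eq {s : ℂ} (hs : 0 < s.re) : riemannZeta₁ s = s + ∑' n, gz n s := by
  have hO : IsOpen {s : ℂ | 0 < s.re} := isOpen_lt continuous_const continuous_re
  have hA : AnalyticOnNhd ℂ riemannZeta₁ {s : ℂ | 0 < s.re} :=
    differentiable_riemannZeta₁.differentiableOn.analyticOnNhd hO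
  have hB : AnalyticOnNhd ℂ (fun s => s + ∑' n, gz n s) {s : ℂ | 0 < s.re} :=
    (differentiableOn_id.add gz_diffOn).analyticOnNhd hO
  refine hA.eqOn_of_preconnected_of_eventuallyEq hB (convex_halfSpace_re_gt 0).isPreconnected
    (z₀ := 2) sI ?_ hs
  filter_upwards [(isOpen_lt continuous_const continuous_re).mem_nhds
    (show (2:ℂ) ∈ {s : ℂ | 1 < s.re} by simp)] with w hw
  have hw' : 1 < w.re := hw
  have hw1 : w ≠ 1 := by rintro rfl; simp at hw'
  have h1 : riemannZeta₁ w = (w - 1) * riemannZeta w := by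
    rw [riemannZeta_eq_inv_sub_mul hw1, ← mul_assoc, mul_inv_cancel₀ (sub_ne_zero.mpr hw1), one_mul]
  have hz := zeta_eq_tsum_one_div_nat_add_one_cpow hw'
  have hsum : Summable (fun n : ℕ => 1 / ((n : ℂ) + 1) ^ w) := by
    have := (summable_nat_add_iff 1).mpr (Complex.summable_one_div_nat_cpow.mpr hw')
    simpa using this
  have hsum2 : Summable (fun n : ℕ => ((n : ℂ) + 2) ^ (-w)) := by
    have := (summable_nat_add_iff 1).mpr hsum
    refine this.congr (fun n => ?_)
    push_cast
    rw [Complex.cpow_neg, one_div, show (n : ℂ) + 1 + 1 = n + 2 by ring]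
  have hlim := (gz_summable (by linarith : 0 < w.re)).hasSum.tendsto_sum_nat
  have hlim2 : Tendsto (fun N => ∑ n ∈ Finset.range N, gz n w) atTop
      (𝓝 ((w - 1) * (∑' n : ℕ, ((n : ℂ) + 2) ^ (-w)) + 0 - 1)) := by
    simp_rw [gz_sum_range]
    refine ((hsum2.hasSum.tendsto_sum_nat.const_mul _).add ?_).sub_const 1
    rw [tendsto_zero_iff_norm_tendsto_zero]
    have h3 : Tendsto (fun N : ℕ => ((N + 1 : ℕ) : ℝ) ^ (-(w.re - 1))) atTop (𝓝 0) :=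
      (tendsto_rpow_neg_atTop lI).comp (tendsto_natCast_atTop_atTop.comp (tendsto_add_atTop_nat 1))
    refine h3.congr (fun N => ?_)
    have := norm_cpow_eq_rpow_re_of_pos (show o0 < ((N + 1 : ℕ) : ℝ) by positivity) (1 - w)
    push_cast at this ⊢
    rw [this]; simp
  have he := tendsto_nhds_unique hlim hlim2
  change riemannZeta₁ w = w + ∑' n, gz n w
  rw [he, h1, hz, hsum.tsum_eq_zero_add]
  simp only [Nat.cast_zero, zero_add, one_cpow]
  have : ∀ n : ℕ, 1 / (((n + 1 : ℕ) : ℂ) + 1) ^ w = ((n : ℂ) + 2) ^ (-w) := by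
    intro n; push_cast
    rw [Complex.cpow_neg, one_div, show (n : ℂ) + 1 + 1 = n + 2 by ring]
  simp_rw [this]
  ring
lemma zeta1_bd : ∃ C : ℝ, 0 < C ∧ ∀ s : ℂ, 0.998 ≤ s.re → s.re ≤ 3 →
    ‖riemannZeta₁ s‖ ≤ C * (3 + |s.im|) ^ o3 := by
  set S := ∑' n : ℕ, ((n : ℝ) + 1) ^ (-1.001 : ℝ) with hS
  have hSs := sum_pow (-1.001) nN
  have hS0 : 0 ≤ S := tsum_nonneg (fun n => pV)
  refine ⟨4 + 3 * S, pV, fun s h1 h2 => ?_⟩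
  set τ := 3 + |s.im| with hτ
  have hτ3 : 3 ≤ τ := by have := abs_nonneg s.im; linarith
  have hτ0 : 0 < τ := lI
  set N := ⌊τ⌋₊ with hN
  have hN1 : (N : ℝ) ≤ τ := Nat.floor_le hτ0.le
  have hN2 : τ < N + 1 := Nat.lt_floor_add_one τ
  have hns : ‖s‖ ≤ τ := by
    refine (norm_le_abs_re_add_abs_im s).trans ?_
    rw [abs_of_nonneg lI]; linarith
  have hns1 : ‖s - 1‖ ≤ τ := by
    refine (norm_le_abs_re_add_abs_im _).trans ?_
    have : |(s - 1).re| ≤ 3 := by simp; rw [abs_le]; constructor <;> linarith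
    simp at this ⊢; linarith
  have hτe : τ ≤ τ ^ o3 := by
    conv_lhs => rw [← Real.rpow_one τ]
    exact Real.rpow_le_rpow_of_exponent_le lI nN
  have h2τ : ((N : ℝ) + 1) ^ (0.003 : ℝ) ≤ 2 * τ ^ (0.003 : ℝ) := by
    calc ((N : ℝ) + 1) ^ (0.003 : ℝ) ≤ (2 * τ) ^ (0.003 : ℝ) := by gcongr; linarith
      _ = 2 ^ (0.003 : ℝ) * τ ^ (0.003 : ℝ) := Real.mul_rpow nN hτ0.le
      _ ≤ 2 ^ o1 * τ ^ (0.003 : ℝ) := by gcongr <;> norm_num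
      _ = _ := nN
  have hττ : τ * τ ^ (0.003 : ℝ) = τ ^ o3 := by
    conv_lhs => rw [← Real.rpow_one τ, ← Real.rpow_mul hτ0.le, ← Real.rpow_add hτ0]
    norm_num
  have hA : ‖∑ n ∈ Finset.range N, ((n : ℂ) + 2) ^ (-s)‖ ≤ 2 * τ ^ (0.003 : ℝ) * S := by
    refine (norm_sum_le _ _).trans ?_
    calc _ ≤ ∑ n ∈ Finset.range N, (2 * τ ^ (0.003 : ℝ)) * ((n : ℝ) + 1) ^ (-1.001 : ℝ) := by
          apply Finset.sum_le_sum
          intro n hn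
          have hn' : (n : ℝ) + 1 ≤ N := by exact_mod_cast Finset.mem_range.mp hn
          have := norm_cpow_eq_rpow_re_of_pos (show o0 < ((n:ℝ) + 2) by positivity) (-s)
          push_cast at this
          rw [this]
          calc ((n : ℝ) + 2) ^ (-s).re ≤ ((n : ℝ) + 2) ^ (0.003 + -1.001 : ℝ) := by
                apply Real.rpow_le_rpow_of_exponent_le (by linarith [(Nat.cast_nonneg n : o0 ≤ n)])
                simp; linarith
            _ = ((n : ℝ) + 2) ^ (0.003 : ℝ) * ((n : ℝ) + 2) ^ (-1.001 : ℝ) := Real.rpow_add pV _ _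
            _ ≤ ((N : ℝ) + 1) ^ (0.003 : ℝ) * ((n : ℝ) + 1) ^ (-1.001 : ℝ) := by
                gcongr ?_ ^ _ * ?_
                · linarith
                · apply Real.rpow_le_rpow_of_nonpos pV lI nN
            _ ≤ _ := by gcongr
      _ = (2 * τ ^ (0.003 : ℝ)) * ∑ n ∈ Finset.range N, ((n : ℝ) + 1) ^ (-1.001 : ℝ) := by rw [Finset.mul_sum]
      _ ≤ _ := by
          gcongr
          exact hSs.sum_le_tsum _ (fun n _ => pV)
  have hB : ‖∑' n, gz (n + N) s‖ ≤ τ ^ o3 * S := by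
    have hb : ∀ n : ℕ, ‖gz (n + N) s‖ ≤ τ ^ o3 * ((n : ℝ) + 1) ^ (-1.001 : ℝ) := by
      intro n
      refine (gz_bd (n + N) lI).trans ?_
      calc ‖s - 1‖ * ‖s‖ * (((n + N : ℕ) : ℝ) + 1) ^ (-s.re - 1)
          ≤ τ * τ * (((n : ℝ) + 1) ^ (-1.001 : ℝ) * τ ^ (-0.997 : ℝ)) := by
            gcongr
            calc (((n + N : ℕ) : ℝ) + 1) ^ (-s.re - 1) ≤ (((n + N : ℕ) : ℝ) + 1) ^ (-1.001 + -0.997 : ℝ) := by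
                  apply Real.rpow_le_rpow_of_exponent_le (by linarith [(Nat.cast_nonneg (n+N) : o0 ≤ (n+N:ℕ))])
                  linarith
              _ = (((n + N : ℕ) : ℝ) + 1) ^ (-1.001 : ℝ) * (((n + N : ℕ) : ℝ) + 1) ^ (-0.997 : ℝ) := Real.rpow_add pV _ _
              _ ≤ _ := by
                  have hnn := (Nat.cast_nonneg n : o0 ≤ n)
                  gcongr ?_ * ?_
                  · apply Real.rpow_le_rpow_of_nonpos pV (by push_cast; linarith) nN
                  · apply Real.rpow_le_rpow_of_nonpos pV (by push_cast; linarith) nN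
        _ = τ ^ o3 * ((n : ℝ) + 1) ^ (-1.001 : ℝ) := by
            have : τ * τ * τ ^ (-0.997 : ℝ) = τ ^ o3 := by
              conv_lhs => rw [← Real.rpow_one τ, ← Real.rpow_mul hτ0.le, ← Real.rpow_add hτ0, ← Real.rpow_add hτ0]
              norm_num
            rw [← this]; ring
    exact (tsum_of_norm_bounded (hSs.hasSum.mul_left _) hb)
  have hC : ‖((N : ℂ) + 1) ^ (1 - s)‖ ≤ 2 * τ := by
    have := norm_cpow_eq_rpow_re_of_pos (show o0 < ((N:ℝ) + 1) by positivity) (1 - s)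
    push_cast at this
    rw [this]
    calc ((N : ℝ) + 1) ^ (1 - s).re ≤ ((N : ℝ) + 1) ^ (0.003 : ℝ) := by
          apply Real.rpow_le_rpow_of_exponent_le lI
          simp; linarith
      _ ≤ 2 * τ ^ (0.003 : ℝ) := h2τ
      _ ≤ 2 * τ ^ o1 := by gcongr <;> linarith
      _ = _ := sI
  have hsum := gz_summable (s := s) lI
  rw [zeta1_eq lI, ← hsum.sum_add_tsum_nat_add N, gz_sum_range]
  have e : s + ((s - 1) * (∑ n ∈ Finset.range N, ((n : ℂ) + 2) ^ (-s)) + ((N : ℂ) + 1) ^ (1 - s) - 1 + ∑' n, gz (n + N) s)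
    = (s - 1) + (s - 1) * (∑ n ∈ Finset.range N, ((n : ℂ) + 2) ^ (-s)) + ((N : ℂ) + 1) ^ (1 - s) + ∑' n, gz (n + N) s := by ring
  rw [e]
  refine (norm_add₄_le).trans ?_
  rw [norm_mul]
  have h5 : ‖s - 1‖ * ‖∑ n ∈ Finset.range N, ((n : ℂ) + 2) ^ (-s)‖ ≤ 2 * S * τ ^ o3 := by
    calc _ ≤ τ * (2 * τ ^ (0.003 : ℝ) * S) := by gcongr
      _ = _ := by rw [← hττ]; ring
  nlinarith
lemma tau_shift {C x y : ℝ} (hC : 0 < C) (hxy : |x - y| ≤ 0.001) :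
    C * (3 + |x|) ^ o3 ≤ 4 * C * (3 + |y|) ^ o3 := by
  have h : |x| ≤ |y| + 0.001 := by
    have := abs_sub_abs_le_abs_sub x y; linarith
  have h0 := abs_nonneg y
  have h00 := abs_nonneg x
  calc C * (3 + |x|) ^ o3 ≤ C * (2 * (3 + |y|)) ^ o3 := by gcongr; linarith
    _ = C * (2 ^ o3 * (3 + |y|) ^ o3) := by rw [Real.mul_rpow nN lI]
    _ ≤ C * (2 ^ o2 * (3 + |y|) ^ o3) := by gcongr <;> norm_num
    _ = _ := by norm_num; ring
lemma deriv_bd {f : ℂ → ℂ} (hf : Differentiable ℂ f) {C a b : ℝ} (hC : 0 < C)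
    (h : ∀ s : ℂ, a ≤ s.re → s.re ≤ b → ‖f s‖ ≤ C * (3 + |s.im|) ^ o3) (s : ℂ)
    (h1 : a + 0.001 ≤ s.re) (h2 : s.re ≤ b - 0.001) :
    ‖deriv f s‖ ≤ (4000 * C) * (3 + |s.im|) ^ o3 := by
  have := norm_deriv_le_of_forall_mem_sphere_norm_le (f := f) (c := s) (R := 0.001)
    (C := 4 * C * (3 + |s.im|) ^ o3) nN hf.diffContOnCl (by
      intro z hz
      have hz' : ‖z - s‖ = 0.001 := by simpa [dist_eq_norm] using hz
      have hr := (abs_re_le_norm (z - s)).trans hz'.le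
      have hi := (abs_im_le_norm (z - s)).trans hz'.le
      simp at hr hi
      rw [abs_le] at hr
      exact (h z (by linarith [hr.1]) (by linarith [hr.2])).trans (tau_shift hC hi))
  refine this.trans (le_of_eq ?_)
  rw [div_eq_iff nN]; ring
lemma zeta1_bds : ∃ C : ℝ, 0 < C ∧ ∀ s : ℂ, 1 ≤ s.re → s.re ≤ 2.5 →
    ‖riemannZeta₁ s‖ ≤ C * (3 + |s.im|) ^ o3 ∧
    ‖deriv riemannZeta₁ s‖ ≤ C * (3 + |s.im|) ^ o3 ∧
    ‖deriv (deriv riemannZeta₁) s‖ ≤ C * (3 + |s.im|) ^ o3 := by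
  obtain ⟨C, hC, h⟩ := zeta1_bd
  have h1 := deriv_bd differentiable_riemannZeta₁ hC h
  have hd : Differentiable ℂ (deriv riemannZeta₁) := fun s =>
    (differentiable_riemannZeta₁.analyticAt s).deriv.differentiableAt
  have h2 := deriv_bd hd (C := 4000 * C) pV h1
  refine ⟨4000 * (4000 * C), pV, fun s hs1 hs2 => ?_⟩
  have hp : 0 < (3 + |s.im|) ^ o3 := Real.rpow_pos_of_pos pV _
  have hCp := mul_pos hC hp
  have h0 := h s lI lI
  have h1' := h1 s lI lI
  have h2' := h2 s lI lI
  exact ⟨lI, lI, h2'⟩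
lemma zeta1_mul {s : ℂ} (hs : s ≠ 1) : riemannZeta₁ s = (s - 1) * riemannZeta s := by
  rw [riemannZeta_eq_inv_sub_mul hs, ← mul_assoc, mul_inv_cancel₀ (sub_ne_zero.mpr hs), one_mul]
lemma zeta1_ne {s : ℂ} (hs : 1 ≤ s.re) : riemannZeta₁ s ≠ 0 := by
  by_cases h : s = 1
  · rw [h, riemannZeta₁_one]; exact one_ne_zero
  · rw [zeta1_mul h]
    exact mul_ne_zero (sub_ne_zero.mpr h) (riemannZeta_ne_zero_of_one_le_re hs)
lemma three41 {x : ℝ} (hx : 0 < x) (y : ℝ) :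
    1 ≤ ‖riemannZeta (1 + x)‖ ^ 3 * ‖riemannZeta (1 + x + I * y)‖ ^ 4 * ‖riemannZeta (1 + x + 2 * I * y)‖ := by
  have h := DirichletCharacter.norm_LSeries_product_ge_one (N := 1) 1 hx y
  have e : ∀ s : ℂ, 1 < s.re → LSeries (fun n : ℕ => (1 : DirichletCharacter ℂ 1) n) s = riemannZeta s := by
    intro s hs
    rw [← LSeries_one_eq_riemannZeta hs]
    apply LSeries_congr
    intro n _
    have : ((n : ℕ) : ZMod 1) = 1 := Subsingleton.elim _ _
    rw [this]; simp
  rw [one_pow, e _ (by simp [hx]), e _ (by simp [hx]), e _ (by simp [hx])] at h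
  simpa [norm_mul, norm_pow] using h
lemma zeta1_lower1 : ∃ c : ℝ, 0 < c ∧ ∀ σ t : ℝ, 0 < σ → σ ≤ 1 → 1 ≤ |t| →
    c * (σ ^ (0.75 : ℝ) * |t| ^ (0.99925 : ℝ)) ≤ ‖riemannZeta₁ (1 + σ + I * t)‖ := by
  obtain ⟨C, hC, h⟩ := zeta1_bds
  set D := (C * 3 ^ o3) ^ 3 * (C * 5 ^ o3) with hD
  have hD0 : 0 < D := pV
  refine ⟨D⁻¹ ^ (0.25 : ℝ), pV, fun σ t h0 h1 ht => ?_⟩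
  have ht0 : 0 < |t| := lI
  have hz := three41 h0 t
  have n1 : (1 + σ : ℂ) ≠ 1 := by simp; exact_mod_cast h0.ne'
  have n2 : (1 + σ + I * t : ℂ) ≠ 1 := by
    intro h; have := congrArg re h; simp at this; exact h0.ne' this
  have n3 : (1 + σ + 2 * I * t : ℂ) ≠ 1 := by
    intro h; have := congrArg re h; simp at this; exact h0.ne' this
  have b1 := (h (1 + σ) (by simp; linarith) (by simp; linarith)).1
  have b3 := (h (1 + σ + 2 * I * t) (by simp; linarith) (by simp; linarith)).1
  have i1 : ((1 + σ : ℂ)).im = 0 := sI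
  have i3 : ((1 + σ + 2 * I * t : ℂ)).im = 2 * t := sI
  rw [i1] at b1; rw [i3] at b3
  rw [zeta1_mul n1, norm_mul] at b1
  rw [zeta1_mul n3, norm_mul] at b3
  have e1 : ‖(1 + σ - 1 : ℂ)‖ = σ := by simp [abs_of_pos h0]
  have e3 : |t| ≤ ‖(1 + σ + 2 * I * t - 1 : ℂ)‖ := by
    refine le_trans ?_ (abs_im_le_norm _)
    simp [abs_mul]; linarith
  have e2 : |t| ≤ ‖(1 + σ + I * t - 1 : ℂ)‖ := by
    refine le_trans ?_ (abs_im_le_norm _)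
    simp
  rw [e1] at b1
  have b3' : |t| * ‖riemannZeta (1 + σ + 2 * I * t)‖ ≤ C * 5 ^ o3 * |t| ^ o3 := by
    calc |t| * ‖riemannZeta (1 + σ + 2 * I * t)‖ ≤ C * (3 + |2 * t|) ^ o3 :=
          le_trans (by gcongr) b3
      _ ≤ C * (5 * |t|) ^ o3 := by gcongr; rw [abs_mul]; simp; linarith
      _ = _ := by rw [Real.mul_rpow nN ht0.le]; ring
  rw [zeta1_mul n2, norm_mul]
  set A := ‖riemannZeta (1 + σ)‖
  set B := ‖riemannZeta (1 + σ + I * t)‖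
  set E := ‖riemannZeta (1 + σ + 2 * I * t)‖
  have hA : 0 ≤ A := norm_nonneg _
  have hB : 0 ≤ B := norm_nonneg _
  have hE : 0 ≤ E := norm_nonneg _
  have key : σ ^ 3 * |t| ^ 5 ≤ D * |t| ^ o3 * (|t| * B) ^ 4 * 1 := by
    calc σ ^ 3 * |t| ^ 5 ≤ σ ^ 3 * |t| ^ 5 * (A ^ 3 * B ^ 4 * E) := le_mul_of_one_le_right pV hz
      _ = (σ * A) ^ 3 * (|t| * E) * (|t| * B) ^ 4 := by ring
      _ ≤ (C * (3 + |0|) ^ o3) ^ 3 * (C * 5 ^ o3 * |t| ^ o3) * (|t| * B) ^ 4 := by gcongr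
      _ = _ := by rw [hD, abs_zero, add_zero]; ring
  have key2 : D⁻¹ * (σ ^ 3 * |t| ^ (3.997 : ℝ)) ≤ (|t| * B) ^ 4 := by
    rw [inv_mul_le_iff₀ hD0]
    have hp : 0 < |t| ^ o3 := pV
    have : |t| ^ (3.997 : ℝ) * |t| ^ o3 = |t| ^ 5 := by
      rw [← Real.rpow_add ht0, ← Real.rpow_natCast]; norm_num
    refine le_of_mul_le_mul_right ?_ hp
    calc _ = σ ^ 3 * |t| ^ 5 := by rw [← this]; ring
      _ ≤ _ := lI
  have key3 := Real.rpow_le_rpow pV key2 (show o0 ≤ 0.25 by norm_num)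
  rw [Real.mul_rpow pV pV, Real.mul_rpow pV pV,
    ← Real.rpow_natCast, ← Real.rpow_natCast, ← Real.rpow_mul h0.le, ← Real.rpow_mul pV, ← Real.rpow_mul pV] at key3
  norm_num at key3
  norm_num
  refine key3.trans ?_
  gcongr
lemma zeta1_lower : ∃ c : ℝ, 0 < c ∧ ∀ σ t : ℝ, 0 < σ → σ ≤ 1 → 1 ≤ |t| →
    c * |t| ^ (0.988 : ℝ) ≤ ‖riemannZeta₁ (1 + σ + I * t)‖ := by
  obtain ⟨C, hC, h⟩ := zeta1_bds
  obtain ⟨c, hc, h1⟩ := zeta1_lower1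
  set C' := C * 4 ^ o3 with hC'
  have hC'0 : 0 < C' := pV
  set r := min 1 (c / (2 * C')) with hr
  have hr0 : 0 < r := lt_min one_pos pV
  have hr1 : r ≤ 1 := min_le_left _ _
  have hr2 : r * (2 * C') ≤ c := by rw [← le_div_iff₀ pV]; exact min_le_right _ _
  have r4 : (r ^ 4) ^ (0.75 : ℝ) = r ^ 3 := by
    rw [← Real.rpow_natCast, ← Real.rpow_mul hr0.le, ← Real.rpow_natCast]; norm_num
  refine ⟨c * r ^ 3 / 2, pV, fun σ t h0 hσ ht => ?_⟩
  have ht0 : 0 < |t| := lI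
  set σ0 := r ^ 4 * |t| ^ (-0.015 : ℝ) with hσ0
  have hσ00 : 0 < σ0 := pV
  have hσ01 : σ0 ≤ 1 := by
    apply mul_le_one₀ (pow_le_one₀ hr0.le hr1) pV
    exact Real.rpow_le_one_of_one_le_of_nonpos ht nN
  have main : c * (σ0 ^ (0.75 : ℝ) * |t| ^ (0.99925 : ℝ)) = c * r ^ 3 * |t| ^ (0.988 : ℝ) := by
    rw [hσ0, Real.mul_rpow pV pV, r4, ← Real.rpow_mul ht0.le, mul_assoc (r^3), ← Real.rpow_add ht0]
    norm_num; ring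
  have hp : 0 < |t| ^ (0.988 : ℝ) := pV
  have hcp : 0 < c * r ^ 3 * |t| ^ (0.988 : ℝ) := pV
  rcases le_total σ0 σ with hle | hle
  · refine le_trans ?_ (h1 σ t h0 hσ ht)
    refine le_trans ?_ (show c * (σ0 ^ (0.75 : ℝ) * |t| ^ (0.99925 : ℝ)) ≤ _ by gcongr)
    rw [main]; linarith
  · have hb := h1 σ0 t hσ00 hσ01 ht
    rw [main] at hb
    have hdiff : ‖riemannZeta₁ (1 + σ0 + I * t) - riemannZeta₁ (1 + σ + I * t)‖ ≤
        C' * |t| ^ o3 * σ0 := by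
      have := (convex_Icc σ σ0).norm_image_sub_le_of_norm_hasDerivWithin_le
        (f := fun u : ℝ => riemannZeta₁ (1 + u + I * t))
        (f' := fun u : ℝ => deriv riemannZeta₁ (1 + u + I * t)) (C := C' * |t| ^ o3)
        (by
          intro u hu
          have hd : HasDerivAt riemannZeta₁ (deriv riemannZeta₁ (1 + u + I * t)) (1 + u + I * t) :=
            (differentiable_riemannZeta₁ _).hasDerivAt
          have hl : HasDerivAt (fun u : ℝ => (1 + u + I * t : ℂ)) 1 u := by
            simpa using ((ofRealCLM.hasDerivAt (x := u)).const_add 1).add_const (I * t)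
          have := hd.comp u hl
          rw [mul_one] at this
          exact this.hasDerivWithinAt)
        (by
          intro u hu
          have hh := (h (1 + u + I * t) (by simp; linarith [hu.1]) (by simp; linarith [hu.2])).2.1
          refine hh.trans ?_
          have : (1 + u + I * t : ℂ).im = t := sI
          rw [this, hC']
          calc C * (3 + |t|) ^ o3 ≤ C * (4 * |t|) ^ o3 := by gcongr; linarith
            _ = _ := by rw [Real.mul_rpow nN ht0.le]; ring)
        (Set.left_mem_Icc.mpr hle) (Set.right_mem_Icc.mpr hle)
      refine this.trans ?_
      gcongr
      rw [Real.norm_eq_abs, abs_of_nonneg lI]; linarith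
    have e : C' * |t| ^ o3 * σ0 = C' * r * r ^ 3 * |t| ^ (0.988 : ℝ) := by
      have : |t| ^ o3 * |t| ^ (-0.015 : ℝ) = |t| ^ (0.988 : ℝ) := by
        rw [← Real.rpow_add ht0]; norm_num
      rw [hσ0, ← this]; ring
    rw [e] at hdiff
    have h3 : ‖riemannZeta₁ (1 + σ0 + I * t)‖ ≤ ‖riemannZeta₁ (1 + σ + I * t)‖ +
      ‖riemannZeta₁ (1 + σ0 + I * t) - riemannZeta₁ (1 + σ + I * t)‖ := by
      have := norm_add_le (riemannZeta₁ (1 + σ + I * t)) (riemannZeta₁ (1 + σ0 + I * t) - riemannZeta₁ (1 + σ + I * t))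
      simpa using this
    have h4 : r * (2 * C') * (r ^ 3 * |t| ^ (0.988 : ℝ)) ≤ c * (r ^ 3 * |t| ^ (0.988 : ℝ)) := by gcongr
    linarith
def EE (s : ℂ) : ℂ := ((deriv (deriv riemannZeta₁) (1 + s) * riemannZeta₁ (1 + s)
  - deriv riemannZeta₁ (1 + s) ^ 2) / riemannZeta₁ (1 + s) ^ 2 + 1) / (1 + s)
lemma EE_bd : ∃ C : ℝ, 0 < C ∧ ∀ σ t : ℝ, 0 < σ → σ ≤ 1 →
    ‖EE (σ + I * t)‖ ≤ C * (1 + |t|) ^ (-0.9 : ℝ) := by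
  obtain ⟨C, hC, h⟩ := zeta1_bds
  obtain ⟨c, hc, hl⟩ := zeta1_lower
  have hd : Differentiable ℂ (deriv riemannZeta₁) := fun s =>
    (differentiable_riemannZeta₁.analyticAt s).deriv.differentiableAt
  have hdd : Differentiable ℂ (deriv (deriv riemannZeta₁)) := fun s =>
    (hd.analyticAt s).deriv.differentiableAt
  have hcomp : IsCompact (Set.Icc o0 1 ×ˢ Set.Icc (-1:ℝ) 1) := isCompact_Icc.prod isCompact_Icc
  have hcont : ContinuousOn (fun p : ℝ × ℝ => EE (p.1 + I * p.2)) (Set.Icc o0 1 ×ˢ Set.Icc (-1:ℝ) 1) := by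
    unfold EE
    have c0 := differentiable_riemannZeta₁.continuous
    have c1 := hd.continuous
    have c2 := hdd.continuous
    refine ContinuousOn.div ((ContinuousOn.div ?_ ?_ ?_).add continuousOn_const) ?_ ?_
    · exact (by fun_prop : Continuous _).continuousOn
    · exact (by fun_prop : Continuous _).continuousOn
    · rintro ⟨x, y⟩ hxy
      exact pow_ne_zero _ (zeta1_ne (by simp; exact hxy.1.1))
    · exact (by fun_prop : Continuous _).continuousOn
    · rintro ⟨x, y⟩ hxy h0
      have := congrArg re h0
      simp at this; have := hxy.1.1; simp at this; linarith
  obtain ⟨M, hM⟩ := hcomp.exists_bound_of_continuousOn hcont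
  set C' := C * 4 ^ o3 with hC'
  have hC'0 : 0 < C' := pV
  set D := C' / c + (C' / c) ^ 2 + 1 with hD
  have hD0 : 0 < D := pV
  refine ⟨(|M| + D) * 2 ^ (0.9 : ℝ), pV, fun σ t h0 h1 => ?_⟩
  rcases le_total |t| 1 with ht | ht
  · have hh := hM (σ, t) ⟨⟨h0.le, h1⟩, abs_le.mp ht⟩
    have h2 : 1 ≤ 2 ^ (0.9 : ℝ) * (1 + |t|) ^ (-0.9 : ℝ) := by
      rw [Real.rpow_neg pV, ← div_eq_mul_inv, one_le_div pV]
      gcongr; linarith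
    calc _ ≤ |M| := hh.trans (le_abs_self M)
      _ ≤ |M| + D := lI
      _ ≤ (|M| + D) * (2 ^ (0.9 : ℝ) * (1 + |t|) ^ (-0.9 : ℝ)) := le_mul_of_one_le_right pV h2
      _ = _ := by ring
  · have ht0 : 0 < |t| := lI
    obtain ⟨b0, b1, b2⟩ := h (1 + (σ + I * t)) (by simp; linarith) (by simp; linarith)
    have him : (1 + (σ + I * t) : ℂ).im = t := sI
    rw [him] at b0 b1 b2
    have hτ : C * (3 + |t|) ^ o3 ≤ C' * |t| ^ o3 := by
      calc C * (3 + |t|) ^ o3 ≤ C * (4 * |t|) ^ o3 := by gcongr; linarith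
            _ = _ := by rw [Real.mul_rpow nN ht0.le]; ring
    have hlow := hl σ t h0 h1 ht
    rw [add_assoc] at hlow
    unfold EE
    set Z := riemannZeta₁ (1 + (σ + I * t))
    set Z1 := deriv riemannZeta₁ (1 + (σ + I * t))
    set Z2 := deriv (deriv riemannZeta₁) (1 + (σ + I * t))
    have hZ0 : Z ≠ 0 := zeta1_ne (by simp; linarith)
    have hZp : 0 < ‖Z‖ := norm_pos_iff.mpr hZ0
    have hrat : |t| ^ o3 = |t| ^ (0.015 : ℝ) * |t| ^ (0.988 : ℝ) := by
      rw [← Real.rpow_add ht0]; norm_num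
    have q1 : ‖Z1‖ / ‖Z‖ ≤ C' / c * |t| ^ (0.015 : ℝ) := by
      rw [div_le_iff₀ hZp]
      calc ‖Z1‖ ≤ C' * |t| ^ o3 := b1.trans hτ
        _ = C' / c * |t| ^ (0.015 : ℝ) * (c * |t| ^ (0.988 : ℝ)) := by rw [hrat]; field_simp
        _ ≤ _ := by gcongr
    have q2 : ‖Z2‖ / ‖Z‖ ≤ C' / c * |t| ^ (0.015 : ℝ) := by
      rw [div_le_iff₀ hZp]
      calc ‖Z2‖ ≤ C' * |t| ^ o3 := b2.trans hτ
        _ = C' / c * |t| ^ (0.015 : ℝ) * (c * |t| ^ (0.988 : ℝ)) := by rw [hrat]; field_simp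
        _ ≤ _ := by gcongr
    have e : (Z2 * Z - Z1 ^ 2) / Z ^ 2 + 1 = Z2 / Z - (Z1 / Z) ^ 2 + 1 := by field_simp
    have hx1 : 1 ≤ |t| ^ (0.015 : ℝ) := Real.one_le_rpow ht nN
    have hx2 : |t| ^ (0.015 : ℝ) * |t| ^ (0.015 : ℝ) = |t| ^ (0.03 : ℝ) := by
      rw [← Real.rpow_add ht0]; norm_num
    set X := |t| ^ (0.015 : ℝ)
    have hnum : ‖Z2 / Z - (Z1 / Z) ^ 2 + 1‖ ≤ D * |t| ^ (0.03 : ℝ) := by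
      have n1 : ‖Z2 / Z - (Z1 / Z) ^ 2 + 1‖ ≤ ‖Z2‖ / ‖Z‖ + (‖Z1‖ / ‖Z‖) ^ 2 + 1 := by
        refine (norm_add_le _ _).trans ?_
        rw [norm_one]
        refine add_le_add_left ((norm_sub_le _ _).trans ?_) 1
        rw [norm_pow, norm_div, norm_div]
      have n2 : (‖Z1‖ / ‖Z‖) ^ 2 ≤ (C' / c * X) ^ 2 := by gcongr
      have hq : 0 < C' / c := pV
      rw [← hx2, hD]
      nlinarith [mul_nonneg hq.le (mul_nonneg (sub_nonneg.mpr hx1) (zero_le_one.trans hx1))]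
    have hden : |t| ≤ ‖(1 + (σ + I * t) : ℂ)‖ := by
      refine le_trans ?_ (abs_im_le_norm _)
      simp
    rw [e, norm_div]
    calc _ ≤ D * |t| ^ (0.03 : ℝ) / |t| := by gcongr
      _ = D * |t| ^ (-0.97 : ℝ) := by
        rw [mul_div_assoc]
        congr 1
        conv_lhs => rw [← Real.rpow_one |t|, ← Real.rpow_mul ht0.le, ← Real.rpow_sub ht0]
        norm_num
      _ ≤ D * |t| ^ (-0.9 : ℝ) := by
        gcongr
        norm_num
      _ ≤ D * (2 ^ (0.9 : ℝ) * (1 + |t|) ^ (-0.9 : ℝ)) := by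
        gcongr
        rw [Real.rpow_neg pV, Real.rpow_neg pV, ← div_eq_mul_inv, inv_eq_one_div,
          div_le_div_iff₀ pV pV, one_mul, ← Real.mul_rpow nN ht0.le]
        gcongr; linarith
      _ ≤ _ := by
        rw [mul_assoc]
        gcongr
        linarith [abs_nonneg M]
end PN
end PNT
noncomputable section PNT
namespace PN
open Complex Filter Topology ArithmeticFunction
def SL (x : ℝ) : ℝ := ∑ k ∈ Finset.Icc 1 ⌊x⌋₊, ArithmeticFunction.vonMangoldt k * Real.log k
def qq (y : ℝ) : ℝ := SL (Real.exp y) * Real.exp (-y) - y + 1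
lemma SL_nonneg (x : ℝ) : 0 ≤ SL x :=
  Finset.sum_nonneg fun k hk => mul_nonneg vonMangoldt_nonneg (Real.log_natCast_nonneg k)
lemma SL_mono : Monotone SL := fun x y h => by
  apply Finset.sum_le_sum_of_subset_of_nonneg
  · exact Finset.Icc_subset_Icc_right (Nat.floor_mono h)
  · exact fun k _ _ => mul_nonneg vonMangoldt_nonneg (Real.log_natCast_nonneg k)
lemma SL_le {x : ℝ} (hx : 1 ≤ x) : SL x ≤ 6 * x * Real.log x := by
  have h1 : SL x ≤ Chebyshev.psi x * Real.log x := by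
    rw [SL, Chebyshev.psi_eq_sum_Icc, Finset.sum_mul, ← Finset.add_sum_Ioc_eq_sum_Icc (Nat.zero_le _)]
    simp only [ArithmeticFunction.map_zero, zero_mul, zero_add]
    rw [show Finset.Icc 1 ⌊x⌋₊ = Finset.Ioc 0 ⌊x⌋₊ from rfl]
    apply Finset.sum_le_sum
    intro k hk
    rw [Finset.mem_Ioc] at hk
    gcongr
    · exact_mod_cast hk.1
    · exact (Nat.le_floor_iff lI).mp hk.2
  have h2 := Chebyshev.psi_le_const_mul_self (x := x) lI
  have h4 : Real.log 4 ≤ 2 := by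
    rw [show (4:ℝ) = 2 ^ 2 by norm_num, Real.log_pow]; have := Real.log_two_lt_d9; push_cast; linarith
  have h5 := Real.log_nonneg hx
  refine h1.trans ?_
  gcongr
  nlinarith
lemma qq_bd {y : ℝ} (hy : 0 ≤ y) : |qq y| ≤ 7 * (1 + y) := by
  have h1 := SL_le (Real.one_le_exp hy)
  rw [Real.log_exp] at h1
  have h2 : SL (Real.exp y) * Real.exp (-y) ≤ 6 * y := by
    calc _ ≤ 6 * Real.exp y * y * Real.exp (-y) := by gcongr
      _ = 6 * y * (Real.exp y * Real.exp (-y)) := by ring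
      _ = _ := by rw [← Real.exp_add]; simp
  have h3 : 0 ≤ SL (Real.exp y) * Real.exp (-y) := mul_nonneg (SL_nonneg _) (Real.exp_pos _).le
  unfold qq
  rw [abs_le]; constructor <;> linarith
lemma qq_meas : Measurable qq := by
  have : Measurable fun y => SL (Real.exp y) := (SL_mono.comp Real.exp_monotone).measurable
  unfold qq
  fun_prop
lemma logL {s : ℂ} (hs : 0 < s.re) :
    LSeries (fun n => ((ArithmeticFunction.vonMangoldt n * Real.log n : ℝ) : ℂ)) (1 + s) =
    1 / s ^ 2 + (deriv (deriv riemannZeta₁) (1 + s) * riemannZeta₁ (1 + s)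
      - deriv riemannZeta₁ (1 + s) ^ 2) / riemannZeta₁ (1 + s) ^ 2 := by
  have h1 : LSeries (fun n => ((ArithmeticFunction.vonMangoldt n * Real.log n : ℝ) : ℂ)) (1 + s) =
      LSeries (LSeries.logMul (fun n => (ArithmeticFunction.vonMangoldt n : ℂ))) (1 + s) := by
    apply LSeries_congr
    intro n _
    simp [LSeries.logMul, mul_comm, Complex.natCast_log]
  have hab : LSeries.abscissaOfAbsConv (fun n => (ArithmeticFunction.vonMangoldt n : ℂ)) < (1 + s).re := by
    have : LSeries.abscissaOfAbsConv (fun n => (ArithmeticFunction.vonMangoldt n : ℂ)) ≤ o1 :=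
      LSeries.abscissaOfAbsConv_le_of_forall_lt_LSeriesSummable (fun y hy =>
        LSeriesSummable_vonMangoldt (by simpa using hy))
    refine lt_of_le_of_lt this ?_
    rw [EReal.coe_lt_coe_iff]; simp [hs]
  have hd1 := LSeries_hasDerivAt hab
  have hd : Differentiable ℂ (deriv riemannZeta₁) := fun s =>
    (differentiable_riemannZeta₁.analyticAt s).deriv.differentiableAt
  have hZ : riemannZeta₁ (1 + s) ≠ 0 := zeta1_ne (by simp; linarith)
  have hs0 : s ≠ 0 := by rintro rfl; simp at hs
  have hd2 : HasDerivAt (fun w => (w - 1)⁻¹ - deriv riemannZeta₁ w / riemannZeta₁ w)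
      (-1 / (1 + s - 1) ^ 2 - (deriv (deriv riemannZeta₁) (1 + s) * riemannZeta₁ (1 + s)
      - deriv riemannZeta₁ (1 + s) * deriv riemannZeta₁ (1 + s)) / riemannZeta₁ (1 + s) ^ 2) (1 + s) := by
    refine HasDerivAt.sub ?_ ?_
    · exact ((hasDerivAt_id _).sub_const 1).inv (by simpa using hs0)
    · exact (hd _).hasDerivAt.div (differentiable_riemannZeta₁ _).hasDerivAt hZ
  have heq : (fun w => (w - 1)⁻¹ - deriv riemannZeta₁ w / riemannZeta₁ w) =ᶠ[𝓝 (1 + s)]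
      LSeries (fun n => (ArithmeticFunction.vonMangoldt n : ℂ)) := by
    filter_upwards [(isOpen_lt continuous_const continuous_re).mem_nhds
      (show (1 + s) ∈ {s : ℂ | 1 < s.re} by simp [hs])] with w hw
    have hw' : 1 < w.re := hw
    have hw1 : w ≠ 1 := by rintro rfl; simp at hw'
    have hZw : riemannZeta₁ w ≠ 0 := zeta1_ne hw'.le
    have := sub_ne_zero_of_ne hw1
    rw [LSeries_vonMangoldt_eq_deriv_riemannZeta_div hw', deriv_riemannZeta_eq_neg_inv_sub_sq_mul_add hw1,
      riemannZeta_eq_inv_sub_mul hw1]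
    field_simp
    ring
  have := hd1.unique (hd2.congr_of_eventuallyEq heq.symm)
  rw [h1, ← neg_eq_iff_eq_neg.mpr this.symm]
  rw [show 1 + s - 1 = s by ring]
  ring
lemma exp_image : Real.exp '' Set.Ioi 0 = Set.Ioi 1 := by
  ext x; constructor
  · rintro ⟨y, hy, rfl⟩; exact Real.one_lt_exp_iff.mpr hy
  · intro hx
    exact ⟨Real.log x, Real.log_pos hx, Real.exp_log (lt_trans one_pos hx)⟩
lemma int_lin_exp {σ : ℝ} (hσ : 0 < σ) : IntegrableOn (fun y : ℝ => (1 + y) * Real.exp (-σ * y)) (Set.Ioi 0) := by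
  have h1 := integrableOn_rpow_mul_exp_neg_mul_rpow (p := 1) (s := 1) (b := σ) nN one_pos hσ
  have h2 := integrableOn_rpow_mul_exp_neg_mul_rpow (p := 1) (s := 0) (b := σ) nN one_pos hσ
  refine (h2.add h1).congr_fun (fun y hy => ?_) measurableSet_Ioi
  simp; ring
lemma norm_cexp_neg_mul (s : ℂ) (y : ℝ) : ‖cexp (-s * y)‖ = Real.exp (-s.re * y) := by
  rw [Complex.norm_exp]; simp
lemma int_of_bd {f : ℝ → ℝ} (hf : Measurable f) {C : ℝ} (h : ∀ y, 0 ≤ y → |f y| ≤ C * (1 + y)) {s : ℂ} (hs : 0 < s.re) :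
    IntegrableOn (fun y : ℝ => (f y : ℂ) * cexp (-s * y)) (Set.Ioi 0) := by
  refine Integrable.mono' ((int_lin_exp hs).const_mul C) fP ?_
  filter_upwards [ae_restrict_mem measurableSet_Ioi] with y hy
  rw [norm_mul, norm_cexp_neg_mul, Complex.norm_real, ← mul_assoc]
  gcongr
  exact h y (le_of_lt hy)
lemma lap_lin {s : ℂ} (hs : 0 < s.re) : ∫ y in Set.Ioi o0, ((y - 1 : ℝ) : ℂ) * cexp (-s * y) = 1 / s ^ 2 - 1 / s := by
  have hs0 : s ≠ 0 := by rintro rfl; simp at hs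
  have hint : IntegrableOn (fun y : ℝ => ((y - 1 : ℝ) : ℂ) * cexp (-s * y)) (Set.Ioi 0) :=
    int_of_bd (f := fun y => y - 1) fP (C := 1) (fun y hy => by rw [abs_le]; constructor <;> linarith) hs
  have := integral_Ioi_of_hasDerivAt_of_tendsto' (a := 0) (m := 0)
    (f := fun y : ℝ => -(((y:ℂ) - 1) / s + 1 / s ^ 2) * cexp (-s * y))
    (f' := fun y : ℝ => ((y - 1 : ℝ) : ℂ) * cexp (-s * y)) (by
      intro y _
      have h1 : HasDerivAt (fun y : ℝ => (y : ℂ)) 1 y := ofRealCLM.hasDerivAt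
      have h2 := (((h1.sub_const 1).div_const s).add_const (1 / s ^ 2)).fun_neg.fun_mul ((h1.const_mul (-s)).cexp)
      refine h2.congr_deriv ?_
      push_cast
      field_simp
      ring) hint (by
      rw [tendsto_zero_iff_norm_tendsto_zero]
      have t1 : Tendsto (fun y : ℝ => (y ^ 1 * Real.exp (-s.re * y)) ) atTop (𝓝 0) := by
        have := tendsto_rpow_mul_exp_neg_mul_atTop_nhds_zero 1 s.re hs
        simpa using this
      have t0 : Tendsto (fun y : ℝ => (y ^ 0 * Real.exp (-s.re * y)) ) atTop (𝓝 0) := by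
        have := tendsto_rpow_mul_exp_neg_mul_atTop_nhds_zero 0 s.re hs
        simpa using this
      have t2 := (t1.const_mul (1 / ‖s‖)).add (t0.const_mul (1 / ‖s‖ + 1 / ‖s‖ ^ 2))
      simp only [mul_zero, add_zero] at t2
      refine squeeze_zero' (Eventually.of_forall fun _ => norm_nonneg _) ?_ t2
      filter_upwards [eventually_ge_atTop 0] with y hy
      rw [norm_mul, norm_neg, norm_cexp_neg_mul]
      calc _ ≤ ((y + 1) / ‖s‖ + 1 / ‖s‖ ^ 2) * Real.exp (-s.re * y) := by
            gcongr
            refine (norm_add_le _ _).trans ?_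
            rw [norm_div, norm_div, norm_pow, norm_one]
            gcongr
            refine (norm_sub_le _ _).trans ?_
            simp [abs_of_nonneg hy]
        _ = _ := by ring)
  rw [this]; simp
  field_simp
  ring
lemma laplace {s : ℂ} (hs : 0 < s.re) : ∫ y in Set.Ioi o0, (qq y : ℂ) * cexp (-s * y) = EE s := by
  have hs0 : s ≠ 0 := by rintro rfl; simp at hs
  have hs1 : 1 + s ≠ 0 := by
    intro h; have := congrArg re h; simp at this; linarith
  have hO : (fun n : ℕ ↦ ∑ k ∈ Finset.Icc 1 n, ArithmeticFunction.vonMangoldt k * Real.log k)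
      =O[atTop] fun n ↦ (n : ℝ) ^ (1 + s.re / 2) := by
    refine Asymptotics.IsBigO.of_bound (6 * (2 / s.re)) ?_
    filter_upwards [eventually_ge_atTop 1] with n hn
    have hn' : o1 ≤ n := by exact_mod_cast hn
    have := SL_le hn'
    rw [SL, Nat.floor_natCast] at this
    rw [Real.norm_of_nonneg (Finset.sum_nonneg fun k hk => mul_nonneg vonMangoldt_nonneg (Real.log_natCast_nonneg k)),
      Real.norm_of_nonneg pV]
    have hl := Real.log_le_rpow_div (x := (n:ℝ)) pV (show 0 < s.re / 2 by linarith)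
    calc _ ≤ _ := this
      _ ≤ 6 * n * ((n:ℝ) ^ (s.re / 2) / (s.re / 2)) := by gcongr
      _ = _ := by rw [Real.rpow_add pV, Real.rpow_one]; field_simp
  have hL := LSeries_eq_mul_integral_of_nonneg (fun n => ArithmeticFunction.vonMangoldt n * Real.log n) (s := 1 + s)
    (show 0 ≤ 1 + s.re / 2 by linarith) (by simp; linarith) hO
    (fun n => mul_nonneg vonMangoldt_nonneg (Real.log_natCast_nonneg n))
  rw [logL hs, ← exp_image, integral_image_eq_integral_abs_deriv_smul measurableSet_Ioi
    (fun x _ => (Real.hasDerivAt_exp x).hasDerivWithinAt) Real.exp_injective.injOn] at hL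
  have e1 : ∫ y in Set.Ioi o0, |Real.exp y| • ((∑ k ∈ Finset.Icc 1 ⌊Real.exp y⌋₊,
      ((ArithmeticFunction.vonMangoldt k * Real.log k : ℝ) : ℂ)) * ((Real.exp y : ℝ) : ℂ) ^ (-(1 + s + 1))) =
      ∫ y in Set.Ioi o0, ((qq y : ℂ) * cexp (-s * y) + ((y - 1 : ℝ) : ℂ) * cexp (-s * y)) := by
    refine setIntegral_congr_fun measurableSet_Ioi (fun y _ => ?_)
    have : ((Real.exp y : ℝ) : ℂ) ^ (-(1 + s + 1)) = cexp (y * (-(1 + s + 1))) := by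
      rw [Complex.cpow_def_of_ne_zero (by exact_mod_cast (Real.exp_pos y).ne'), ← Complex.ofReal_log (Real.exp_pos y).le, Real.log_exp]
    simp only [this, abs_of_pos (Real.exp_pos y), ← Complex.ofReal_sum]
    rw [← SL, Complex.real_smul, qq]
    push_cast
    have e2 : cexp (y * (-(1 + s + 1))) = cexp (-s * y) * cexp (-y) * cexp (-y) := by
      rw [← Complex.exp_add, ← Complex.exp_add]; ring_nf
    have e3 : cexp y * cexp (-y) = 1 := by rw [← Complex.exp_add]; simp
    rw [e2]
    linear_combination (SL (Real.exp y) * cexp (-s * y) * cexp (-y)) * e3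
  rw [e1, integral_add (int_of_bd qq_meas (fun y hy => qq_bd hy) hs)
    (int_of_bd (f := fun y => y - 1) fP (C := 1) (fun y hy => by rw [abs_le]; constructor <;> linarith) hs),
    lap_lin hs] at hL
  unfold EE
  set R := (deriv (deriv riemannZeta₁) (1 + s) * riemannZeta₁ (1 + s)
  - deriv riemannZeta₁ (1 + s) ^ 2) / riemannZeta₁ (1 + s) ^ 2
  rw [eq_div_iff hs1]
  generalize (∫ y in Set.Ioi o0, (qq y : ℂ) * cexp (-s * y)) = J at hL ⊢
  generalize R = R' at hL ⊢
  field_simp at hL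
  apply mul_left_cancel₀ (pow_ne_zero 2 hs0)
  linear_combination -hL
lemma gauss_bound : ∃ C : ℝ, 0 < C ∧ ∀ b : ℝ, 0 < b → b ≤ 1 →
    ∫ t : ℝ, (1 + |t|) ^ (-0.9 : ℝ) * Real.exp (-b * t ^ 2) ≤ C * b ^ o01 := by
  have hI : Integrable (fun t : ℝ => (1 + ‖t‖) ^ (-1.1 : ℝ)) := integrable_one_add_norm (by simp; norm_num)
  set J := ∫ t : ℝ, (1 + ‖t‖) ^ (-1.1 : ℝ) with hJ
  have hJ0 : 0 ≤ J := integral_nonneg (fun t => pV)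
  refine ⟨2 * J + 2, pV, fun b hb hb1 => ?_⟩
  set R := b ^ (-0.5 : ℝ) with hR
  have hR1 : 1 ≤ R := Real.one_le_rpow_of_pos_of_le_one_of_nonpos hb hb1 nN
  have hG := integrable_exp_neg_mul_sq hb
  have hpt : ∀ t : ℝ, (1 + |t|) ^ (-0.9 : ℝ) * Real.exp (-b * t ^ 2) ≤
      2 * b ^ o01 * (1 + ‖t‖) ^ (-1.1 : ℝ) + b ^ (0.45 : ℝ) * Real.exp (-b * t ^ 2) := by
    intro t
    rw [Real.norm_eq_abs]
    have he : Real.exp (-b * t ^ 2) ≤ 1 := Real.exp_le_one_iff.mpr (by nlinarith [sq_nonneg t])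
    rcases le_total |t| R with h | h
    · have : (1 + |t|) ^ (-0.9 : ℝ) ≤ 2 * b ^ o01 * (1 + |t|) ^ (-1.1 : ℝ) := by
        calc (1 + |t|) ^ (-0.9 : ℝ) = (1 + |t|) ^ o5 * (1 + |t|) ^ (-1.1 : ℝ) := by
              rw [← Real.rpow_add pV]; norm_num
          _ ≤ (2 * R) ^ o5 * (1 + |t|) ^ (-1.1 : ℝ) := by gcongr; linarith
          _ = 2 ^ o5 * b ^ o01 * (1 + |t|) ^ (-1.1 : ℝ) := by
              rw [Real.mul_rpow nN lI, hR, ← Real.rpow_mul hb.le]; norm_num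
          _ ≤ 2 ^ o1 * b ^ o01 * (1 + |t|) ^ (-1.1 : ℝ) := by gcongr <;> norm_num
          _ = _ := nN
      calc _ ≤ (1 + |t|) ^ (-0.9 : ℝ) * 1 := by gcongr
        _ ≤ 2 * b ^ o01 * (1 + |t|) ^ (-1.1 : ℝ) := lI
        _ ≤ _ := by have : 0 ≤ b ^ (0.45 : ℝ) * Real.exp (-b * t ^ 2) := pV
                    linarith
    · have : (1 + |t|) ^ (-0.9 : ℝ) ≤ b ^ (0.45 : ℝ) := by
        calc (1 + |t|) ^ (-0.9 : ℝ) ≤ R ^ (-0.9 : ℝ) :=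
              Real.rpow_le_rpow_of_nonpos lI lI nN
          _ = _ := by rw [hR, ← Real.rpow_mul hb.le]; norm_num
      calc _ ≤ b ^ (0.45 : ℝ) * Real.exp (-b * t ^ 2) := by gcongr
        _ ≤ _ := by have : 0 ≤ 2 * b ^ o01 * (1 + |t|) ^ (-1.1 : ℝ) := pV
                    linarith
  have hint2 : Integrable (fun t : ℝ => 2 * b ^ o01 * (1 + ‖t‖) ^ (-1.1 : ℝ) + b ^ (0.45 : ℝ) * Real.exp (-b * t ^ 2)) :=
    (hI.const_mul _).add (hG.const_mul _)
  calc _ ≤ ∫ t : ℝ, (2 * b ^ o01 * (1 + ‖t‖) ^ (-1.1 : ℝ) + b ^ (0.45 : ℝ) * Real.exp (-b * t ^ 2)) := by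
        apply integral_mono_of_nonneg (Eventually.of_forall fun t => pV) hint2 (Eventually.of_forall hpt)
    _ = 2 * b ^ o01 * J + b ^ (0.45 : ℝ) * √(π / b) := by
        rw [integral_add (hI.const_mul _) (hG.const_mul _), integral_const_mul, integral_const_mul, integral_gaussian]
    _ ≤ 2 * b ^ o01 * J + 2 * b ^ o01 := by
        refine add_le_add le_rfl ?_
        have h1 : √(π / b) ≤ 2 * b ^ (-0.5 : ℝ) := by
          rw [Real.sqrt_le_left pV, mul_pow, ← Real.rpow_natCast, ← Real.rpow_natCast, ← Real.rpow_mul hb.le]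
          norm_num
          rw [Real.rpow_neg_one, ← div_eq_mul_inv]
          gcongr
          exact Real.pi_le_four
        calc b ^ (0.45 : ℝ) * √(π / b) ≤ b ^ (0.45 : ℝ) * (2 * b ^ (-0.5 : ℝ)) := by gcongr
          _ = 2 * b ^ (-0.05 : ℝ) := by
              rw [mul_left_comm, ← Real.rpow_add hb]; norm_num
          _ ≤ _ := by
              gcongr 2 * ?_
              exact Real.rpow_le_rpow_of_exponent_ge hb hb1 nN
    _ = _ := by ring
lemma smooth : ∃ C : ℝ, 0 < C ∧ ∀ σ b z : ℝ, 0 < σ → σ ≤ 1 → 0 < b → b ≤ 1 →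
    |∫ y in Set.Ioi o0, qq y * Real.exp (-σ * y) * Real.exp (-(z - y) ^ 2 / (4 * b))| ≤ C * b ^ (0.4 : ℝ) := by
  obtain ⟨C1, hC1, hE⟩ := EE_bd
  obtain ⟨C2, hC2, hG⟩ := gauss_bound
  refine ⟨C1 * C2, pV, fun σ b z hσ hσ1 hb hb1 => ?_⟩
  have hbc : 0 < (b : ℂ).re := by simpa using hb
  set F : ℝ → ℝ → ℂ := fun t y => (qq y : ℂ) * cexp (-(σ + I * t) * y) * (cexp (I * z * t) * cexp (-b * t ^ 2)) with hF
  have hFi : Integrable (Function.uncurry F) ((volume : Measure ℝ).prod (volume.restrict (Set.Ioi o0))) := by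
    have hprod : Integrable (fun p : ℝ × ℝ => Real.exp (-b * p.1 ^ 2) * (7 * ((1 + p.2) * Real.exp (-σ * p.2))))
        ((volume : Measure ℝ).prod (volume.restrict (Set.Ioi o0))) :=
      (integrable_exp_neg_mul_sq hb).mul_prod ((int_lin_exp hσ).const_mul 7)
    have hm := qq_meas
    refine hprod.mono' ?_ ?_
    · apply Measurable.aestronglyMeasurable
      simp only [hF, Function.uncurry_def]
      fun_prop
    · have : ∀ᵐ p : ℝ × ℝ ∂((volume : Measure ℝ).prod (volume.restrict (Set.Ioi o0))), 0 < p.2 := by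
        rw [Measure.ae_prod_iff_ae_ae (measurableSet_lt measurable_const measurable_snd)]
        exact Eventually.of_forall fun t => ae_restrict_mem measurableSet_Ioi
      filter_upwards [this] with p hp
      simp only [hF, Function.uncurry_def]
      rw [norm_mul, norm_mul, norm_mul, norm_cexp_neg_mul, Complex.norm_real]
      have n1 : ‖cexp (I * z * p.1)‖ = 1 := by
        rw [Complex.norm_exp]; simp
      have n2 : ‖cexp (-b * p.1 ^ 2)‖ = Real.exp (-b * p.1 ^ 2) := by
        rw [show (-b * p.1 ^ 2 : ℂ) = ((-b * p.1 ^ 2 : ℝ) : ℂ) by push_cast; ring, Complex.norm_exp_ofReal]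
      rw [n1, n2]
      have n3 := qq_bd hp.le
      simp only [add_re, ofReal_re, mul_re, I_re, zero_mul, I_im, ofReal_im, mul_zero, sub_self, add_zero, one_mul]
      rw [mul_comm, Real.norm_eq_abs]
      refine mul_le_mul_of_nonneg_left ?_ (Real.exp_pos _).le
      rw [← mul_assoc]
      exact mul_le_mul_of_nonneg_right n3 (Real.exp_pos _).le
  have hsw := integral_integral_swap hFi
  have hL : ∀ t : ℝ, ∫ y in Set.Ioi o0, F t y = EE (σ + I * t) * (cexp (I * z * t) * cexp (-b * t ^ 2)) := by
    intro t
    rw [hF]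
    simp only
    rw [integral_mul_const, laplace (by simpa using hσ)]
  have hR : ∀ y : ℝ, ∫ t : ℝ, F t y = ((π / b : ℂ) ^ (1 / 2 : ℂ)) * ((qq y * Real.exp (-σ * y) * Real.exp (-(z - y) ^ 2 / (4 * b)) : ℝ) : ℂ) := by
    intro y
    have h1 := fourierIntegral_gaussian hbc (z - y)
    have : ∀ t : ℝ, F t y = ((qq y : ℂ) * cexp (-σ * y)) * (cexp (I * (z - y) * t) * cexp (-b * t ^ 2)) := by
      intro t
      rw [hF]; simp only
      rw [show -(σ + I * t) * y = -σ * y + -(I * y * t) by ring, Complex.exp_add,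
        show I * (z - y) * t = I * z * t + -(I * y * t) by ring, Complex.exp_add]
      ring
    simp_rw [this]
    rw [integral_const_mul, h1]
    push_cast
    ring
  simp_rw [hL, hR] at hsw
  rw [integral_const_mul] at hsw
  have hof : ∫ y in Set.Ioi o0, ((qq y * Real.exp (-σ * y) * Real.exp (-(z - y) ^ 2 / (4 * b)) : ℝ) : ℂ) =
    ((∫ y in Set.Ioi o0, qq y * Real.exp (-σ * y) * Real.exp (-(z - y) ^ 2 / (4 * b)) : ℝ) : ℂ) := integral_ofReal
  rw [hof] at hsw
  have hn := congrArg norm hsw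
  rw [norm_mul, Complex.norm_real, Real.norm_eq_abs] at hn
  have hpi : ‖((π / b : ℂ) ^ (1 / 2 : ℂ))‖ = (π / b) ^ (0.5 : ℝ) := by
    have := norm_cpow_eq_rpow_re_of_pos (show 0 < π / b by positivity) (1 / 2)
    push_cast at this
    rw [this]; norm_num
  have hup : ‖∫ t : ℝ, EE (σ + I * t) * (cexp (I * z * t) * cexp (-b * t ^ 2))‖ ≤ C1 * (C2 * b ^ o01) := by
    refine (norm_integral_le_integral_norm _).trans ?_
    refine le_trans ?_ (mul_le_mul_of_nonneg_left (hG b hb hb1) hC1.le)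
    rw [← integral_const_mul]
    apply integral_mono_of_nonneg (Eventually.of_forall fun t => norm_nonneg _)
    · refine Integrable.const_mul ?_ _
      refine (integrable_exp_neg_mul_sq hb).mono' fP (Eventually.of_forall fun t => ?_)
      rw [Real.norm_of_nonneg pV]
      apply mul_le_of_le_one_left pV
      exact Real.rpow_le_one_of_one_le_of_nonpos (by linarith [abs_nonneg t]) nN
    · refine Eventually.of_forall fun t => ?_
      simp only
      have n1 : ‖cexp (I * z * t)‖ = 1 := by
        rw [Complex.norm_exp]; simp
      have n2 : ‖cexp (-b * t ^ 2)‖ = Real.exp (-b * t ^ 2) := by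
        rw [show (-b * t ^ 2 : ℂ) = ((-b * t ^ 2 : ℝ) : ℂ) by push_cast; ring, Complex.norm_exp_ofReal]
      rw [norm_mul, norm_mul, n1, n2, one_mul, ← mul_assoc]
      gcongr
      exact hE σ t hσ hσ1
  rw [hn, hpi] at hup
  have hbb : b ^ (-0.5 : ℝ) ≤ (π / b) ^ (0.5 : ℝ) := by
    rw [Real.rpow_neg hb.le, ← Real.inv_rpow hb.le]
    gcongr
    rw [inv_eq_one_div]
    gcongr
    linarith [Real.pi_gt_three]
  set X := |∫ y in Set.Ioi o0, qq y * Real.exp (-σ * y) * Real.exp (-(z - y) ^ 2 / (4 * b))|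
  have hX : 0 ≤ X := abs_nonneg _
  have h5 : b ^ (-0.5 : ℝ) * X ≤ C1 * (C2 * b ^ o01) := le_trans (by gcongr) hup
  have hb5 : b ^ (0.5 : ℝ) * b ^ (-0.5 : ℝ) = 1 := by rw [← Real.rpow_add hb]; norm_num
  have hb4 : b ^ (0.5 : ℝ) * b ^ o01 = b ^ (0.4 : ℝ) := by rw [← Real.rpow_add hb]; norm_num
  calc X = b ^ (0.5 : ℝ) * (b ^ (-0.5 : ℝ) * X) := by rw [← mul_assoc, hb5, one_mul]
    _ ≤ b ^ (0.5 : ℝ) * (C1 * (C2 * b ^ o01)) := by gcongr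
    _ = _ := by rw [← hb4]; ring
lemma ev_small (C : ℝ) : ∀ᶠ w : ℝ in atTop,
    84 * w * Real.exp (-(w ^ (0.1:ℝ)) / 32) + C * w ^ (0.17:ℝ) < 2 * Real.exp (-3) * w ^ o5 := by
  have t1 : Tendsto (fun w : ℝ => (w ^ (0.1:ℝ)) ^ (8:ℝ) * Real.exp (-(1/32) * (w ^ (0.1:ℝ)))) atTop (𝓝 0) :=
    (tendsto_rpow_mul_exp_neg_mul_atTop_nhds_zero 8 (1/32) nN).comp (tendsto_rpow_atTop nN)
  have t2 : Tendsto (fun w : ℝ => w ^ (-(0.03:ℝ))) atTop (𝓝 0) := tendsto_rpow_neg_atTop nN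
  have t3 := (t1.const_mul 84).add (t2.const_mul C)
  rw [mul_zero, mul_zero, add_zero] at t3
  have h := t3.eventually_lt_const (show o0 < 2 * Real.exp (-3) by positivity)
  filter_upwards [h, eventually_gt_atTop 0] with w hw hw0
  have h2 := mul_lt_mul_of_pos_right hw (Real.rpow_pos_of_pos hw0 0.2)
  refine lt_of_eq_of_lt ?_ h2
  rw [add_mul, ← Real.rpow_mul hw0.le, mul_assoc C, ← Real.rpow_add hw0]
  have : w = w ^ (0.8:ℝ) * w ^ o5 := by rw [← Real.rpow_add hw0]; norm_num
  rw [show -(w ^ (0.1:ℝ)) / 32 = -(1/32) * (w ^ (0.1:ℝ)) by ring]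
  nth_rw 1 [this]
  norm_num
  ring
lemma unsm : ∃ Z : ℝ, 1 ≤ Z ∧ ∀ s w : ℝ, |s| = 1 → Z ≤ w →
    ¬ ∀ y, |y - w| ≤ w ^ o8 / 2 → w ^ o5 ≤ s * qq y := by
  obtain ⟨C, hC, hS⟩ := smooth
  obtain ⟨Z, hZ⟩ := eventually_atTop.mp (ev_small C)
  obtain ⟨Z2, hZ2⟩ := eventually_atTop.mp ((tendsto_rpow_neg_atTop (show o0 < 0.05 by norm_num)).eventually_lt_const (show o0 < 1/2 by norm_num))
  refine ⟨max 1 (max Z Z2), le_max_left _ _, fun s w hs hw hall => ?_⟩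
  have hw1 : 1 ≤ w := (le_max_left _ _).trans hw
  have hwZ : Z ≤ w := ((le_max_left _ _).trans (le_max_right _ _)).trans hw
  have hwZ2 : Z2 ≤ w := ((le_max_right _ _).trans (le_max_right _ _)).trans hw
  have hw0 : 0 < w := lI
  set r := w ^ (-0.85 : ℝ) with hr
  have hr0 : 0 < r := pV
  have hr1 : r ≤ w ^ o8 / 2 := by
    have : r = w ^ (-0.05:ℝ) * w ^ o8 := by rw [hr, ← Real.rpow_add hw0]; norm_num
    rw [this]
    have h5 : 0 < w ^ o8 := pV
    have := hZ2 w hwZ2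
    nlinarith
  have hrle : r ≤ 1 := Real.rpow_le_one_of_one_le_of_nonpos hw1 nN
  have hrw : r ≤ w := lI
  set b := r ^ 2 with hb
  have hb0 : 0 < b := pV
  have hb1 : b ≤ 1 := by rw [hb]; nlinarith
  have key := hS w⁻¹ b w pV (inv_le_one_of_one_le₀ hw1) hb0 hb1
  set f : ℝ → ℝ := fun y => qq y * Real.exp (-w⁻¹ * y) * Real.exp (-(w - y) ^ 2 / (4 * b)) with hf
  set ε := Real.exp (-(w ^ (0.1:ℝ)) / 32) with hε
  have hG : Integrable (fun y : ℝ => Real.exp (-(1/(8*b)) * (y - w) ^ 2)) :=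
    (integrable_exp_neg_mul_sq (show 0 < 1/(8*b) by positivity)).comp_sub_right w
  have hGv : ∫ y : ℝ, Real.exp (-(1/(8*b)) * (y - w) ^ 2) ≤ 6 * r := by
    rw [integral_sub_right_eq_self (fun y : ℝ => Real.exp (-(1/(8*b)) * y ^ 2)) w, integral_gaussian,
      Real.sqrt_le_left pV, hb]
    have := Real.pi_le_four
    rw [div_div_eq_mul_div, div_one]
    nlinarith [sq_nonneg r]
  have hyw : ∀ y : ℝ, y * Real.exp (-w⁻¹ * y) ≤ w := by
    intro y
    have := Real.add_one_le_exp (w⁻¹ * y)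
    have h2 : y ≤ w * Real.exp (w⁻¹ * y) := by
      have : w * (w⁻¹ * y) ≤ w * Real.exp (w⁻¹ * y) := by gcongr; linarith
      rwa [← mul_assoc, mul_inv_cancel₀ hw0.ne', one_mul] at this
    rw [show -w⁻¹ * y = -(w⁻¹ * y) by ring, Real.exp_neg, ← div_eq_mul_inv, div_le_iff₀ (Real.exp_pos _)]
    exact h2
  have hlow : ∀ y : ℝ, 0 < y → (Set.Icc (w - r) (w + r)).indicator (fun _ => Real.exp (-3) * w ^ o5) y
      - 14 * w * ε * Real.exp (-(1/(8*b)) * (y - w) ^ 2) ≤ s * f y := by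
    intro y hy
    by_cases hin : |y - w| ≤ w ^ o8 / 2
    · have hq := hall y hin
      have hq0 : 0 ≤ s * qq y := le_trans pV hq
      have hsf : s * f y = (s * qq y) * (Real.exp (-w⁻¹ * y) * Real.exp (-(w - y) ^ 2 / (4 * b))) := by rw [hf]; ring
      have hpos : 0 ≤ 14 * w * ε * Real.exp (-(1/(8*b)) * (y - w) ^ 2) := pV
      by_cases hm : y ∈ Set.Icc (w - r) (w + r)
      · rw [Set.indicator_of_mem hm, hsf, ← Real.exp_add]
        have : Real.exp (-3) ≤ Real.exp (-w⁻¹ * y + -(w - y) ^ 2 / (4 * b)) := by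
          apply Real.exp_le_exp.mpr
          have h1 : w⁻¹ * y ≤ 2 := by
            rw [inv_mul_le_iff₀ hw0]; linarith [hm.2]
          have h2 : (w - y) ^ 2 / (4 * b) ≤ 1 := by
            rw [div_le_one pV, hb]
            have : (w - y)^2 ≤ r^2 := sq_le_sq' (by linarith [hm.2]) (by linarith [hm.1])
            nlinarith [sq_nonneg r]
          rw [neg_div]; linarith
        have h3 : Real.exp (-3) * w ^ o5 ≤ (s * qq y) * Real.exp (-w⁻¹ * y + -(w - y) ^ 2 / (4 * b)) := by
          rw [mul_comm]; gcongr
        linarith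
      · rw [Set.indicator_of_notMem hm, hsf]
        have : 0 ≤ (s * qq y) * (Real.exp (-w⁻¹ * y) * Real.exp (-(w - y) ^ 2 / (4 * b))) := pV
        linarith
    · have hm : y ∉ Set.Icc (w - r) (w + r) := fun hm => hin (by
        rw [abs_le]; constructor <;> linarith [hm.1, hm.2])
      rw [Set.indicator_of_notMem hm, zero_sub]
      push Not at hin
      have habs : |s * f y| ≤ 14 * w * ε * Real.exp (-(1/(8*b)) * (y - w) ^ 2) := by
        rw [abs_mul, hs, one_mul, hf]
        simp only
        rw [abs_mul, abs_mul, Real.abs_exp, Real.abs_exp]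
        have e1 : |qq y| * Real.exp (-w⁻¹ * y) ≤ 14 * w := by
          calc |qq y| * Real.exp (-w⁻¹ * y) ≤ 7 * (1 + y) * Real.exp (-w⁻¹ * y) := by gcongr; exact qq_bd hy.le
            _ = 7 * (Real.exp (-w⁻¹ * y) + y * Real.exp (-w⁻¹ * y)) := by ring
            _ ≤ 7 * (1 + w) := by
                gcongr
                · apply Real.exp_le_one_iff.mpr
                  have : 0 < w⁻¹ * y := pV
                  linarith
                · exact hyw y
            _ ≤ _ := lI
        have e2 : Real.exp (-(w - y) ^ 2 / (4 * b)) ≤ ε * Real.exp (-(1/(8*b)) * (y - w) ^ 2) := by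
          rw [hε, ← Real.exp_add]
          apply Real.exp_le_exp.mpr
          have h1 : (w ^ o8 / 2)^2 ≤ (w - y)^2 := by
            rw [← sq_abs (w - y), abs_sub_comm]; gcongr
          have h2 : (w ^ o8 / 2)^2 = w ^ (0.1:ℝ) * b / 4 := by
            have k1 : (w ^ o8)^2 = w ^ (-1.6:ℝ) := by rw [← Real.rpow_natCast, ← Real.rpow_mul hw0.le]; norm_num
            have k2 : (w ^ (-0.85:ℝ))^2 = w ^ (-1.7:ℝ) := by rw [← Real.rpow_natCast, ← Real.rpow_mul hw0.le]; norm_num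
            rw [hb, hr, div_pow, k1, k2, ← Real.rpow_add hw0]; norm_num
          rw [h2] at h1
          have h3 : w ^ (0.1:ℝ) / 32 ≤ (w-y)^2 / (8*b) := by
            rw [div_le_div_iff₀ nN pV]; nlinarith
          have h4 : (w-y)^2 / (4*b) = 2 * ((w-y)^2 / (8*b)) := by field_simp; ring
          have h5 : 1/(8*b) * (y-w)^2 = (w-y)^2 / (8*b) := by field_simp; ring
          rw [neg_div, neg_div, h4, neg_mul, h5]; linarith
        calc _ ≤ 14 * w * (ε * Real.exp (-(1/(8*b)) * (y - w) ^ 2)) := by gcongr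
          _ = _ := by ring
      linarith [(abs_le.mp habs).1]
  have hfi : IntegrableOn f (Set.Ioi 0) := by
    have h7 : IntegrableOn (fun y : ℝ => 7 * ((1 + y) * Real.exp (-w⁻¹ * y))) (Set.Ioi 0) :=
      (int_lin_exp (show 0 < w⁻¹ by positivity)).const_mul 7
    refine h7.mono' ?_ ?_
    · have := qq_meas
      apply Measurable.aestronglyMeasurable
      rw [hf]; fun_prop
    · filter_upwards [ae_restrict_mem measurableSet_Ioi] with y hy
      rw [hf, Real.norm_eq_abs]
      simp only
      rw [abs_mul, abs_mul, Real.abs_exp, Real.abs_exp]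
      have e0 : Real.exp (-(w - y) ^ 2 / (4 * b)) ≤ 1 := by
        apply Real.exp_le_one_iff.mpr
        rw [neg_div]; have : 0 ≤ (w - y)^2 / (4*b) := pV
        linarith
      calc _ ≤ |qq y| * Real.exp (-w⁻¹ * y) * 1 := by gcongr
        _ ≤ 7 * (1 + y) * Real.exp (-w⁻¹ * y) := by rw [mul_one]; gcongr; exact qq_bd (Set.mem_Ioi.mp hy).le
        _ = _ := by ring
  have hind : Integrable ((Set.Icc (w - r) (w + r)).indicator (fun _ => Real.exp (-3) * w ^ o5)) :=
    (integrable_indicator_iff measurableSet_Icc).mpr (integrableOn_const sI (by finiteness))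
  have hlo : 2 * Real.exp (-3) * w ^ o5 * r - 84 * w * ε * r ≤ s * ∫ y in Set.Ioi o0, f y := by
    rw [← integral_const_mul]
    calc _ ≤ (∫ y in Set.Ioi o0, (Set.Icc (w - r) (w + r)).indicator (fun _ => Real.exp (-3) * w ^ o5) y)
          - ∫ y in Set.Ioi o0, 14 * w * ε * Real.exp (-(1/(8*b)) * (y - w) ^ 2) := by
          apply sub_le_sub
          · rw [setIntegral_indicator measurableSet_Icc]
            have : Set.Ioc (w - r) (w + r) ⊆ Set.Ioi 0 ∩ Set.Icc (w - r) (w + r) := fun y hy => by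
              refine ⟨?_, hy.1.le, hy.2⟩
              rw [Set.mem_Ioi]; linarith [hy.1]
            calc _ = ∫ y in Set.Ioc (w - r) (w + r), Real.exp (-3) * w ^ o5 := by
                  rw [setIntegral_const]
                  simp only [measureReal_def, Real.volume_Ioc, smul_eq_mul]
                  rw [ENNReal.toReal_ofReal lI]; ring
              _ ≤ _ := setIntegral_mono_set (by
                    refine ((integrableOn_const (s := Set.Icc (w-r) (w+r)) sI (by finiteness))).mono_set Set.inter_subset_right)
                    (Eventually.of_forall fun y => by simp only [Pi.zero_apply]; positivity) (LE.le.eventuallyLE this)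
          · rw [integral_const_mul]
            have : ∫ y in Set.Ioi o0, Real.exp (-(1/(8*b)) * (y - w) ^ 2) ≤ 6 * r :=
              (setIntegral_le_integral hG (Eventually.of_forall fun y => by simp only [Pi.zero_apply]; positivity)).trans hGv
            calc _ ≤ 14 * w * ε * (6 * r) := by gcongr
              _ = _ := by ring
      _ = ∫ y in Set.Ioi o0, ((Set.Icc (w - r) (w + r)).indicator (fun _ => Real.exp (-3) * w ^ o5) y
          - 14 * w * ε * Real.exp (-(1/(8*b)) * (y - w) ^ 2)) := by
          rw [integral_sub hind.integrableOn (hG.integrableOn.const_mul _)]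
      _ ≤ _ := setIntegral_mono_on (hind.integrableOn.sub (hG.integrableOn.const_mul _)) (hfi.const_mul s) measurableSet_Ioi
          (fun y hy => hlow y hy)
  have hup : s * ∫ y in Set.Ioi o0, f y ≤ C * w ^ (0.17:ℝ) * r := by
    refine (le_abs_self _).trans ?_
    rw [abs_mul, hs, one_mul]
    refine key.trans (le_of_eq ?_)
    rw [mul_assoc, hb, hr, ← Real.rpow_natCast, ← Real.rpow_mul hw0.le, ← Real.rpow_mul hw0.le, ← Real.rpow_add hw0]
    norm_num
  have h9 := hZ w hwZ
  rw [← hε] at h9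
  have h10 := mul_lt_mul_of_pos_right h9 hr0
  linarith
lemma qq_large : ∃ Z : ℝ, 1 ≤ Z ∧ ∀ z, Z ≤ z → |qq z| ≤ 4 * z ^ o5 := by
  obtain ⟨Z, hZ1, hZ⟩ := unsm
  obtain ⟨Z2, hZ2⟩ := eventually_atTop.mp ((tendsto_rpow_neg_atTop (show o0 < 0.8 by norm_num)).eventually_lt_const (show o0 < 1/50 by norm_num))
  refine ⟨max (2 * Z) Z2, le_trans lI (le_max_left _ _), fun z hz => ?_⟩
  have hz1 : 2 * Z ≤ z := (le_max_left _ _).trans hz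
  have hz0 : 0 < z := lI
  set e := z ^ o8 with he
  have he0 : 0 < e := pV
  have he1 : e < 1 / 50 := hZ2 z ((le_max_right _ _).trans hz)
  have hez : z * e = z ^ o5 := by
    nth_rw 1 [← Real.rpow_one z]; rw [he, ← Real.rpow_add hz0]; norm_num
  set Q := z ^ o5 with hQ
  have hQ0 : 0 < Q := pV
  have hSz : SL (Real.exp z) * Real.exp (-z) = qq z + z - 1 := by rw [qq]; ring
  have hSz0 : 0 ≤ qq z + z - 1 := by rw [← hSz]; have := SL_nonneg (Real.exp z); positivity
  by_contra hcon
  rw [not_le, lt_abs] at hcon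
  have h2p : o2 ^ o5 ≤ 1.5 := by
    have : o2 ^ o5 ≤ (1.5 ^ (5:ℝ)) ^ o5 := by gcongr; norm_num
    rw [← Real.rpow_mul nN] at this; norm_num at this ⊢; exact this
  rcases hcon with hcon | hcon
  · refine hZ 1 (z + e) sI lI fun y hy => ?_
    have hw : (z + e) ^ o8 ≤ e := Real.rpow_le_rpow_of_nonpos hz0 lI nN
    rw [abs_le] at hy
    set h := y - z with hh
    have hh1 : 0 ≤ h := by rw [hh]; linarith
    have hh2 : h ≤ 1.5 * e := by rw [hh]; linarith
    have hw2 : (z + e) ^ o5 ≤ 1.5 * Q := by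
      calc (z + e) ^ o5 ≤ (2 * z) ^ o5 := by gcongr; linarith
        _ = 2 ^ o5 * Q := by rw [Real.mul_rpow nN hz0.le]
        _ ≤ _ := by gcongr
    have hmon : SL (Real.exp z) ≤ SL (Real.exp y) := SL_mono (Real.exp_le_exp.mpr lI)
    have hq : (qq z + z - 1) * (1 - h) ≤ SL (Real.exp y) * Real.exp (-y) := by
      calc (qq z + z - 1) * (1 - h) ≤ (qq z + z - 1) * Real.exp (-h) := by
            gcongr; linarith [Real.add_one_le_exp (-h)]
        _ = SL (Real.exp z) * Real.exp (-y) := by rw [← hSz, mul_assoc, ← Real.exp_add]; congr 2; rw [hh]; ring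
        _ ≤ _ := by gcongr
    have hy' : y = z + h := by rw [hh]; ring
    have hqy : qq y = SL (Real.exp y) * Real.exp (-y) - y + 1 := rfl
    rw [one_mul]
    have : h * z ≤ 1.5 * Q := by
      calc h * z ≤ 1.5 * e * z := by gcongr
        _ = 1.5 * Q := by rw [← hez]; ring
    have h3 : qq z * h ≤ qq z * (1/10) := by
      apply mul_le_mul_of_nonneg_left <;> linarith
    have hfin : qq z - qq z * h - h * z ≤ qq y := by rw [hqy]; linarith
    linarith
  · refine hZ (-1) (z - e) sI lI fun y hy => ?_
    have hw : (z - e) ^ o8 ≤ 1.76 * e := by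
      have h3 : (z - e) ^ o8 ≤ (z / 2) ^ o8 := Real.rpow_le_rpow_of_nonpos lI lI nN
      refine h3.trans ?_
      rw [Real.div_rpow hz0.le nN, Real.rpow_neg (x := 2) nN, div_inv_eq_mul, mul_comm, ← he]
      gcongr
      have : o2 ^ (0.8:ℝ) ≤ (1.76 ^ (5/4:ℝ)) ^ (0.8:ℝ) := by
        gcongr
        have h4 : o2 = (16 : ℝ) ^ oq := by
          rw [show (16:ℝ) = 2 ^ (4:ℝ) by norm_num, ← Real.rpow_mul nN]; norm_num
        have h5 : (1.76 ^ (5/4:ℝ) : ℝ) = (1.76 ^ (5:ℝ)) ^ oq := by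
          rw [← Real.rpow_mul nN]; norm_num
        rw [h4, h5]; gcongr; norm_num
      rw [← Real.rpow_mul nN] at this; norm_num at this ⊢; exact this
    rw [abs_le] at hy
    set h := z - y with hh
    have hh1 : 0 ≤ h := by rw [hh]; linarith
    have hh2 : h ≤ 1.9 * e := by rw [hh]; linarith
    have hw2 : (z - e) ^ o5 ≤ 1.5 * Q := by
      calc (z - e) ^ o5 ≤ z ^ o5 := by gcongr <;> linarith
        _ ≤ _ := lI
    have hmon : SL (Real.exp y) ≤ SL (Real.exp z) := SL_mono (Real.exp_le_exp.mpr lI)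
    have hE : Real.exp h ≤ 1 + 1.1 * h := by
      have := Real.abs_exp_sub_one_sub_id_le (x := h) (by rw [abs_of_nonneg hh1]; linarith)
      have := (abs_le.mp this).2
      nlinarith
    have hq : SL (Real.exp y) * Real.exp (-y) ≤ (qq z + z - 1) * (1 + 1.1 * h) := by
      calc _ ≤ SL (Real.exp z) * Real.exp (-y) := by gcongr
        _ = (qq z + z - 1) * Real.exp h := by rw [← hSz, mul_assoc, ← Real.exp_add]; congr 2; rw [hh]; ring
        _ ≤ _ := by gcongr
    have hqy : qq y = SL (Real.exp y) * Real.exp (-y) - y + 1 := rfl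
    have hy' : y = z - h := by rw [hh]; ring
    have : h * z ≤ 1.9 * Q := by
      calc h * z ≤ 1.9 * e * z := by gcongr
        _ = 1.9 * Q := by rw [← hez]; ring
    have h3 : qq z * h ≤ 0 := mul_nonpos_of_nonpos_of_nonneg lI hh1
    have hfin : qq y ≤ qq z + 1.1 * (qq z * h) + 1.1 * (h * z) := by rw [hqy]; linarith
    linarith
lemma SL_psi {x : ℝ} (hx : 1 ≤ x) : |Chebyshev.psi x * Real.log x - SL x| ≤ 6 * x := by
  have h := sum_mul_eq_sub_integral_mul₀ (f := Real.log) (fun k => vonMangoldt k) sI x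
    (fun t ht => (Real.hasDerivAt_log (by linarith [ht.1])).differentiableAt)
    (by
      rw [Real.deriv_log']
      exact (continuousOn_inv₀.mono (fun t ht => by simp; linarith [ht.1])).integrableOn_Icc)
  have e1 : ∑ k ∈ Finset.Icc 0 ⌊x⌋₊, Real.log k * vonMangoldt k = SL x := by
    rw [SL, ← Finset.add_sum_Ioc_eq_sum_Icc (Nat.zero_le _)]
    simp only [ArithmeticFunction.map_zero, mul_zero, zero_add]
    rw [show Finset.Icc 1 ⌊x⌋₊ = Finset.Ioc 0 ⌊x⌋₊ from rfl]
    exact Finset.sum_congr rfl fun k _ => mul_comm _ _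
  simp only [e1, ← Chebyshev.psi_eq_sum_Icc] at h
  rw [h]
  have : |∫ t in Set.Ioc 1 x, deriv Real.log t * Chebyshev.psi t| ≤ 6 * (x - 1) := by
    have := norm_setIntegral_le_of_norm_le_const (μ := volume) (s := Set.Ioc 1 x) (f := fun t => deriv Real.log t * Chebyshev.psi t) (C := 6) sI (fun t ht => by
      have ht0 : 0 < t := by linarith [ht.1]
      have h2 := Chebyshev.psi_le_const_mul_self ht0.le
      have h3 := Chebyshev.psi_nonneg t
      have h4 : Real.log 4 ≤ 2 := by
        rw [show (4:ℝ) = 2 ^ 2 by norm_num, Real.log_pow]; have := Real.log_two_lt_d9; push_cast; linarith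
      rw [Real.deriv_log, Real.norm_of_nonneg pV, inv_mul_le_iff₀ ht0]
      nlinarith)
    rw [Real.norm_eq_abs, measureReal_def, Real.volume_Ioc, ENNReal.toReal_ofReal lI] at this
    exact this
  rw [show ∀ a b : ℝ, a * b - (b * a - ∫ t in Set.Ioc 1 x, deriv Real.log t * Chebyshev.psi t) = ∫ t in Set.Ioc 1 x, deriv Real.log t * Chebyshev.psi t from fun a b => by ring]
  linarith
theorem PNT : ∃ C : ℝ, 0 < C ∧ ∀ x : ℝ, 2 ≤ x → |Chebyshev.psi x - x| ≤ C * x * (Real.log x) ^ o8 := by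
  obtain ⟨Z, hZ1, hZ⟩ := qq_large
  refine ⟨11 + 7 * Z, lI, fun x hx => ?_⟩
  have hx0 : 0 < x := lI
  have hl0 : 0 < Real.log x := Real.log_pos lI
  set L := Real.log x with hL
  rcases le_total Z L with h | h
  · have h1 := hZ L h
    have h2 := SL_psi (show 1 ≤ x by linarith)
    have hq : SL x = x * (qq L + L - 1) := by
      rw [qq, hL, Real.exp_neg, Real.exp_log hx0]; field_simp; ring
    have h1L : 1 ≤ L := lI
    have h4 : 1 ≤ L ^ o5 := Real.one_le_rpow h1L nN
    have h3 : |L * (Chebyshev.psi x - x)| ≤ 11 * x * L ^ o5 := by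
      have : L * (Chebyshev.psi x - x) = (Chebyshev.psi x * L - SL x) + x * qq L - x := by rw [hq]; ring
      rw [this]
      calc _ ≤ |Chebyshev.psi x * L - SL x| + |x * qq L| + |x| := by
            refine (abs_sub _ _).trans ?_
            gcongr
            exact abs_add_le _ _
        _ ≤ 6 * x + x * (4 * L ^ o5) + x := by
            rw [abs_mul, abs_of_pos hx0]; gcongr
        _ ≤ _ := by nlinarith
    rw [abs_mul, abs_of_pos hl0] at h3
    have h5 : L * L ^ o8 = L ^ o5 := by
      nth_rw 1 [← Real.rpow_one L]; rw [← Real.rpow_add hl0]; norm_num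
    rw [← h5] at h3
    have h6 : L * |Chebyshev.psi x - x| ≤ L * ((11 + 7 * Z) * x * L ^ o8) := by
      refine h3.trans ?_
      have : 0 ≤ x * (L * L ^ o8) * (7 * Z) := pV
      nlinarith
    exact le_of_mul_le_mul_left h6 hl0
  · have h2 := Chebyshev.psi_le_const_mul_self hx0.le
    have h3 := Chebyshev.psi_nonneg x
    have h4 : Real.log 4 ≤ 2 := by
      rw [show (4:ℝ) = 2 ^ 2 by norm_num, Real.log_pow]; have := Real.log_two_lt_d9; push_cast; linarith
    have h5 : |Chebyshev.psi x - x| ≤ 7 * x := by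
      rw [abs_le]; constructor <;> nlinarith
    have h6 : Z⁻¹ ≤ L ^ o8 := by
      calc Z⁻¹ = Z ^ (-1:ℝ) := by rw [Real.rpow_neg_one]
        _ ≤ Z ^ o8 := by apply Real.rpow_le_rpow_of_exponent_le hZ1; norm_num
        _ ≤ L ^ o8 := Real.rpow_le_rpow_of_nonpos hl0 h nN
    calc _ ≤ 7 * x := h5
      _ = 7 * Z * x * Z⁻¹ := by field_simp
      _ ≤ (11 + 7 * Z) * x * Z⁻¹ := by gcongr; linarith
      _ ≤ _ := by gcongr
end PN
end PNT
noncomputable section XI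
namespace PN
open Filter Topology
structure IsXi (ξ : ℝ → ℝ) : Prop where
  z : ∀ u : ℝ, u < 1 → ξ u = 0
  e : ∀ u : ℝ, 1 ≤ u → u * ξ u = 2 + 2 * ∫ t in o1..(u - 1), ξ t
namespace IsXi
variable {ξ : ℝ → ℝ}
lemma int_lt (h : IsXi ξ) {a b : ℝ} (ha : a ≤ 1) (hb : b ≤ 1) : ∫ t in a..b, ξ t = 0 := by
  have : ∫ t in a..b, ξ t = ∫ t in a..b, o0 := by
    apply intervalIntegral.integral_congr_ae
    have : ∀ᵐ t : ℝ, t ≠ 1 := by simp [ae_iff]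
    filter_upwards [this] with t ht hm
    apply h.z
    rcases le_total a b with hab | hab
    · rw [Set.uIoc_of_le hab] at hm; exact lt_of_le_of_ne (hm.2.trans hb) ht
    · rw [Set.uIoc_of_ge hab] at hm; exact lt_of_le_of_ne (hm.2.trans ha) ht
  rw [this]; simp
lemma e' (h : IsXi ξ) {u : ℝ} (hu : 1 ≤ u) : u * ξ u = 2 + 2 * ∫ t in o1..(max (u - 1) 1), ξ t := by
  rw [h.e u hu]
  rcases le_total (u - 1) 1 with h1 | h1
  · rw [max_eq_right h1, h.int_lt le_rfl h1, h.int_lt le_rfl le_rfl]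
  · rw [max_eq_left h1]
lemma eq' (h : IsXi ξ) {u : ℝ} (hu : 1 ≤ u) : ξ u = (2 + 2 * ∫ t in o1..(max (u - 1) 1), ξ t) / u := by
  rw [eq_div_iff lI, mul_comm]; exact h.e' hu
lemma cont_aux (h : IsXi ξ) (n : ℕ) : ContinuousOn ξ (Set.Icc 1 (n + 1)) := by
  induction n with
  | zero => simp
  | succ n ih =>
    push_cast at ih ⊢
    have h1 : o1 ≤ n + 1 := by linarith [(Nat.cast_nonneg n : o0 ≤ n)]
    have hI : IntegrableOn ξ (Set.uIcc 1 ((n:ℝ) + 1)) := by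
      rw [Set.uIcc_of_le h1]; exact ih.integrableOn_Icc
    have h2 := intervalIntegral.continuousOn_primitive_interval (μ := volume) hI
    rw [Set.uIcc_of_le h1] at h2
    have h3 : ContinuousOn (fun u : ℝ => (2 + 2 * ∫ t in o1..(max (u - 1) 1), ξ t) / u) (Set.Icc 1 ((n:ℝ) + 1 + 1)) := by
      apply ContinuousOn.div
      · apply continuousOn_const.add
        apply continuousOn_const.mul
        exact h2.comp (f := fun u : ℝ => max (u - 1) 1) fP (fun u hu => ⟨le_max_right _ _, max_le (by linarith [hu.2]) h1⟩)
      · fun_prop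
      · intro u hu; linarith [hu.1]
    exact h3.congr fun u hu => h.eq' hu.1
lemma cont (h : IsXi ξ) : ContinuousOn ξ (Set.Ici 1) := by
  intro u hu
  obtain ⟨n, hn⟩ := exists_nat_gt u
  have h1 := h.cont_aux n u ⟨hu, lI⟩
  apply h1.mono_of_mem_nhdsWithin
  rw [mem_nhdsWithin]
  exact ⟨Set.Iio (n + 1), isOpen_Iio, by simp; linarith, fun x hx => ⟨hx.2, le_of_lt hx.1⟩⟩
lemma ii (h : IsXi ξ) {a b : ℝ} (ha : 1 ≤ a) (hb : 1 ≤ b) : IntervalIntegrable ξ volume a b := by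
  apply ContinuousOn.intervalIntegrable
  apply h.cont.mono
  intro x hx
  rcases le_total a b with hab | hab
  · rw [Set.uIcc_of_le hab] at hx; exact ha.trans hx.1
  · rw [Set.uIcc_of_ge hab] at hx; exact hb.trans hx.1
lemma meas (h : IsXi ξ) : Measurable ξ := by
  classical
  have h1 : ξ = (Set.Ici 1).piecewise (fun x => ξ (max x 1)) (fun _ => 0) := by
    funext x
    by_cases hx : x ∈ Set.Ici o1
    · rw [Set.piecewise_eq_of_mem _ _ _ hx, max_eq_left (Set.mem_Ici.mp hx)]
    · rw [Set.piecewise_eq_of_notMem _ _ _ hx]; exact h.z x (lt_of_not_ge (fun h' => hx (Set.mem_Ici.mpr h')))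
  rw [h1]
  apply Measurable.piecewise measurableSet_Ici
  · apply Continuous.measurable
    exact h.cont.comp_continuous fP (fun x => Set.mem_Ici.mpr (le_max_right _ _))
  · fun_prop
lemma eq12 (h : IsXi ξ) {u : ℝ} (h1 : 1 ≤ u) (h2 : u ≤ 2) : ξ u = 2 / u := by
  rw [h.eq' h1, max_eq_right lI]; simp
lemma eq23 (h : IsXi ξ) {u : ℝ} (h1 : 2 ≤ u) (h2 : u ≤ 3) : ξ u = (2 + 4 * Real.log (u - 1)) / u := by
  rw [h.eq' lI, max_eq_left lI]
  have : ∫ t in o1..(u - 1), ξ t = ∫ t in o1..(u - 1), 2 * t⁻¹ := by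
    apply intervalIntegral.integral_congr
    intro t ht
    rw [Set.uIcc_of_le lI] at ht
    simp only
    rw [h.eq12 ht.1 (by linarith [ht.2])]; ring
  rw [this, intervalIntegral.integral_const_mul, integral_inv_of_pos one_pos lI, div_one]
  ring
lemma hasDeriv (h : IsXi ξ) {u : ℝ} (hu : 2 < u) : HasDerivAt (fun u => u * ξ u) (2 * ξ (u - 1)) u := by
  have hc : ContinuousAt ξ (u - 1) := (h.cont (u-1) (by simp; linarith)).continuousAt (Ici_mem_nhds lI)
  have h1 : HasDerivAt (fun x => ∫ t in o1..x, ξ t) (ξ (u - 1)) (u - 1) :=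
    intervalIntegral.integral_hasDerivAt_right (h.ii le_rfl lI)
      (h.meas.stronglyMeasurable.stronglyMeasurableAtFilter) hc
  have h2 : HasDerivAt (fun x => 2 + 2 * ∫ t in o1..(x - 1), ξ t) (2 * ξ (u - 1)) u := by
    have := (h1.comp_sub_const u 1).const_mul 2
    exact this.const_add 2
  apply h2.congr_of_eventuallyEq
  filter_upwards [Ioi_mem_nhds hu] with x hx
  exact h.e x (by linarith [Set.mem_Ioi.mp hx])
def g (ξ : ℝ → ℝ) (u : ℝ) : ℝ := ξ u / (u + 2)
lemma g_deriv (h : IsXi ξ) {u : ℝ} (hu : 2 < u) :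
    HasDerivAt (g ξ) (-(2 * (u + 1) / (u * (u + 2))) * (g ξ u - g ξ (u - 1))) u := by
  have h1 := (h.hasDeriv hu).div ((hasDerivAt_id u).fun_mul ((hasDerivAt_id u).add_const 2)) (by simp; constructor <;> linarith)
  have h2 := HasDerivAt.congr_of_eventuallyEq (f₁ := g ξ) h1 (by
    filter_upwards [Ioi_mem_nhds (show 0 < u by linarith)] with x hx
    have : 0 < x := hx
    simp only [g, Pi.div_apply, id]
    field_simp)
  refine h2.congr_deriv ?_
  simp only [g, id]
  have : u - 1 + 2 = u + 1 := by ring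
  rw [this]
  field_simp
  ring
lemma nonneg_aux (h : IsXi ξ) (n : ℕ) : ∀ u : ℝ, u ≤ n → 0 ≤ ξ u := by
  induction n with
  | zero => intro u hu; rw [h.z u (by push_cast at hu; linarith)]
  | succ n ih =>
    intro u hu
    rcases lt_or_ge u 1 with h1 | h1
    · rw [h.z u h1]
    · rw [h.eq' h1]
      have : 0 ≤ ∫ t in o1..(max (u - 1) 1), ξ t := by
        rcases le_total (u - 1) 1 with h2 | h2
        · rw [max_eq_right h2]; simp
        · rw [max_eq_left h2]
          apply intervalIntegral.integral_nonneg h2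
          intro t ht; apply ih; push_cast at hu; linarith [ht.2]
      positivity
lemma nonneg (h : IsXi ξ) (u : ℝ) : 0 ≤ ξ u := by
  obtain ⟨n, hn⟩ := exists_nat_ge u
  exact h.nonneg_aux n u hn
lemma gc (h : IsXi ξ) : ContinuousOn (g ξ) (Set.Ici 1) := by
  apply h.cont.div fP
  intro x hx; have : o1 ≤ x := hx
  linarith
lemma q_le {u U : ℝ} (hU : 1 ≤ U) (hu : U ≤ u) : 2 * (u + 1) / (u * (u + 2)) ≤ 2 * (U + 1) / (U * (U + 2)) := by
  have hU0 : 0 < U := lI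
  have hu0 : 0 < u := lI
  rw [div_le_div_iff₀ pV pV]
  nlinarith [mul_nonneg (sub_nonneg.mpr hu) (show 0 ≤ U + u * U + u + 2 by positivity), mul_nonneg (sub_nonneg.mpr hu) (show 0 ≤ U * u by positivity)]
lemma g_decay (h : IsXi ξ) {a K : ℝ} (ha : 3 ≤ a) (hK : ∀ u, a - 1 < u → u ≤ a → |deriv (g ξ) u| ≤ K) :
    ∀ u, a - 1 < u → |deriv (g ξ) u| ≤ K * Real.exp (-(u - a) / 2) := by
  have hK0 : 0 ≤ K := (abs_nonneg _).trans (hK a lI le_rfl)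
  set B : ℝ → ℝ := fun u => |deriv (g ξ) u| * Real.exp ((u - a) / 2) with hB
  have hq : ∀ u, a < u → ∃ η, u - 1 < η ∧ η < u ∧ |deriv (g ξ) u| ≤ 8 / 15 * |deriv (g ξ) η| := by
    intro u hu
    obtain ⟨η, hη, he⟩ := exists_deriv_eq_slope (g ξ) (show u - 1 < u by linarith)
      (h.gc.mono fun x hx => by have := hx.1; simp; linarith)
      (fun x hx => (h.g_deriv (by linarith [hx.1])).differentiableAt.differentiableWithinAt)
    refine ⟨η, hη.1, hη.2, ?_⟩
    rw [he, (h.g_deriv lI).deriv]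
    have : u - (u - 1) = 1 := by ring
    have hq3 : 2 * (u + 1) / (u * (u + 2)) ≤ 8 / 15 := (q_le (U := 3) nN lI).trans nN
    rw [this, div_one, abs_mul, abs_neg, abs_of_nonneg (by apply div_nonneg <;> nlinarith)]
    gcongr
  have hbd : ∀ U, ∃ S, ∀ u, a - 1 < u → u ≤ U → B u ≤ S := by
    intro U
    have hc : ContinuousOn (g ξ) (Set.Icc 1 U) := h.gc.mono fun x hx => hx.1
    obtain ⟨M, hM⟩ := isCompact_Icc.exists_bound_of_continuousOn hc
    refine ⟨1 * (M + M) * Real.exp ((U - a)/2), fun u h1 h2 => ?_⟩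
    rw [hB]; simp only
    rw [(h.g_deriv lI).deriv, abs_mul, abs_neg, abs_of_nonneg (by apply div_nonneg <;> nlinarith)]
    have e1 := hM u ⟨lI, h2⟩
    have e2 := hM (u - 1) ⟨lI, lI⟩
    rw [Real.norm_eq_abs] at e1 e2
    have hM0 : 0 ≤ M := (abs_nonneg _).trans e1
    have hq2 : 2 * (u + 1) / (u * (u + 2)) ≤ 1 := (q_le (U := 2) nN lI).trans nN
    gcongr
    · exact (abs_sub _ _).trans (by gcongr)
  have he1 : Real.exp (1/2) ≤ 1.7 := by
    have := Real.exp_one_lt_d9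
    have h2 : Real.exp (1/2) ^ 2 = Real.exp 1 := by rw [← Real.exp_nat_mul]; norm_num
    nlinarith [Real.exp_pos (1/2)]
  have main : ∀ U, a < U → ∀ u, a - 1 < u → u ≤ U → B u ≤ K := by
    intro U hU
    obtain ⟨S0, hS0⟩ := hbd U
    set A := B '' (Set.Ioc (a - 1) U) with hA
    have hbdd : BddAbove A := ⟨S0, by rintro _ ⟨u, hu, rfl⟩; exact hS0 u hu.1 hu.2⟩
    set S := sSup A with hS
    have hle : ∀ u, a - 1 < u → u ≤ U → B u ≤ S := fun u h1 h2 => le_csSup hbdd ⟨u, ⟨h1, h2⟩, rfl⟩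
    have hB0 : ∀ u, 0 ≤ B u := fun u => by rw [hB]; positivity
    have hS0 : 0 ≤ S := (hB0 a).trans (hle a lI hU.le)
    have hSK : S ≤ max K (0.95 * S) := by
      refine csSup_le (Set.Nonempty.image B ⟨a, ⟨lI, hU.le⟩⟩) ?_
      rintro _ ⟨u, hu, rfl⟩
      rcases le_or_gt u a with h1 | h1
      · apply le_max_of_le_left
        calc B u ≤ K * 1 := by
              rw [hB]; simp only
              gcongr
              · exact hK u hu.1 h1
              · apply Real.exp_le_one_iff.mpr; linarith
          _ = K := mul_one K
      · apply le_max_of_le_right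
        obtain ⟨η, e1, e2, e3⟩ := hq u h1
        have e4 := hle η lI (by linarith [hu.2])
        have e5 : Real.exp ((u - a)/2) ≤ 1.7 * Real.exp ((η - a)/2) := by
          calc Real.exp ((u - a)/2) ≤ Real.exp (1/2 + (η - a)/2) := by apply Real.exp_le_exp.mpr; linarith
            _ = Real.exp (1/2) * Real.exp ((η - a)/2) := Real.exp_add _ _
            _ ≤ _ := by gcongr
        calc B u ≤ (8 / 15 * |deriv (g ξ) η|) * (1.7 * Real.exp ((η - a)/2)) := by
              rw [hB]; simp only; gcongr
          _ = (8/15*1.7) * B η := by rw [hB]; ring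
          _ ≤ (8/15*1.7) * S := by gcongr
          _ ≤ 0.95 * S := by gcongr; norm_num
    have hSK2 : S ≤ K := by
      rcases le_max_iff.mp hSK with h1 | h1
      · exact h1
      · linarith
    intro u h1 h2
    exact (hle u h1 h2).trans hSK2
  intro u hu
  have := main (max u a + 1) (by linarith [le_max_right u a]) u hu (by linarith [le_max_left u a])
  rw [hB] at this; simp only at this
  rw [neg_div, Real.exp_neg, ← div_eq_mul_inv, le_div_iff₀ (Real.exp_pos _)]
  exact this
lemma g_diff (h : IsXi ξ) {a K : ℝ} (ha : 3 ≤ a) (hK : ∀ u, a - 1 < u → u ≤ a → |deriv (g ξ) u| ≤ K)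
    {u v : ℝ} (hu : a - 1 < u) (huv : u ≤ v) : |g ξ v - g ξ u| ≤ 2 * K * Real.exp (-(u - a) / 2) := by
  have hK0 : 0 ≤ K := (abs_nonneg _).trans (hK a lI le_rfl)
  have hd := h.g_decay ha hK
  have hB : ∀ x ∈ Set.Ico u v, HasDerivWithinAt (fun x => -2 * K * Real.exp (-(x - a) / 2) + 2 * K * Real.exp (-(u - a) / 2)) (K * Real.exp (-(x - a) / 2)) (Set.Ici x) x := by
    intro x _
    have h1 : HasDerivAt (fun x : ℝ => -(x - a) / 2) (-1/2) x := by
      simpa using (((hasDerivAt_id x).sub_const a).fun_neg).div_const 2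
    have := ((h1.exp).const_mul (-2 * K)).add_const (2 * K * Real.exp (-(u - a) / 2))
    refine (this.hasDerivWithinAt).congr_deriv ?_
    ring
  have := image_norm_le_of_norm_deriv_right_le_deriv_boundary' (f := fun x => g ξ x - g ξ u) (f' := deriv (g ξ)) (a := u) (b := v)
      (B := fun x => -2 * K * Real.exp (-(x - a) / 2) + 2 * K * Real.exp (-(u - a) / 2)) (B' := fun x => K * Real.exp (-(x - a) / 2))
      ((h.gc.mono fun x hx => by have := hx.1; simp; linarith).sub continuousOn_const)
      (fun x hx => ((h.g_deriv (by linarith [hx.1])).differentiableAt.hasDerivAt.sub_const _).hasDerivWithinAt)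
      sI fP hB (fun x hx => by
        rw [Real.norm_eq_abs]; exact hd x (by linarith [hx.1]))
  have h2 := this (Set.right_mem_Icc.mpr huv)
  rw [Real.norm_eq_abs] at h2
  have : 0 ≤ 2 * K * Real.exp (-(v - a) / 2) := pV
  linarith
lemma bound_aux (h : IsXi ξ) : ∃ c K : ℝ, 0 ≤ K ∧ ∀ u : ℝ, 0 ≤ u → |ξ u - c * (u + 2)| ≤ K * Real.exp (-u / 4) := by
  obtain ⟨M, hM⟩ := isCompact_Icc.exists_bound_of_continuousOn (h.gc.mono (fun x (hx : x ∈ Set.Icc 1 3) => hx.1))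
  have hK : ∀ u, (3:ℝ) - 1 < u → u ≤ 3 → |deriv (g ξ) u| ≤ M + M := by
    intro u h1 h2
    have e1 := hM u ⟨lI, h2⟩
    have e2 := hM (u - 1) ⟨lI, lI⟩
    rw [Real.norm_eq_abs] at e1 e2
    have hq2 : 2 * (u + 1) / (u * (u + 2)) ≤ 1 := (q_le (U := 2) nN lI).trans nN
    rw [(h.g_deriv lI).deriv, abs_mul, abs_neg, abs_of_nonneg (by apply div_nonneg <;> nlinarith)]
    calc _ ≤ 1 * |g ξ u - g ξ (u - 1)| := by gcongr
      _ ≤ M + M := by rw [one_mul]; exact (abs_sub _ _).trans (add_le_add e1 e2)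
  set K := M + M
  have hK0 : 0 ≤ K := (abs_nonneg _).trans (hK 3 lI le_rfl)
  have hd : ∀ u v : ℝ, 2 < u → u ≤ v → |g ξ v - g ξ u| ≤ 2 * K * Real.exp (-(u - 3) / 2) := fun u v h1 h2 =>
    h.g_diff le_rfl hK lI h2
  have hb : Tendsto (fun u : ℝ => 2 * K * Real.exp (-(u - 3) / 2)) atTop (𝓝 0) := by
    rw [show o0 = 2 * K * 0 by ring]
    apply Tendsto.const_mul
    apply Real.tendsto_exp_atBot.comp
    apply Tendsto.atBot_div_const nN
    exact tendsto_neg_atTop_atBot.comp (tendsto_atTop_add_const_right _ _ tendsto_id)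
  have hc : CauchySeq (g ξ) := by
    apply Metric.cauchySeq_iff'.mpr
    intro ε hε
    obtain ⟨u, hu, hu2⟩ := ((hb.eventually_lt_const hε).and (eventually_gt_atTop 2)).exists
    exact ⟨u, fun v hv => lt_of_le_of_lt (by rw [Real.dist_eq]; exact hd u v hu2 hv) hu⟩
  obtain ⟨c, hc⟩ := cauchySeq_tendsto_of_complete hc
  have h3 : ∀ u, 2 < u → |g ξ u - c| ≤ 2 * K * Real.exp (-(u - 3) / 2) := by
    intro u hu
    have : Tendsto (fun v => |g ξ v - g ξ u|) atTop (𝓝 |c - g ξ u|) := (hc.sub_const _).abs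
    rw [abs_sub_comm]
    exact le_of_tendsto this ((eventually_ge_atTop u).mono fun v hv => hd u v hu hv)
  set K' := 2 * K * Real.exp (3/2) * 6 + (2 + 4 * |c|) * Real.exp 1
  refine ⟨c, K', pV, fun u hu => ?_⟩
  rcases lt_or_ge 2 u with h1 | h1
  · have e1 : ξ u - c * (u + 2) = (u + 2) * (g ξ u - c) := by
      rw [g]; field_simp
    rw [e1, abs_mul, abs_of_pos lI]
    have e2 : u + 2 ≤ 6 * Real.exp (u / 4) := by
      have := Real.add_one_le_exp (u / 4); linarith
    calc (u + 2) * |g ξ u - c| ≤ (6 * Real.exp (u / 4)) * (2 * K * Real.exp (-(u - 3) / 2)) := by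
          gcongr; exact h3 u h1
      _ = 2 * K * Real.exp (3/2) * 6 * Real.exp (-u / 4) := by
          rw [show -(u - 3) / 2 = 3 / 2 + (- u / 4) + (- (u / 4)) by ring, Real.exp_add, Real.exp_add, Real.exp_neg (u/4)]
          field_simp
      _ ≤ K' * Real.exp (-u / 4) := by
          gcongr; apply le_add_of_nonneg_right; positivity
  · have e0 : |ξ u| ≤ 2 := by
      rcases lt_or_ge u 1 with h2 | h2
      · rw [h.z u h2]; norm_num
      · rw [h.eq12 h2 h1, abs_of_pos pV, div_le_iff₀ lI]; linarith
    have e1 : |ξ u - c * (u + 2)| ≤ 2 + 4 * |c| := by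
      refine (abs_sub _ _).trans ?_
      rw [abs_mul, abs_of_pos (by linarith : 0 < u + 2)]
      nlinarith [abs_nonneg c]
    calc |ξ u - c * (u + 2)| ≤ (2 + 4 * |c|) * 1 := lI
      _ ≤ (2 + 4 * |c|) * (Real.exp 1 * Real.exp (-u / 4)) := by
          gcongr; rw [← Real.exp_add]; apply Real.one_le_exp; linarith
      _ ≤ K' * Real.exp (-u / 4) := by
          rw [← mul_assoc]; gcongr; apply le_add_of_nonneg_left; positivity
lemma bound (h : IsXi ξ) (δ : ℝ) (hδ1 : 0.713611 < δ) (hδ2 : δ < 0.713614) (c : ℝ) (hc : c = Real.exp (-2 * Real.eulerMascheroniConstant))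
    (hδeq : 0 = 1 + (∫ v in Set.Ioi o0, (ξ v - (v + 2) * c) * (v + 1) ^ (-δ - 1)) + c / δ + c / (δ - 1)) :
    ∃ K : ℝ, 0 ≤ K ∧ ∀ u : ℝ, 0 ≤ u → |ξ u - c * (u + 2)| ≤ K * Real.exp (-u / 4) := by
  obtain ⟨c', K, hK, hb⟩ := h.bound_aux
  by_cases hcc : c' = c
  · exact ⟨K, hK, hcc ▸ hb⟩
  exfalso
  have hint : IntegrableOn (fun v : ℝ => Real.exp (-v / 4)) (Set.Ioi 0) := by
    have := integrableOn_exp_mul_Ioi (show (-1/4 : ℝ) < 0 by norm_num) 0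
    refine this.congr_fun (fun x _ => by simp only; congr 1; ring) measurableSet_Ioi
  have hm : Measurable (fun v : ℝ => (v + 1) ^ (-δ - 1)) := fP
  have h1 : IntegrableOn (fun v => (ξ v - c' * (v + 2)) * (v + 1) ^ (-δ - 1)) (Set.Ioi 0) := by
    refine Integrable.mono' (hint.const_mul K) (((h.meas.sub fP).mul hm).aestronglyMeasurable) ?_
    refine (ae_restrict_mem measurableSet_Ioi).mono fun v hv => ?_
    have hv : 0 < v := hv
    rw [Real.norm_eq_abs, abs_mul]
    have : |(v + 1) ^ (-δ - 1)| ≤ 1 := by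
      rw [abs_of_nonneg pV]
      exact Real.rpow_le_one_of_one_le_of_nonpos lI lI
    calc _ ≤ (K * Real.exp (-v / 4)) * 1 := by
          gcongr; exact hb v hv.le
      _ = _ := mul_one _
  have hn : ¬ IntegrableOn (fun v => (ξ v - (v + 2) * c) * (v + 1) ^ (-δ - 1)) (Set.Ioi 0) := by
    intro h2
    have h3 : IntegrableOn (fun v : ℝ => (v + 2) * (v + 1) ^ (-δ - 1)) (Set.Ioi 0) := by
      have h4 : IntegrableOn (fun v => (c' - c)⁻¹ * ((ξ v - (v + 2) * c) * (v + 1) ^ (-δ - 1) - (ξ v - c' * (v + 2)) * (v + 1) ^ (-δ - 1))) (Set.Ioi 0) := (h2.sub h1).const_mul _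
      refine h4.congr_fun (fun v _ => ?_) measurableSet_Ioi
      have : c' - c ≠ 0 := sub_ne_zero.mpr hcc
      simp only
      field_simp
      ring
    have h4 : IntegrableOn (fun v : ℝ => v ^ (-δ)) (Set.Ioi 1) := by
      have h5 : IntegrableOn (fun v : ℝ => 2 * ((v + 2) * (v + 1) ^ (-δ - 1))) (Set.Ioi 1) := (h3.mono_set (Set.Ioi_subset_Ioi zero_le_one)).const_mul 2
      refine Integrable.mono' h5 fP ?_
      refine (ae_restrict_mem measurableSet_Ioi).mono fun v hv => ?_
      have hv : 1 < v := hv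
      have hv0 : 0 < v := lI
      rw [Real.norm_eq_abs, abs_of_nonneg pV]
      have e1 : (v + 1) ^ (-δ - 1) = (v + 1) ^ (-δ) / (v + 1) := by rw [Real.rpow_sub_one lI]
      have e2 : v ^ (-δ) ≤ 2 * (v + 1) ^ (-δ) := by
        rw [Real.rpow_neg hv0.le, Real.rpow_neg lI, ← div_eq_mul_inv, inv_eq_one_div, div_le_div_iff₀ pV pV, one_mul]
        calc (v + 1) ^ δ ≤ (2 * v) ^ δ := by
              apply Real.rpow_le_rpow <;> linarith
          _ = 2 ^ δ * v ^ δ := Real.mul_rpow nN hv0.le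
          _ ≤ 2 * v ^ δ := by
              gcongr
              calc o2 ^ δ ≤ 2 ^ o1 := by apply Real.rpow_le_rpow_of_exponent_le <;> linarith
                _ = 2 := sI
      refine e2.trans ?_
      rw [e1, ← mul_div_assoc]
      have : (v + 1) ^ (-δ) ≤ (v + 2) * (v + 1) ^ (-δ) / (v + 1) := by
        rw [le_div_iff₀ lI, mul_comm]
        gcongr; linarith
      linarith
    have h5 := (integrableOn_Ioi_rpow_iff (s := -δ) one_pos).mp h4
    linarith
  rw [integral_undef hn] at hδeq
  have hγ := Real.one_half_lt_eulerMascheroniConstant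
  have hc1 : c ≤ 0.4 := by
    rw [hc]
    calc Real.exp (-2 * Real.eulerMascheroniConstant) ≤ Real.exp (-1) := by apply Real.exp_le_exp.mpr; linarith
      _ = (Real.exp 1)⁻¹ := Real.exp_neg 1
      _ ≤ 0.4 := by
        rw [inv_le_comm₀ (Real.exp_pos _) nN]
        linarith [Real.exp_one_gt_d9]
  have hc0 : 0 < c := by rw [hc]; positivity
  have e1 : c / (1 - δ) ≤ c * 3.5 := by
    rw [div_le_iff₀ lI]; nlinarith
  have e2 : c * 1.4 ≤ c / δ := by
    rw [le_div_iff₀ lI]; nlinarith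
  have e3 : c / (δ - 1) = - (c / (1 - δ)) := by rw [← neg_sub, div_neg]
  rw [e3] at hδeq
  linarith
end IsXi
structure KX (ξ : ℝ → ℝ) (c : ℝ) : Prop extends IsXi ξ where
  c0 : 0 < c
  bd : ∃ K : ℝ, 0 ≤ K ∧ ∀ u : ℝ, 0 ≤ u → |ξ u - c * (u + 2)| ≤ K * Real.exp (-u / 4)
def kap (ξ : ℝ → ℝ) (c u : ℝ) : ℝ := ξ u - c * (u + 2)
namespace KX
variable {ξ : ℝ → ℝ} {c : ℝ}
lemma kmeas (h : KX ξ c) : Measurable (kap ξ c) := h.meas.sub fP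
lemma xi_ii (h : KX ξ c) (a b : ℝ) : IntervalIntegrable ξ volume a b := by
  have h1 : ∀ b, IntervalIntegrable ξ volume 1 b := by
    intro b
    rcases le_total 1 b with hb | hb
    · exact h.ii le_rfl hb
    · refine (intervalIntegrable_const (c := o0)).congr_ae ?_
      have : ∀ᵐ t : ℝ, t ≠ 1 := by simp [ae_iff]
      refine ae_restrict_of_ae_restrict_of_subset (Set.Subset.rfl) ?_
      filter_upwards [ae_restrict_of_ae this, ae_restrict_mem measurableSet_uIoc] with t ht hm
      rw [Set.uIoc_of_ge hb] at hm
      exact (h.z t (lt_of_le_of_ne hm.2 ht)).symm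
  exact (h1 a).symm.trans (h1 b)
lemma k_ii (h : KX ξ c) (a b : ℝ) : IntervalIntegrable (kap ξ c) volume a b :=
  (h.xi_ii a b).sub (Continuous.intervalIntegrable fP a b)
lemma K1 (h : KX ξ c) {u : ℝ} (hu : 1 ≤ u) : u * kap ξ c u = 2 - 3 * c + 2 * ∫ t in o0..(u-1), kap ξ c t := by
  have h1 : ∫ t in o0..(u-1), kap ξ c t = (∫ t in o0..(u-1), ξ t) - ∫ t in o0..(u-1), c * (t + 2) :=
    intervalIntegral.integral_sub (h.xi_ii _ _) (Continuous.intervalIntegrable fP _ _)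
  have h2 : ∫ t in o0..(u-1), c * (t + 2) = c * ((u-1)^2/2 + 2 * (u - 1)) := by
    rw [intervalIntegral.integral_const_mul, intervalIntegral.integral_add (Continuous.intervalIntegrable fP _ _) (Continuous.intervalIntegrable fP _ _)]
    rw [integral_id, intervalIntegral.integral_const, smul_eq_mul]; ring
  have h3 : ∫ t in o0..(u-1), ξ t = ∫ t in o1..(u-1), ξ t := by
    rw [← intervalIntegral.integral_add_adjacent_intervals (h.xi_ii 0 1) (h.xi_ii 1 (u-1)), h.int_lt zero_le_one le_rfl, zero_add]
  have h4 := h.e u hu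
  rw [h1, h2, h3, kap]
  linear_combination h4
lemma lip (h : KX ξ c) : ∃ C : ℝ, 0 ≤ C ∧ ∀ u v : ℝ, 1 ≤ u → u ≤ v → |kap ξ c u - kap ξ c v| ≤ C * (v - u) / u := by
  obtain ⟨K, hK, hb⟩ := h.bd
  have hb' : ∀ u, 0 ≤ u → |kap ξ c u| ≤ K := fun u hu => (hb u hu).trans (by
    have : Real.exp (-u/4) ≤ 1 := Real.exp_le_one_iff.mpr lI
    nlinarith)
  refine ⟨3 * K, pV, fun u v hu huv => ?_⟩
  have h1 := h.K1 hu
  have h2 := h.K1 (hu.trans huv)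
  have h3 := intervalIntegral.integral_add_adjacent_intervals (h.k_ii 0 (u-1)) (h.k_ii (u-1) (v-1))
  have h4 : |∫ t in (u-1)..(v-1), kap ξ c t| ≤ K * |(v - 1) - (u - 1)| :=
    intervalIntegral.norm_integral_le_of_norm_le_const (f := kap ξ c) (fun t ht => by
      rw [Set.uIoc_of_le lI] at ht
      exact hb' t (by linarith [ht.1]))
  rw [abs_of_nonneg (show 0 ≤ v - 1 - (u - 1) by linarith)] at h4
  have h5 : u * (kap ξ c u - kap ξ c v) = (v - u) * kap ξ c v - 2 * ∫ t in (u-1)..(v-1), kap ξ c t := by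
    linear_combination h1 - h2 + 2 * h3
  have h6 : u * |kap ξ c u - kap ξ c v| ≤ 3 * K * (v - u) := by
    have e1 : u * |kap ξ c u - kap ξ c v| = |u * (kap ξ c u - kap ξ c v)| := by rw [abs_mul, abs_of_pos (show 0 < u by linarith)]
    rw [e1, h5]
    refine (abs_sub _ _).trans ?_
    rw [abs_mul, abs_mul, abs_of_nonneg (show 0 ≤ v - u by linarith), abs_of_pos (show o0 < 2 by norm_num)]
    have := mul_le_mul_of_nonneg_left (hb' v lI) (show 0 ≤ v - u by linarith)
    linarith
  rw [le_div_iff₀ lI]; linarith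
end KX
def tau (n : ℕ) : ℝ := (n.divisors.card : ℝ)
lemma tau_nonneg (n : ℕ) : 0 ≤ tau n := Nat.cast_nonneg _
def fS (S : Finset ℕ) (n : ℕ) : ℝ := if ∀ p ∈ S, ¬ p ∣ n then tau n else 0
lemma fS_nonneg (S : Finset ℕ) (n : ℕ) : 0 ≤ fS S n := by
  unfold fS; split_ifs <;> simp [tau_nonneg]
def PhiS (S : Finset ℕ) (x : ℝ) : ℝ := ∑ n ∈ Finset.Icc 1 ⌊x⌋₊, fS S n
lemma sum_dvd (g : ℕ → ℝ) (N d : ℕ) (hd : 0 < d) :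
    ∑ n ∈ Finset.Icc 1 N, (if d ∣ n then g (n / d) else 0) = ∑ m ∈ Finset.Icc 1 (N / d), g m := by
  rw [← Finset.sum_filter]
  refine Finset.sum_nbij' (fun n => n / d) (fun m => m * d) ?_ ?_ ?_ ?_ ?_
  · intro n hn
    simp only [Finset.mem_filter, Finset.mem_Icc] at hn ⊢
    exact ⟨Nat.div_pos (Nat.le_of_dvd hn.1.1 hn.2) hd, Nat.div_le_div_right hn.1.2⟩
  · intro m hm
    simp only [Finset.mem_filter, Finset.mem_Icc] at hm ⊢
    exact ⟨⟨Nat.mul_pos hm.1 hd, (Nat.le_div_iff_mul_le hd).mp hm.2⟩, Dvd.intro_left _ rfl⟩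
  · intro n hn
    simp only [Finset.mem_filter] at hn
    exact Nat.div_mul_cancel hn.2
  · intro m hm; exact Nat.mul_div_cancel _ hd
  · intro n hn; rfl
lemma tau_pow_mul {p : ℕ} (hp : p.Prime) (k m : ℕ) (hm : ¬ p ∣ m) : tau (p ^ k * m) = (k + 1) * tau m := by
  unfold tau
  rw [Nat.Coprime.card_divisors_mul (((Nat.Prime.coprime_iff_not_dvd hp).mpr hm).pow_left k), Nat.divisors_prime_pow hp]
  simp
lemma fS_insert {S : Finset ℕ} (hS : ∀ q ∈ S, q.Prime) {p : ℕ} (hp : p.Prime) (hpS : p ∉ S) {n : ℕ} (hn : 1 ≤ n) :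
    fS (insert p S) n = fS S n - 2 * (if p ∣ n then fS S (n / p) else 0) + (if p ^ 2 ∣ n then fS S (n / p ^ 2) else 0) := by
  obtain ⟨k, m, hm, rfl⟩ := Nat.exists_eq_pow_mul_and_not_dvd (show n ≠ 0 by omega) p hp.ne_one
  have key : ∀ j, (∀ q ∈ S, ¬ q ∣ p ^ j * m) ↔ ∀ q ∈ S, ¬ q ∣ m := by
    intro j
    refine forall₂_congr fun q hq => not_congr ?_
    rw [(hS q hq).dvd_mul]
    constructor
    · rintro (h | h)
      · exact absurd ((Nat.prime_dvd_prime_iff_eq (hS q hq) hp).mp ((hS q hq).dvd_of_dvd_pow h)) (fun h' => hpS (h' ▸ hq))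
      · exact h
    · exact Or.inr
  have hf : ∀ j : ℕ, fS S (p ^ j * m) = (j + 1) * fS S m := by
    intro j
    unfold fS
    simp only [key j, tau_pow_mul hp j m hm]
    split_ifs <;> simp
  have hins : fS (insert p S) (p ^ k * m) = if k = 0 then fS S m else 0 := by
    rcases Nat.eq_zero_or_pos k with rfl | hk
    · simp only [pow_zero, one_mul, if_true, fS, Finset.forall_mem_insert, hm, not_false_eq_true, true_and]
    · rw [if_neg oM, fS, if_neg]
      intro h
      exact h p (Finset.mem_insert_self _ _) (Dvd.dvd.mul_right (dvd_pow_self p oM) m)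
  have hp0 : 0 < p := hp.pos
  rw [hins]
  match k with
  | 0 =>
    have h2 : ¬ p ^ 2 ∣ m := fun h => hm ((dvd_pow_self p two_ne_zero).trans h)
    simp [hm, h2]
  | 1 =>
    have h2 : ¬ p ^ 2 ∣ p ^ 1 * m := by
      intro h
      rw [pow_two, pow_one] at h
      exact hm (Nat.dvd_of_mul_dvd_mul_left hp0 h)
    have e1 : p ^ 1 * m / p = m := by rw [pow_one, Nat.mul_div_cancel_left _ hp0]
    rw [hf, if_neg h2, if_neg one_ne_zero, if_pos (show p ∣ p ^ 1 * m by rw [pow_one]; exact Dvd.intro _ rfl), e1]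
    push_cast; ring
  | k + 2 =>
    have e1 : p ^ (k+2) * m / p = p ^ (k+1) * m := by
      rw [show p ^ (k+2) * m = p * (p ^ (k+1) * m) by ring, Nat.mul_div_cancel_left _ hp0]
    have e2 : p ^ (k+2) * m / p ^ 2 = p ^ k * m := by
      rw [show p ^ (k+2) * m = p ^ 2 * (p ^ k * m) by ring, Nat.mul_div_cancel_left _ pV]
    have d1 : p ∣ p ^ (k+2) * m := ⟨p ^ (k+1) * m, by ring⟩
    have d2 : p ^ 2 ∣ p ^ (k+2) * m := ⟨p ^ k * m, by ring⟩
    rw [if_pos d1, if_pos d2, e1, e2, hf, hf, hf, if_neg oM]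
    push_cast; ring
lemma PhiS_insert {S : Finset ℕ} (hS : ∀ q ∈ S, q.Prime) {p : ℕ} (hp : p.Prime) (hpS : p ∉ S) (x : ℝ) :
    PhiS (insert p S) x = PhiS S x - 2 * PhiS S (x / p) + PhiS S (x / p ^ 2) := by
  unfold PhiS
  rw [Finset.sum_congr rfl (fun n hn => fS_insert hS hp hpS (Finset.mem_Icc.mp hn).1), Finset.sum_add_distrib, Finset.sum_sub_distrib,
    ← Finset.mul_sum, sum_dvd _ _ _ hp.pos, sum_dvd _ _ _ (pow_pos hp.pos 2)]
  rw [Nat.floor_div_natCast, ← Nat.cast_pow, Nat.floor_div_natCast]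
lemma tau_eq_sum (N : ℕ) : ∑ n ∈ Finset.Icc 1 N, tau n = ∑ a ∈ Finset.Icc 1 N, ((N / a : ℕ) : ℝ) := by
  have := ArithmeticFunction.sum_Ioc_sigma0_eq_sum_div N
  unfold tau
  rw [show Finset.Icc 1 N = Finset.Ioc 0 N by ext; simp [Nat.succ_le_iff]]
  simp only [ArithmeticFunction.sigma_zero_apply] at this
  exact_mod_cast this
lemma hyper (N : ℕ) : ∑ n ∈ Finset.Icc 1 N, tau n + (N.sqrt:ℝ)^2 = 2 * ∑ a ∈ Finset.Icc 1 N.sqrt, ((N / a : ℕ) : ℝ) := by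
  rw [tau_eq_sum]
  set r := N.sqrt
  have hr1 : r * r ≤ N := Nat.sqrt_le N
  have hr2 : N < (r+1) * (r+1) := Nat.lt_succ_sqrt N
  have hrN : r ≤ N := Nat.sqrt_le_self N
  have hc : ∀ a ∈ Finset.Icc 1 N, ((N / a : ℕ) : ℝ) = ∑ b ∈ Finset.Icc 1 N, if a * b ≤ N then o1 else 0 := by
    intro a ha
    have ha' := Finset.mem_Icc.mp ha
    rw [← Finset.sum_filter, Finset.sum_const, nsmul_eq_mul, mul_one]
    have : (Finset.Icc 1 N).filter (fun b => a * b ≤ N) = Finset.Icc 1 (N / a) := by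
      ext b
      simp only [Finset.mem_filter, Finset.mem_Icc, Nat.le_div_iff_mul_le (show 0 < a by omega)]
      rw [mul_comm b a]
      constructor
      · rintro ⟨⟨h1, h2⟩, h3⟩; exact ⟨h1, h3⟩
      · rintro ⟨h1, h3⟩; exact ⟨⟨h1, (Nat.le_mul_of_pos_left b oM).trans h3⟩, h3⟩
    rw [this]; simp
  have hsub : ∀ F : ℕ → ℝ, ∑ a ∈ Finset.Icc 1 r, F a = ∑ a ∈ Finset.Icc 1 N, if a ≤ r then F a else 0 := by
    intro F
    rw [← Finset.sum_filter]
    congr 1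
    ext a; simp only [Finset.mem_filter, Finset.mem_Icc]; omega
  have h1 : ∑ a ∈ Finset.Icc 1 r, ((N / a : ℕ) : ℝ) = ∑ a ∈ Finset.Icc 1 N, ∑ b ∈ Finset.Icc 1 N, if a ≤ r ∧ a * b ≤ N then o1 else 0 := by
    rw [hsub]
    refine Finset.sum_congr rfl fun a ha => ?_
    split_ifs with h
    · rw [hc a ha]; simp [h]
    · simp [h]
  have h2 : ∑ a ∈ Finset.Icc 1 r, ((N / a : ℕ) : ℝ) = ∑ a ∈ Finset.Icc 1 N, ∑ b ∈ Finset.Icc 1 N, if b ≤ r ∧ a * b ≤ N then o1 else 0 := by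
    rw [h1, Finset.sum_comm]
    simp only [mul_comm]
  have h3 : (r:ℝ)^2 = ∑ a ∈ Finset.Icc 1 N, ∑ b ∈ Finset.Icc 1 N, if a ≤ r ∧ b ≤ r then o1 else 0 := by
    have e : ∀ a ∈ Finset.Icc 1 N, (∑ b ∈ Finset.Icc 1 N, if a ≤ r ∧ b ≤ r then o1 else 0) = if a ≤ r then (r:ℝ) else 0 := by
      intro a _
      split_ifs with h
      · have := hsub (fun _ => 1)
        simp only [h, true_and]
        rw [← this]; simp
      · simp [h]
    rw [Finset.sum_congr rfl e, ← hsub]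
    simp; ring
  rw [two_mul]
  nth_rewrite 1 [h1]
  rw [h2, h3, Finset.sum_congr rfl hc, ← Finset.sum_add_distrib, ← Finset.sum_add_distrib]
  refine Finset.sum_congr rfl fun a ha => ?_
  rw [← Finset.sum_add_distrib, ← Finset.sum_add_distrib]
  refine Finset.sum_congr rfl fun b hb => ?_
  by_cases ha' : a ≤ r <;> by_cases hb' : b ≤ r
  · have : a * b ≤ N := (Nat.mul_le_mul ha' hb').trans hr1
    simp [ha', hb', this]
  · simp [ha', hb']
  · simp [ha', hb']
  · have : ¬ a * b ≤ N := by
      have := Nat.mul_le_mul (show r + 1 ≤ a by omega) (show r + 1 ≤ b by omega)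
      omega
    simp [ha', hb', this]
def C0 : ℝ := 2 * Real.eulerMascheroniConstant - 1
lemma harm_bd (n : ℕ) (hn : 1 ≤ n) : |(∑ a ∈ Finset.Icc 1 n, (a:ℝ)⁻¹) - Real.log n - Real.eulerMascheroniConstant| ≤ 1 / n := by
  have h1 := Real.eulerMascheroniSeq_lt_eulerMascheroniConstant n
  have h2 := Real.eulerMascheroniConstant_lt_eulerMascheroniSeq' n
  have h3 : ((harmonic n : ℚ) : ℝ) = ∑ a ∈ Finset.Icc 1 n, (a:ℝ)⁻¹ := by
    rw [harmonic_eq_sum_Icc]; push_cast; rfl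
  rw [Real.eulerMascheroniSeq, h3] at h1
  rw [Real.eulerMascheroniSeq', if_neg oM, h3] at h2
  have hn0 : o0 < n := by exact_mod_cast hn
  have h4 : Real.log (n + 1) - Real.log n ≤ 1 / n := by
    rw [← Real.log_div pV pV]
    have := Real.log_le_sub_one_of_pos (show 0 < ((n:ℝ) + 1) / n by positivity)
    rw [add_div, div_self hn0.ne'] at *
    linarith
  rw [abs_le]; constructor <;> linarith
lemma D_asymp {x : ℝ} (hx : 1 ≤ x) : |PhiS ∅ x - x * (Real.log x + C0)| ≤ 30 * x ^ (1/2 : ℝ) := by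
  have hx0 : 0 < x := lI
  rw [← Real.sqrt_eq_rpow]
  set s := √x with hs
  have hs2 : s ^ 2 = x := Real.sq_sqrt hx0.le
  have hs1 : 1 ≤ s := Real.one_le_sqrt.mpr hx
  set N := ⌊x⌋₊ with hN
  set r := N.sqrt with hr
  have hN1 : 1 ≤ N := Nat.one_le_floor_iff x |>.mpr hx
  have hr1 : 1 ≤ r := Nat.sqrt_pos.mpr hN1
  have hrr : r * r ≤ N := Nat.sqrt_le N
  have hrr2 : N < (r+1)*(r+1) := Nat.lt_succ_sqrt N
  have hNx : (N:ℝ) ≤ x := Nat.floor_le hx0.le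
  have hNx2 : x < N + 1 := Nat.lt_floor_add_one x
  have hrr' : (r:ℝ) * r ≤ N := by exact_mod_cast hrr
  have hrr2' : (N:ℝ) + 1 ≤ (r+1)*(r+1) := by exact_mod_cast hrr2
  have hr1' : o1 ≤ r := by exact_mod_cast hr1
  have hrs : (r:ℝ) ≤ s := by
    apply Real.le_sqrt_of_sq_le; nlinarith
  have hrs2 : s < r + 1 := by
    rw [hs, Real.sqrt_lt' lI]; nlinarith
  have h1 := hyper N
  have hP : PhiS ∅ x = ∑ n ∈ Finset.Icc 1 N, tau n := by
    unfold PhiS fS; simp [hN]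
  have h2 := abs_le.mp (harm_bd r hr1)
  have hlog : |Real.log x - 2 * Real.log r| ≤ 2 / r := by
    have e : Real.log x - 2 * Real.log r = 2 * (Real.log (s / r)) := by
      rw [Real.log_div pV pV, ← hs2, Real.log_pow]; push_cast; ring
    have e1 : 0 ≤ Real.log (s / r) := Real.log_nonneg (by rw [le_div_iff₀ lI]; linarith)
    have e2 : Real.log (s / r) ≤ 1 / r := by
      refine (Real.log_le_sub_one_of_pos pV).trans ?_
      rw [div_sub_one pV]
      gcongr; linarith
    rw [e, abs_of_nonneg lI]
    rw [show 2 / (r:ℝ) = 2 * (1 / r) by ring]; linarith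
  have hsum1 : ∑ a ∈ Finset.Icc 1 r, ((N / a : ℕ) : ℝ) ≤ x * ∑ a ∈ Finset.Icc 1 r, (a:ℝ)⁻¹ := by
    rw [Finset.mul_sum]
    refine Finset.sum_le_sum fun a ha => ?_
    refine (Nat.cast_div_le).trans ?_
    rw [div_eq_mul_inv]; gcongr
  have hsum2 : x * ∑ a ∈ Finset.Icc 1 r, (a:ℝ)⁻¹ - r ≤ ∑ a ∈ Finset.Icc 1 r, ((N / a : ℕ) : ℝ) := by
    have : (r:ℝ) = ∑ a ∈ Finset.Icc 1 r, o1 := sI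
    refine (sub_le_sub_left this.symm.le _).trans ?_
    rw [Finset.mul_sum, ← Finset.sum_sub_distrib]
    refine Finset.sum_le_sum fun a ha => ?_
    rw [hN, ← Nat.floor_div_natCast, ← div_eq_mul_inv]
    exact (Nat.sub_one_lt_floor _).le
  have hxr : x / r ≤ 2 * s := by
    rw [div_le_iff₀ lI]; nlinarith
  have hl := abs_le.mp hlog
  have e1 : x * (1 / r) ≤ 2 * s := by rw [mul_one_div]; exact hxr
  have e2 : x * (2 / r) ≤ 4 * s := by rw [show x * (2 / (r:ℝ)) = 2 * (x / r) by ring]; linarith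
  set H := ∑ a ∈ Finset.Icc 1 r, (a:ℝ)⁻¹
  have f1 := mul_le_mul_of_nonneg_left h2.1 hx0.le
  have f2 := mul_le_mul_of_nonneg_left h2.2 hx0.le
  have f3 := mul_le_mul_of_nonneg_left hl.1 hx0.le
  have f4 := mul_le_mul_of_nonneg_left hl.2 hx0.le
  have f5 : x - 3 * s ≤ (r:ℝ)^2 := by nlinarith
  have f6 : (r:ℝ)^2 ≤ x := by nlinarith
  rw [hP, C0, abs_le]
  constructor <;> linarith
def AS (S : Finset ℕ) : ℝ := ∏ p ∈ S, (1 - (p:ℝ)⁻¹) ^ 2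
def LS (S : Finset ℕ) : ℝ := ∑ p ∈ S, Real.log p / (p - 1)
def ES (S : Finset ℕ) (x : ℝ) : ℝ := PhiS S x - x * AS S * (Real.log x + C0 + 2 * LS S)
lemma ES_insert {S : Finset ℕ} (hS : ∀ q ∈ S, q.Prime) {p : ℕ} (hp : p.Prime) (hpS : p ∉ S) {x : ℝ} (hx : 0 < x) :
    ES (insert p S) x = ES S x - 2 * ES S (x / p) + ES S (x / p ^ 2) := by
  have hp1 : o1 < p := by exact_mod_cast hp.one_lt
  have hp0 : o0 < p := lI
  have hpm : (p:ℝ) - 1 ≠ 0 := lI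
  unfold ES
  rw [PhiS_insert hS hp hpS, AS, LS, Finset.prod_insert hpS, Finset.sum_insert hpS, ← AS, ← LS,
    Real.log_div hx.ne' hp0.ne', Real.log_div hx.ne' pV, Real.log_pow]
  push_cast
  field_simp
  ring
lemma C0_bd : 0 ≤ C0 ∧ C0 ≤ 1 := by
  have h1 := Real.one_half_lt_eulerMascheroniConstant
  have h2 := Real.eulerMascheroniConstant_lt_two_thirds
  unfold C0; constructor <;> linarith
lemma E0_bd {s : ℝ} (hs : 1/2 ≤ s) (hs1 : s < 1) {x : ℝ} (hx : 0 < x) : |ES ∅ x| ≤ 30 / (1 - s) * x ^ s := by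
  have hC := C0_bd
  have h1s : 1 ≤ 1 / (1 - s) := by rw [le_div_iff₀ lI]; linarith
  have hE : ES ∅ x = PhiS ∅ x - x * (Real.log x + C0) := by simp [ES, AS, LS]
  rw [hE]
  rcases le_or_gt 1 x with h1 | h1
  · calc _ ≤ 30 * x ^ (1/2:ℝ) := D_asymp h1
      _ ≤ 30 * x ^ s := by
        gcongr
      _ ≤ 30 / (1 - s) * x ^ s := by
        gcongr
        rw [le_div_iff₀ lI]; linarith
  · have hP : PhiS ∅ x = 0 := by
      unfold PhiS; rw [Nat.floor_eq_zero.mpr h1]; simp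
    rw [hP, zero_sub, abs_neg, abs_mul, abs_of_pos hx]
    have h2 : -Real.log x ≤ x ^ (s - 1) / (1 - s) := by
      have := Real.log_le_rpow_div (x := x⁻¹) pV (show 0 < 1 - s by linarith)
      rwa [Real.log_inv, Real.inv_rpow hx.le, ← Real.rpow_neg hx.le, neg_sub] at this
    have h3 : 1 ≤ x ^ (s - 1) / (1 - s) := by
      have := Real.one_le_rpow_of_pos_of_le_one_of_nonpos hx h1.le (show s - 1 ≤ 0 by linarith)
      rw [le_div_iff₀ lI]; linarith
    have h4 : x * x ^ (s - 1) = x ^ s := by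
      rw [Real.rpow_sub_one hx.ne']; field_simp
    have hl : Real.log x ≤ 0 := Real.log_nonpos hx.le h1.le
    calc x * |Real.log x + C0| ≤ x * (2 * (x ^ (s - 1) / (1 - s))) := by
          gcongr
          rw [abs_le]; constructor <;> linarith
      _ = 2 / (1 - s) * (x * x ^ (s-1)) := by ring
      _ ≤ 30 / (1 - s) * x ^ s := by
          rw [h4]; gcongr <;> norm_num
lemma E_bd {s : ℝ} (hs : 1/2 ≤ s) (hs1 : s < 1) (S : Finset ℕ) (hS : ∀ q ∈ S, q.Prime) :
    ∀ x : ℝ, 0 < x → |ES S x| ≤ 30 / (1 - s) * (∏ p ∈ S, (1 + (p:ℝ) ^ (-s)) ^ 2) * x ^ s := by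
  induction S using Finset.induction_on with
  | empty => intro x hx; simpa using E0_bd hs hs1 hx
  | insert p S hp ih =>
    intro x hx
    have hS' : ∀ q ∈ S, q.Prime := fun q hq => hS q (Finset.mem_insert_of_mem hq)
    have hpp : p.Prime := hS p (Finset.mem_insert_self _ _)
    have hp0 : o0 < p := by exact_mod_cast hpp.pos
    rw [ES_insert hS' hpp hp hx, Finset.prod_insert hp]
    set Q := ∏ p ∈ S, (1 + (p:ℝ) ^ (-s)) ^ 2
    have h1 := ih hS' x hx
    have h2 := ih hS' (x / p) pV
    have h3 := ih hS' (x / p ^ 2) pV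
    have e2 : (x / p) ^ s = x ^ s * (p:ℝ) ^ (-s) := by
      rw [Real.div_rpow hx.le hp0.le, Real.rpow_neg hp0.le]; rfl
    have e3 : (x / p ^ 2) ^ s = x ^ s * ((p:ℝ) ^ (-s)) ^ 2 := by
      rw [Real.div_rpow hx.le pV, Real.rpow_neg hp0.le, ← Real.rpow_natCast, ← Real.rpow_natCast, ← Real.rpow_mul hp0.le, inv_rpow pV, ← Real.rpow_mul hp0.le, mul_comm s]; rfl
    rw [e2] at h2; rw [e3] at h3
    calc |ES S x - 2 * ES S (x / p) + ES S (x / p ^ 2)| ≤ |ES S x| + 2 * |ES S (x / p)| + |ES S (x / p ^ 2)| := by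
          refine (abs_add_le _ _).trans ?_
          gcongr
          refine (abs_sub _ _).trans ?_
          rw [abs_mul, abs_two]
      _ ≤ 30 / (1 - s) * Q * x ^ s + 2 * (30 / (1 - s) * Q * (x ^ s * (p:ℝ) ^ (-s))) + 30 / (1 - s) * Q * (x ^ s * ((p:ℝ) ^ (-s))^2) := by
          linarith
      _ = _ := by ring
def Sy (y : ℝ) : Finset ℕ := (Finset.Icc 1 ⌊y⌋₊).filter Nat.Prime
lemma mem_Sy {y : ℝ} (hy : 0 ≤ y) {p : ℕ} : p ∈ Sy y ↔ p.Prime ∧ (p:ℝ) ≤ y := by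
  unfold Sy
  simp only [Finset.mem_filter, Finset.mem_Icc, Nat.le_floor_iff hy]
  constructor
  · rintro ⟨⟨_, h⟩, h2⟩; exact ⟨h2, h⟩
  · rintro ⟨h, h2⟩; exact ⟨⟨h.pos, h2⟩, h⟩
lemma Sy_prime {y : ℝ} : ∀ q ∈ Sy y, q.Prime := fun q hq => (Finset.mem_filter.mp hq).2
lemma sum_inv_exp (j : ℕ) : ∑ p ∈ Sy (Real.exp (j + 1)), (p:ℝ)⁻¹ ≤ 1 / 2 + 4 * (harmonic j : ℝ) := by
  induction j with
  | zero =>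
    have : Sy (Real.exp ((0:ℕ) + 1)) = {2} := by
      ext p
      rw [mem_Sy (Real.exp_pos _).le]
      simp only [Nat.cast_zero, zero_add, Finset.mem_singleton]
      constructor
      · rintro ⟨h1, h2⟩
        have := h1.two_le
        have h3 : (p:ℝ) < 3 := h2.trans_lt (Real.exp_one_lt_d9.trans nN)
        have h4 : p < 3 := by exact_mod_cast h3
        omega
      · rintro rfl
        exact ⟨Nat.prime_two, by have := Real.exp_one_gt_d9; push_cast; linarith⟩
    rw [this]; norm_num
  | succ j ih =>
    set y := Real.exp (j + 1) with hy
    set y' := Real.exp ((j+1:ℕ) + 1) with hy'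
    have hyy : y' = Real.exp 1 * y := by rw [hy, hy', ← Real.exp_add]; push_cast; congr 1; ring
    have hy0 : 0 < y := Real.exp_pos _
    have hle : y ≤ y' := by rw [hyy]; nlinarith [Real.exp_one_gt_d9]
    have hsub : Sy y ⊆ Sy y' := by
      intro p hp; rw [mem_Sy lI] at hp ⊢; exact ⟨hp.1, hp.2.trans hle⟩
    rw [← Finset.sum_sdiff hsub, harmonic_succ]
    have hjpos : o0 < j + 1 := pV
    have h1 : ∑ p ∈ Sy y' \ Sy y, (p:ℝ)⁻¹ ≤ ∑ p ∈ Sy y' \ Sy y, Real.log p * (((j:ℝ) + 1)⁻¹ * y⁻¹) := by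
      refine Finset.sum_le_sum fun p hp => ?_
      rw [Finset.mem_sdiff, mem_Sy lI, mem_Sy hy0.le] at hp
      have hpy : y < p := by
        by_contra h; exact hp.2 ⟨hp.1.1, le_of_not_gt h⟩
      have hlog : (j:ℝ) + 1 ≤ Real.log p := by
        rw [Real.le_log_iff_exp_le lI]; exact hpy.le
      rw [← mul_assoc, ← one_mul (p:ℝ)⁻¹]
      gcongr
      rw [← div_eq_mul_inv, le_div_iff₀ hjpos]; linarith
    have h2 : ∑ p ∈ Sy y' \ Sy y, Real.log p ≤ Real.log 4 * y' := by
      refine le_trans ?_ (Chebyshev.theta_le_log4_mul_x lI)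
      rw [Chebyshev.theta]
      have : Sy y' = (Finset.Ioc 0 ⌊y'⌋₊).filter Nat.Prime := by
        unfold Sy; congr 1
      rw [← this]
      refine Finset.sum_le_sum_of_subset_of_nonneg Finset.sdiff_subset fun p hp _ => Real.log_natCast_nonneg _
    rw [← Finset.sum_mul] at h1
    have hl4 : Real.log 4 * Real.exp 1 ≤ 4 := by
      have : Real.log 4 = 2 * Real.log 2 := by rw [show (4:ℝ) = 2^2 by norm_num, Real.log_pow]; push_cast; rfl
      rw [this]
      nlinarith [Real.log_two_lt_d9, Real.exp_one_lt_d9, Real.log_two_gt_d9]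
    have h3 : (∑ p ∈ Sy y' \ Sy y, Real.log p) * (((j:ℝ) + 1)⁻¹ * y⁻¹) ≤ 4 * ((j:ℝ)+1)⁻¹ := by
      calc _ ≤ (Real.log 4 * y') * (((j:ℝ) + 1)⁻¹ * y⁻¹) := by gcongr
        _ = (Real.log 4 * Real.exp 1) * ((j:ℝ)+1)⁻¹ := by rw [hyy]; field_simp
        _ ≤ _ := by gcongr
    push_cast
    linarith
lemma sum_inv_bd {y : ℝ} (hy : 2 ≤ y) : ∑ p ∈ Sy y, (p:ℝ)⁻¹ ≤ 5 + 4 * Real.log (Real.log y + 1) := by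
  have hL : 0 < Real.log y := Real.log_pos lI
  set j := ⌊Real.log y⌋₊
  have hj1 : (j:ℝ) ≤ Real.log y := Nat.floor_le hL.le
  have hj2 : Real.log y < j + 1 := Nat.lt_floor_add_one _
  have hsub : Sy y ⊆ Sy (Real.exp (j+1)) := by
    intro p hp
    rw [mem_Sy lI] at hp; rw [mem_Sy (Real.exp_pos _).le]
    exact ⟨hp.1, hp.2.trans ((Real.log_le_iff_le_exp lI).mp hj2.le)⟩
  have h1 := Finset.sum_le_sum_of_subset_of_nonneg (f := fun p : ℕ => (p:ℝ)⁻¹) hsub (fun p _ _ => pV)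
  have h2 := sum_inv_exp j
  have h3 := harmonic_le_one_add_log j
  have h4 : Real.log j ≤ Real.log (Real.log y + 1) := by
    rcases Nat.eq_zero_or_pos j with h | h
    · rw [h]; simp; apply Real.log_nonneg; linarith
    · apply Real.log_le_log (by exact_mod_cast h); linarith
  linarith
def Phi (y x : ℝ) : ℝ := PhiS (Sy y) x
def Ay (y : ℝ) : ℝ := AS (Sy y)
def Ly (y : ℝ) : ℝ := LS (Sy y)
lemma B1 : ∃ C : ℝ, 0 < C ∧ ∀ y x : ℝ, 2 ≤ y → 0 < x →
    |Phi y x - x * Ay y * (Real.log x + C0 + 2 * Ly y)| ≤ C * (Real.log y + 1) ^ 12 * (x * Real.exp (-(Real.log x / Real.log y) / 4)) := by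
  refine ⟨120 * Real.exp 13, pV, fun y x hy hx => ?_⟩
  set L := Real.log y with hLdef
  have hL2 : 1/2 < L := by
    have := Real.log_le_log nN hy
    linarith [Real.log_two_gt_d9]
  have hL : 0 < L := lI
  set s := 1 - 1 / (4 * L) with hs
  have hs1 : s < 1 := by rw [hs]; have : 0 < 1 / (4 * L) := pV
                         linarith
  have hs2 : 1/2 ≤ s := by
    have : 1 / (4 * L) ≤ 1/2 := by rw [div_le_div_iff₀ pV nN]; linarith
    rw [hs]; linarith
  have h := E_bd hs2 hs1 (Sy y) Sy_prime x hx
  have e1 : 30 / (1 - s) = 120 * L := by rw [hs]; field_simp; ring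
  have e2 : x ^ s = x * Real.exp (-(Real.log x / L) / 4) := by
    rw [Real.rpow_def_of_pos hx]
    nth_rewrite 2 [← Real.exp_log hx]
    rw [← Real.exp_add, hs]; congr 1; field_simp; ring
  have e3 : ∏ p ∈ Sy y, (1 + (p:ℝ) ^ (-s)) ^ 2 ≤ Real.exp 13 * (L + 1) ^ 11 := by
    have hq : Real.exp (1/4) ≤ 1.3 := by
      have h4 : Real.exp (1/4) ^ 4 = Real.exp 1 := by rw [← Real.exp_nat_mul]; norm_num
      by_contra hcon
      push Not at hcon
      have : (1.3:ℝ)^4 < Real.exp (1/4) ^ 4 := by gcongr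
      rw [h4] at this
      linarith [Real.exp_one_lt_d9]
    calc ∏ p ∈ Sy y, (1 + (p:ℝ) ^ (-s)) ^ 2 ≤ ∏ p ∈ Sy y, Real.exp (2.6 * (p:ℝ)⁻¹) := by
          refine Finset.prod_le_prod (fun p _ => pV) fun p hp => ?_
          rw [mem_Sy lI] at hp
          have hp0 : o0 < p := by exact_mod_cast hp.1.pos
          have a1 : (p:ℝ) ^ (-s) ≤ 1.3 * (p:ℝ)⁻¹ := by
            rw [hs, neg_sub, Real.rpow_sub hp0, Real.rpow_one, div_eq_mul_inv]
            gcongr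
            refine le_trans ?_ hq
            rw [Real.rpow_def_of_pos hp0]
            apply Real.exp_le_exp.mpr
            rw [mul_one_div, div_le_div_iff₀ pV nN]
            have := Real.log_le_log hp0 hp.2
            linarith
          calc (1 + (p:ℝ) ^ (-s)) ^ 2 ≤ (Real.exp (1.3 * (p:ℝ)⁻¹)) ^ 2 := by
                gcongr
                have := Real.add_one_le_exp (1.3 * (p:ℝ)⁻¹)
                linarith
            _ = _ := by rw [← Real.exp_nat_mul]; congr 1; push_cast; ring
      _ = Real.exp (2.6 * ∑ p ∈ Sy y, (p:ℝ)⁻¹) := by rw [← Real.exp_sum, Finset.mul_sum]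
      _ ≤ Real.exp (13 + 11 * Real.log (L + 1)) := by
          apply Real.exp_le_exp.mpr
          have := sum_inv_bd hy
          have : 0 ≤ Real.log (L + 1) := Real.log_nonneg lI
          linarith
      _ = _ := by
          rw [Real.exp_add, show (11:ℝ) * Real.log (L+1) = ((11:ℕ):ℝ) * Real.log (L + 1) by norm_num, Real.exp_nat_mul, Real.exp_log lI]
  rw [e1, e2] at h
  refine (show |Phi y x - x * Ay y * (Real.log x + C0 + 2 * Ly y)| = |ES (Sy y) x| from rfl).le.trans (h.trans ?_)
  refine mul_le_mul_of_nonneg_right ?_ pV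
  calc 120 * L * ∏ p ∈ Sy y, (1 + (p:ℝ) ^ (-s)) ^ 2 ≤ 120 * (L + 1) * (Real.exp 13 * (L + 1) ^ 11) := by gcongr; linarith
    _ = _ := by ring
lemma theta_PNT : ∃ C : ℝ, 0 < C ∧ ∀ x : ℝ, 2 ≤ x → |Chebyshev.theta x - x| ≤ C * x * (Real.log x) ^ o8 := by
  obtain ⟨C, hC, h⟩ := PNT
  obtain ⟨C', h'⟩ := Chebyshev.psi_sub_theta_le_mul_sqrt
  refine ⟨C + 2 * |C'|, pV, fun x hx => ?_⟩
  have hx0 : 0 < x := lI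
  have hl : 0 < Real.log x := Real.log_pos lI
  have h1 := h x hx
  have h2 := h' x
  have h3 := Chebyshev.theta_le_psi x
  have h4 : √x ≤ 2 * x * (Real.log x) ^ o8 := by
    rw [Real.rpow_neg hl.le, ← div_eq_mul_inv, le_div_iff₀ pV]
    have h5 : Real.log x ^ (0.8:ℝ) ≤ 2 * √x := by
      rcases le_total (Real.log x) 1 with h6 | h6
      · have := Real.rpow_le_one hl.le h6 (show o0 ≤ 0.8 by norm_num)
        have : 1 ≤ √x := Real.one_le_sqrt.mpr lI
        linarith
      · calc Real.log x ^ (0.8:ℝ) ≤ Real.log x ^ o1 := Real.rpow_le_rpow_of_exponent_le h6 nN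
          _ = 2 * Real.log (√x) := by rw [Real.rpow_one, Real.log_sqrt hx0.le]; ring
          _ ≤ 2 * √x := by have := Real.log_le_sub_one_of_pos (Real.sqrt_pos.mpr hx0); linarith
    calc √x * Real.log x ^ (0.8:ℝ) ≤ √x * (2 * √x) := by gcongr
      _ = 2 * x := by nlinarith [Real.sq_sqrt hx0.le]
  have h6 : C' * √x ≤ |C'| * (2 * x * (Real.log x) ^ o8) :=
    (mul_le_mul_of_nonneg_right (le_abs_self C') (Real.sqrt_nonneg x)).trans (mul_le_mul_of_nonneg_left h4 (abs_nonneg _))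
  have h0 : 0 ≤ |C'| * (2 * x * (Real.log x) ^ o8) := pV
  rw [abs_le] at h1 ⊢
  constructor <;> linarith
def LamS (S : Finset ℕ) (n : ℕ) : ℝ := if ∀ p ∈ S, ¬ p ∣ n then ArithmeticFunction.vonMangoldt n else 0
def fA (S : Finset ℕ) : ArithmeticFunction ℝ := ⟨fS S, by simp [fS, tau]⟩
def LA (S : Finset ℕ) : ArithmeticFunction ℝ := ⟨LamS S, by simp [LamS]⟩
lemma tau_log (n : ℕ) : tau n * Real.log n = 2 * ∑ q ∈ n.divisorsAntidiagonal, ArithmeticFunction.vonMangoldt q.1 * tau q.2 := by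
  open ArithmeticFunction in
  have h1 : ((ArithmeticFunction.vonMangoldt : ArithmeticFunction ℝ) * ((ArithmeticFunction.zeta : ArithmeticFunction ℝ) * (ArithmeticFunction.zeta : ArithmeticFunction ℝ))) n
      = ∑ q ∈ n.divisorsAntidiagonal, ArithmeticFunction.vonMangoldt q.1 * tau q.2 := by
    rw [ArithmeticFunction.mul_apply]
    refine Finset.sum_congr rfl fun q hq => ?_
    congr 1
    rw [ArithmeticFunction.coe_mul_zeta_apply, tau]
    rw [Finset.sum_congr rfl (fun i hi => by rw [ArithmeticFunction.natCoe_apply, ArithmeticFunction.zeta_apply, if_neg (Nat.pos_of_mem_divisors hi).ne'])]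
    simp
  rw [← h1, ← mul_assoc, ArithmeticFunction.vonMangoldt_mul_zeta, ArithmeticFunction.coe_mul_zeta_apply, two_mul]
  nth_rewrite 2 [← Nat.sum_div_divisors]
  rw [← Finset.sum_add_distrib, Finset.sum_congr rfl (g := fun _ => Real.log n)]
  · rw [Finset.sum_const, nsmul_eq_mul, tau]
  · intro d hd
    have hd' := Nat.mem_divisors.mp hd
    have hd0 : (d:ℝ) ≠ 0 := by
      have := Nat.pos_of_mem_divisors hd
      positivity
    have hn0 : (n:ℝ) ≠ 0 := by exact_mod_cast hd'.2
    simp only [ArithmeticFunction.log_apply]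
    rw [Nat.cast_div hd'.1 hd0, Real.log_div hn0 hd0]; ring
lemma f_log {S : Finset ℕ} (hS : ∀ q ∈ S, q.Prime) (n : ℕ) : fS S n * Real.log n = 2 * (LA S * fA S) n := by
  rw [ArithmeticFunction.mul_apply]
  by_cases h : ∀ p ∈ S, ¬ p ∣ n
  · rw [fS, if_pos h, tau_log]
    congr 1
    refine Finset.sum_congr rfl fun q hq => ?_
    have hq' := (Nat.mem_divisorsAntidiagonal.mp hq).1
    show _ = LamS S q.1 * fS S q.2
    rw [LamS, fS, if_pos, if_pos]
    · intro p hp hd; exact h p hp (hq' ▸ hd.mul_left _)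
    · intro p hp hd; exact h p hp (hq' ▸ hd.mul_right _)
  · rw [fS, if_neg h, zero_mul, Finset.sum_eq_zero, mul_zero]
    intro q hq
    have hq' := (Nat.mem_divisorsAntidiagonal.mp hq).1
    push Not at h
    obtain ⟨p, hp, hd⟩ := h
    rw [← hq', (hS p hp).dvd_mul] at hd
    show LamS S q.1 * fS S q.2 = 0
    rcases hd with hd | hd
    · rw [LamS, if_neg (fun h => h p hp hd), zero_mul]
    · rw [fS, if_neg (fun h => h p hp hd), mul_zero]
def psiS (S : Finset ℕ) (x : ℝ) : ℝ := ∑ d ∈ Finset.Icc 1 ⌊x⌋₊, LamS S d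
lemma Icc_Ioc (N : ℕ) : Finset.Icc 1 N = Finset.Ioc 0 N := rfl
lemma sum_f_log {S : Finset ℕ} (hS : ∀ q ∈ S, q.Prime) (x : ℝ) :
    ∑ n ∈ Finset.Icc 1 ⌊x⌋₊, fS S n * Real.log n = 2 * ∑ m ∈ Finset.Icc 1 ⌊x⌋₊, fS S m * psiS S (x / m) := by
  rw [Finset.sum_congr rfl (fun n _ => f_log hS n), ← Finset.mul_sum, Icc_Ioc, mul_comm (LA S), ArithmeticFunction.sum_Ioc_mul_eq_sum_sum]
  congr 1
  refine Finset.sum_congr rfl fun m _ => ?_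
  rw [psiS, Nat.floor_div_natCast]; rfl
lemma psi_le_y {y t : ℝ} (hy : 0 ≤ y) (ht : t ≤ y) : psiS (Sy y) t = 0 := by
  refine Finset.sum_eq_zero fun d hd => ?_
  have hd' := Finset.mem_Icc.mp hd
  rw [LamS]
  split_ifs with h
  · by_contra hne
    obtain ⟨p, hp, hpd⟩ := Nat.exists_prime_and_dvd (n := d) (fun h1 => by rw [h1] at hne; simp at hne)
    refine h p ((mem_Sy hy).mpr ⟨hp, ?_⟩) hpd
    have h1 : (p:ℝ) ≤ d := by exact_mod_cast Nat.le_of_dvd hd'.1 hpd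
    have h2 : (d:ℝ) ≤ t := by
      refine (Nat.le_floor_iff' oM).mp hd'.2
    linarith
  · rfl
lemma psi_y : ∃ C : ℝ, 0 < C ∧ ∀ y t : ℝ, 2 ≤ y → y ≤ t → |psiS (Sy y) t - (t - y)| ≤ C * t * (Real.log y) ^ o8 := by
  obtain ⟨C, hC, h⟩ := PNT
  obtain ⟨C', hC', h'⟩ := theta_PNT
  refine ⟨C + 2 * C', pV, fun y t hy ht => ?_⟩
  have hl : 0 < Real.log y := Real.log_pos lI
  have hsub : Sy y ⊆ Finset.Icc 1 ⌊t⌋₊ := by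
    intro p hp
    unfold Sy at hp
    have := Finset.mem_Icc.mp (Finset.mem_filter.mp hp).1
    exact Finset.mem_Icc.mpr ⟨this.1, this.2.trans (Nat.floor_le_floor ht)⟩
  have hth : ∑ p ∈ Sy y, ArithmeticFunction.vonMangoldt p = Chebyshev.theta y := by
    rw [Chebyshev.theta]
    refine Finset.sum_congr rfl fun p hp => ?_
    exact ArithmeticFunction.vonMangoldt_apply_prime (Finset.mem_filter.mp hp).2
  have up : psiS (Sy y) t ≤ Chebyshev.psi t - Chebyshev.theta y := by
    rw [← hth, le_sub_iff_add_le, Chebyshev.psi, psiS, ← Icc_Ioc]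
    have e : ∑ p ∈ Sy y, ArithmeticFunction.vonMangoldt p = ∑ d ∈ Finset.Icc 1 ⌊t⌋₊, if d ∈ Sy y then ArithmeticFunction.vonMangoldt d else 0 := by
      rw [← Finset.sum_filter]; congr 1; ext d; simp only [Finset.mem_filter]
      exact ⟨fun h => ⟨hsub h, h⟩, fun h => h.2⟩
    rw [e, ← Finset.sum_add_distrib]
    refine Finset.sum_le_sum fun d hd => ?_
    rw [LamS]
    by_cases hd1 : d ∈ Sy y
    · rw [if_pos hd1, if_neg (fun h => h d hd1 dvd_rfl), zero_add]
    · rw [if_neg hd1, add_zero]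
      split_ifs
      · rfl
      · exact ArithmeticFunction.vonMangoldt_nonneg
  have low : Chebyshev.theta t - Chebyshev.theta y ≤ psiS (Sy y) t := by
    have hs2 : Sy y ⊆ Sy t := by
      intro p hp; rw [mem_Sy lI] at hp ⊢; exact ⟨hp.1, hp.2.trans ht⟩
    have : Chebyshev.theta t = ∑ p ∈ Sy t, Real.log p := rfl
    have h2 : Chebyshev.theta y = ∑ p ∈ Sy y, Real.log p := rfl
    rw [this, h2, ← Finset.sum_sdiff_eq_sub hs2, psiS]
    have hs3 : Sy t \ Sy y ⊆ Finset.Icc 1 ⌊t⌋₊ := fun p hp => (Finset.mem_filter.mp (Finset.mem_sdiff.mp hp).1).1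
    refine le_trans (Finset.sum_le_sum (g := fun p => LamS (Sy y) p) fun p hp => ?_)
      (Finset.sum_le_sum_of_subset_of_nonneg hs3 fun d _ _ => by
        rw [LamS]; split_ifs <;> simp [ArithmeticFunction.vonMangoldt_nonneg])
    have hp' := Finset.mem_sdiff.mp hp
    have hpp : p.Prime := Sy_prime p hp'.1
    rw [LamS, if_pos, ArithmeticFunction.vonMangoldt_apply_prime hpp]
    intro q hq hqp
    rw [(Nat.prime_dvd_prime_iff_eq (Sy_prime q hq) hpp).mp hqp] at hq
    exact hp'.2 hq
  have ht0 : 0 < t := lI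
  have mono : (Real.log t) ^ o8 ≤ (Real.log y) ^ o8 :=
    Real.rpow_le_rpow_of_nonpos hl (Real.log_le_log lI ht) nN
  have h1 : |Chebyshev.psi t - t| ≤ C * t * (Real.log y) ^ o8 :=
    (h t lI).trans (mul_le_mul_of_nonneg_left mono pV)
  have h2 : |Chebyshev.theta t - t| ≤ C' * t * (Real.log y) ^ o8 :=
    (h' t lI).trans (mul_le_mul_of_nonneg_left mono pV)
  have h3 : |Chebyshev.theta y - y| ≤ C' * t * (Real.log y) ^ o8 :=
    (h' y lI).trans (by gcongr)
  rw [abs_le] at *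
  have : 0 ≤ C * t * (Real.log y) ^ o8 := pV
  have : 0 ≤ C' * t * (Real.log y) ^ o8 := pV
  constructor <;> linarith
def SM (c : ℕ → ℝ) (t : ℝ) : ℝ := ∑ n ∈ Finset.Icc 1 ⌊Real.exp t⌋₊, c n
lemma SM_eq (c : ℕ → ℝ) {t z : ℝ} (h : t ≤ z) : SM c t = ∑ n ∈ Finset.Icc 1 ⌊Real.exp z⌋₊, if Real.log n ≤ t then c n else 0 := by
  rw [SM, ← Finset.sum_filter]
  congr 1
  ext n
  simp only [Finset.mem_filter, Finset.mem_Icc]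
  constructor
  · rintro ⟨h1, h2⟩
    refine ⟨⟨h1, h2.trans (Nat.floor_le_floor (Real.exp_le_exp.mpr h))⟩, ?_⟩
    rw [Real.log_le_iff_le_exp (by exact_mod_cast h1)]
    exact (Nat.le_floor_iff (Real.exp_pos _).le).mp h2
  · rintro ⟨⟨h1, h2⟩, h3⟩
    refine ⟨h1, ?_⟩
    rw [Real.log_le_iff_le_exp (by exact_mod_cast h1)] at h3
    exact (Nat.le_floor_iff (Real.exp_pos _).le).mpr h3
lemma SM_mono {c : ℕ → ℝ} (hc : ∀ n, 0 ≤ c n) : Monotone (SM c) := by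
  intro a b hab
  refine Finset.sum_le_sum_of_subset_of_nonneg ?_ fun n _ _ => hc n
  exact Finset.Icc_subset_Icc_right (Nat.floor_le_floor (Real.exp_le_exp.mpr hab))
lemma SM_meas (c : ℕ → ℝ) : Measurable (SM c) := by
  have h1 : Measurable (fun k : ℕ => ∑ n ∈ Finset.Icc 1 k, c n) := measurable_from_nat
  exact h1.comp (Nat.measurable_floor.comp Real.measurable_exp)
lemma step_ii {g : ℝ → ℝ} (hg : Continuous g) (c a b l : ℝ) : IntervalIntegrable (fun t => g t * (if l ≤ t then c else 0)) volume a b := by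
  have : (fun t => g t * (if l ≤ t then c else 0)) = (Set.Ici l).indicator (fun t => g t * c) := by
    funext t; by_cases h : l ≤ t <;> simp [Set.indicator, h]
  rw [this]
  have h2 : IntervalIntegrable (fun t => g t * c) volume a b := Continuous.intervalIntegrable fP a b
  rw [intervalIntegrable_iff] at h2 ⊢
  exact h2.indicator measurableSet_Ici
lemma SM_ii (c : ℕ → ℝ) {g : ℝ → ℝ} (hg : Continuous g) (a b : ℝ) : IntervalIntegrable (fun t => g t * SM c t) volume a b := by
  have h1 : IntervalIntegrable (fun t => ∑ n ∈ Finset.Icc 1 ⌊Real.exp (max a b)⌋₊, g t * (if Real.log n ≤ t then c n else 0)) volume a b := by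
    have := IntervalIntegrable.sum (μ := volume) (a := a) (b := b) (Finset.Icc 1 ⌊Real.exp (max a b)⌋₊) (f := fun n t => g t * (if Real.log n ≤ t then c n else 0)) (fun n _ => step_ii hg (c n) a b (Real.log n))
    refine this.congr ?_
    exact fun t _ => sI
  refine h1.congr ?_
  intro t ht
  simp only
  rw [SM_eq c (show t ≤ max a b from ht.2), Finset.mul_sum]
lemma abelLog (c : ℕ → ℝ) {g : ℝ → ℝ} (hg : Continuous g) {z : ℝ} (hz : 0 ≤ z) :
    ∫ t in o0..z, g t * SM c t = ∑ n ∈ Finset.Icc 1 ⌊Real.exp z⌋₊, c n * ∫ t in (Real.log n)..z, g t := by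
  have h1 : ∫ t in o0..z, g t * SM c t = ∫ t in o0..z, ∑ n ∈ Finset.Icc 1 ⌊Real.exp z⌋₊, g t * (if Real.log n ≤ t then c n else 0) := by
    apply intervalIntegral.integral_congr
    intro t ht
    rw [Set.uIcc_of_le hz] at ht
    simp only
    rw [SM_eq c ht.2, Finset.mul_sum]
  rw [h1, intervalIntegral.integral_finset_sum (fun n _ => step_ii hg _ _ _ _)]
  refine Finset.sum_congr rfl fun n hn => ?_
  have hn' := Finset.mem_Icc.mp hn
  have hl0 : 0 ≤ Real.log n := Real.log_natCast_nonneg n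
  have hlz : Real.log n ≤ z := by
    rw [Real.log_le_iff_le_exp (by exact_mod_cast hn'.1)]
    exact (Nat.le_floor_iff (Real.exp_pos _).le).mp hn'.2
  rw [← intervalIntegral.integral_add_adjacent_intervals (step_ii hg (c n) 0 (Real.log n) (Real.log n)) (step_ii hg (c n) (Real.log n) z (Real.log n))]
  have e1 : ∫ t in o0..(Real.log n), g t * (if Real.log n ≤ t then c n else 0) = 0 := by
    rw [intervalIntegral.integral_congr_ae (g := fun _ => o0)]; · simp
    have : ∀ᵐ t : ℝ, t ≠ Real.log n := by simp [ae_iff]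
    filter_upwards [this] with t ht hm
    rw [Set.uIoc_of_le hl0] at hm
    rw [if_neg (fun h => ht (le_antisymm hm.2 h)), mul_zero]
  have e2 : ∫ t in (Real.log n)..z, g t * (if Real.log n ≤ t then c n else 0) = ∫ t in (Real.log n)..z, g t * c n := by
    apply intervalIntegral.integral_congr
    intro t ht
    rw [Set.uIcc_of_le hlz] at ht
    simp only [if_pos ht.1]
  rw [e1, e2, zero_add, intervalIntegral.integral_mul_const, mul_comm]
lemma abel_log1 (c : ℕ → ℝ) {z : ℝ} (hz : 0 ≤ z) :
    ∑ n ∈ Finset.Icc 1 ⌊Real.exp z⌋₊, c n * Real.log n = z * SM c z - ∫ t in o0..z, SM c t := by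
  have h := abelLog c (g := fun _ => 1) continuous_const hz
  simp only [one_mul, intervalIntegral.integral_const, smul_eq_mul, mul_one] at h
  rw [h, SM, Finset.mul_sum, ← Finset.sum_sub_distrib]
  exact Finset.sum_congr rfl fun n _ => by ring
lemma abel_inv (c : ℕ → ℝ) {z : ℝ} (hz : 0 ≤ z) :
    ∑ n ∈ Finset.Icc 1 ⌊Real.exp z⌋₊, c n / n = Real.exp (-z) * SM c z + ∫ t in o0..z, Real.exp (-t) * SM c t := by
  have h := abelLog c (g := fun t => Real.exp (-t)) fP hz
  rw [h, SM, Finset.mul_sum, ← Finset.sum_add_distrib]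
  refine Finset.sum_congr rfl fun n hn => ?_
  have hn0 : o0 < n := by exact_mod_cast (Finset.mem_Icc.mp hn).1
  have : ∫ t in (Real.log n)..z, Real.exp (-t) = (n:ℝ)⁻¹ - Real.exp (-z) := by
    rw [intervalIntegral.integral_comp_neg (fun t => Real.exp t), integral_exp, Real.exp_neg, Real.exp_log hn0]
  rw [this]; field_simp; ring
def cy (y : ℝ) (n : ℕ) : ℝ := if n = 1 then 0 else fS (Sy y) n
def mu (y t : ℝ) : ℝ := Real.exp (-t) * SM (cy y) t
lemma cy_nonneg (y : ℝ) (n : ℕ) : 0 ≤ cy y n := by unfold cy; split_ifs <;> simp [fS_nonneg]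
lemma fS_one {y : ℝ} : fS (Sy y) 1 = 1 := by
  rw [fS, if_pos]
  · simp [tau]
  · intro p hp h; exact (Sy_prime p hp).one_lt.ne' (Nat.dvd_one.mp h)
lemma SM_cy {y t : ℝ} (ht : 0 ≤ t) : SM (cy y) t = Phi y (Real.exp t) - 1 := by
  have h1 : 1 ≤ ⌊Real.exp t⌋₊ := (Nat.one_le_floor_iff _).mpr (Real.one_le_exp ht)
  rw [Phi, PhiS, SM, ← Finset.add_sum_Ioc_eq_sum_Icc h1, ← Finset.add_sum_Ioc_eq_sum_Icc h1, fS_one, cy, if_pos rfl, zero_add, add_sub_cancel_left]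
  exact Finset.sum_congr rfl fun n hn => by rw [cy, if_neg (by have := (Finset.mem_Ioc.mp hn).1; omega)]
lemma cy_zero {y : ℝ} (hy : 0 ≤ y) {n : ℕ} (hn : (n:ℝ) ≤ y) : cy y n = 0 := by
  unfold cy
  split_ifs with h1
  · rfl
  · rcases Nat.eq_zero_or_pos n with rfl | h0
    · simp [fS, tau]
    obtain ⟨p, hp, hpd⟩ := Nat.exists_prime_and_dvd h1
    rw [fS, if_neg]
    intro h
    refine h p ((mem_Sy hy).mpr ⟨hp, le_trans ?_ hn⟩) hpd
    exact_mod_cast Nat.le_of_dvd h0 hpd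
lemma SM_cy_zero {y t : ℝ} (hy : 0 < y) (ht : t ≤ Real.log y) : SM (cy y) t = 0 := by
  refine Finset.sum_eq_zero fun n hn => cy_zero hy.le ?_
  have h1 := (Nat.le_floor_iff (Real.exp_pos _).le).mp (Finset.mem_Icc.mp hn).2
  exact h1.trans ((Real.le_log_iff_exp_le hy).mp ht)
lemma mu_nonneg (y t : ℝ) : 0 ≤ mu y t := by
  unfold mu SM
  have := Finset.sum_nonneg (s := Finset.Icc 1 ⌊Real.exp t⌋₊) (fun n _ => cy_nonneg y n)
  positivity
lemma mu_zero {y t : ℝ} (hy : 0 < y) (ht : t ≤ Real.log y) : mu y t = 0 := by rw [mu, SM_cy_zero hy ht, mul_zero]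
lemma mu_ii {g : ℝ → ℝ} (hg : Continuous g) (y a b : ℝ) : IntervalIntegrable (fun t => g t * mu y t) volume a b := by
  have := SM_ii (cy y) (g := fun t => g t * Real.exp (-t)) fP a b
  simpa only [mu, mul_assoc] using this
lemma sum_f_split (y : ℝ) (G : ℕ → ℝ) {N : ℕ} (hN : 1 ≤ N) :
    ∑ n ∈ Finset.Icc 1 N, fS (Sy y) n * G n = G 1 + ∑ n ∈ Finset.Icc 1 N, cy y n * G n := by
  rw [← Finset.add_sum_Ioc_eq_sum_Icc hN, ← Finset.add_sum_Ioc_eq_sum_Icc (f := fun n => cy y n * G n) hN, fS_one, cy, if_pos rfl, zero_mul, zero_add, one_mul]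
  congr 1
  exact Finset.sum_congr rfl fun n hn => by rw [cy, if_neg (by have := (Finset.mem_Ioc.mp hn).1; omega)]
lemma B2eq : ∃ C : ℝ, 0 < C ∧ ∀ y z : ℝ, 2 ≤ y → Real.log y ≤ z →
    |z * mu y z - (2 + 2 * (∫ s in o0..(z - Real.log y), mu y s) - 2 * Real.exp (Real.log y - z) + ∫ s in o0..z, Real.exp (s - z) * mu y s)|
      ≤ C * (Real.log y) ^ o8 * (1 + mu y (z - Real.log y) + ∫ s in o0..(z - Real.log y), mu y s) := by
  obtain ⟨C, hC, hpsi⟩ := psi_y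
  refine ⟨2 * C, pV, fun y z hy hz => ?_⟩
  set L := Real.log y with hL
  have hL0 : 0 < L := Real.log_pos lI
  have hey : Real.exp L = y := Real.exp_log lI
  set Z := z - L with hZ
  have hZ0 : 0 ≤ Z := by rw [hZ]; linarith
  set x := Real.exp z with hx
  have hxX : x = y * Real.exp Z := by rw [hx, hZ, ← hey, ← Real.exp_add]; congr 1; ring
  have hx0 : 0 < x := Real.exp_pos _
  have h1 : 1 ≤ ⌊x⌋₊ := (Nat.one_le_floor_iff _).mpr (Real.one_le_exp lI)
  have hX1 : 1 ≤ ⌊Real.exp Z⌋₊ := (Nat.one_le_floor_iff _).mpr (Real.one_le_exp hZ0)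
  have hA := sum_f_log (S := Sy y) Sy_prime x
  rw [sum_f_split y (fun n => Real.log n) h1, abel_log1 _ lI] at hA
  simp only [Nat.cast_one, Real.log_one, zero_add] at hA
  have hB : ∑ m ∈ Finset.Icc 1 ⌊x⌋₊, fS (Sy y) m * psiS (Sy y) (x / m) = ∑ m ∈ Finset.Icc 1 ⌊Real.exp Z⌋₊, fS (Sy y) m * psiS (Sy y) (x / m) := by
    symm
    refine Finset.sum_subset (Finset.Icc_subset_Icc_right (Nat.floor_le_floor ?_)) fun m hm hm2 => ?_
    · rw [hxX]; nlinarith [Real.exp_pos Z]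
    · have hm' := Finset.mem_Icc.mp hm
      have hm0 : o0 < m := by exact_mod_cast hm'.1
      rw [psi_le_y lI, mul_zero]
      have : Real.exp Z < m := by
        by_contra hcon
        exact hm2 (Finset.mem_Icc.mpr ⟨hm'.1, (Nat.le_floor_iff (Real.exp_pos _).le).mpr (le_of_not_gt hcon)⟩)
      rw [div_le_iff₀ hm0, hxX]
      gcongr
  rw [hB] at hA
  have hinv := abel_inv (cy y) hZ0
  set I := ∫ s in o0..Z, Real.exp (-s) * SM (cy y) s
  have hC1 : |∑ m ∈ Finset.Icc 1 ⌊Real.exp Z⌋₊, fS (Sy y) m * psiS (Sy y) (x / m) - ∑ m ∈ Finset.Icc 1 ⌊Real.exp Z⌋₊, fS (Sy y) m * (x / m - y)|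
      ≤ C * L ^ o8 * x * (1 + Real.exp (-Z) * SM (cy y) Z + I) := by
    have hs := sum_f_split y (fun n => 1 / (n:ℝ)) hX1
    simp only [mul_one_div, Nat.cast_one, div_one] at hs
    rw [hinv] at hs
    rw [add_assoc, ← hs, ← Finset.sum_sub_distrib, Finset.mul_sum]
    refine (Finset.abs_sum_le_sum_abs _ _).trans (Finset.sum_le_sum fun m hm => ?_)
    have hm' := Finset.mem_Icc.mp hm
    have hm0 : o0 < m := by exact_mod_cast hm'.1
    have hmX := (Nat.le_floor_iff (Real.exp_pos _).le).mp hm'.2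
    rw [← mul_sub, abs_mul, abs_of_nonneg (fS_nonneg _ _)]
    have := hpsi y (x / m) hy (by rw [le_div_iff₀ hm0, hxX]; gcongr)
    calc fS (Sy y) m * |psiS (Sy y) (x / m) - (x / m - y)| ≤ fS (Sy y) m * (C * (x / m) * L ^ o8) :=
          mul_le_mul_of_nonneg_left this (fS_nonneg _ _)
      _ = _ := by ring
  have hD : ∑ m ∈ Finset.Icc 1 ⌊Real.exp Z⌋₊, fS (Sy y) m * (x / m - y) = x - y + x * I := by
    rw [sum_f_split y (fun n => x / n - y) hX1]
    have : ∑ n ∈ Finset.Icc 1 ⌊Real.exp Z⌋₊, cy y n * (x / n - y) = x * ∑ n ∈ Finset.Icc 1 ⌊Real.exp Z⌋₊, cy y n / n - y * SM (cy y) Z := by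
      rw [SM, Finset.mul_sum, Finset.mul_sum, ← Finset.sum_sub_distrib]
      exact Finset.sum_congr rfl fun n _ => by ring
    rw [this, hinv]
    have e : x * Real.exp (-Z) = y := by rw [hxX, mul_assoc, ← Real.exp_add]; simp
    push_cast
    linear_combination (SM (cy y) Z) * e
  have hI : I = ∫ s in o0..Z, mu y s := rfl
  have hJ : ∫ s in o0..z, SM (cy y) s = x * ∫ s in o0..z, Real.exp (s - z) * mu y s := by
    rw [← intervalIntegral.integral_const_mul]
    refine intervalIntegral.integral_congr fun s _ => ?_
    simp only [mu]
    rw [← mul_assoc, ← mul_assoc, hx, ← Real.exp_add, ← Real.exp_add]; simp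
  have hmz : x * mu y z = SM (cy y) z := by rw [mu, ← mul_assoc, hx, ← Real.exp_add]; simp
  have hexy : x * Real.exp (L - z) = y := by rw [hx, ← Real.exp_add, ← hey]; congr 1; ring
  rw [hJ, ← hmz] at hA
  rw [hD] at hC1
  set J := ∫ s in o0..z, Real.exp (s - z) * mu y s
  set Q := ∑ m ∈ Finset.Icc 1 ⌊Real.exp Z⌋₊, fS (Sy y) m * psiS (Sy y) (x / m)
  have key : x * (z * mu y z - (2 + 2 * (∫ s in o0..Z, mu y s) - 2 * Real.exp (L - z) + J)) = 2 * (Q - (x - y + x * I)) := by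
    rw [← hI]; linear_combination hA + 2 * hexy
  have k2 : x * |z * mu y z - (2 + 2 * (∫ s in o0..Z, mu y s) - 2 * Real.exp (L - z) + J)| = 2 * |Q - (x - y + x * I)| := by
    rw [← abs_of_pos hx0, ← abs_mul, abs_of_pos hx0, key, abs_mul, abs_two]
  rw [← mul_le_mul_iff_right₀ hx0, k2, ← hI]
  calc 2 * |Q - (x - y + x * I)| ≤ 2 * (C * L ^ o8 * x * (1 + Real.exp (-Z) * SM (cy y) Z + I)) := by gcongr
    _ = _ := by rw [mu]; ring
lemma sup_contract {F : ℝ → ℝ} {s : Set ℝ} {A q M : ℝ} (hA : 0 ≤ A) (hq : 0 ≤ q) (hq1 : q < 1) (hM : 0 ≤ M)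
    (hb : ∀ x ∈ s, F x ≤ M) (st : ∀ S : ℝ, 0 ≤ S → (∀ x ∈ s, F x ≤ S) → ∀ x ∈ s, F x ≤ A + q * S) :
    ∀ x ∈ s, F x ≤ A / (1 - q) := by
  have hq' : 0 < 1 - q := lI
  have key : ∀ n : ℕ, ∀ x ∈ s, F x ≤ A / (1 - q) + q ^ n * M := by
    intro n
    induction n with
    | zero => intro x hx; have := hb x hx; have : 0 ≤ A / (1 - q) := pV
              simp; linarith [hb x hx]
    | succ n ih =>
      intro x hx
      refine (st _ pV ih x hx).trans (le_of_eq ?_)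
      field_simp
      ring
  intro x hx
  have : Tendsto (fun n : ℕ => A / (1 - q) + q ^ n * M) atTop (𝓝 (A / (1 - q) + 0 * M)) :=
    ((tendsto_pow_atTop_nhds_zero_of_lt_one hq hq1).mul_const M).const_add _
  simpa using ge_of_tendsto' this fun n => key n x hx
lemma mu_int_le {y z S D : ℝ} {k : ℕ} (hz : 0 ≤ z) (hS : ∀ t, 0 ≤ t → t ≤ z → mu y t ≤ S * t ^ k / D) :
    ∫ s in o0..z, mu y s ≤ S * z ^ (k + 1) / ((k + 1) * D) := by
  have := intervalIntegral.integral_mono_on hz (by simpa using mu_ii (g := fun _ => 1) fP y 0 z)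
    (Continuous.intervalIntegrable (u := fun t : ℝ => S / D * t ^ k) fP 0 z)
    (fun t ht => (hS t ht.1 ht.2).trans (le_of_eq (by ring)))
  refine this.trans (le_of_eq ?_)
  rw [intervalIntegral.integral_const_mul, integral_pow]
  simp only [ne_eq, Nat.succ_ne_zero, not_false_eq_true, zero_pow, sub_zero, Nat.add_eq_zero_iff, one_ne_zero, and_false]
  rw [div_mul_div_comm, mul_comm D]
lemma mu_J_le {y z S D : ℝ} {k : ℕ} (hz : 0 ≤ z) (hS0 : 0 ≤ S) (hD : 0 ≤ D) (hS : ∀ t, 0 ≤ t → t ≤ z → mu y t ≤ S * t ^ k / D) :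
    ∫ s in o0..z, Real.exp (s - z) * mu y s ≤ S * z ^ k / D := by
  have := intervalIntegral.integral_mono_on hz (mu_ii (g := fun s => Real.exp (s - z)) fP y 0 z)
    (Continuous.intervalIntegrable (u := fun t : ℝ => Real.exp (t - z) * (S * z ^ k / D)) fP 0 z)
    (fun t ht => mul_le_mul_of_nonneg_left ((hS t ht.1 ht.2).trans
      (by have := ht.2; have := ht.1; gcongr)) (Real.exp_pos _).le)
  refine this.trans ?_
  rw [intervalIntegral.integral_mul_const, intervalIntegral.integral_comp_sub_right (fun t => Real.exp t), integral_exp]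
  refine mul_le_of_le_one_left pV ?_
  have := Real.exp_pos (0 - z)
  simp only [sub_self, Real.exp_zero]; linarith
lemma mu_up : ∃ L0 : ℝ, 1 ≤ L0 ∧ ∀ y t : ℝ, 2 ≤ y → L0 ≤ Real.log y → 0 ≤ t → mu y t ≤ 8 * t ^ 3 / Real.log y ^ 4 := by
  obtain ⟨C, hC, h⟩ := B2eq
  have ht : Tendsto (fun L : ℝ => C * L ^ o8) atTop (𝓝 (C * 0)) :=
    (tendsto_rpow_neg_atTop nN).const_mul C
  rw [mul_zero] at ht
  obtain ⟨L1, hL1⟩ := eventually_atTop.mp (ht.eventually (gt_mem_nhds (show o0 < 0.05 by norm_num)))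
  refine ⟨max 40 L1, (by norm_num : o1 ≤ 40).trans (le_max_left _ _), fun y t hy hL ht0 => ?_⟩
  set L := Real.log y with hLd
  have hL40 : 40 ≤ L := (le_max_left _ _).trans hL
  have hCL := (hL1 L ((le_max_right _ _).trans hL)).le
  have hCL0 : 0 ≤ C * L ^ o8 := pV
  have hL0 : 0 < L := lI
  rcases le_total t L with htL | htL
  · rw [mu_zero lI htL]; positivity
  have main := sup_contract (F := fun t => mu y t * L ^ 4 / t ^ 3) (s := Set.Icc L t) (A := 2.05) (q := 0.6) (M := SM (cy y) t * L)
    nN nN nN (mul_nonneg (Finset.sum_nonneg fun n _ => cy_nonneg y n) hL0.le) ?_ ?_ t ⟨htL, le_rfl⟩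
  · have h3 : 0 < t ^ 3 := pow_pos (hL0.trans_le htL) 3
    have hL4 : 0 < L ^ 4 := pV
    rw [div_le_iff₀ h3] at main
    rw [le_div_iff₀ hL4]
    refine main.trans ?_
    gcongr; norm_num
  · intro s hs
    have hs0 : 0 < s := hL0.trans_le hs.1
    have e1 : mu y s ≤ SM (cy y) t := by
      unfold mu
      have h1 := SM_mono (cy_nonneg y) hs.2
      have h2 : Real.exp (-s) ≤ 1 := Real.exp_le_one_iff.mpr lI
      have h3 : 0 ≤ SM (cy y) s := Finset.sum_nonneg fun n _ => cy_nonneg y n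
      nlinarith
    have e2 : L ^ 4 ≤ L * s ^ 3 := by
      have := pow_le_pow_left₀ hL0.le hs.1 3
      nlinarith
    rw [div_le_iff₀ pV]
    have := mu_nonneg y s
    calc mu y s * L ^ 4 ≤ SM (cy y) t * (L * s ^ 3) := mul_le_mul e1 e2 pV (this.trans e1)
      _ = _ := by ring
  · intro S hS hF z hz
    have hz0 : 0 < z := hL0.trans_le hz.1
    have hμ : ∀ s, 0 ≤ s → s ≤ z → mu y s ≤ S * s ^ 3 / L ^ 4 := by
      intro s hs0 hsz
      rcases le_total s L with hsL | hsL
      · rw [mu_zero lI hsL]; positivity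
      · have := hF s ⟨hsL, hsz.trans hz.2⟩
        have hs0 : 0 < s := hL0.trans_le hsL
        have h3 : 0 < s ^ 3 := pV
        have hL4 : 0 < L ^ 4 := pV
        rw [div_le_iff₀ h3] at this
        rwa [le_div_iff₀ hL4]
    have hb := (abs_le.mp (h y z hy hz.1)).2
    have hzL : 0 ≤ z - L := by linarith [hz.1]
    have i1 := mu_int_le hzL fun s h0 h1 => hμ s h0 lI
    have i2 := mu_J_le hz0.le hS pV hμ
    have i3 := hμ (z - L) hzL lI
    have hZ3 : (z - L) ^ 3 ≤ z ^ 3 := pow_le_pow_left₀ hzL lI 3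
    have hZ4 : (z - L) ^ 4 ≤ z ^ 4 := pow_le_pow_left₀ hzL lI 4
    set P := S * z ^ 4 / L ^ 4
    have hP : 0 ≤ P := pV
    have i1' : ∫ s in o0..(z - L), mu y s ≤ P / 4 := by
      refine i1.trans ?_
      push_cast
      calc S * (z - L) ^ (3 + 1) / ((3 + 1) * L ^ 4) ≤ S * z ^ 4 / ((3 + 1) * L ^ 4) := by gcongr
        _ = _ := by simp only [P]; field_simp; norm_num
    have hzP : S * z ^ 3 / L ^ 4 ≤ P / 40 := by
      have : S * z ^ 3 / L ^ 4 * 40 ≤ S * z ^ 3 / L ^ 4 * z := by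
        apply mul_le_mul_of_nonneg_left (by linarith [hz.1]) pV
      have e : S * z ^ 3 / L ^ 4 * z = P := by simp only [P]; ring
      linarith
    have i3' : mu y (z - L) ≤ P / 40 := i3.trans (le_trans (by gcongr) hzP)
    have he : 0 ≤ Real.exp (L - z) := (Real.exp_pos _).le
    have e1 : C * L ^ o8 * (1 + mu y (z - L) + ∫ s in o0..(z - L), mu y s) ≤ 0.05 * (1 + P / 40 + P / 4) :=
      mul_le_mul hCL lI (add_nonneg (add_nonneg zero_le_one (mu_nonneg _ _)) (intervalIntegral.integral_nonneg hzL fun s _ => mu_nonneg y s)) nN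
    have e2 : z * mu y z ≤ 2.05 + 0.6 * P := lI
    have hL4 : 0 < L ^ 4 := pV
    have e3 : 1 ≤ z ^ 4 / L ^ 4 := by rw [one_le_div hL4]; exact pow_le_pow_left₀ hL0.le hz.1 4
    have e4 : z * mu y z ≤ (2.05 + 0.6 * S) * (z ^ 4 / L ^ 4) := by
      have : P = S * (z ^ 4 / L ^ 4) := by simp only [P]; ring
      rw [this] at e2; linarith
    rw [div_le_iff₀ pV]
    rw [← mul_div_assoc, le_div_iff₀ hL4] at e4
    have := le_of_mul_le_mul_left (a := z) (b := mu y z * L ^ 4) (c := (2.05 + 0.6 * S) * z ^ 3) lI hz0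
    exact this
variable {ξ : ℝ → ℝ} {c : ℝ}
lemma KX.xi_up (h : KX ξ c) : ∃ K : ℝ, 0 < K ∧ ∀ u : ℝ, 1 ≤ u → ξ u ≤ K * u := by
  obtain ⟨K, hK, hb⟩ := h.bd
  refine ⟨3 * c + K + 1, by have := h.c0; positivity, fun u hu => ?_⟩
  have h1 := (abs_le.mp (hb u lI)).2
  have h2 : Real.exp (-u/4) ≤ 1 := Real.exp_le_one_iff.mpr lI
  have := h.c0
  nlinarith
def Xs (ξ : ℝ → ℝ) (L t : ℝ) : ℝ := ξ (t / L) / L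
lemma Xs_zero (h : KX ξ c) {L t : ℝ} (hL : 0 < L) (ht : t < L) : Xs ξ L t = 0 := by
  rw [Xs, h.z _ (by rwa [div_lt_one hL]), zero_div]
lemma Xs_int (ξ : ℝ → ℝ) {L : ℝ} (hL : 0 < L) (b : ℝ) : ∫ s in o0..b, Xs ξ L s = ∫ v in o0..(b / L), ξ v := by
  unfold Xs
  rw [intervalIntegral.integral_div, intervalIntegral.integral_comp_div _ hL.ne']
  simp [hL.ne']
lemma Xs_ii (h : KX ξ c) {L : ℝ} (hL : 0 < L) (a b : ℝ) : IntervalIntegrable (Xs ξ L) volume a b := by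
  have := ((h.xi_ii (a / L) (b / L)).comp_mul_right (c := L⁻¹))
  simp only [← div_eq_mul_inv] at this
  have h2 := this.div_const L
  convert h2 using 1 <;> first | rfl | field_simp
lemma Xs_eq (h : KX ξ c) {L t : ℝ} (hL : 0 < L) (ht : L ≤ t) : t * Xs ξ L t = 2 + 2 * ∫ s in o0..(t - L), Xs ξ L s := by
  have h1 := h.e (t / L) (by rwa [one_le_div hL])
  rw [Xs_int ξ hL, sub_div, div_self hL.ne']
  have h2 : ∫ v in o0..(t/L - 1), ξ v = ∫ v in o1..(t/L - 1), ξ v := by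
    rw [← intervalIntegral.integral_add_adjacent_intervals (h.xi_ii 0 1) (h.xi_ii 1 _), h.int_lt zero_le_one le_rfl, zero_add]
  rw [h2, ← h1, Xs]
  ring
lemma e_int {f : ℝ → ℝ} {L Z : ℝ} (hL : 0 < L) (hZ : 0 ≤ Z) (h0 : ∀ t, t < L → f t = 0) {g : ℝ → ℝ} (hf : ∀ a b, IntervalIntegrable f volume a b)
    (hg : ∀ a b, IntervalIntegrable g volume a b) (hb : ∀ t, L ≤ t → t ≤ Z → f t ≤ g t) :
    ∫ s in o0..Z, f s ≤ if Z ≤ L then 0 else ∫ s in L..Z, g s := by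
  have hz : ∀ b, 0 ≤ b → b ≤ L → ∫ s in o0..b, f s = 0 := by
    intro b hb0 hb
    have : ∫ t in o0..b, f t = ∫ t in o0..b, o0 := by
      apply intervalIntegral.integral_congr_ae
      have : ∀ᵐ x : ℝ ∂volume, x ≠ L := by simp [ae_iff, measure_singleton]
      filter_upwards [this] with x hx hx2
      rw [Set.uIoc_of_le hb0] at hx2
      exact h0 x (lt_of_le_of_ne (hx2.2.trans hb) hx)
    rw [this]; simp
  split_ifs with hZL
  · rw [hz Z hZ hZL]
  · push Not at hZL
    rw [← intervalIntegral.integral_add_adjacent_intervals (hf 0 L) (hf L Z), hz L hL.le le_rfl, zero_add]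
    exact intervalIntegral.integral_mono_on hZL.le (hf _ _) (hg _ _) fun t ht => hb t ht.1 ht.2
lemma mu_xi (h : KX ξ c) : ∃ L0 C : ℝ, 1 ≤ L0 ∧ 0 < C ∧ ∀ y t : ℝ, 2 ≤ y → L0 ≤ Real.log y → Real.log y ≤ t →
    |mu y t - Xs ξ (Real.log y) t| * Real.log y ≤ C * ((t / Real.log y) ^ 5 * Real.log y ^ o8 + Real.exp (Real.log y - t)) := by
  obtain ⟨C, hC, hB⟩ := B2eq
  obtain ⟨L0, hL01, hup⟩ := mu_up
  obtain ⟨K, hK, hKb⟩ := h.xi_up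
  refine ⟨L0, (10 + 11 * C) / (1 - 0.4), hL01, by norm_num; positivity, fun y t hy hLL htL => ?_⟩
  set L := Real.log y with hLd
  have hL1 : 1 ≤ L := hL01.trans hLL
  have hL0 : 0 < L := lI
  set W : ℝ → ℝ := fun t => (t / L) ^ 5 * L ^ o8 + Real.exp (L - t) with hW
  have hLp : 0 < L ^ o8 := pV
  have hWp : ∀ s, L ≤ s → 0 < W s := fun s hs => by have : 0 < s := hL0.trans_le hs
                                                    simp only [hW]; positivity
  have hei : ∀ a b, IntervalIntegrable (fun s => mu y s - Xs ξ L s) volume a b := fun a b =>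
    (by simpa using mu_ii (g := fun _ => 1) fP y a b : IntervalIntegrable (mu y) volume a b).sub (Xs_ii h hL0 a b)
  have ht0 : 0 < t := hL0.trans_le htL
  have ht00 : 0 ≤ (8 * t ^ 3 / L ^ 4 + K * (t / L) / L) * L / L ^ o8 := pV
  have main := sup_contract (F := fun t => |mu y t - Xs ξ L t| * L / W t) (s := Set.Icc L t) (A := 10 + 11 * C) (q := 0.4)
    (M := (8 * t ^ 3 / L ^ 4 + K * (t / L) / L) * L / L ^ o8) pV nN nN (ht00 : 0 ≤ (8 * t ^ 3 / L ^ 4 + K * (t / L) / L) * L / L ^ o8) ?_ ?_ t ⟨htL, le_rfl⟩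
  · rwa [div_le_iff₀ (hWp t htL)] at main
  · intro s hs
    have hs0 : 0 < s := hL0.trans_le hs.1
    have hs1 : 1 ≤ s / L := by rw [one_le_div hL0]; exact hs.1
    have e1 : |mu y s - Xs ξ L s| ≤ 8 * t ^ 3 / L ^ 4 + K * (t / L) / L := by
      have a1 : mu y s ≤ 8 * t ^ 3 / L ^ 4 := (hup y s hy hLL hs0.le).trans (by have := hs.2; gcongr)
      have a2 : Xs ξ L s ≤ K * (t / L) / L := by
        unfold Xs
        have := hs.2
        refine div_le_div_of_nonneg_right ((hKb _ hs1).trans (by gcongr)) hL0.le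
      have a3 := mu_nonneg y s
      have a4 : 0 ≤ Xs ξ L s := div_nonneg (h.nonneg _) hL0.le
      rw [abs_le]; constructor <;> linarith
    have e2 : L ^ o8 ≤ W s := by
      have : 1 ≤ (s / L) ^ 5 := one_le_pow₀ hs1
      have := Real.exp_pos (L - s)
      simp only [hW]
      nlinarith
    have e0 : 0 ≤ |mu y s - Xs ξ L s| := abs_nonneg _
    exact div_le_div₀ (mul_nonneg (e0.trans e1) hL0.le) (mul_le_mul_of_nonneg_right e1 hL0.le) hLp e2
  · intro S hS hF z hz
    have hz0 : 0 < z := hL0.trans_le hz.1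
    set u := z / L with hu
    have hu1 : 1 ≤ u := by rw [hu, one_le_div hL0]; exact hz.1
    have hzu : z = u * L := by rw [hu]; field_simp
    have hzL : 0 ≤ z - L := by linarith [hz.1]
    have hμ : ∀ s, 0 ≤ s → s ≤ z → mu y s ≤ 8 * s ^ 3 / L ^ 4 := fun s h0 _ => hup y s hy hLL h0
    have i1 := mu_int_le hzL fun s h0 h1 => hμ s h0 lI
    have i2 := mu_J_le hz0.le nN pV hμ
    have i2' : 0 ≤ ∫ s in o0..z, Real.exp (s - z) * mu y s := intervalIntegral.integral_nonneg hz0.le fun s _ => mul_nonneg (Real.exp_pos _).le (mu_nonneg y s)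
    have i3 := hμ (z - L) hzL lI
    have i4 : ∫ s in o0..(z - L), |mu y s - Xs ξ L s| ≤ S * (u ^ 6 * L ^ o8 * (1 / 5)) := by
      have hgi : ∀ a b, IntervalIntegrable (fun s => S / L * W s) volume a b := fun a b => by
        apply Continuous.intervalIntegrable; simp only [hW]; fun_prop
      have := e_int (f := fun s => |mu y s - Xs ξ L s|) (g := fun s => S / L * W s) hL0 hzL
        (fun s hs => by rw [mu_zero lI hs.le, Xs_zero h hL0 hs]; simp) (fun a b => (hei a b).abs) hgi
        (fun s h1 h2 => by
          have := hF s ⟨h1, by linarith [hz.2]⟩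
          rw [div_le_iff₀ (hWp s h1)] at this
          rw [div_mul_eq_mul_div, le_div_iff₀ hL0]; exact this)
      refine this.trans ?_
      split_ifs with hc
      · positivity
      · push Not at hc
        have hu2 : 2 ≤ u := by rw [hu, le_div_iff₀ hL0]; linarith
        rw [intervalIntegral.integral_const_mul]
        have j1 : ∫ s in L..(z - L), W s ≤ L * (u ^ 6 / 6) * L ^ o8 + 1 := by
          simp only [hW]
          rw [intervalIntegral.integral_add (Continuous.intervalIntegrable fP _ _) (Continuous.intervalIntegrable fP _ _),
            intervalIntegral.integral_mul_const, intervalIntegral.integral_comp_div (fun v => v ^ 5) hL0.ne', integral_pow,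
            intervalIntegral.integral_comp_sub_left (fun v => Real.exp v), integral_exp]
          have k1 : ((z - L) / L) ^ 6 ≤ u ^ 6 := pow_le_pow_left₀ pV (by rw [hu]; gcongr; linarith) 6
          have k2 := Real.exp_pos (L - (z - L))
          have k3 : L / L = 1 := div_self hL0.ne'
          have k4 : (((z - L) / L) ^ (5 + 1) - (L / L) ^ (5 + 1)) / ((5:ℕ) + 1) ≤ u ^ 6 / 6 := by
            rw [k3]; norm_num; linarith
          rw [smul_eq_mul, sub_self, Real.exp_zero]
          have := mul_le_mul_of_nonneg_left (mul_le_mul_of_nonneg_left k4 hL0.le) hLp.le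
          linarith
        have j2 : 1 ≤ L * (u ^ 6 / 64) * L ^ o8 := by
          have a1 : (64:ℝ) ≤ u ^ 6 := by have := pow_le_pow_left₀ nN hu2 6; norm_num at this ⊢; exact this
          have a2 : 1 ≤ L * L ^ o8 := by
            nth_rewrite 1 [← Real.rpow_one L]
            rw [← Real.rpow_add hL0]
            exact Real.one_le_rpow hL1 nN
          have : 1 ≤ u ^ 6 / 64 := lI
          calc o1 ≤ (L * L ^ o8) * (u ^ 6 / 64) := one_le_mul_of_one_le_of_one_le a2 this
            _ = _ := by ring
        have hp : 0 ≤ u ^ 6 * L ^ o8 := pV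
        calc S / L * ∫ s in L..(z - L), W s ≤ S / L * (L * (u ^ 6 * L ^ o8 * (1/5))) := by
              refine mul_le_mul_of_nonneg_left ?_ pV
              have : 0 ≤ L * (u ^ 6 * L ^ o8) := pV
              linarith
          _ = _ := by field_simp
    have hb := h.xi_ii 0 1
    have hb := hB y z hy hz.1
    have hXe := Xs_eq h hL0 hz.1
    have hdiff : (∫ s in o0..(z - L), mu y s) - ∫ s in o0..(z - L), Xs ξ L s = ∫ s in o0..(z - L), (mu y s - Xs ξ L s) :=
      (intervalIntegral.integral_sub (by simpa using mu_ii (g := fun _ => 1) fP y _ _) (Xs_ii h hL0 _ _)).symm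
    have habs := intervalIntegral.abs_integral_le_integral_abs (f := fun s => mu y s - Xs ξ L s) (μ := volume) hzL
    rw [← hdiff] at habs
    set I1 := ∫ s in o0..(z - L), mu y s
    set I2 := ∫ s in o0..(z - L), Xs ξ L s
    set I3 := ∫ s in o0..(z - L), |mu y s - Xs ξ L s|
    set J := ∫ s in o0..z, Real.exp (s - z) * mu y s
    have hu3 : 8 * z ^ 3 / L ^ 4 ≤ 8 * u ^ 3 / L := by rw [hzu]; apply le_of_eq; field_simp
    have hZ3 : (z - L) ^ 3 ≤ z ^ 3 := pow_le_pow_left₀ hzL lI 3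
    have hZ4 : (z - L) ^ 4 ≤ z ^ 4 := pow_le_pow_left₀ hzL lI 4
    have i3' : mu y (z - L) ≤ 8 * u ^ 3 / L := i3.trans (le_trans (by gcongr) hu3)
    have i1' : I1 ≤ 2 * u ^ 4 := by
      refine i1.trans ?_
      push_cast
      calc 8 * (z - L) ^ (3 + 1) / ((3 + 1) * L ^ 4) ≤ 8 * z ^ 4 / ((3 + 1) * L ^ 4) := by gcongr
        _ = _ := by rw [hzu]; field_simp; norm_num
    have u35 : u ^ 3 ≤ u ^ 5 := pow_le_pow_right₀ hu1 nN
    have u45 : u ^ 4 ≤ u ^ 5 := pow_le_pow_right₀ hu1 nN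
    have u15 : 1 ≤ u ^ 5 := one_le_pow₀ hu1
    have hLi : 1 / L ≤ L ^ o8 := by
      rw [one_div, ← Real.rpow_neg_one]; exact Real.rpow_le_rpow_of_exponent_le hL1 nN
    have hLi1 : 1 / L ≤ 1 := by rw [div_le_one hL0]; exact hL1
    have hv : 8 * u ^ 3 / L = 8 * u ^ 3 * (1 / L) := by ring
    have q1 : 8 * u ^ 3 / L ≤ 8 * (u ^ 5 * L ^ o8) := by
      rw [hv]
      calc 8 * u ^ 3 * (1 / L) ≤ 8 * u ^ 5 * L ^ o8 := by gcongr
        _ = _ := by ring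
    have q2 : 1 + mu y (z - L) + I1 ≤ 11 * u ^ 5 := by
      have : 8 * u ^ 3 / L ≤ 8 * u ^ 3 := by rw [hv]; exact mul_le_of_le_one_right pV hLi1
      linarith
    have q3 : C * L ^ o8 * (1 + mu y (z - L) + I1) ≤ 11 * C * (u ^ 5 * L ^ o8) := by
      calc C * L ^ o8 * (1 + mu y (z - L) + I1) ≤ C * L ^ o8 * (11 * u ^ 5) := by gcongr
        _ = _ := by ring
    have hE := Real.exp_pos (L - z)
    have fin : |z * (mu y z - Xs ξ L z)| ≤ (10 + 11 * C) * W z + 0.4 * S * (u * W z) := by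
      have e1 : z * (mu y z - Xs ξ L z) = (z * mu y z - (2 + 2 * I1 - 2 * Real.exp (L - z) + J)) + 2 * (I1 - I2) + (J - 2 * Real.exp (L - z)) := by
        linear_combination -hXe
      have e2 : |J - 2 * Real.exp (L - z)| ≤ 8 * (u ^ 5 * L ^ o8) + 2 * Real.exp (L - z) := by
        rw [abs_le]; constructor <;> linarith
      have e3 : |2 * (I1 - I2)| ≤ 0.4 * S * (u * (u ^ 5 * L ^ o8)) := by
        rw [abs_mul, abs_two]
        have : u * (u ^ 5 * L ^ o8) = u ^ 6 * L ^ o8 := by ring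
        rw [this]; linarith
      rw [e1]
      refine (abs_add_le _ _).trans ?_
      have := abs_add_le (z * mu y z - (2 + 2 * I1 - 2 * Real.exp (L - z) + J)) (2 * (I1 - I2))
      have p1 : 0 ≤ C * Real.exp (L - z) := pV
      have p2 : 0 ≤ S * (u * Real.exp (L - z)) := pV
      have p3 : 0 ≤ u ^ 5 * L ^ o8 := pV
      have hWz : W z = u ^ 5 * L ^ o8 + Real.exp (L - z) := rfl
      rw [hWz]
      linarith
    rw [abs_mul, abs_of_pos hz0] at fin
    have hWz := hWp z hz.1
    rw [div_le_iff₀ hWz]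
    have g1 : u * (|mu y z - Xs ξ L z| * L) ≤ u * ((10 + 11 * C + 0.4 * S) * W z) := by
      have : u * (|mu y z - Xs ξ L z| * L) = z * |mu y z - Xs ξ L z| := by rw [hzu]; ring
      rw [this]
      refine fin.trans ?_
      have : 0 ≤ (u - 1) * ((10 + 11 * C) * W z) := mul_nonneg lI pV
      linarith
    exact le_of_mul_le_mul_left g1 lI
variable {ξ : ℝ → ℝ} {c : ℝ}
lemma log_two_le {y : ℝ} (hy : 2 ≤ y) : 1/2 ≤ Real.log y := by
  have := Real.log_two_gt_d9
  have := Real.log_le_log nN hy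
  linarith
lemma B1' : ∃ C : ℝ, 0 < C ∧ ∀ y t : ℝ, 2 ≤ y → 0 ≤ t →
    |mu y t - Ay y * (t + (C0 + 2 * Ly y))| ≤ C * (Real.log y + 1) ^ 12 * Real.exp (-(t / Real.log y) / 4) := by
  obtain ⟨C, hC, h⟩ := B1
  refine ⟨C + 1, pV, fun y t hy ht => ?_⟩
  have h1 := h y (Real.exp t) hy (Real.exp_pos _)
  have hL := log_two_le hy
  set L := Real.log y
  rw [Real.log_exp] at h1
  have hL0 : 0 < L := lI
  have e1 : mu y t - Ay y * (t + (C0 + 2 * Ly y)) = Real.exp (-t) * (Phi y (Real.exp t) - Real.exp t * Ay y * (t + C0 + 2 * Ly y)) - Real.exp (-t) := by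
    rw [mu, SM_cy ht]
    have : Real.exp (-t) * Real.exp t = 1 := by rw [← Real.exp_add]; simp
    linear_combination (Ay y * (t + (C0 + 2 * Ly y))) * this
  have e2 : Real.exp (-t) ≤ (L + 1) ^ 12 * Real.exp (-(t / L) / 4) := by
    have a1 : Real.exp (-t) ≤ Real.exp (-(t / L) / 4) := by
      apply Real.exp_le_exp.mpr
      have : t / L ≤ 2 * t := by rw [div_le_iff₀ hL0]; nlinarith
      linarith
    have a2 : 1 ≤ (L + 1) ^ 12 := one_le_pow₀ lI
    nlinarith [Real.exp_pos (-(t / L) / 4)]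
  have e3 : |Real.exp (-t) * (Phi y (Real.exp t) - Real.exp t * Ay y * (t + C0 + 2 * Ly y))| ≤ C * ((L + 1) ^ 12 * Real.exp (-(t / L) / 4)) := by
    rw [abs_mul, abs_of_pos (Real.exp_pos _)]
    calc _ ≤ Real.exp (-t) * (C * (L + 1) ^ 12 * (Real.exp t * Real.exp (-(t / L) / 4))) := mul_le_mul_of_nonneg_left h1 (Real.exp_pos _).le
      _ = (Real.exp (-t) * Real.exp t) * (C * ((L + 1) ^ 12 * Real.exp (-(t / L) / 4))) := by ring
      _ = _ := by rw [← Real.exp_add]; simp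
  rw [e1]
  refine (abs_sub _ _).trans ?_
  rw [abs_of_pos (Real.exp_pos (-t))]
  linarith
lemma U_bd : ∃ C : ℝ, 0 < C ∧ ∀ L : ℝ, 1 ≤ L → (120 * Real.log (L + 1)) ^ 5 ≤ C * L ^ (0.04:ℝ) := by
  refine ⟨(30000:ℝ) ^ 5, nN, fun L hL => ?_⟩
  have h1 := Real.log_le_rpow_div (x := L + 1) lI (show o0 < 0.008 by norm_num)
  have h2 : (L + 1) ^ (0.008:ℝ) ≤ 2 * L ^ (0.008:ℝ) := by
    calc (L + 1) ^ (0.008:ℝ) ≤ (2 * L) ^ (0.008:ℝ) := Real.rpow_le_rpow lI lI nN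
      _ = 2 ^ (0.008:ℝ) * L ^ (0.008:ℝ) := Real.mul_rpow nN lI
      _ ≤ 2 * L ^ (0.008:ℝ) := by
        refine mul_le_mul_of_nonneg_right ?_ pV
        calc o2 ^ (0.008:ℝ) ≤ 2 ^ o1 := Real.rpow_le_rpow_of_exponent_le nN nN
          _ = 2 := nN
  have h3 : 120 * Real.log (L + 1) ≤ 30000 * L ^ (0.008:ℝ) := by
    have : (L + 1) ^ (0.008:ℝ) / 0.008 = 125 * (L + 1) ^ (0.008:ℝ) := by ring
    linarith
  have h4 : L ^ (0.04:ℝ) = (L ^ (0.008:ℝ)) ^ 5 := by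
    rw [← Real.rpow_natCast, ← Real.rpow_mul lI]; norm_num
  rw [h4, ← mul_pow]
  exact pow_le_pow_left₀ (mul_nonneg nN (Real.log_nonneg lI)) h3 5
lemma Ay_bd (y : ℝ) : 0 ≤ Ay y ∧ Ay y ≤ 1 := by
  unfold Ay AS
  refine ⟨Finset.prod_nonneg fun p _ => sq_nonneg _, Finset.prod_le_one (fun p _ => sq_nonneg _) fun p hp => ?_⟩
  have h2 : o2 ≤ p := by exact_mod_cast (Sy_prime p hp).two_le
  have h1 : 0 < (p:ℝ)⁻¹ := pV
  have : (p:ℝ)⁻¹ ≤ 1 := inv_le_one_of_one_le₀ lI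
  exact pow_le_one₀ lI lI
lemma Ly_bd {y : ℝ} (hy : 0 ≤ y) : 0 ≤ Ly y ∧ Ly y ≤ y := by
  unfold Ly LS
  constructor
  · refine Finset.sum_nonneg fun p hp => ?_
    have h2 : o2 ≤ p := by exact_mod_cast (Sy_prime p hp).two_le
    exact div_nonneg (Real.log_nonneg lI) lI
  · have : ∀ p ∈ Sy y, Real.log p / ((p:ℝ) - 1) ≤ 1 := fun p hp => by
      have h2 : o2 ≤ p := by exact_mod_cast (Sy_prime p hp).two_le
      rw [div_le_one lI]
      exact Real.log_le_sub_one_of_pos lI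
    refine (Finset.sum_le_card_nsmul _ _ _ this).trans ?_
    have h3 : (Sy y).card ≤ ⌊y⌋₊ := (Finset.card_filter_le _ _).trans sI
    have h4 := Nat.floor_le hy
    have h5 : ((Sy y).card : ℝ) ≤ ⌊y⌋₊ := by exact_mod_cast h3
    simp only [nsmul_eq_mul, mul_one]; linarith
set_option maxHeartbeats 1000000 in
lemma B3 (h : KX ξ c) : ∃ C : ℝ, 0 < C ∧ ∀ y : ℝ, 2 ≤ y → |Ay y * Real.log y ^ 2 - c| ≤ C * Real.log y ^ o72 ∧
    ∀ t, Real.log y ≤ t → |mu y t * Real.log y - (Ay y * t * Real.log y + kap ξ c (t / Real.log y) + 2 * c)| ≤ C * (Real.log y ^ o72 + Real.exp (Real.log y - t)) := by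
  obtain ⟨L0, C3, hL01, hC3, h3⟩ := mu_xi h
  obtain ⟨C1, hC1, h1⟩ := B1'
  obtain ⟨C5, hC5, h5⟩ := U_bd
  obtain ⟨K, hK, hk⟩ := h.bd
  have hc := h.c0
  set C6 := C1 + (C3 * (C5 + 1)) + K with hC6
  have hC6p : 0 < C6 := pV
  set CA := C3 * (C5 + 1) + 2 * C6 * (C5 + 1) + C1 + 3 * C6 + K with hCA
  set B := (L0 ^ 2 + c) + (L0 * ((1 + 2 * Real.exp L0) + C1 * (L0 + 1) ^ 12) + K + 2 * c) with hB
  have hBp : 0 < B := pV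
  have hCAp : 0 < CA := pV
  clear_value C6 CA B
  refine ⟨CA + B * L0 ^ (0.72:ℝ), pV, fun y hy => ?_⟩
  have hL := log_two_le hy
  have hLy := Ly_bd (y := y) lI
  have hA := Ay_bd y
  have hC0 := C0_bd
  have hey : y = Real.exp (Real.log y) := (Real.exp_log lI).symm
  have h1y := fun t => h1 y t hy
  have h3y := fun t => h3 y t hy
  set L := Real.log y with hLd
  have hLpos : 0 < L := lI
  set A := Ay y
  set M := C0 + 2 * Ly y
  have hM0 : 0 ≤ M := by simp only [M]; linarith
  set e72 := L ^ o72 with he72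
  have he72p : 0 < e72 := pV
  rcases lt_or_ge L L0 with hLs | hLb
  · have hL1' : 1 ≤ L0 ^ (0.72:ℝ) * e72 := by
      have e1 : L0 ^ (0.72:ℝ) * L0 ^ o72 = 1 := by rw [← Real.rpow_add lI]; norm_num
      rw [← e1]
      refine mul_le_mul_of_nonneg_left ?_ pV
      exact Real.rpow_le_rpow_of_nonpos hLpos hLs.le nN
    have hB1 : B ≤ (CA + B * L0 ^ (0.72:ℝ)) * e72 := by
      have : 0 ≤ CA * e72 := pV
      have : B * 1 ≤ B * (L0 ^ (0.72:ℝ) * e72) := mul_le_mul_of_nonneg_left hL1' hBp.le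
      linarith
    have hM : M ≤ 1 + 2 * Real.exp L0 := by
      have : y ≤ Real.exp L0 := by rw [hey]; exact Real.exp_le_exp.mpr hLs.le
      simp only [M]; linarith
    constructor
    · refine le_trans ?_ hB1
      have a1 : A * L ^ 2 ≤ L0 ^ 2 := by
        have : L ^ 2 ≤ L0 ^ 2 := pow_le_pow_left₀ hLpos.le hLs.le 2
        have := mul_le_mul hA.2 this pV zero_le_one
        linarith
      have a2 : 0 ≤ A * L ^ 2 := mul_nonneg hA.1 pV
      have a3 : 0 ≤ L0 * ((1 + 2 * Real.exp L0) + C1 * (L0 + 1) ^ 12) := pV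
      have a4 : 0 ≤ L0 ^ 2 := pV
      rw [abs_le]; constructor <;> linarith
    · intro t ht
      have hexp := Real.exp_pos (L - t)
      refine le_trans ?_ (hB1.trans (mul_le_mul_of_nonneg_left lI pV))
      have ht0 : 0 < t := lI
      have b1 := h1y t ht0.le
      have htL0 : 0 < t / L := pV
      have hEt : Real.exp (-(t / L) / 4) ≤ 1 := Real.exp_le_one_iff.mpr lI
      have b2 : |mu y t - A * (t + M)| ≤ C1 * (L0 + 1) ^ 12 := by
        refine b1.trans ?_
        calc C1 * (L + 1) ^ 12 * Real.exp (-(t / L) / 4) ≤ C1 * (L0 + 1) ^ 12 * 1 := by gcongr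
          _ = _ := by ring
      have b3 := hk (t / L) pV
      have b4 : |kap ξ c (t / L)| ≤ K := b3.trans (by
        have : Real.exp (-(t / L) / 4) ≤ 1 := hEt
        exact mul_le_of_le_one_right hK this)
      have b5 : |(mu y t - A * t)| ≤ (1 + 2 * Real.exp L0) + C1 * (L0 + 1) ^ 12 := by
        have : mu y t - A * t = (mu y t - A * (t + M)) + A * M := by ring
        rw [this]
        refine (abs_add_le _ _).trans ?_
        have : |A * M| ≤ 1 + 2 * Real.exp L0 := by
          rw [abs_of_nonneg (mul_nonneg hA.1 hM0)]
          have := mul_le_mul hA.2 hM hM0 zero_le_one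
          linarith
        linarith
      have b6 : |(mu y t - A * t) * L| ≤ L0 * ((1 + 2 * Real.exp L0) + C1 * (L0 + 1) ^ 12) := by
        rw [abs_mul, abs_of_pos hLpos, mul_comm L0]
        exact mul_le_mul b5 hLs.le hLpos.le pV
      have e : mu y t * L - (A * t * L + kap ξ c (t / L) + 2 * c) = (mu y t - A * t) * L - kap ξ c (t / L) - 2 * c := by ring
      rw [e]
      have a4 : 0 ≤ L0 ^ 2 := pV
      have := abs_le.mp b4; have := abs_le.mp b6
      rw [abs_le]; constructor <;> linarith
  have hL1 : 1 ≤ L := hL01.trans hLb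
  set e76 := L ^ (-0.76:ℝ) with he76
  have he76p : 0 < e76 := pV
  have h7672 : e76 ≤ e72 := Real.rpow_le_rpow_of_exponent_le hL1 nN
  have hinv : L⁻¹ ≤ e76 := by rw [← Real.rpow_neg_one]; exact Real.rpow_le_rpow_of_exponent_le hL1 nN
  set U := 60 * Real.log (L + 1) with hU
  have hlog : 1/2 ≤ Real.log (L + 1) := log_two_le lI
  have hU2 : 2 ≤ U := lI
  have hU5 : ∀ u, 1 ≤ u → u ≤ 2 * U → u ^ 5 * L ^ o8 ≤ C5 * e76 := by
    intro u hu1 hu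
    have a1 : u ^ 5 ≤ C5 * L ^ (0.04:ℝ) := (pow_le_pow_left₀ lI lI 5).trans (h5 L hL1)
    have a2 : L ^ (0.04:ℝ) * L ^ o8 = e76 := by rw [← Real.rpow_add hLpos]; norm_num [he76]
    rw [← a2, ← mul_assoc]
    exact mul_le_mul_of_nonneg_right a1 pV
  have hU1 : ∀ u, 1 ≤ u → u ≤ 2 * U → u * e76 ≤ (C5 + 1) * e72 := by
    intro u hu1 hu
    have a1 : u ^ 5 ≤ C5 * L ^ (0.04:ℝ) := (pow_le_pow_left₀ lI lI 5).trans (h5 L hL1)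
    have a2 : L ^ (0.04:ℝ) * e76 = e72 := by rw [he76, ← Real.rpow_add hLpos]; norm_num [he72]
    have a3 : u ≤ u ^ 5 := le_self_pow₀ hu1 nN
    have := mul_le_mul_of_nonneg_right (a3.trans a1) he76p.le
    rw [mul_assoc, a2] at this
    linarith
  have hexpU : ∀ u, U ≤ u → Real.exp (-u / 4) * (L + 1) ^ 13 ≤ e76 ∧ Real.exp (-u/4) ≤ e76 := by
    intro u hu
    have a1 : Real.exp (-u / 4) ≤ ((L + 1) ^ 15)⁻¹ := by
      have : ((L + 1) ^ 15)⁻¹ = Real.exp (-(15 * Real.log (L + 1))) := by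
        rw [Real.exp_neg, ← Real.exp_log (show 0 < L + 1 by linarith), ← Real.exp_nat_mul, Real.log_exp]; norm_num
      rw [this]; apply Real.exp_le_exp.mpr; linarith
    have a2 : Real.exp (-u / 4) * (L + 1) ^ 13 ≤ L⁻¹ := by
      calc Real.exp (-u / 4) * (L + 1) ^ 13 ≤ ((L + 1) ^ 15)⁻¹ * (L + 1) ^ 13 := by gcongr
        _ = ((L + 1) ^ 2)⁻¹ := by field_simp
        _ ≤ L⁻¹ := by gcongr; have := mul_nonneg hLpos.le hLpos.le; rw [sq]; linarith
    refine ⟨a2.trans hinv, le_trans ?_ (a2.trans hinv)⟩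
    exact le_mul_of_one_le_right (Real.exp_pos _).le (one_le_pow₀ lI)
  have E1 : ∀ u, U ≤ u → |mu y (u * L) * L - A * L * (u * L + M)| ≤ C1 * e76 := by
    intro u hu
    have hu0 : 0 < u := lI
    have b1 := h1y (u * L) pV
    rw [mul_div_cancel_right₀ _ hLpos.ne'] at b1
    have e : mu y (u * L) * L - A * L * (u * L + M) = (mu y (u * L) - A * (u * L + M)) * L := by ring
    rw [e, abs_mul, abs_of_pos hLpos]
    calc _ ≤ C1 * (L + 1) ^ 12 * Real.exp (-u / 4) * (L + 1) := mul_le_mul b1 lI hLpos.le pV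
      _ = C1 * (Real.exp (-u / 4) * (L + 1) ^ 13) := by ring
      _ ≤ _ := mul_le_mul_of_nonneg_left (hexpU u hu).1 hC1.le
  have E3 : ∀ u, U ≤ u → |kap ξ c u| ≤ K * e76 := fun u hu =>
    (hk u lI).trans (mul_le_mul_of_nonneg_left (hexpU u hu).2 hK)
  have E2 : ∀ u, 1 ≤ u → u ≤ 2 * U → |mu y (u * L) * L - ξ u| ≤ C3 * (C5 * e76 + Real.exp (L - u * L)) := by
    intro u hu1 hu2
    have b := h3y (u * L) hLb (le_mul_of_one_le_left hLpos.le hu1)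
    rw [Xs, mul_div_cancel_right₀ _ hLpos.ne'] at b
    have e : mu y (u * L) * L - ξ u = (mu y (u * L) - ξ u / L) * L := by field_simp
    rw [e, abs_mul, abs_of_pos hLpos]
    refine b.trans (mul_le_mul_of_nonneg_left ?_ hC3.le)
    linarith [hU5 u hu1 hu2]
  have E4 : ∀ u, U ≤ u → u ≤ 2 * U → |A * L * (u * L + M) - c * (u + 2)| ≤ C6 * e76 := by
    intro u hu hu2
    have a1 := abs_le.mp (E1 u hu)
    have a2 := abs_le.mp (E2 u lI hu2)
    have a3 := abs_le.mp (E3 u hu)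
    have a4 : Real.exp (L - u * L) ≤ e76 := by
      refine le_trans ?_ hinv
      calc Real.exp (L - u * L) ≤ Real.exp (-L) := Real.exp_le_exp.mpr (by
            have := mul_le_mul_of_nonneg_right (hU2.trans hu) hLpos.le; linarith)
        _ = (Real.exp L)⁻¹ := Real.exp_neg _
        _ ≤ L⁻¹ := by gcongr; linarith [Real.add_one_le_exp L]
    have a5 := mul_le_mul_of_nonneg_left a4 hC3.le
    unfold kap at a3
    simp only [hC6]
    rw [abs_le]; constructor <;> linarith
  have f1 := E4 U le_rfl lI
  have f2 := E4 (2 * U) lI le_rfl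
  have g2 : |A * L * M - 2 * c| ≤ 3 * C6 * e76 := by
    have := abs_le.mp f1; have := abs_le.mp f2
    rw [abs_le]; constructor <;> linarith
  have g1 : |A * L ^ 2 - c| ≤ 2 * C6 * e76 := by
    have : |U * (A * L ^ 2 - c)| ≤ 2 * C6 * e76 := by
      have := abs_le.mp f1; have := abs_le.mp f2
      rw [abs_le]; constructor <;> linarith
    rw [abs_mul, abs_of_pos lI] at this
    have h0 := mul_le_mul_of_nonneg_right (show 1 ≤ U by linarith) (abs_nonneg (A * L ^ 2 - c))
    linarith
  have hBL : 0 ≤ B * L0 ^ (0.72:ℝ) := pV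
  have r0 : 0 ≤ C3 * (C5 + 1) := pV
  have r1 : 0 ≤ 2 * C6 * (C5 + 1) := pV
  constructor
  · refine g1.trans ?_
    have : 2 * C6 ≤ CA + B * L0 ^ (0.72:ℝ) := lI
    exact mul_le_mul this h7672 he76p.le pV
  · intro t ht
    set u := t / L with hu
    have htu : t = u * L := by rw [hu]; field_simp
    have hu1 : 1 ≤ u := by rw [hu, one_le_div hLpos]; exact ht
    have hexp := Real.exp_pos (L - t)
    suffices hs : |mu y t * L - (A * t * L + kap ξ c u + 2 * c)| ≤ CA * (e72 + Real.exp (L - t)) by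
      refine hs.trans (mul_le_mul_of_nonneg_right lI pV)
    rcases le_total u (2 * U) with hu2 | hu2
    · have a2 := E2 u hu1 hu2
      have a3 : |u * (A * L ^ 2 - c)| ≤ 2 * C6 * (C5 + 1) * e72 := by
        rw [abs_mul, abs_of_pos lI]
        calc u * |A * L ^ 2 - c| ≤ u * (2 * C6 * e76) := mul_le_mul_of_nonneg_left g1 lI
          _ = 2 * C6 * (u * e76) := by ring
          _ ≤ 2 * C6 * ((C5 + 1) * e72) := mul_le_mul_of_nonneg_left (hU1 u hu1 hu2) pV
          _ = _ := by ring
      have e : mu y t * L - (A * t * L + kap ξ c u + 2 * c) = (mu y (u * L) * L - ξ u) - u * (A * L ^ 2 - c) := by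
        rw [kap, htu]; ring
      rw [e]
      refine (abs_sub _ _).trans ((add_le_add a2 a3).trans ?_)
      rw [← htu]
      have p1 : C3 * (C5 * e76) ≤ C3 * (C5 + 1) * e72 := by
        have : C5 * e76 ≤ (C5 + 1) * e72 := mul_le_mul lI h7672 he76p.le pV
        have := mul_le_mul_of_nonneg_left this hC3.le
        linarith
      have p2 : C3 * Real.exp (L - t) ≤ CA * Real.exp (L - t) := by
        refine mul_le_mul_of_nonneg_right ?_ hexp.le
        have : 0 ≤ C3 * C5 := pV
        linarith
      have p3 : (C3 * (C5 + 1) + 2 * C6 * (C5 + 1)) * e72 ≤ CA * e72 := by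
        refine mul_le_mul_of_nonneg_right ?_ he72p.le
        linarith
      linarith
    · have a1 := abs_le.mp (E1 u lI)
      have a3 := abs_le.mp (E3 u lI)
      have g2 := abs_le.mp g2
      rw [← htu] at a1
      have p3 : (C1 + 3 * C6 + K) * e76 ≤ CA * e72 := mul_le_mul lI h7672 he76p.le pV
      have p4 : 0 ≤ CA * Real.exp (L - t) := pV
      rw [abs_le]; constructor <;> linarith
def part (n p : ℕ) : ℕ := ∏ q ∈ n.primeFactors.filter (· < p), q ^ n.factorization q
lemma part_mul {n : ℕ} (hn : n ≠ 0) (p : ℕ) : part n p * (∏ q ∈ n.primeFactors.filter (fun q => ¬ q < p), q ^ n.factorization q) = n := by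
  rw [part, Finset.prod_filter_mul_prod_filter_not]
  exact Nat.prod_factorization_pow_eq_self hn
lemma prime_dvd_part {n p q : ℕ} (hq : q.Prime) (h : q ∣ part n p) : q < p ∧ q ∣ n := by
  rw [part, hq.prime.dvd_finsetProd_iff] at h
  obtain ⟨r, hr, h⟩ := h
  have hr' := Finset.mem_filter.mp hr
  have hrp := Nat.prime_of_mem_primeFactors hr'.1
  have := (Nat.prime_dvd_prime_iff_eq hq hrp).mp (hq.dvd_of_dvd_pow h)
  subst this
  exact ⟨hr'.2, Nat.dvd_of_mem_primeFactors hr'.1⟩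
lemma part_part {n : ℕ} (hn : n ≠ 0) {p q : ℕ} (hqp : q ≤ p) : part (part n p) q = part n q := by
  have h0 : part n p ≠ 0 := fun h => hn (by rw [← part_mul hn p, h, zero_mul])
  have hf : (part n p).factorization = n.factorization.filter (· < p) := by
    have : part n p = (n.factorization.filter (· < p)).prod (· ^ ·) := by
      rw [part, Finsupp.prod, Finsupp.support_filter, Nat.support_factorization]
      exact Finset.prod_congr rfl fun q hq => by rw [Finsupp.filter_apply, if_pos (Finset.mem_filter.mp hq).2]
    rw [this]
    apply Nat.prod_pow_factorization_eq_self
    intro r hr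
    rw [Finsupp.support_filter, Nat.support_factorization] at hr
    exact Nat.prime_of_mem_primeFactors (Finset.mem_filter.mp hr).1
  have hs : (part n p).primeFactors = n.primeFactors.filter (· < p) := by
    rw [← Nat.support_factorization, hf, Finsupp.support_filter, Nat.support_factorization]
  unfold part at *
  rw [hs, hf, Finset.filter_filter]
  have : n.primeFactors.filter (fun a => a < p ∧ a < q) = n.primeFactors.filter (· < q) := by
    apply Finset.filter_congr; intro r _; constructor
    · exact fun h => h.2
    · exact fun h => ⟨oM, h⟩
  rw [this]
  refine Finset.prod_congr rfl fun r hr => ?_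
  rw [Finsupp.filter_apply, if_pos]
  have := (Finset.mem_filter.mp hr).2; omega
variable {θ : ℕ → ℝ}
lemma fac_exists {n : ℕ} (hn : n ≠ 0) : ∃ m ∈ Bset θ, m ∣ n ∧ ∀ p : ℕ, p.Prime → p ∣ n / m → θ m < p := by
  classical
  by_cases hB : n ∈ Bset θ
  · refine ⟨n, hB, dvd_rfl, fun p hp h => ?_⟩
    rw [Nat.div_self (Nat.pos_of_ne_zero hn), Nat.dvd_one] at h
    exact absurd h hp.ne_one
  · have hex : ∃ p : ℕ, p.Prime ∧ p ∣ n ∧ θ (part n p) < p := by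
      by_contra hcon
      push Not at hcon
      exact hB ⟨Nat.pos_of_ne_zero hn, hcon⟩
    obtain ⟨hp, hpn, hpθ⟩ := Nat.find_spec hex
    set p := Nat.find hex
    have hmul := part_mul hn p
    have h0 : part n p ≠ 0 := fun h => hn (by rw [← hmul, h, zero_mul])
    refine ⟨part n p, ⟨Nat.pos_of_ne_zero h0, fun q hq hqd => ?_⟩, ⟨_, hmul.symm⟩, fun q hq hqd => ?_⟩
    · obtain ⟨hqp, hqn⟩ := prime_dvd_part hq hqd
      have := Nat.find_min hex hqp
      push Not at this
      have h2 := this hq hqn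
      rw [← part_part hn hqp.le] at h2
      exact h2
    · have e : n / part n p = ∏ q ∈ n.primeFactors.filter (fun q => ¬ q < p), q ^ n.factorization q := by
        conv_lhs => rw [← hmul]
        rw [part_mul hn p]
        exact Nat.div_eq_of_eq_mul_right (Nat.pos_of_ne_zero h0) hmul.symm
      rw [e, hq.prime.dvd_finsetProd_iff] at hqd
      obtain ⟨r, hr, h⟩ := hqd
      have hr' := Finset.mem_filter.mp hr
      have hrp := Nat.prime_of_mem_primeFactors hr'.1
      have := (Nat.prime_dvd_prime_iff_eq hq hrp).mp (hq.dvd_of_dvd_pow h)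
      subst this
      have : (p:ℝ) ≤ q := by exact_mod_cast not_lt.mp hr'.2
      linarith
lemma fac_unique (hθ : ∀ n : ℕ, 1 ≤ n → ((max 2 n : ℕ) : ℝ) ≤ θ n) {n m m' : ℕ} (hn : n ≠ 0)
    (hm : m ∈ Bset θ) (hmn : m ∣ n) (h : ∀ p : ℕ, p.Prime → p ∣ n / m → θ m < p)
    (hm' : m' ∈ Bset θ) (hmn' : m' ∣ n) (h' : ∀ p : ℕ, p.Prime → p ∣ n / m' → θ m' < p) (hle : θ m ≤ θ m') : m = m' := by
  have small : ∀ q : ℕ, q ∣ m → (q:ℝ) ≤ θ m := fun q hqm => by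
    have h1 : (q:ℝ) ≤ (max 2 m : ℕ) := by exact_mod_cast (Nat.le_of_dvd hm.1 hqm).trans (le_max_right _ _)
    exact h1.trans (hθ m hm.1)
  have hcop : Nat.Coprime m (n / m') := by
    apply Nat.Coprime.symm
    apply Nat.coprime_of_dvd
    intro k hk hkn hkm
    have := h' k hk hkn
    have := small k hkm
    linarith
  have hdvd : m ∣ m' := by
    refine hcop.dvd_of_dvd_mul_right ?_
    rwa [Nat.mul_div_cancel' hmn']
  obtain ⟨s, rfl⟩ := hdvd
  by_contra hne
  have hs1 : s ≠ 1 := fun h => hne (by rw [h, mul_one])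
  have hs0 : s ≠ 0 := fun h => by rw [h, mul_zero] at hmn'; exact hn (Nat.eq_zero_of_zero_dvd hmn')
  have hp := Nat.minFac_prime hs1
  set p := s.minFac
  have hsr : s ∣ n / m := by
    obtain ⟨r, rfl⟩ := hmn'
    rw [mul_assoc, Nat.mul_div_cancel_left _ hm.1]; exact Dvd.intro _ rfl
  have hpθ := h p hp ((Nat.minFac_dvd s).trans hsr)
  have hB := hm'.2 p hp ((Nat.minFac_dvd s).mul_left m)
  have hm0 : m ≠ 0 := hm.1.ne'
  have : (∏ q ∈ (m * s).primeFactors.filter (· < p), q ^ (m * s).factorization q) = m := by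
    conv_rhs => rw [← Nat.prod_factorization_pow_eq_self hm0]
    rw [Finsupp.prod, Nat.support_factorization]
    have hset : (m * s).primeFactors.filter (· < p) = m.primeFactors := by
      ext q
      simp only [Finset.mem_filter, Nat.mem_primeFactors]
      constructor
      · rintro ⟨⟨hq, hqd, _⟩, hqp⟩
        refine ⟨hq, ?_, hm0⟩
        rcases hq.dvd_mul.mp hqd with h1 | h1
        · exact h1
        · exact absurd (Nat.minFac_le_of_dvd hq.two_le h1) (not_le.mpr hqp)
      · rintro ⟨hq, hqm, _⟩
        refine ⟨⟨hq, hqm.mul_right s, mul_ne_zero hm0 hs0⟩, ?_⟩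
        have := small q hqm
        exact_mod_cast this.trans_lt hpθ
    rw [hset]
    refine Finset.prod_congr rfl fun q hq => ?_
    obtain ⟨hq1, hqm, _⟩ := Nat.mem_primeFactors.mp hq
    rw [Nat.factorization_mul hm0 hs0, Finsupp.add_apply, Nat.factorization_eq_zero_of_not_dvd (n := s), add_zero]
    intro hqs
    have h1 : p ≤ q := Nat.minFac_le_of_dvd hq1.two_le hqs
    have h2 : (p:ℝ) ≤ q := by exact_mod_cast h1
    have := small q hqm
    linarith
  rw [this] at hB
  linarith
open Classical in
def am (θ : ℕ → ℝ) (m : ℕ) : ℝ := if m ∈ Bset θ then tau m else 0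
lemma am_nonneg (θ : ℕ → ℝ) (m : ℕ) : 0 ≤ am θ m := by unfold am; split_ifs <;> simp [tau_nonneg]
lemma am_le (θ : ℕ → ℝ) (m : ℕ) : am θ m ≤ tau m := by unfold am; split_ifs <;> simp [tau_nonneg]
lemma T_eq (θ : ℕ → ℝ) (z : ℝ) : T θ (Real.exp z) = SM (am θ) z := by
  classical
  rw [T, SM, Finset.sum_filter]
  exact Finset.sum_congr rfl fun n _ => by simp only [am, tau]
lemma tau_fac (hθ : ∀ n : ℕ, 1 ≤ n → ((max 2 n : ℕ) : ℝ) ≤ θ n) {N n : ℕ} (hn : n ∈ Finset.Icc 1 N) :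
    ∑ m ∈ Finset.Icc 1 N, (if m ∣ n then am θ m * fS (Sy (θ m)) (n / m) else 0) = tau n := by
  have hn' := Finset.mem_Icc.mp hn
  have hn0 : n ≠ 0 := oM
  obtain ⟨m, hm, hmn, h⟩ := fac_exists (θ := θ) hn0
  have hθ0 : ∀ m, m ∈ Bset θ → 0 ≤ θ m := fun m hm => (Nat.cast_nonneg _).trans (hθ m hm.1)
  have hmem : m ∈ Finset.Icc 1 N := Finset.mem_Icc.mpr ⟨hm.1, (Nat.le_of_dvd hn'.1 hmn).trans hn'.2⟩
  rw [Finset.sum_eq_single m]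
  · rw [if_pos hmn, am, if_pos hm, fS, if_pos]
    · unfold tau
      have hcop : Nat.Coprime m (n / m) := by
        apply Nat.Coprime.symm
        apply Nat.coprime_of_dvd
        intro k hk hkn hkm
        have h1 := h k hk hkn
        have h2 : (k:ℝ) ≤ (max 2 m : ℕ) := by exact_mod_cast (Nat.le_of_dvd hm.1 hkm).trans (le_max_right _ _)
        have := h2.trans (hθ m hm.1)
        linarith
      rw [← Nat.cast_mul, ← hcop.card_divisors_mul, Nat.mul_div_cancel' hmn]
    · intro p hp hpd
      obtain ⟨h1, h2⟩ := (mem_Sy (hθ0 m hm)).mp hp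
      have := h p h1 hpd
      linarith
  · intro m' _ hne
    split_ifs with hd
    · by_cases hB : m' ∈ Bset θ
      · rw [fS]
        split_ifs with hf
        · have h' : ∀ p : ℕ, p.Prime → p ∣ n / m' → θ m' < p := fun p hp hpd => by
            by_contra hcon
            exact hf p ((mem_Sy (hθ0 m' hB)).mpr ⟨hp, not_lt.mp hcon⟩) hpd
          exfalso
          rcases le_total (θ m) (θ m') with hle | hle
          · exact hne (fac_unique hθ hn0 hm hmn h hB hd h' hle).symm
          · exact hne (fac_unique hθ hn0 hB hd h' hm hmn h hle)
        · rw [mul_zero]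
      · rw [am, if_neg hB, zero_mul]
    · rfl
  · exact fun h => absurd hmem h
lemma D_fac (hθ : ∀ n : ℕ, 1 ≤ n → ((max 2 n : ℕ) : ℝ) ≤ θ n) (x : ℝ) :
    PhiS ∅ x = ∑ m ∈ Finset.Icc 1 ⌊x⌋₊, am θ m * Phi (θ m) (x / m) := by
  have h1 : PhiS ∅ x = ∑ n ∈ Finset.Icc 1 ⌊x⌋₊, tau n := by
    rw [PhiS]; exact Finset.sum_congr rfl fun n _ => by simp [fS]
  rw [h1, ← Finset.sum_congr rfl (fun n hn => tau_fac hθ hn), Finset.sum_comm]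
  refine Finset.sum_congr rfl fun m hm => ?_
  rw [sum_dvd (fun r => am θ m * fS (Sy (θ m)) r) _ m (Finset.mem_Icc.mp hm).1, ← Finset.mul_sum, Phi, PhiS, Nat.floor_div_natCast]
def GG (θ : ℕ → ℝ) (z : ℝ) : ℝ := Real.exp (-z) * SM (am θ) z
lemma GG_nonneg (θ : ℕ → ℝ) (z : ℝ) : 0 ≤ GG θ z := mul_nonneg (Real.exp_pos _).le (Finset.sum_nonneg fun n _ => am_nonneg θ n)
lemma Main0 (hθ : ∀ n : ℕ, 1 ≤ n → ((max 2 n : ℕ) : ℝ) ≤ θ n) {z : ℝ} (hz : 0 ≤ z) :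
    |GG θ z + ∑ m ∈ Finset.Icc 1 ⌊Real.exp z⌋₊, am θ m / m * mu (θ m) (z - Real.log m) - (z + C0)| ≤ 30 * Real.exp (-z / 2) := by
  have h1 := D_asymp (x := Real.exp z) (by simpa using Real.one_le_exp hz)
  rw [Real.log_exp, D_fac hθ] at h1
  have e1 : ∑ m ∈ Finset.Icc 1 ⌊Real.exp z⌋₊, am θ m * Phi (θ m) (Real.exp z / m) =
      Real.exp z * (GG θ z + ∑ m ∈ Finset.Icc 1 ⌊Real.exp z⌋₊, am θ m / m * mu (θ m) (z - Real.log m)) := by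
    have e0 : Real.exp z * GG θ z = ∑ m ∈ Finset.Icc 1 ⌊Real.exp z⌋₊, am θ m := by
      rw [GG, ← mul_assoc, ← Real.exp_add]; simp [SM]
    rw [mul_add, e0, Finset.mul_sum, ← Finset.sum_add_distrib]
    refine Finset.sum_congr rfl fun m hm => ?_
    have hm' := Finset.mem_Icc.mp hm
    have hm0 : o0 < m := by exact_mod_cast hm'.1
    have hmz : (m:ℝ) ≤ Real.exp z := (Nat.le_floor_iff (Real.exp_pos _).le).mp hm'.2
    have hl : Real.log m ≤ z := by rw [← Real.log_exp z]; exact Real.log_le_log hm0 hmz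
    have e2 : Real.exp (z - Real.log m) = Real.exp z / m := by rw [Real.exp_sub, Real.exp_log hm0]
    have e3 : Real.exp (-(z - Real.log m)) = m / Real.exp z := by rw [Real.exp_neg, e2, inv_div]
    rw [mu, SM_cy lI, e2, e3]
    have := Real.exp_pos z
    field_simp
    ring
  have e2 : (Real.exp z) ^ (1/2:ℝ) = Real.exp z * Real.exp (-z / 2) := by
    rw [← Real.exp_mul, ← Real.exp_add]; congr 1; ring
  rw [e1, ← mul_sub, abs_mul, abs_of_pos (Real.exp_pos z), e2] at h1
  refine le_of_mul_le_mul_left (h1.trans (le_of_eq (by ring))) (Real.exp_pos z)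
variable {ξ : ℝ → ℝ} {c : ℝ}
lemma KX.k_bd (h : KX ξ c) : ∃ K : ℝ, 0 < K ∧ ∀ u : ℝ, 0 ≤ u → |kap ξ c u| ≤ K := by
  obtain ⟨K, hK, hb⟩ := h.bd
  refine ⟨K + 1, pV, fun u hu => (hb u hu).trans ?_⟩
  have : Real.exp (-u / 4) ≤ 1 := Real.exp_le_one_iff.mpr lI
  nlinarith
def Qw (ξ : ℝ → ℝ) (w z : ℝ) : ℝ := ∫ r in (max w 1)..(z / 2), Real.exp (w - r) * (ξ (z / r - 1) / r)
def I2 (w : ℝ) : ℝ := ∫ r in Set.Ioi (max w 1), Real.exp (w - r) * (r ^ 2)⁻¹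
lemma int_exp_sub (w a b : ℝ) : ∫ r in a..b, Real.exp (w - r) = Real.exp (w - a) - Real.exp (w - b) := by
  rw [intervalIntegral.integral_comp_sub_left (fun t => Real.exp t), integral_exp]
lemma int_exp_poly (w a b : ℝ) : ∫ r in a..b, Real.exp (w - r) * (1 + (r - w) ^ 2) =
    Real.exp (w - a) * ((a - w) ^ 2 + 2 * (a - w) + 3) - Real.exp (w - b) * ((b - w) ^ 2 + 2 * (b - w) + 3) := by
  have hd : ∀ r : ℝ, HasDerivAt (fun r => -(Real.exp (w - r) * ((r - w) ^ 2 + 2 * (r - w) + 3))) (Real.exp (w - r) * (1 + (r - w) ^ 2)) r := by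
    intro r
    have h1 : HasDerivAt (fun r : ℝ => Real.exp (w - r)) (-Real.exp (w - r)) r := by
      have := ((hasDerivAt_id r).const_sub w).exp
      simpa using this
    have h2 : HasDerivAt (fun r : ℝ => (r - w) ^ 2 + 2 * (r - w) + 3) (2 * (r - w) + 2) r := by
      have h0 := (hasDerivAt_id r).sub_const w
      have := ((h0.pow 2).add (h0.const_mul 2)).add_const 3
      simpa using this
    exact ((h1.mul h2).neg).congr_deriv (by ring)
  rw [intervalIntegral.integral_eq_sub_of_hasDerivAt (fun r _ => hd r) (Continuous.intervalIntegrable fP _ _)]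
  ring
lemma exp_Ioi_int (w a : ℝ) : IntegrableOn (fun r => Real.exp (w - r)) (Set.Ioi a) := by
  have : (fun r : ℝ => Real.exp (w - r)) = fun r => Real.exp w * Real.exp (-r) := by
    ext r; rw [← Real.exp_add]; ring_nf
  rw [this]
  exact (integrableOn_exp_neg_Ioi a).const_mul _
lemma exp_Ioi (w a : ℝ) : ∫ r in Set.Ioi a, Real.exp (w - r) = Real.exp (w - a) := by
  have : (fun r : ℝ => Real.exp (w - r)) = fun r => Real.exp w * Real.exp (-r) := by
    ext r; rw [← Real.exp_add]; ring_nf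
  rw [this, integral_const_mul, integral_exp_neg_Ioi, ← Real.exp_add]; ring_nf
lemma expsq_int {w a : ℝ} (ha : 1 ≤ a) : IntegrableOn (fun r => Real.exp (w - r) * (r ^ 2)⁻¹) (Set.Ioi a) := by
  refine Integrable.mono' (exp_Ioi_int w a) ?_ ?_
  · exact (Measurable.mul fP fP).aestronglyMeasurable
  · refine (ae_restrict_iff' measurableSet_Ioi).mpr (ae_of_all _ fun r hr => ?_)
    have hr1 : 1 < r := lt_of_le_of_lt ha hr
    rw [Real.norm_eq_abs, abs_of_nonneg pV]
    exact mul_le_of_le_one_right (Real.exp_pos _).le (inv_le_one_of_one_le₀ (by nlinarith))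
lemma expsq_le {w a : ℝ} (ha : 1 ≤ a) : 0 ≤ (∫ r in Set.Ioi a, Real.exp (w - r) * (r ^ 2)⁻¹) ∧
    ∫ r in Set.Ioi a, Real.exp (w - r) * (r ^ 2)⁻¹ ≤ Real.exp (w - a) * (a ^ 2)⁻¹ := by
  refine ⟨setIntegral_nonneg measurableSet_Ioi fun r _ => pV, ?_⟩
  have := setIntegral_mono_on (expsq_int (w := w) ha) ((exp_Ioi_int w a).mul_const ((a ^ 2)⁻¹)) measurableSet_Ioi
    (fun r hr => by
      have hr1 : a < r := hr
      refine mul_le_mul_of_nonneg_left (inv_anti₀ pV (by gcongr)) (Real.exp_pos _).le)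
  rwa [integral_mul_const, exp_Ioi] at this
lemma I2_lower {w : ℝ} (hw : 1 ≤ w) : (w ^ 2)⁻¹ - 6 / w ^ 3 ≤ I2 w := by
  rw [I2, max_eq_left hw]
  have hI : IntegrableOn (fun r => Real.exp (w - r) * (r ^ 2)⁻¹) (Set.Ioi w) := expsq_int hw
  have hb : ∀ b, w ≤ b → ∫ r in w..b, Real.exp (w - r) * (r ^ 2)⁻¹ ≤ ∫ r in Set.Ioi w, Real.exp (w - r) * (r ^ 2)⁻¹ := by
    intro b hb
    rw [intervalIntegral.integral_of_le hb]
    exact setIntegral_mono_set hI ((ae_restrict_iff' measurableSet_Ioi).mpr (ae_of_all _ fun r _ => by simp only [Pi.zero_apply]; positivity)) Set.Ioc_subset_Ioi_self.eventuallyLE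
  have hw0 : 0 < w := lI
  have hk : ∀ b, w ≤ b → (w ^ 2)⁻¹ * (1 - Real.exp (w - b)) - 6 / w ^ 3 ≤ ∫ r in w..b, Real.exp (w - r) * (r ^ 2)⁻¹ := by
    intro b hb
    have i1 : IntervalIntegrable (fun r => Real.exp (w - r) * (w ^ 2)⁻¹ - Real.exp (w - r) * (1 + (r - w) ^ 2) * (2 / w ^ 3)) volume w b := Continuous.intervalIntegrable fP _ _
    have i2 : IntervalIntegrable (fun r => Real.exp (w - r) * (r ^ 2)⁻¹) volume w b := by
      refine ContinuousOn.intervalIntegrable ?_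
      rw [Set.uIcc_of_le hb]
      refine ContinuousOn.mul fP (ContinuousOn.inv₀ fP fun r hr => ?_)
      have : 0 < r := hw0.trans_le hr.1
      positivity
    have h1 := intervalIntegral.integral_mono_on hb i1 i2 (fun r hr => by
        have hr0 : 0 < r := hw0.trans_le hr.1
        have hrw := hr.1
        have : (w ^ 2)⁻¹ - (1 + (r - w) ^ 2) * (2 / w ^ 3) ≤ (r ^ 2)⁻¹ := by
          have e : (w ^ 2)⁻¹ - (r ^ 2)⁻¹ ≤ 2 * (r - w) / w ^ 3 := by
            have : (w ^ 2)⁻¹ - (r ^ 2)⁻¹ = (r - w) * ((r + w) / (w ^ 2 * r ^ 2)) := by field_simp; ring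
            rw [this]
            have e2 : (r + w) / (w ^ 2 * r ^ 2) ≤ 2 / w ^ 3 := by
              rw [div_le_div_iff₀ pV pV]
              have : (r + w) * w ≤ 2 * r ^ 2 := by nlinarith
              calc (r + w) * w ^ 3 = ((r + w) * w) * w ^ 2 := by ring
                _ ≤ 2 * r ^ 2 * w ^ 2 := mul_le_mul_of_nonneg_right this pV
                _ = _ := by ring
            calc (r - w) * ((r + w) / (w ^ 2 * r ^ 2)) ≤ (r - w) * (2 / w ^ 3) := mul_le_mul_of_nonneg_left e2 lI
              _ = _ := by ring
          have e3 : 2 * (r - w) / w ^ 3 ≤ (1 + (r - w) ^ 2) * (2 / w ^ 3) := by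
            have : (1 + (r - w) ^ 2) * (2 / w ^ 3) = 2 * (1 + (r - w) ^ 2) / w ^ 3 := by ring
            rw [this]; refine div_le_div_of_nonneg_right ?_ pV
            nlinarith [sq_nonneg (r - w - 1)]
          linarith
        have := mul_le_mul_of_nonneg_left this (Real.exp_pos (w - r)).le
        linarith)
    refine le_trans ?_ h1
    rw [intervalIntegral.integral_sub (Continuous.intervalIntegrable fP _ _) (Continuous.intervalIntegrable fP _ _),
      intervalIntegral.integral_mul_const, intervalIntegral.integral_mul_const, int_exp_sub, int_exp_poly]
    have : 0 ≤ Real.exp (w - b) * ((b - w) ^ 2 + 2 * (b - w) + 3) * (2 / w ^ 3) := by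
      have : 0 ≤ b - w := lI
      positivity
    simp only [sub_self, Real.exp_zero]
    have e : 6 / w ^ 3 = 3 * (2 / w ^ 3) := by ring
    rw [e]; linarith
  have hlim : Tendsto (fun b => (w ^ 2)⁻¹ * (1 - Real.exp (w - b)) - 6 / w ^ 3) atTop (𝓝 ((w ^ 2)⁻¹ * (1 - 0) - 6 / w ^ 3)) := by
    refine Tendsto.sub_const (Tendsto.const_mul _ (Tendsto.const_sub _ ?_)) _
    exact Real.tendsto_exp_atBot.comp (tendsto_atBot_add_const_left _ w tendsto_neg_atTop_atBot)
  have := le_of_tendsto hlim ((eventually_ge_atTop w).mono fun b hb' => (hk b hb').trans (hb b hb'))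
  simpa using this
lemma I2_upper (w : ℝ) : 0 ≤ I2 w ∧ I2 w ≤ 1 ∧ (1 ≤ w → I2 w ≤ (w ^ 2)⁻¹) := by
  have h1 := expsq_le (w := w) (le_max_right w 1)
  have hm := le_max_left w 1
  have h2 : Real.exp (w - max w 1) ≤ 1 := Real.exp_le_one_iff.mpr lI
  have h3 : ((max w 1) ^ 2)⁻¹ ≤ 1 := inv_le_one_of_one_le₀ (one_le_pow₀ (le_max_right _ _))
  refine ⟨h1.1, h1.2.trans (mul_le_one₀ h2 pV h3), fun h => ?_⟩
  have := h1.2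
  rw [max_eq_left h] at this
  unfold I2
  rw [max_eq_left h]
  simpa using this
structure Dat (Kb w y : ℝ) : Prop where
  w0 : 0 ≤ w
  y2 : 2 ≤ y
  wv : w ≤ Real.log y
  vw : Real.log y ≤ w + Kb * (1 + w) ^ oq
lemma Dat.v_ge {Kb w y : ℝ} (d : Dat Kb w y) : (1 + w) / 4 ≤ Real.log y := by
  have := log_two_le d.y2
  have := d.wv
  rcases le_total 1 w with h | h <;> linarith
lemma rpow_quarter_le {x : ℝ} (hx : 0 ≤ x) (p : ℝ) (hp : p ≤ 0) {v : ℝ} (hv : (1 + x) / 4 ≤ v) : v ^ p ≤ 4 ^ (-p) * (1 + x) ^ p := by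
  calc v ^ p ≤ ((1 + x) / 4) ^ p := Real.rpow_le_rpow_of_nonpos pV hv hp
    _ = _ := by rw [Real.div_rpow pV nN, Real.rpow_neg nN]; field_simp
set_option maxHeartbeats 1000000 in
lemma Fpt (h : KX ξ c) {Kb : ℝ} (hKb : 0 ≤ Kb) : ∃ C : ℝ, 0 < C ∧ ∀ w y z r : ℝ, Dat Kb w y → w + Real.log y ≤ z → max w 1 ≤ r → r ≤ z / 2 →
    |(-kap ξ c (z / r - 1) - c) / r - (-kap ξ c ((z - w) / Real.log y) - c) / Real.log y| ≤ C * (1 + w) ^ o7 * (1 + (r - w) ^ 2) := by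
  obtain ⟨K, hK, hk⟩ := h.k_bd
  obtain ⟨CL, hCL, hl⟩ := h.lip
  have hc := h.c0
  obtain ⟨CH, hCH⟩ : ∃ CH, CH = K + c := ⟨_, rfl⟩
  have hCH0 : 0 < CH := by rw [hCH]; linarith
  refine ⟨12 * CH + 4 * ((CL + CH) * (Kb + 3)), pV, fun w y z r d hz hr hrz => ?_⟩
  have hw := d.w0
  have hv := log_two_le d.y2
  have hwv := d.wv
  have hvw := d.vw
  generalize Real.log y = v at *
  have hr1 : 1 ≤ r := (le_max_right _ _).trans hr
  have hwr : w ≤ r := (le_max_left _ _).trans hr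
  have hr0 : 0 < r := lI
  have hv0 : 0 < v := lI
  obtain ⟨s, hs⟩ : ∃ s, s = z / r - 1 := ⟨_, rfl⟩
  obtain ⟨s', hs'⟩ : ∃ s', s' = (z - w) / v := ⟨_, rfl⟩
  rw [← hs, ← hs']
  have hs1 : 1 ≤ s := by
    rw [hs, le_sub_iff_add_le, le_div_iff₀ hr0]; linarith
  have hs1' : 1 ≤ s' := by rw [hs', le_div_iff₀ hv0]; linarith
  have hb : ∀ u, 1 ≤ u → |-kap ξ c u - c| ≤ CH := fun u hu => by
    have := abs_le.mp (hk u lI)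
    rw [abs_le, hCH]; constructor <;> linarith
  have hsq : 1 ≤ 1 + (r - w) ^ 2 := by linarith [sq_nonneg (r - w)]
  have hp : 0 < (1 + w) ^ o7 := pV
  rcases lt_or_ge w 1 with hw1 | hw1
  · have h1 : |(-kap ξ c s - c) / r| ≤ CH := by
      rw [abs_div, abs_of_pos hr0, div_le_iff₀ hr0]
      exact (hb s hs1).trans (le_mul_of_one_le_right hCH0.le hr1)
    have h2 : |(-kap ξ c s' - c) / v| ≤ 2 * CH := by
      rw [abs_div, abs_of_pos hv0, div_le_iff₀ hv0]
      have := mul_le_mul_of_nonneg_left hv hCH0.le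
      linarith [hb s' hs1']
    have h3 : 1/4 ≤ (1 + w) ^ o7 := by
      calc oq = 2 ^ (-2:ℝ) := by rw [Real.rpow_neg nN]; norm_num
        _ ≤ 2 ^ o7 := Real.rpow_le_rpow_of_exponent_le nN nN
        _ ≤ _ := Real.rpow_le_rpow_of_nonpos lI lI nN
    have h4 : 3 * CH ≤ 12 * CH * (1 + w) ^ o7 := by
      have := mul_le_mul_of_nonneg_left h3 hCH0.le
      linarith
    have h5 : 0 ≤ 4 * ((CL + CH) * (Kb + 3)) := pV
    refine (abs_sub _ _).trans ((add_le_add h1 h2).trans ?_)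
    calc CH + 2 * CH ≤ 12 * CH * (1 + w) ^ o7 * 1 := lI
      _ ≤ _ := mul_le_mul (mul_le_mul_of_nonneg_right lI hp.le) hsq zero_le_one pV
  · have hw0 : 0 < w := lI
    obtain ⟨dd, hdd⟩ : ∃ dd, dd = r - w := ⟨_, rfl⟩
    rw [← hdd] at hsq ⊢
    have hd0 : 0 ≤ dd := lI
    obtain ⟨X, hX⟩ : ∃ X, X = (v - w) + 2 * dd + dd ^ 2 := ⟨_, rfl⟩
    have hX0 : 0 ≤ X := by
      have : 0 ≤ v - w := lI
      rw [hX]; positivity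
    have hz1 : 0 < z - r := lI
    have hzw : 0 < z - w := lI
    have k1 : |kap ξ c s - kap ξ c s'| ≤ CL * X / w := by
      rcases le_total s' s with hss | hss
      · rw [abs_sub_comm]
        refine (hl s' s hs1' hss).trans ?_
        rw [mul_div_assoc, mul_div_assoc]
        refine mul_le_mul_of_nonneg_left ?_ hCL
        rw [div_le_div_iff₀ lI hw0]
        have e1 : s * w ≤ v * s' := by
          have : s = (z - r) / r := by rw [hs]; field_simp
          rw [this, hs', mul_div_cancel₀ _ hv0.ne', div_mul_eq_mul_div, div_le_iff₀ hr0]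
          exact mul_le_mul lI hwr hw hzw.le
        have e2 : 0 ≤ (2 * dd + dd ^ 2) * s' := pV
        rw [hX]; linarith
      · refine (hl s s' hs1 hss).trans ?_
        rw [mul_div_assoc, mul_div_assoc]
        refine mul_le_mul_of_nonneg_left ?_ hCL
        rw [div_le_div_iff₀ lI hw0]
        have e1 : s' * w ≤ (w + 2 * dd + dd ^ 2) * s := by
          have a1 : s = (z - r) / r := by rw [hs]; field_simp
          have a2 : s' * w ≤ z - w := by
            rw [hs', div_mul_eq_mul_div, div_le_iff₀ hv0]
            exact mul_le_mul_of_nonneg_left hwv hzw.le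
          refine a2.trans ?_
          rw [a1, ← mul_div_assoc, le_div_iff₀ hr0]
          have a3 : r = w + dd := by rw [hdd]; ring
          have a4 : r ≤ z - r := lI
          have a5 : (z - w) = (z - r) + dd := by rw [hdd]; ring
          rw [a5]
          have a6 : dd * r ≤ dd * (z - r) := mul_le_mul_of_nonneg_left a4 hd0
          have a7 : 0 ≤ dd ^ 2 * (z - r) := pV
          have a8 : (z - r) * r = (z - r) * w + (z - r) * dd := by rw [← mul_add, ← a3]
          linarith
        have e2 : 0 ≤ (v - w) * s := mul_nonneg lI lI
        rw [hX]; linarith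
    have k2 : |1 / r - 1 / v| ≤ X / w ^ 2 := by
      have e : 1 / r - 1 / v = (v - r) / (r * v) := by field_simp
      rw [e, abs_div, abs_of_pos (by positivity : 0 < r * v)]
      refine div_le_div₀ hX0 ?_ pV (by rw [sq]; exact mul_le_mul hwr hwv hw hr0.le)
      have : 0 ≤ dd ^ 2 := pV
      rw [abs_le]; constructor <;> linarith
    have k3 : |(-kap ξ c s - c) / r - (-kap ξ c s' - c) / v| ≤ (CL + CH) * X / w ^ 2 := by
      have e : (-kap ξ c s - c) / r - (-kap ξ c s' - c) / v = -(kap ξ c s - kap ξ c s') / r + (-kap ξ c s' - c) * (1 / r - 1 / v) := by ring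
      rw [e]
      have b1 : |-(kap ξ c s - kap ξ c s') / r| ≤ CL * X / w ^ 2 := by
        rw [abs_div, abs_neg, abs_of_pos hr0]
        calc |kap ξ c s - kap ξ c s'| / r ≤ (CL * X / w) / w := by gcongr
          _ = _ := by field_simp
      have b2 : |(-kap ξ c s' - c) * (1 / r - 1 / v)| ≤ CH * (X / w ^ 2) := by
        rw [abs_mul]; exact mul_le_mul (hb s' hs1') k2 (abs_nonneg _) pV
      refine (abs_add_le _ _).trans ((add_le_add b1 b2).trans (le_of_eq (by ring)))
    have hq : 1 ≤ (1 + w) ^ oq := Real.one_le_rpow lI nN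
    have k4 : X ≤ (Kb + 3) * ((1 + w) ^ oq * (1 + dd ^ 2)) := by
      have a1 : v - w ≤ Kb * (1 + w) ^ oq := lI
      have a2 : 2 * dd + dd ^ 2 ≤ 3 * (1 + dd ^ 2) := by linarith [sq_nonneg (dd - 1), sq_nonneg dd, (by ring : (dd-1)^2 = dd^2-2*dd+1)]
      have a3 : 3 * (1 + dd ^ 2) ≤ 3 * ((1 + w) ^ oq * (1 + dd ^ 2)) := by
        have := mul_le_mul_of_nonneg_right hq (by positivity : 0 ≤ 1 + dd ^ 2)
        linarith
      have a4 : Kb * (1 + w) ^ oq ≤ Kb * ((1 + w) ^ oq * (1 + dd ^ 2)) := by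
        refine mul_le_mul_of_nonneg_left ?_ hKb
        exact le_mul_of_one_le_right pV hsq
      rw [hX]; linarith
    have k5 : (1 + w) ^ oq / w ^ 2 ≤ 4 * (1 + w) ^ o7 := by
      have a1 : (w ^ 2)⁻¹ ≤ 4 * (1 + w) ^ (-2:ℝ) := by
        rw [Real.rpow_neg lI, Real.rpow_two, ← div_eq_mul_inv, inv_eq_one_div, div_le_div_iff₀ pV pV]
        have := pow_le_pow_left₀ lI (by linarith : 1 + w ≤ 2 * w) 2
        linarith [(by ring : (2*w)^2 = 4 * w^2)]
      calc (1 + w) ^ oq / w ^ 2 ≤ (1 + w) ^ oq * (4 * (1 + w) ^ (-2:ℝ)) := by rw [div_eq_mul_inv]; gcongr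
        _ = 4 * (1 + w) ^ (-1.75:ℝ) := by
          rw [mul_left_comm, ← Real.rpow_add lI]; norm_num
        _ ≤ _ := by
          have := Real.rpow_le_rpow_of_exponent_le (x := 1 + w) lI (show (-1.75:ℝ) ≤ -1.72 by norm_num)
          linarith
    refine k3.trans ?_
    calc (CL + CH) * X / w ^ 2 ≤ (CL + CH) * ((Kb + 3) * ((1 + w) ^ oq * (1 + dd ^ 2))) / w ^ 2 := by gcongr
      _ = (CL + CH) * (Kb + 3) * ((1 + w) ^ oq / w ^ 2) * (1 + dd ^ 2) := by ring
      _ ≤ (CL + CH) * (Kb + 3) * (4 * (1 + w) ^ o7) * (1 + dd ^ 2) := by gcongr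
      _ = 4 * ((CL + CH) * (Kb + 3)) * (1 + w) ^ o7 * (1 + dd ^ 2) := by ring
      _ ≤ _ := by gcongr; linarith [show 0 ≤ 12 * CH by positivity]
variable {ξ : ℝ → ℝ} {c : ℝ}
lemma small_pow {w : ℝ} (h0 : 0 ≤ w) (h1 : w ≤ 1) : 1/8 ≤ (1 + w) ^ o27 ∧ 1/8 ≤ (1 + w) ^ o7 := by
  have a : 1/8 ≤ (1 + w) ^ o27 := by
    calc (1/8:ℝ) = 2 ^ (-3:ℝ) := by rw [Real.rpow_neg nN]; norm_num
      _ ≤ 2 ^ o27 := Real.rpow_le_rpow_of_exponent_le nN nN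
      _ ≤ _ := Real.rpow_le_rpow_of_nonpos lI lI nN
  exact ⟨a, a.trans (Real.rpow_le_rpow_of_exponent_le lI nN)⟩
lemma sigma_bd (h : KX ξ c) {Kb : ℝ} (hKb : 0 ≤ Kb) : ∃ C : ℝ, 0 < C ∧ ∀ w y : ℝ, Dat Kb w y →
    |Ay y - c * I2 w| ≤ C * (1 + w) ^ o27 := by
  obtain ⟨C1, hC1, h1⟩ := B3 h
  have hc := h.c0
  refine ⟨8 * (1 + c) + (C1 * 4 ^ (2.72:ℝ) + c * (8 * (6 + 2 * Kb))), pV, fun w y d => ?_⟩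
  have hw := d.w0
  have hp : 0 < (1 + w) ^ o27 := pV
  obtain ⟨u0, u1, u2⟩ := I2_upper w
  obtain ⟨A0, A1⟩ := Ay_bd y
  rcases lt_or_ge w 1 with hw1 | hw1
  · have s := (small_pow hw hw1.le).1
    have : |Ay y - c * I2 w| ≤ 1 + c := by
      have b1 : 0 ≤ c * I2 w := pV
      have b2 : c * I2 w ≤ c := mul_le_of_le_one_right hc.le u1
      rw [abs_le]; constructor <;> linarith
    have e1 := mul_le_mul_of_nonneg_left s (by linarith : 0 ≤ 8 * (1 + c))
    have e2 : 0 ≤ (C1 * 4 ^ (2.72:ℝ) + c * (8 * (6 + 2 * Kb))) * (1 + w) ^ o27 := pV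
    rw [add_mul]; linarith
  · have hv := log_two_le d.y2
    have hwv := d.wv
    have hvw := d.vw
    have hB := (h1 y d.y2).1
    have hq := rpow_quarter_le hw (-2.72) nN d.v_ge
    generalize Real.log y = v at *
    have hv0 : 0 < v := lI
    have hw0 : 0 < w := lI
    have l := I2_lower hw1
    have u := u2 hw1
    generalize I2 w = I at *
    have t1 : |Ay y - c / v ^ 2| ≤ C1 * 4 ^ (2.72:ℝ) * (1 + w) ^ o27 := by
      have e : Ay y - c / v ^ 2 = (Ay y * v ^ 2 - c) / v ^ 2 := by field_simp
      rw [e, abs_div, abs_of_pos (by positivity : 0 < v ^ 2)]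
      have e2 : v ^ o72 / v ^ 2 = v ^ o27 := by
        rw [← Real.rpow_natCast v 2, ← Real.rpow_sub hv0]; norm_num
      calc |Ay y * v ^ 2 - c| / v ^ 2 ≤ C1 * v ^ o72 / v ^ 2 := by gcongr
        _ = C1 * v ^ o27 := by rw [mul_div_assoc, e2]
        _ ≤ C1 * (4 ^ (-(-2.72):ℝ) * (1 + w) ^ o27) := mul_le_mul_of_nonneg_left hq hC1.le
        _ = _ := by norm_num; ring
    have t2 : |(v ^ 2)⁻¹ - I| ≤ (6 + 2 * (v - w)) / w ^ 3 := by
      have a1 : (v ^ 2)⁻¹ ≤ (w ^ 2)⁻¹ := inv_anti₀ pV (by gcongr)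
      have a2 : (w ^ 2)⁻¹ - (v ^ 2)⁻¹ ≤ 2 * (v - w) / w ^ 3 := by
        have : (w ^ 2)⁻¹ - (v ^ 2)⁻¹ = (v - w) * ((v + w) / (w ^ 2 * v ^ 2)) := by field_simp; ring
        rw [this, mul_comm 2, mul_div_assoc]
        refine mul_le_mul_of_nonneg_left ?_ lI
        rw [div_le_div_iff₀ pV pV]
        have : (v + w) * w ≤ 2 * v ^ 2 := (mul_le_mul (by linarith : v + w ≤ 2 * v) hwv hw lI).trans (by rw [sq, mul_assoc])
        calc (v + w) * w ^ 3 = ((v + w) * w) * w ^ 2 := by ring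
          _ ≤ 2 * v ^ 2 * w ^ 2 := mul_le_mul_of_nonneg_right this pV
          _ = _ := by ring
      have a3 : 0 ≤ 2 * (v - w) / w ^ 3 := div_nonneg lI pV
      have a4 : 0 ≤ 6 / w ^ 3 := pV
      rw [add_div, abs_le]; constructor <;> linarith
    have t3 : (6 + 2 * (v - w)) / w ^ 3 ≤ 8 * (6 + 2 * Kb) * (1 + w) ^ o27 := by
      have q1 : 1 ≤ (1 + w) ^ oq := Real.one_le_rpow lI nN
      have a1 : (w ^ 3)⁻¹ ≤ 8 * (1 + w) ^ (-3:ℝ) := by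
        have e : (1 + w) ^ (-3:ℝ) = ((1 + w) ^ 3)⁻¹ := by rw [Real.rpow_neg lI]; norm_cast
        rw [e, ← div_eq_mul_inv, inv_eq_one_div, div_le_div_iff₀ pV pV]
        have := pow_le_pow_left₀ lI (by linarith : 1 + w ≤ 2 * w) 3
        linarith [(by ring : (2*w)^3 = 8 * w^3)]
      calc (6 + 2 * (v - w)) / w ^ 3 ≤ ((6 + 2 * Kb) * (1 + w) ^ oq) * (8 * (1 + w) ^ (-3:ℝ)) := by
            rw [div_eq_mul_inv]; exact mul_le_mul lI a1 pV pV
        _ = 8 * (6 + 2 * Kb) * ((1 + w) ^ oq * (1 + w) ^ (-3:ℝ)) := by ring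
        _ = 8 * (6 + 2 * Kb) * (1 + w) ^ (-2.75:ℝ) := by rw [← Real.rpow_add lI]; norm_num
        _ ≤ _ := mul_le_mul_of_nonneg_left (Real.rpow_le_rpow_of_exponent_le lI nN) pV
    have e : Ay y - c * I = (Ay y - c / v ^ 2) + c * ((v ^ 2)⁻¹ - I) := by ring
    rw [e]
    refine (abs_add_le _ _).trans ?_
    rw [abs_mul, abs_of_pos hc]
    have t4 := mul_le_mul_of_nonneg_left (t2.trans t3) hc.le
    have t5 : 0 ≤ 8 * (1 + c) * (1 + w) ^ o27 := pV
    linarith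
lemma perA (h : KX ξ c) {Kb : ℝ} (hKb : 0 ≤ Kb) : ∃ C : ℝ, 0 < C ∧ ∀ w y z : ℝ, Dat Kb w y → 2 ≤ z → w ≤ z / 2 → w + Real.log y ≤ z →
    |mu y (z - w) - Qw ξ w z - (Ay y - c * I2 w) * z| ≤ C * ((1 + w) ^ o7 + (1 + w)⁻¹ * (Real.exp (w + Real.log y - z) + Real.exp (w - z / 2))) := by
  obtain ⟨C1, hC1, h1⟩ := B3 h
  obtain ⟨C2, hC2, h2⟩ := Fpt h hKb
  obtain ⟨K, hK, hk⟩ := h.k_bd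
  have hc := h.c0
  refine ⟨(2 * C1 * 4 ^ (1.72:ℝ) + 4 * C1 + 16 * c * Kb + 16 * (K + c) + 6 * C2) + 4 * c + 4 * (K + c), pV, fun w y z d hz hwz hvz => ?_⟩
  have hw := d.w0
  have hwv := d.wv
  have hvw := d.vw
  have hv4 := d.v_ge
  obtain ⟨hB, hB'⟩ := h1 y d.y2
  have hB2 := hB' (z - w) lI
  have hq := rpow_quarter_le hw (-1.72) nN d.v_ge
  have hv := log_two_le d.y2
  have hF := fun r => h2 w y z r d hvz
  clear h1 h2 hB' d
  generalize Real.log y = v at *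
  have hv0 : 0 < v := lI
  have hp : 0 < (1 + w) ^ o7 := pV
  have hwz1 : max w 1 ≤ z / 2 := max_le hwz lI
  have hs' : 0 ≤ (z - w) / v := div_nonneg lI hv0.le
  have hk' := hk _ hs'
  generalize kap ξ c ((z - w) / v) = k' at *
  have hkc : |k' + c| ≤ K + c := (abs_add_le _ _).trans (by rw [abs_of_pos hc]; linarith)
  have hvi : v⁻¹ ≤ 4 * (1 + w)⁻¹ := by
    rw [← div_eq_mul_inv, inv_le_comm₀ hv0 pV, inv_div]; exact hv4
  have e72 : v⁻¹ * v ^ o72 = v ^ o7 := by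
    rw [← Real.rpow_neg_one, ← Real.rpow_add hv0]; norm_num
  have hq' : v ^ o7 ≤ 4 ^ (1.72:ℝ) * (1 + w) ^ o7 := by simpa using hq
  set tail := ∫ r in Set.Ioi (z / 2), Real.exp (w - r) * (r ^ 2)⁻¹ with htail
  set F : ℝ → ℝ := fun r => (-kap ξ c (z / r - 1) - c) / r - (-k' - c) / v with hFd
  have hFm : Measurable F := by
    have := h.kmeas
    have : Measurable fun r => kap ξ c (z / r - 1) := this.comp fP
    fun_prop
  have hFb : ∀ r ∈ Set.Ioc (max w 1) (z / 2), ‖Real.exp (w - r) * F r‖ ≤ C2 * (1 + w) ^ o7 * (Real.exp (w - r) * (1 + (r - w) ^ 2)) := by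
    intro r hr
    rw [norm_mul, Real.norm_eq_abs, Real.norm_eq_abs, Real.abs_exp]
    have := mul_le_mul_of_nonneg_left (hF r hr.1.le hr.2) (Real.exp_pos (w - r)).le
    linarith
  have hgi : IntervalIntegrable (fun r => C2 * (1 + w) ^ o7 * (Real.exp (w - r) * (1 + (r - w) ^ 2))) volume (max w 1) (z / 2) :=
    Continuous.intervalIntegrable fP _ _
  have hFi : IntervalIntegrable (fun r => Real.exp (w - r) * F r) volume (max w 1) (z / 2) := by
    refine hgi.mono_fun' (Measurable.aestronglyMeasurable fP) ?_
    rw [Set.uIoc_of_le hwz1]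
    exact (ae_restrict_iff' measurableSet_Ioc).mpr (ae_of_all _ hFb)
  have b5 : |∫ r in (max w 1)..(z / 2), Real.exp (w - r) * F r| ≤ 6 * C2 * (1 + w) ^ o7 := by
    have := intervalIntegral.norm_integral_le_of_norm_le hwz1 (ae_of_all _ hFb) hgi
    refine this.trans ?_
    rw [intervalIntegral.integral_const_mul, int_exp_poly]
    have a1 : 0 ≤ Real.exp (w - z / 2) * ((z / 2 - w) ^ 2 + 2 * (z / 2 - w) + 3) := by
      have : 0 ≤ z / 2 - w := lI
      positivity
    have a2 : Real.exp (w - max w 1) * ((max w 1 - w) ^ 2 + 2 * (max w 1 - w) + 3) ≤ 6 := by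
      have x0 : 0 ≤ max w 1 - w := by linarith [le_max_left w 1]
      have x1 : max w 1 - w ≤ 1 := by
        rcases max_cases w 1 with ⟨e, _⟩ | ⟨e, _⟩ <;> rw [e] <;> linarith
      have : Real.exp (w - max w 1) ≤ 1 := Real.exp_le_one_iff.mpr lI
      have y : (max w 1 - w) ^ 2 + 2 * (max w 1 - w) + 3 ≤ 6 := by linarith [pow_le_one₀ x0 x1 (n := 2)]
      calc _ ≤ 1 * 6 := mul_le_mul this y pV zero_le_one
        _ = 6 := nN
    calc _ ≤ C2 * (1 + w) ^ o7 * 6 := mul_le_mul_of_nonneg_left lI pV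
      _ = _ := by ring
  have hsplit : I2 w = (∫ r in (max w 1)..(z / 2), Real.exp (w - r) * (r ^ 2)⁻¹) + tail := by
    rw [I2, htail, intervalIntegral.integral_of_le hwz1, ← setIntegral_union (Set.Ioc_disjoint_Ioi le_rfl) measurableSet_Ioi
      ((expsq_int (le_max_right w 1)).mono_set Set.Ioc_subset_Ioi_self) (expsq_int lI), Set.Ioc_union_Ioi_eq_Ioi hwz1]
  have hQ : Qw ξ w z = c * z * (I2 w - tail) + (k' + c) / v * (Real.exp (w - max w 1) - Real.exp (w - z / 2)) - ∫ r in (max w 1)..(z / 2), Real.exp (w - r) * F r := by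
    have i1 : IntervalIntegrable (fun r => Real.exp (w - r) * (r ^ 2)⁻¹) volume (max w 1) (z / 2) :=
      (intervalIntegrable_iff_integrableOn_Ioc_of_le hwz1).mpr ((expsq_int (le_max_right w 1)).mono_set Set.Ioc_subset_Ioi_self)
    have i2 : IntervalIntegrable (fun r => Real.exp (w - r)) volume (max w 1) (z / 2) := Continuous.intervalIntegrable fP _ _
    rw [hsplit, ← int_exp_sub, ← intervalIntegral.integral_const_mul, add_sub_cancel_right, ← intervalIntegral.integral_const_mul,
      ← intervalIntegral.integral_add (i1.const_mul _) (i2.const_mul _), ← intervalIntegral.integral_sub ((i1.const_mul _).add (i2.const_mul _)) hFi, Qw]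
    refine intervalIntegral.integral_congr fun r hr => ?_
    rw [Set.uIcc_of_le hwz1] at hr
    have hr0 : 0 < r := lt_of_lt_of_le one_pos ((le_max_right w 1).trans hr.1)
    simp only [hFd, kap]
    field_simp
    ring
  have b3 : |c * z * tail| ≤ 4 * c * ((1 + w)⁻¹ * Real.exp (w - z / 2)) := by
    have := expsq_le (w := w) (by linarith : 1 ≤ z / 2)
    rw [← htail] at this
    rw [abs_of_nonneg (mul_nonneg pV this.1)]
    have hz1 : z⁻¹ ≤ (1 + w)⁻¹ := inv_anti₀ pV lI
    calc c * z * tail ≤ c * z * (Real.exp (w - z / 2) * ((z / 2) ^ 2)⁻¹) := mul_le_mul_of_nonneg_left this.2 pV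
      _ = 4 * c * (z⁻¹ * Real.exp (w - z / 2)) := by field_simp; norm_num
      _ ≤ _ := by gcongr
  have b4 : |(k' + c) / v * (1 - (Real.exp (w - max w 1) - Real.exp (w - z / 2)))| ≤ 16 * (K + c) * (1 + w) ^ o7 + 4 * (K + c) * ((1 + w)⁻¹ * Real.exp (w - z / 2)) := by
    have a1 : |1 - Real.exp (w - max w 1)| * v⁻¹ ≤ 16 * (1 + w) ^ o7 := by
      rcases le_total 1 w with h1 | h1
      · rw [max_eq_left h1]; simp; positivity
      · have s := (small_pow hw h1).2
        have a : |1 - Real.exp (w - max w 1)| ≤ 1 := by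
          have : Real.exp (w - max w 1) ≤ 1 := Real.exp_le_one_iff.mpr (by linarith [le_max_left w 1])
          rw [abs_of_nonneg lI]; linarith [Real.exp_pos (w - max w 1)]
        have b : v⁻¹ ≤ 2 := by rw [inv_le_comm₀ hv0 nN]; linarith
        calc _ ≤ 1 * o2 := mul_le_mul a b pV zero_le_one
          _ ≤ _ := lI
    have e : (k' + c) / v * (1 - (Real.exp (w - max w 1) - Real.exp (w - z / 2))) = (k' + c) * ((1 - Real.exp (w - max w 1)) * v⁻¹ + v⁻¹ * Real.exp (w - z / 2)) := by ring
    rw [e, abs_mul]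
    have a2 : |(1 - Real.exp (w - max w 1)) * v⁻¹ + v⁻¹ * Real.exp (w - z / 2)| ≤ 16 * (1 + w) ^ o7 + 4 * (1 + w)⁻¹ * Real.exp (w - z / 2) := by
      refine (abs_add_le _ _).trans (add_le_add ?_ ?_)
      · rw [abs_mul, abs_of_pos (inv_pos.mpr hv0)]; exact a1
      · rw [abs_of_pos pV]; gcongr
    calc _ ≤ (K + c) * (16 * (1 + w) ^ o7 + 4 * (1 + w)⁻¹ * Real.exp (w - z / 2)) := mul_le_mul hkc a2 (abs_nonneg _) pV
      _ = _ := by ring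
  have b1 : |mu y (z - w) - (Ay y * (z - w) + (k' + 2 * c) / v)| ≤ C1 * 4 ^ (1.72:ℝ) * (1 + w) ^ o7 + 4 * C1 * ((1 + w)⁻¹ * Real.exp (w + v - z)) := by
    have e : mu y (z - w) - (Ay y * (z - w) + (k' + 2 * c) / v) = (mu y (z - w) * v - (Ay y * (z - w) * v + k' + 2 * c)) * v⁻¹ := by field_simp; ring
    rw [e, abs_mul, abs_of_pos (inv_pos.mpr hv0)]
    have e2 : v - (z - w) = w + v - z := by ring
    rw [e2] at hB2
    calc _ ≤ C1 * (v ^ o72 + Real.exp (w + v - z)) * v⁻¹ := mul_le_mul_of_nonneg_right hB2 pV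
      _ = C1 * (v⁻¹ * v ^ o72) + C1 * (v⁻¹ * Real.exp (w + v - z)) := by ring
      _ ≤ C1 * (4 ^ (1.72:ℝ) * (1 + w) ^ o7) + C1 * (4 * (1 + w)⁻¹ * Real.exp (w + v - z)) := by rw [e72]; gcongr
      _ = _ := by ring
  have b2 : |c / v - Ay y * w| ≤ (C1 * 4 ^ (1.72:ℝ) + 16 * c * Kb) * (1 + w) ^ o7 := by
    have e : c / v - Ay y * w = -((Ay y * v ^ 2 - c) * (w / v ^ 2)) + c * ((v - w) / v ^ 2) := by field_simp; ring
    have wv1 : w / v ^ 2 ≤ v⁻¹ := by rw [sq, ← div_div, div_eq_mul_inv (w / v)]; exact mul_le_of_le_one_left pV ((div_le_one hv0).mpr hwv)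
    have x1 : |(Ay y * v ^ 2 - c) * (w / v ^ 2)| ≤ C1 * 4 ^ (1.72:ℝ) * (1 + w) ^ o7 := by
      rw [abs_mul, abs_of_nonneg (by positivity : 0 ≤ w / v ^ 2)]
      calc _ ≤ C1 * v ^ o72 * v⁻¹ := mul_le_mul hB wv1 pV pV
        _ = C1 * (v⁻¹ * v ^ o72) := by ring
        _ ≤ C1 * (4 ^ (1.72:ℝ) * (1 + w) ^ o7) := by rw [e72]; gcongr
        _ = _ := by ring
    have x2 : (v - w) / v ^ 2 ≤ 16 * Kb * (1 + w) ^ o7 := by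
      have : (v ^ 2)⁻¹ ≤ 16 * (1 + w) ^ (-2:ℝ) := by
        have := pow_le_pow_left₀ pV hvi 2
        rw [Real.rpow_neg lI, Real.rpow_two, ← inv_pow, ← inv_pow]
        linarith [(by ring : (4 * (1 + w)⁻¹) ^ 2 = 16 * (1 + w)⁻¹ ^ 2)]
      calc (v - w) / v ^ 2 ≤ Kb * (1 + w) ^ oq * (16 * (1 + w) ^ (-2:ℝ)) := by
            rw [div_eq_mul_inv]; exact mul_le_mul lI this pV pV
        _ = 16 * Kb * ((1 + w) ^ oq * (1 + w) ^ (-2:ℝ)) := by ring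
        _ = 16 * Kb * (1 + w) ^ (-1.75:ℝ) := by rw [← Real.rpow_add lI]; norm_num
        _ ≤ _ := mul_le_mul_of_nonneg_left (Real.rpow_le_rpow_of_exponent_le lI nN) pV
    rw [e]
    refine (abs_add_le _ _).trans ?_
    rw [abs_neg, abs_mul c, abs_of_pos hc, abs_of_nonneg (div_nonneg lI pV : 0 ≤ (v - w) / v ^ 2)]
    have := mul_le_mul_of_nonneg_left x2 hc.le
    linarith
  have key : mu y (z - w) - Qw ξ w z - (Ay y - c * I2 w) * z = (mu y (z - w) - (Ay y * (z - w) + (k' + 2 * c) / v)) + (c / v - Ay y * w) + c * z * tail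
      + (k' + c) / v * (1 - (Real.exp (w - max w 1) - Real.exp (w - z / 2))) + ∫ r in (max w 1)..(z / 2), Real.exp (w - r) * F r := by
    rw [hQ]; ring
  rw [key]
  have tri : ∀ a b d e f : ℝ, |a + b + d + e + f| ≤ |a| + |b| + |d| + |e| + |f| := fun a b d e f =>
    (abs_add_le _ _).trans (add_le_add_left ((abs_add_le _ _).trans (add_le_add_left (abs_add_three _ _ _) _)) _)
  refine (tri _ _ _ _ _).trans ((add_le_add (add_le_add (add_le_add (add_le_add b1 b2) b3) b4) b5).trans ?_)
  have p1 : 0 ≤ (1 + w)⁻¹ * Real.exp (w + v - z) := pV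
  have p2 : 0 ≤ (1 + w)⁻¹ * Real.exp (w - z / 2) := pV
  have h4 : o0 < 4 ^ (1.72:ℝ) := pV
  rw [mul_add (1 + w)⁻¹]
  have hqq : 0 < C1 * 4 ^ (1.72:ℝ) := pV
  have hcK : 0 ≤ c * Kb := pV
  clear b1 b2 b3 b4 b5 hFi hgi hFb hF hFm hQ hsplit tri key
  generalize (1 + w)⁻¹ * Real.exp (w + v - z) = E1 at *
  generalize (1 + w)⁻¹ * Real.exp (w - z / 2) = E2 at *
  generalize (1 + w) ^ o7 = X at *
  rw [mul_assoc 2 C1, mul_assoc 16 c]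
  generalize C1 * 4 ^ (1.72:ℝ) = q at *
  generalize c * Kb = ck at *
  have m1 := mul_le_mul_of_nonneg_right (by linarith : 2 * q + 16 * ck + 16 * (K + c) + 6 * C2 ≤ (2 * q + 4 * C1 + 16 * ck + 16 * (K + c) + 6 * C2) + 4 * c + 4 * (K + c)) hp.le
  have m2 := mul_le_mul_of_nonneg_right (by linarith : 4 * C1 ≤ (2 * q + 4 * C1 + 16 * ck + 16 * (K + c) + 6 * C2) + 4 * c + 4 * (K + c)) p1
  have m3 := mul_le_mul_of_nonneg_right (by linarith : 4 * c + 4 * (K + c) ≤ (2 * q + 4 * C1 + 16 * ck + 16 * (K + c) + 6 * C2) + 4 * c + 4 * (K + c)) p2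
  linarith
lemma perB (h : KX ξ c) {Kb : ℝ} (hKb : 0 ≤ Kb) : ∃ C : ℝ, 0 < C ∧ ∀ w y z : ℝ, Dat Kb w y → 2 ≤ z → w ≤ z / 2 → z ≤ w + Real.log y →
    |mu y (z - w) - Qw ξ w z - (Ay y - c * I2 w) * z| ≤ C * (1 + w)⁻¹ := by
  obtain ⟨C1, hC1, h1⟩ := sigma_bd h hKb
  obtain ⟨K, hK, hk⟩ := h.xi_up
  refine ⟨(4 * K + C1) * (2 + Kb), pV, fun w y z d hz hwz hvz => ?_⟩
  have hw := d.w0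
  have hvw := d.vw
  have hy := d.y2
  rw [mu_zero lI (by linarith : z - w ≤ Real.log y)]
  have hwz1 : max w 1 ≤ z / 2 := max_le hwz lI
  have hz2 : z ≤ (2 + Kb) * (1 + w) := by
    have : (1 + w) ^ oq ≤ (1 + w) := by
      calc (1 + w) ^ oq ≤ (1 + w) ^ o1 := Real.rpow_le_rpow_of_exponent_le lI nN
        _ = _ := Real.rpow_one _
    have := mul_le_mul_of_nonneg_left this hKb
    linarith
  have e2 : (1 + w) ^ (-2:ℝ) = ((1 + w) ^ 2)⁻¹ := by rw [Real.rpow_neg lI, Real.rpow_two]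
  have hI : I2 w ≤ 4 * ((1 + w) ^ 2)⁻¹ := by
    obtain ⟨_, u1, u2⟩ := I2_upper w
    rw [← div_eq_mul_inv, le_div_iff₀ pV]
    rcases le_total w 1 with h | h
    · calc I2 w * (1 + w) ^ 2 ≤ 1 * (1 + 1) ^ 2 := by gcongr
        _ = 4 := nN
    · calc I2 w * (1 + w) ^ 2 ≤ (w ^ 2)⁻¹ * (2 * w) ^ 2 := mul_le_mul (u2 h) (pow_le_pow_left₀ lI lI 2) pV pV
        _ = 4 := by field_simp; norm_num
  have hi := (expsq_int (w := w) (le_max_right w 1))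
  have hQ : |Qw ξ w z| ≤ K * z * I2 w := by
    have hi' : IntervalIntegrable (fun r => K * z * (Real.exp (w - r) * (r ^ 2)⁻¹)) volume (max w 1) (z / 2) :=
      ((intervalIntegrable_iff_integrableOn_Ioc_of_le hwz1).mpr (hi.mono_set Set.Ioc_subset_Ioi_self)).const_mul _
    have := intervalIntegral.norm_integral_le_of_norm_le (μ := volume) (f := fun r => Real.exp (w - r) * (ξ (z / r - 1) / r)) hwz1 (ae_of_all _ fun r hr => ?_) hi'
    · refine this.trans ?_
      rw [intervalIntegral.integral_const_mul, intervalIntegral.integral_of_le hwz1]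
      refine mul_le_mul_of_nonneg_left ?_ pV
      exact setIntegral_mono_set hi ((ae_restrict_iff' measurableSet_Ioi).mpr (ae_of_all _ fun r _ => by simp only [Pi.zero_apply]; positivity)) Set.Ioc_subset_Ioi_self.eventuallyLE
    · have hr0 : 0 < r := by linarith [hr.1, le_max_right w 1]
      have hs1 : 1 ≤ z / r - 1 := by rw [le_sub_iff_add_le, le_div_iff₀ hr0]; linarith [hr.2]
      have x0 := h.nonneg (z / r - 1)
      have x1 := hk _ hs1
      rw [Real.norm_eq_abs, abs_of_nonneg pV]
      have : ξ (z / r - 1) / r ≤ K * z * (r ^ 2)⁻¹ := by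
        rw [div_le_iff₀ hr0]
        have e : K * z * (r ^ 2)⁻¹ * r = K * (z / r) := by field_simp
        rw [e]
        have := mul_le_mul_of_nonneg_left (by linarith : z / r - 1 ≤ z / r) hK.le
        linarith
      calc _ ≤ Real.exp (w - r) * (K * z * (r ^ 2)⁻¹) := mul_le_mul_of_nonneg_left this (Real.exp_pos _).le
        _ = _ := by ring
  have hS : |Ay y - c * I2 w| ≤ C1 * ((1 + w) ^ 2)⁻¹ := by
    rw [← e2]
    exact (h1 w y d).trans (mul_le_mul_of_nonneg_left (Real.rpow_le_rpow_of_exponent_le lI nN) hC1.le)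
  have e : 0 - Qw ξ w z - (Ay y - c * I2 w) * z = -(Qw ξ w z + (Ay y - c * I2 w) * z) := by ring
  rw [e, abs_neg]
  refine (abs_add_le _ _).trans ?_
  rw [abs_mul, abs_of_nonneg (by linarith : 0 ≤ z)]
  calc |Qw ξ w z| + |Ay y - c * I2 w| * z ≤ K * z * (4 * ((1 + w) ^ 2)⁻¹) + C1 * ((1 + w) ^ 2)⁻¹ * z := by
        refine add_le_add (hQ.trans (mul_le_mul_of_nonneg_left hI pV)) (mul_le_mul_of_nonneg_right hS lI)
    _ = (4 * K + C1) * ((1 + w) ^ 2)⁻¹ * z := by ring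
    _ ≤ (4 * K + C1) * ((1 + w) ^ 2)⁻¹ * ((2 + Kb) * (1 + w)) := mul_le_mul_of_nonneg_left hz2 pV
    _ = _ := by field_simp
def bdf (Kb z w : ℝ) : ℝ := Real.exp (min 0 (2 * w + Kb * (1 + z) ^ oq - z) / 4)
lemma young_q {Kb t : ℝ} (ht : 1 ≤ t) : Kb * t ^ oq ≤ t / 4 + Kb ^ 2 := by
  have h1 : (t ^ oq) ^ 2 ≤ t := by
    rw [← Real.rpow_natCast, ← Real.rpow_mul lI]
    calc t ^ (1/4 * (2:ℕ):ℝ) ≤ t ^ o1 := Real.rpow_le_rpow_of_exponent_le ht nN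
      _ = t := Real.rpow_one t
  nlinarith [sq_nonneg (t ^ oq / 2 - Kb)]
lemma bdf_conv {Kb : ℝ} : ∃ C : ℝ, 0 < C ∧ ∀ w z : ℝ, 0 ≤ w → 2 ≤ z →
    (1 + w)⁻¹ * Real.exp (min 0 (2 * w + Kb * (1 + z) ^ oq - z) / 2) ≤ C * (z⁻¹ * bdf Kb z w) := by
  refine ⟨8 + 8 * Real.exp (1/16 + Kb ^ 2 / 4), pV, fun w z hw hz => ?_⟩
  have hy := young_q (Kb := Kb) (by linarith : 1 ≤ 1 + z)
  have e : Real.exp (min 0 (2 * w + Kb * (1 + z) ^ oq - z) / 2) = bdf Kb z w * bdf Kb z w := by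
    rw [bdf, ← Real.exp_add]; ring_nf
  rw [e, ← mul_assoc, ← mul_assoc]
  have b0 : 0 < bdf Kb z w := Real.exp_pos _
  refine mul_le_mul_of_nonneg_right ?_ b0.le
  have b1 : bdf Kb z w ≤ 1 := Real.exp_le_one_iff.mpr (by linarith [min_le_left 0 (2 * w + Kb * (1 + z) ^ oq - z)])
  rcases le_total (z / 8) w with h | h
  · have : (1 + w)⁻¹ ≤ 8 * z⁻¹ := by
      rw [← div_eq_mul_inv, inv_le_comm₀ pV pV, inv_div]; linarith
    calc (1 + w)⁻¹ * bdf Kb z w ≤ 8 * z⁻¹ * 1 := mul_le_mul this b1 b0.le pV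
      _ ≤ _ := by rw [mul_one]; gcongr; linarith [Real.exp_pos (1/16 + Kb ^ 2 / 4)]
  · have : bdf Kb z w ≤ Real.exp (1/16 + Kb ^ 2 / 4) * (8 * z⁻¹) := by
      have x1 : bdf Kb z w ≤ Real.exp (1/16 + Kb ^ 2 / 4) * Real.exp (- (z / 8)) := by
        rw [← Real.exp_add]
        refine Real.exp_le_exp.mpr ?_
        have := min_le_right 0 (2 * w + Kb * (1 + z) ^ oq - z)
        linarith
      have x2 : Real.exp (-(z / 8)) ≤ 8 * z⁻¹ := by
        rw [Real.exp_neg, ← div_eq_mul_inv, inv_le_comm₀ (Real.exp_pos _) pV, inv_div]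
        linarith [Real.add_one_le_exp (z / 8)]
      exact x1.trans (mul_le_mul_of_nonneg_left x2 (Real.exp_pos _).le)
    calc (1 + w)⁻¹ * bdf Kb z w ≤ 1 * bdf Kb z w := mul_le_mul_of_nonneg_right (inv_le_one_of_one_le₀ lI) b0.le
      _ ≤ Real.exp (1/16 + Kb ^ 2 / 4) * (8 * z⁻¹) := by rw [one_mul]; exact this
      _ ≤ _ := by
        have : 0 ≤ 8 * z⁻¹ := pV
        linarith
lemma perm (h : KX ξ c) {Kb : ℝ} (hKb : 0 ≤ Kb) : ∃ C : ℝ, 0 < C ∧ ∀ w y z : ℝ, Dat Kb w y → 2 ≤ z → w ≤ z / 2 →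
    |mu y (z - w) - Qw ξ w z - (Ay y - c * I2 w) * z| ≤ C * ((1 + w) ^ o7 + z⁻¹ * bdf Kb z w) := by
  obtain ⟨CA, hCA, hA⟩ := perA h hKb
  obtain ⟨CB, hCB, hB⟩ := perB h hKb
  obtain ⟨CC, hCC, hC⟩ := bdf_conv (Kb := Kb)
  refine ⟨CA + (2 * CA + CB) * CC, pV, fun w y z d hz hwz => ?_⟩
  have hw := d.w0
  have hp : 0 ≤ (1 + w) ^ o7 := pV
  have h3 := hC w z hw hz
  have hb0 : 0 ≤ z⁻¹ * bdf Kb z w := by have := (Real.exp_pos (min 0 (2 * w + Kb * (1 + z) ^ oq - z) / 4)).le; unfold bdf; positivity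
  have hmono : Kb * (1 + w) ^ oq ≤ Kb * (1 + z) ^ oq := by gcongr; linarith
  set E := (1 + w)⁻¹ * Real.exp (min 0 (2 * w + Kb * (1 + z) ^ oq - z) / 2) with hE
  have q0 : 0 ≤ (1 + w) ^ o7 * ((2 * CA + CB) * CC) := pV
  have q1 : 0 ≤ CA * (z⁻¹ * bdf Kb z w) := pV
  rcases le_total (w + Real.log y) z with hv | hv
  · refine (hA w y z d hz hwz hv).trans ?_
    have x1 : (1 + w)⁻¹ * (Real.exp (w + Real.log y - z) + Real.exp (w - z / 2)) ≤ 2 * E := by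
      have : Real.exp (w + Real.log y - z) + Real.exp (w - z / 2) ≤ 2 * Real.exp (min 0 (2 * w + Kb * (1 + z) ^ oq - z) / 2) := by
        have k1 : w + Real.log y - z ≤ min 0 (2 * w + Kb * (1 + z) ^ oq - z) / 2 := by
          have := d.vw
          have : w + Real.log y - z ≤ min 0 (2 * w + Kb * (1 + z) ^ oq - z) := le_min lI lI
          linarith
        have k2 : w - z / 2 ≤ min 0 (2 * w + Kb * (1 + z) ^ oq - z) / 2 := by
          have : 2 * (w - z / 2) ≤ min 0 (2 * w + Kb * (1 + z) ^ oq - z) := le_min lI (by linarith [mul_nonneg hKb (by positivity : 0 ≤ (1 + z) ^ oq)])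
          linarith
        linarith [Real.exp_le_exp.mpr k1, Real.exp_le_exp.mpr k2]
      calc _ ≤ (1 + w)⁻¹ * (2 * Real.exp (min 0 (2 * w + Kb * (1 + z) ^ oq - z) / 2)) := mul_le_mul_of_nonneg_left this pV
        _ = 2 * E := by rw [hE]; ring
    have x2 := mul_le_mul_of_nonneg_left (x1.trans (mul_le_mul_of_nonneg_left h3 zero_le_two)) hCA.le
    have x3 : 0 ≤ CB * CC * (z⁻¹ * bdf Kb z w) := pV
    linarith
  · refine (hB w y z d hz hwz hv).trans ?_
    have x1 : (1 + w)⁻¹ = E := by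
      have := d.vw
      rw [hE, min_eq_left lI]; simp
    rw [x1]
    have x2 := mul_le_mul_of_nonneg_left h3 hCB.le
    have x3 : 0 ≤ 2 * CA * CC * (z⁻¹ * bdf Kb z w) := pV
    have x4 : 0 ≤ CA * (1 + w) ^ o7 := pV
    linarith
variable {ξ : ℝ → ℝ} {c : ℝ} {θ : ℕ → ℝ}
lemma abel1 (c : ℕ → ℝ) {g : ℝ → ℝ} (hg : Continuous g) {z : ℝ} (hz : 1 ≤ z) :
    ∫ t in o1..z, g t * SM c t = ∑ n ∈ Finset.Icc 1 ⌊Real.exp z⌋₊, c n * ∫ t in (max (Real.log n) 1)..z, g t := by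
  have gi : ∀ a b, IntervalIntegrable g volume a b := fun a b => hg.intervalIntegrable a b
  rw [← intervalIntegral.integral_interval_sub_left (SM_ii c hg 0 z) (SM_ii c hg 0 1), abelLog c hg lI, abelLog c hg zero_le_one]
  have := SM_eq (fun n => c n * ∫ t in (Real.log n)..1, g t) hz
  rw [SM] at this
  rw [this, ← Finset.sum_sub_distrib]
  refine Finset.sum_congr rfl fun n _ => ?_
  split_ifs with h
  · rw [max_eq_right h, ← mul_sub, intervalIntegral.integral_interval_sub_left (gi _ _) (gi _ _)]
  · rw [max_eq_left (le_of_not_ge h), sub_zero]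
lemma GG_ii {g : ℝ → ℝ} (hg : Continuous g) (a b : ℝ) : IntervalIntegrable (fun t => g t * GG θ t) volume a b := by
  have := SM_ii (am θ) (g := fun t => g t * Real.exp (-t)) fP a b
  simpa only [GG, mul_assoc] using this
lemma Qsum (h : KX ξ c) {z : ℝ} (hz : 2 ≤ z) : ∑ m ∈ Finset.Icc 1 ⌊Real.exp (z / 2)⌋₊, am θ m / m * Qw ξ (Real.log m) z =
    ∫ r in o1..(z / 2), ξ (z / r - 1) / r * GG θ r := by
  set g : ℝ → ℝ := fun r => Real.exp (-r) * (ξ (max 1 (z / max r 1 - 1)) / max r 1) with hg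
  have hm0 : ∀ r : ℝ, max r 1 ≠ 0 := fun r => (lt_of_lt_of_le one_pos (le_max_right r 1)).ne'
  have hgc : Continuous g := by
    have h1 : Continuous fun r : ℝ => max 1 (z / max r 1 - 1) := continuous_const.max (((continuous_const.div (continuous_id.max continuous_const) hm0)).sub continuous_const)
    exact (Real.continuous_exp.comp continuous_neg).mul ((h.cont.comp_continuous h1 fun r => Set.mem_Ici.mpr (le_max_left _ _)).div (continuous_id.max continuous_const) hm0)
  have hgr : ∀ r, 1 ≤ r → r ≤ z / 2 → g r = Real.exp (-r) * (ξ (z / r - 1) / r) := fun r h1 h2 => by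
    have : 1 ≤ z / r - 1 := by rw [le_sub_iff_add_le, le_div_iff₀ lI]; linarith
    simp only [hg]; rw [max_eq_left h1, max_eq_right this]
  have h1 := abel1 (am θ) hgc (by linarith : 1 ≤ z / 2)
  have h2 : ∫ r in o1..(z / 2), ξ (z / r - 1) / r * GG θ r = ∫ t in o1..(z / 2), g t * SM (am θ) t := by
    refine intervalIntegral.integral_congr fun r hr => ?_
    rw [Set.uIcc_of_le lI] at hr
    simp only [hgr r hr.1 hr.2, GG]; ring
  rw [h2, h1]
  refine Finset.sum_congr rfl fun m hm => ?_
  have hm' := Finset.mem_Icc.mp hm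
  have hm0 : o0 < m := by exact_mod_cast hm'.1
  have hw : Real.log m ≤ z / 2 := by
    rw [Real.log_le_iff_le_exp hm0]; exact (Nat.le_floor_iff (Real.exp_pos _).le).mp hm'.2
  rw [div_mul_eq_mul_div, mul_div_assoc, Qw]
  congr 1
  rw [div_eq_mul_inv, mul_comm, ← intervalIntegral.integral_const_mul]
  refine intervalIntegral.integral_congr fun r hr => ?_
  rw [Set.uIcc_of_le (max_le hw lI)] at hr
  rw [hgr r ((le_max_right _ _).trans hr.1) hr.2, sub_eq_add_neg (Real.log m), Real.exp_add, Real.exp_log hm0]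
  field_simp
lemma blk {φ ψ : ℝ → ℝ} (hψ : Continuous ψ) (hψ0 : ∀ r, 0 ≤ ψ r) (hφ : ∀ w r, 0 ≤ w → w ≤ r → r ≤ w + 1 → φ w ≤ ψ r) {R : ℝ} (hR : 1 ≤ R) :
    ∑ m ∈ Finset.Icc 1 ⌊Real.exp (R - 1)⌋₊, am θ m / m * φ (Real.log m) ≤ Real.exp 1 * ∫ r in o0..R, ψ r * GG θ r := by
  set g : ℝ → ℝ := fun r => ψ r * Real.exp (-r) with hg
  have hgc : Continuous g := fP
  have hg0 : ∀ r, 0 ≤ g r := fun r => mul_nonneg (hψ0 r) (Real.exp_pos _).le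
  have e1 : ∫ r in o0..R, ψ r * GG θ r = ∫ r in o0..R, g r * SM (am θ) r := by
    simp only [hg, GG, mul_assoc]
  have hl : ∀ n ∈ Finset.Icc 1 ⌊Real.exp R⌋₊, Real.log n ≤ R := fun n hn => by
    rw [Real.log_le_iff_le_exp (by exact_mod_cast (Finset.mem_Icc.mp hn).1)]
    exact (Nat.le_floor_iff (Real.exp_pos _).le).mp (Finset.mem_Icc.mp hn).2
  rw [e1, abelLog (am θ) hgc lI, Finset.mul_sum]
  have hsub : Finset.Icc 1 ⌊Real.exp (R - 1)⌋₊ ⊆ Finset.Icc 1 ⌊Real.exp R⌋₊ :=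
    Finset.Icc_subset_Icc_right (Nat.floor_le_floor (Real.exp_le_exp.mpr lI))
  refine le_trans ?_ (Finset.sum_le_sum_of_subset_of_nonneg hsub fun n hn _ => mul_nonneg (Real.exp_pos _).le (mul_nonneg (am_nonneg θ n) (intervalIntegral.integral_nonneg (hl n hn) fun r _ => hg0 r)))
  refine Finset.sum_le_sum fun n hn => ?_
  have hn' := Finset.mem_Icc.mp hn
  have hn0 : o0 < n := by exact_mod_cast hn'.1
  have hw0 : 0 ≤ Real.log n := Real.log_natCast_nonneg n
  have hw1 : Real.log n ≤ R - 1 := by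
    rw [Real.log_le_iff_le_exp hn0]; exact (Nat.le_floor_iff (Real.exp_pos _).le).mp hn'.2
  have k : φ (Real.log n) * Real.exp (-(Real.log n + 1)) ≤ ∫ t in (Real.log n)..R, g t := by
    by_cases hneg : φ (Real.log n) < 0
    · exact (mul_nonpos_of_nonpos_of_nonneg hneg.le (Real.exp_pos _).le).trans (intervalIntegral.integral_nonneg lI fun r _ => hg0 r)
    push Not at hneg
    rw [← intervalIntegral.integral_add_adjacent_intervals (hgc.intervalIntegrable _ (Real.log n + 1)) (hgc.intervalIntegrable _ _)]
    have a1 : 0 ≤ ∫ t in (Real.log n + 1)..R, g t := intervalIntegral.integral_nonneg lI fun r _ => hg0 r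
    have a2 : ∫ t in (Real.log n)..(Real.log n + 1), φ (Real.log n) * Real.exp (-(Real.log n + 1)) ≤ ∫ t in (Real.log n)..(Real.log n + 1), g t := by
      refine intervalIntegral.integral_mono_on lI sI (hgc.intervalIntegrable _ _) fun r hr => ?_
      exact mul_le_mul (hφ _ r hw0 hr.1 hr.2) (Real.exp_le_exp.mpr (by linarith [hr.2])) (Real.exp_pos _).le (hψ0 r)
    rw [intervalIntegral.integral_const, smul_eq_mul, add_sub_cancel_left, one_mul] at a2
    linarith
  have e3 : Real.exp (-(Real.log n + 1)) = (n:ℝ)⁻¹ * (Real.exp 1)⁻¹ := by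
    rw [neg_add, Real.exp_add, Real.exp_neg, Real.exp_neg, Real.exp_log hn0]
  rw [e3] at k
  calc am θ n / n * φ (Real.log n) = Real.exp 1 * (am θ n * (φ (Real.log n) * ((n:ℝ)⁻¹ * (Real.exp 1)⁻¹))) := by field_simp
    _ ≤ _ := mul_le_mul_of_nonneg_left (mul_le_mul_of_nonneg_left k (am_nonneg θ n)) (Real.exp_pos _).le
lemma wt_summable {β p CG : ℝ} (hp : β + 1 < p) (hβ : 0 ≤ β) (hCG : 0 ≤ CG) (hG : ∀ r, 0 ≤ r → GG θ r ≤ CG * (1 + r) ^ β) :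
    Summable fun m : ℕ => am θ m / m * (1 + Real.log m) ^ (-p) := by
  have hnn : ∀ m : ℕ, 0 ≤ am θ m / m * (1 + Real.log m) ^ (-p) := fun m => by
    have := am_nonneg θ m
    have := Real.log_natCast_nonneg m
    positivity
  have hψc : Continuous fun r : ℝ => o2 ^ p * (1 + |r|) ^ (-p) :=
    continuous_const.mul (Continuous.rpow_const fP fun r => Or.inl pV)
  refine summable_of_sum_range_le (c := Real.exp 1 * (2 ^ p * (CG * (p - β - 1)⁻¹))) hnn fun N => ?_
  obtain ⟨R, hR⟩ : ∃ R : ℝ, R = Real.log (N + 1) + 1 := ⟨_, rfl⟩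
  have hR1 : 1 ≤ R := by rw [hR]; linarith [Real.log_nonneg (by linarith [Nat.cast_nonneg (α := ℝ) N] : o1 ≤ N + 1)]
  have hbl := blk (θ := θ) (φ := fun w => (1 + w) ^ (-p)) hψc (fun r => pV) (fun w r h0 h1 h2 => by
    have : o2 ^ p * (1 + |r|) ^ (-p) = ((1 + r) / 2) ^ (-p) := by
      rw [Real.div_rpow lI nN, Real.rpow_neg (x := 2) nN, abs_of_nonneg (h0.trans h1)]
      field_simp
    rw [this]
    exact Real.rpow_le_rpow_of_nonpos lI lI lI) hR1
  have hfl : ⌊Real.exp (R - 1)⌋₊ = N + 1 := by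
    rw [hR, add_sub_cancel_right, Real.exp_log pV]; exact_mod_cast Nat.floor_natCast (N + 1)
  rw [hfl] at hbl
  have s1 : ∑ i ∈ Finset.range N, am θ i / i * (1 + Real.log i) ^ (-p) ≤ ∑ m ∈ Finset.Icc 1 (N + 1), am θ m / m * (1 + Real.log m) ^ (-p) := by
    rw [← Finset.sum_filter_ne_zero]
    refine Finset.sum_le_sum_of_subset_of_nonneg (fun i hi => ?_) fun m _ _ => hnn m
    obtain ⟨h1, h2⟩ := Finset.mem_filter.mp hi
    have h3 : i ≠ 0 := fun h => h2 (by simp [h])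
    have := Finset.mem_range.mp h1
    exact Finset.mem_Icc.mpr ⟨oM, oM⟩
  refine s1.trans (hbl.trans (mul_le_mul_of_nonneg_left ?_ (Real.exp_pos _).le))
  have hu : ContinuousOn (fun r : ℝ => 2 ^ p * (CG * (1 + r) ^ (β - p))) (Set.uIcc 0 R) := by
    rw [Set.uIcc_of_le lI]
    refine continuousOn_const.mul (continuousOn_const.mul (ContinuousOn.rpow_const fP fun r hr => Or.inl ?_))
    have := hr.1; positivity
  have m1 : ∫ r in o0..R, 2 ^ p * (1 + |r|) ^ (-p) * GG θ r ≤ ∫ r in o0..R, 2 ^ p * (CG * (1 + r) ^ (β - p)) := by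
    refine intervalIntegral.integral_mono_on lI (GG_ii hψc 0 R) hu.intervalIntegrable fun r hr => ?_
    have hr1 : 0 < 1 + r := by linarith [hr.1]
    rw [abs_of_nonneg hr.1, mul_assoc]
    refine mul_le_mul_of_nonneg_left ?_ pV
    calc (1 + r) ^ (-p) * GG θ r ≤ (1 + r) ^ (-p) * (CG * (1 + r) ^ β) := mul_le_mul_of_nonneg_left (hG r hr.1) pV
      _ = CG * ((1 + r) ^ β * (1 + r) ^ (-p)) := by ring
      _ = _ := by rw [← Real.rpow_add hr1, ← sub_eq_add_neg]
  refine m1.trans ?_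
  rw [intervalIntegral.integral_const_mul, intervalIntegral.integral_const_mul]
  refine mul_le_mul_of_nonneg_left (mul_le_mul_of_nonneg_left ?_ hCG) pV
  rw [intervalIntegral.integral_comp_add_left (fun t => t ^ (β - p)), integral_rpow (Or.inr ⟨lI, by rw [Set.uIcc_of_le lI]; intro h; linarith [h.1]⟩)]
  have e : ((1 + R) ^ (β - p + 1) - (1 + 0) ^ (β - p + 1)) / (β - p + 1) = (1 - (1 + R) ^ (β - p + 1)) * (p - β - 1)⁻¹ := by
    rw [add_zero, Real.one_rpow, ← neg_div_neg_eq, div_eq_mul_inv]; ring_nf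
  rw [e]
  refine mul_le_of_le_one_left (inv_nonneg.mpr lI) ?_
  have : 0 ≤ (1 + R) ^ (β - p + 1) := pV
  linarith
lemma bdf_sum {Kb β CG : ℝ} (hKb : 0 ≤ Kb) (hβ : 0 ≤ β) (hβ1 : β ≤ 1) (hCG : 0 ≤ CG) (hG : ∀ r, 0 ≤ r → GG θ r ≤ CG * (1 + r) ^ β) :
    ∃ C : ℝ, 0 < C ∧ ∀ z, 2 ≤ z → ∑ m ∈ Finset.Icc 1 ⌊Real.exp (z / 2)⌋₊, am θ m / m * bdf Kb z (Real.log m) ≤ C * z ^ (β + 1 / 4) := by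
  refine ⟨Real.exp 1 * ((CG * 4) * (2 * (4 + 2 * (Kb + 1)))) + 1, pV, fun z hz => ?_⟩
  have hz0 : 0 < z := lI
  obtain ⟨X, hX⟩ : ∃ X, X = (1 + z) ^ oq := ⟨_, rfl⟩
  have hX1 : 1 ≤ X := by rw [hX]; exact Real.one_le_rpow lI nN
  have hX2 : X ≤ 2 * z ^ oq := by
    rw [hX]
    calc (1 + z) ^ oq ≤ (2 * z) ^ oq := by gcongr; linarith
      _ = 2 ^ oq * z ^ oq := Real.mul_rpow nN hz0.le
      _ ≤ _ := by
        gcongr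
        calc o2 ^ oq ≤ 2 ^ o1 := Real.rpow_le_rpow_of_exponent_le nN nN
          _ = 2 := Real.rpow_one 2
  set R := z / 2 + 1 with hR
  set b := (z - Kb * X) / 2 with hb
  have hbc : Continuous (bdf Kb z) := by unfold bdf; fun_prop
  have hbl := blk (θ := θ) (φ := bdf Kb z) hbc (fun r => (Real.exp_pos _).le) (fun w r _ h1 _ => by
    unfold bdf
    refine Real.exp_le_exp.mpr (div_le_div_of_nonneg_right (min_le_min le_rfl lI) nN)) (by linarith : 1 ≤ R)
  rw [hR, add_sub_cancel_right, ← hR] at hbl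
  refine hbl.trans ?_
  have hpt : ∀ r, bdf Kb z r ≤ 2 * (Real.exp ((r - b) / 2) / (1 + Real.exp ((r - b) / 2))) := by
    intro r
    have e : (2 * r + Kb * (1 + z) ^ oq - z) / 4 = (r - b) / 2 := by rw [hb, hX]; ring
    have hE := Real.exp_pos ((r - b) / 2)
    rw [← mul_div_assoc, le_div_iff₀ pV]
    rcases le_total ((r - b) / 2) 0 with h | h
    · have : bdf Kb z r ≤ Real.exp ((r - b) / 2) := by
        unfold bdf; rw [← e]
        exact Real.exp_le_exp.mpr (div_le_div_of_nonneg_right (min_le_right _ _) nN)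
      calc _ ≤ Real.exp ((r - b) / 2) * (1 + 1) := mul_le_mul this (by linarith [Real.exp_le_one_iff.mpr h]) pV hE.le
        _ = _ := by ring
    · have : bdf Kb z r ≤ 1 := Real.exp_le_one_iff.mpr (by linarith [min_le_left 0 (2 * r + Kb * (1 + z) ^ oq - z)])
      calc _ ≤ 1 * (1 + Real.exp ((r - b) / 2)) := mul_le_mul_of_nonneg_right this pV
        _ ≤ _ := by linarith [Real.one_le_exp h]
  have hsc : Continuous fun r : ℝ => Real.exp ((r - b) / 2) / (1 + Real.exp ((r - b) / 2)) :=
    Continuous.div fP fP fun r => pV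
  have hint : ∫ r in o0..R, Real.exp ((r - b) / 2) / (1 + Real.exp ((r - b) / 2)) ≤ 2 + 2 * (Kb * X / 2 + 1) := by
    have hd : ∀ r : ℝ, HasDerivAt (fun r => 2 * Real.log (1 + Real.exp ((r - b) / 2))) (Real.exp ((r - b) / 2) / (1 + Real.exp ((r - b) / 2))) r := by
      intro r
      have h1 := (((hasDerivAt_id r).sub_const b).div_const 2).exp.const_add 1
      have h2 := (h1.log (by simp only [id]; positivity)).const_mul 2
      refine h2.congr_deriv ?_
      simp only [id]; ring
    rw [intervalIntegral.integral_eq_sub_of_hasDerivAt (fun r _ => hd r) (hsc.intervalIntegrable _ _)]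
    have l0 : 0 ≤ Real.log (1 + Real.exp ((0 - b) / 2)) := Real.log_nonneg (by linarith [Real.exp_pos ((0 - b) / 2)])
    have hRb : (R - b) / 2 = (Kb * X / 2 + 1) / 2 := by rw [hR, hb]; ring
    have l1 : Real.log (1 + Real.exp ((R - b) / 2)) ≤ 1 + (Kb * X / 2 + 1) / 2 := by
      rw [hRb]
      have : 0 ≤ (Kb * X / 2 + 1) / 2 := pV
      have l := Real.one_le_exp this
      calc Real.log (1 + Real.exp ((Kb * X / 2 + 1) / 2)) ≤ Real.log (Real.exp 1 * Real.exp ((Kb * X / 2 + 1) / 2)) := by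
            refine Real.log_le_log pV ?_
            have := mul_le_mul_of_nonneg_right (by linarith [Real.add_one_le_exp 1] : 2 ≤ Real.exp 1) (Real.exp_pos ((Kb * X / 2 + 1) / 2)).le
            linarith
        _ = _ := by rw [← Real.exp_add, Real.log_exp]
    linarith [mul_nonneg hKb (by linarith : 0 ≤ X)]
  have hGR : ∀ r, 0 ≤ r → r ≤ R → GG θ r ≤ CG * 4 * z ^ β := by
    intro r h0 h1
    refine (hG r h0).trans ?_
    rw [mul_assoc]
    refine mul_le_mul_of_nonneg_left ?_ hCG
    calc (1 + r) ^ β ≤ (4 * z) ^ β := Real.rpow_le_rpow lI (by rw [hR] at h1; linarith) hβ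
      _ = 4 ^ β * z ^ β := Real.mul_rpow nN hz0.le
      _ ≤ _ := by
        gcongr
        calc (4:ℝ) ^ β ≤ 4 ^ o1 := Real.rpow_le_rpow_of_exponent_le nN hβ1
          _ = 4 := Real.rpow_one 4
  have m1 : ∫ r in o0..R, bdf Kb z r * GG θ r ≤ ∫ r in o0..R, CG * 4 * z ^ β * (2 * (Real.exp ((r - b) / 2) / (1 + Real.exp ((r - b) / 2)))) := by
    refine intervalIntegral.integral_mono_on lI (GG_ii hbc 0 R) ((hsc.const_smul o2).const_smul (CG * 4 * z ^ β) |>.intervalIntegrable 0 R) fun r hr => ?_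
    rw [mul_comm]
    exact mul_le_mul (hGR r hr.1 hr.2) (hpt r) (Real.exp_pos _).le pV
  rw [intervalIntegral.integral_const_mul, intervalIntegral.integral_const_mul] at m1
  have hf : 2 + 2 * (Kb * X / 2 + 1) ≤ (4 + 2 * (Kb + 1)) * z ^ oq := by
    have z1 : 1 ≤ z ^ oq := Real.one_le_rpow lI nN
    have := mul_le_mul_of_nonneg_left hX2 hKb
    linarith
  calc _ ≤ Real.exp 1 * (CG * 4 * z ^ β * (2 * ((4 + 2 * (Kb + 1)) * z ^ oq))) := by
        refine mul_le_mul_of_nonneg_left (m1.trans ?_) (Real.exp_pos _).le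
        exact mul_le_mul_of_nonneg_left (mul_le_mul_of_nonneg_left (hint.trans hf) zero_le_two) pV
    _ = Real.exp 1 * ((CG * 4) * (2 * (4 + 2 * (Kb + 1)))) * (z ^ β * z ^ oq) := by ring
    _ ≤ _ := by
      rw [← Real.rpow_add hz0]
      exact mul_le_mul_of_nonneg_right lI pV
variable {ξ : ℝ → ℝ} {c : ℝ} {θ : ℕ → ℝ}
lemma hasSum_ite_mem (F : Finset ℕ) (g : ℕ → ℝ) : HasSum (fun m => if m ∈ F then g m else 0) (∑ m ∈ F, g m) := by
  have := hasSum_sum_of_ne_finset_zero (L := SummationFilter.unconditional ℕ) (f := fun m => if m ∈ F then g m else 0) (s := F) (fun m hm => if_neg hm)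
  rwa [Finset.sum_congr rfl fun m hm => if_pos hm] at this
lemma int_half (h : KX ξ c) {z : ℝ} (hz : 2 ≤ z) (f : ℝ → ℝ) : ∫ r in o1..z, ξ (z / r - 1) / r * f r = ∫ r in o1..(z / 2), ξ (z / r - 1) / r * f r := by
  rw [intervalIntegral.integral_of_le lI, intervalIntegral.integral_of_le lI]
  refine setIntegral_eq_of_subset_of_forall_sdiff_eq_zero measurableSet_Ioc (Set.Ioc_subset_Ioc_right lI) fun r hr => ?_
  have h1 : 1 < r := hr.1.1
  have h2 : z / 2 < r := by
    by_contra hc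
    exact hr.2 ⟨h1, lI⟩
  rw [h.z _ (by rw [sub_lt_iff_lt_add, div_lt_iff₀ lI]; linarith)]; simp
lemma Renew (h : KX ξ c) (hθ : ∀ n : ℕ, 1 ≤ n → ((max 2 n : ℕ) : ℝ) ≤ θ n) {Kb : ℝ} (hKb : 0 ≤ Kb)
    (hD : ∀ m : ℕ, 1 ≤ m → Dat Kb (Real.log m) (θ m)) {β κ CG : ℝ} (hβ : 0 ≤ β) (hβ1 : β ≤ 1) (hκ : 0 ≤ κ) (hκ1 : κ ≤ 1)
    (hp : β + 1 < 1.72 + κ) (hbκ : β - 3 / 4 ≤ κ) (hCG : 0 ≤ CG) (hG : ∀ r, 0 ≤ r → GG θ r ≤ CG * (1 + r) ^ β) :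
    ∃ α C : ℝ, 0 < C ∧ ∀ z, 1 ≤ z → |GG θ z + (∫ r in o1..z, ξ (z / r - 1) / r * GG θ r) - α * z| ≤ C * z ^ κ := by
  obtain ⟨C1, hC1, h1⟩ := perm h hKb
  obtain ⟨C2, hC2, h2⟩ := sigma_bd h hKb
  obtain ⟨C3, hC3, h3⟩ := bdf_sum hKb hβ hβ1 hCG hG
  obtain ⟨p, hpd⟩ : ∃ p, p = 1.72 + κ := ⟨_, rfl⟩
  have hsum := wt_summable (p := p) lI hβ hCG hG
  set b : ℕ → ℝ := fun m => am θ m / m * (1 + Real.log m) ^ (-p) with hb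
  set wt : ℕ → ℝ := fun m => am θ m / m with hwt
  have hwt0 : ∀ m, 0 ≤ wt m := fun m => div_nonneg (am_nonneg θ m) (Nat.cast_nonneg m)
  have hb0 : ∀ m, 0 ≤ b m := fun m => mul_nonneg (hwt0 m) (by have := Real.log_natCast_nonneg m; positivity)
  set σ : ℕ → ℝ := fun m => Ay (θ m) - c * I2 (Real.log m) with hσ
  have hwσ : Summable fun m => wt m * σ m := by
    refine Summable.of_norm_bounded (hsum.mul_left C2) fun m => ?_
    rcases Nat.eq_zero_or_pos m with rfl | hm
    · simp [hwt, hb]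
    have hw := Real.log_natCast_nonneg m
    rw [Real.norm_eq_abs, abs_mul, abs_of_nonneg (hwt0 m)]
    calc wt m * |σ m| ≤ wt m * (C2 * (1 + Real.log m) ^ o27) := mul_le_mul_of_nonneg_left (h2 _ _ (hD m hm)) (hwt0 m)
      _ ≤ wt m * (C2 * (1 + Real.log m) ^ (-p)) := by
        refine mul_le_mul_of_nonneg_left (mul_le_mul_of_nonneg_left ?_ hC2.le) (hwt0 m)
        exact Real.rpow_le_rpow_of_exponent_le lI lI
      _ = _ := by simp only [hb, hwt]; ring
  obtain ⟨α, hα⟩ := hwσ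
  obtain ⟨B, hB⟩ := hsum
  have hB0 : 0 ≤ B := hB.nonneg hb0
  have hC0 := C0_bd
  refine ⟨1 - α, ((C1 + 2 * C2) * B + C1 * C3 + 31) + (CG * 3 + 2 * |1 - α|), pV, fun z hz => ?_⟩
  have hz0 : 0 < z := lI
  have hzκ : 1 ≤ z ^ κ := Real.one_le_rpow hz hκ
  rcases lt_or_ge z 2 with hz2 | hz2
  · have e0 : ∫ r in o1..z, ξ (z / r - 1) / r * GG θ r = 0 := by
      rw [intervalIntegral.integral_of_le hz]
      refine setIntegral_eq_zero_of_forall_eq_zero fun r hr => ?_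
      have hr1 := hr.1
      rw [h.z _ (by rw [sub_lt_iff_lt_add, div_lt_iff₀ lI]; linarith)]; simp
    have g1 : GG θ z ≤ CG * 3 := by
      refine (hG z hz0.le).trans (mul_le_mul_of_nonneg_left ?_ hCG)
      calc (1 + z) ^ β ≤ (1 + z) ^ o1 := Real.rpow_le_rpow_of_exponent_le lI hβ1
        _ ≤ 3 := by rw [Real.rpow_one]; linarith
    have g0 := GG_nonneg θ z
    have t0 : |GG θ z - (1 - α) * z| ≤ CG * 3 + 2 * |1 - α| := by
      refine (abs_sub _ _).trans ?_
      rw [abs_mul, abs_of_nonneg g0, abs_of_pos hz0]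
      have := mul_le_mul_of_nonneg_left hz2.le (abs_nonneg (1 - α))
      linarith
    rw [e0, add_zero]
    have n1 : 0 ≤ (C1 + 2 * C2) * B + C1 * C3 + 31 := pV
    refine t0.trans ((le_mul_of_one_le_right pV hzκ).trans ?_)
    exact mul_le_mul_of_nonneg_right lI pV
  set F := Finset.Icc 1 ⌊Real.exp (z / 2)⌋₊ with hF
  have hFl : ∀ m : ℕ, 1 ≤ m → (m ∈ F ↔ Real.log m ≤ z / 2) := fun m hm => by
    rw [hF, Finset.mem_Icc, Nat.le_floor_iff (Real.exp_pos _).le, Real.log_le_iff_le_exp (by exact_mod_cast hm)]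
    exact ⟨fun h => h.2, fun h => ⟨hm, h⟩⟩
  have hM := Main0 hθ hz0.le
  have eS : ∑ m ∈ Finset.Icc 1 ⌊Real.exp z⌋₊, am θ m / m * mu (θ m) (z - Real.log m) = ∑ m ∈ F, wt m * mu (θ m) (z - Real.log m) := by
    refine (Finset.sum_subset (Finset.Icc_subset_Icc_right (Nat.floor_le_floor (Real.exp_le_exp.mpr lI))) fun m hm hmF => ?_).symm
    have hm1 := (Finset.mem_Icc.mp hm).1
    rw [hFl m hm1] at hmF
    have d := hD m hm1
    rw [mu_zero (by linarith [d.y2]) (by linarith [d.wv]), mul_zero]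
  rw [eS] at hM
  rw [int_half h hz2, ← Qsum h hz2]
  have hs := ((hasSum_ite_mem F fun m => wt m * mu (θ m) (z - Real.log m)).sub (hasSum_ite_mem F fun m => wt m * Qw ξ (Real.log m) z)).sub (hα.mul_right z)
  have hg := (hB.mul_left ((C1 + 2 * C2) * z ^ κ)).add (hasSum_ite_mem F fun m => C1 * z⁻¹ * (wt m * bdf Kb z (Real.log m)))
  have hbd := tsum_of_norm_bounded hg (f := fun m => ((if m ∈ F then wt m * mu (θ m) (z - Real.log m) else 0) - (if m ∈ F then wt m * Qw ξ (Real.log m) z else 0)) - wt m * σ m * z) fun m => ?_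
  · rw [hs.tsum_eq, Real.norm_eq_abs, ← Finset.mul_sum] at hbd
    have hb2 : C1 * z⁻¹ * ∑ m ∈ F, wt m * bdf Kb z (Real.log m) ≤ C1 * C3 * z ^ κ := by
      calc _ ≤ C1 * z⁻¹ * (C3 * z ^ (β + 1/4)) := mul_le_mul_of_nonneg_left (h3 z hz2) pV
        _ = C1 * C3 * (z ^ (-1:ℝ) * z ^ (β + 1/4)) := by rw [Real.rpow_neg_one]; ring
        _ ≤ _ := by
          rw [← Real.rpow_add hz0]
          exact mul_le_mul_of_nonneg_left (Real.rpow_le_rpow_of_exponent_le hz lI) pV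
    have he : Real.exp (-z / 2) ≤ 1 := Real.exp_le_one_iff.mpr lI
    have n2 : 0 ≤ (CG * 3 + 2 * |1 - α|) * z ^ κ := pV
    rw [abs_le] at hM hbd ⊢
    constructor <;> linarith [hM.1, hM.2, hbd.1, hbd.2, hC0.1, hC0.2]
  rcases Nat.eq_zero_or_pos m with rfl | hm
  · simp [hwt, hb, hF]
  have d := hD m hm
  have hw := d.w0
  generalize hlw : Real.log m = w at *
  have hwm := hwt0 m
  have hbm : b m = wt m * (1 + w) ^ (-p) := by simp only [hb, hwt, hlw]
  have hP : 0 < (1 + w) ^ (-p) := pV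
  by_cases hmF : m ∈ F
  · simp only [if_pos hmF]
    have hw2 := (hFl m hm).mp hmF
    rw [hlw] at hw2
    have x := h1 w (θ m) z d hz2 hw2
    have e : wt m * mu (θ m) (z - w) - wt m * Qw ξ w z - wt m * σ m * z = wt m * (mu (θ m) (z - w) - Qw ξ w z - (Ay (θ m) - c * I2 w) * z) := by
      simp only [hσ, hlw]; ring
    rw [e, Real.norm_eq_abs, abs_mul, abs_of_nonneg hwm, hbm]
    have y1 : (1 + w) ^ o7 ≤ z ^ κ * (1 + w) ^ (-p) := by
      have : (1 + w) ^ o7 = (1 + w) ^ κ * (1 + w) ^ (-p) := by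
        rw [← Real.rpow_add lI]; congr 1; rw [hpd]; ring
      rw [this]
      exact mul_le_mul_of_nonneg_right (Real.rpow_le_rpow lI lI hκ) hP.le
    have y2 := mul_le_mul_of_nonneg_left (x.trans (mul_le_mul_of_nonneg_left (add_le_add_left y1 _) hC1.le)) hwm
    have y3 : 0 ≤ 2 * C2 * z ^ κ * (wt m * (1 + w) ^ (-p)) := pV
    refine y2.trans ?_
    linarith
  · simp only [if_neg hmF, sub_zero, zero_sub, add_zero, norm_neg]
    have hw2 : z / 2 < w := by rw [← hlw]; exact lt_of_not_ge fun hh => hmF ((hFl m hm).mpr hh)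
    have x := h2 w (θ m) d
    rw [Real.norm_eq_abs, abs_mul, abs_mul, abs_of_nonneg hwm, abs_of_pos hz0, hbm]
    have y1 : (1 + w) ^ o27 * z ≤ 2 * z ^ κ * (1 + w) ^ (-p) := by
      have : (1 + w) ^ o27 = (1 + w) ^ (κ - 1) * (1 + w) ^ (-p) := by
        rw [← Real.rpow_add lI]; congr 1; rw [hpd]; ring
      rw [this, mul_right_comm]
      refine mul_le_mul_of_nonneg_right ?_ hP.le
      calc (1 + w) ^ (κ - 1) * z ≤ (z / 2) ^ (κ - 1) * z := mul_le_mul_of_nonneg_right (Real.rpow_le_rpow_of_nonpos pV lI lI) hz0.le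
        _ = 2 * ((z / 2) ^ (κ - 1) * (z / 2) ^ o1) := by rw [Real.rpow_one]; ring
        _ = 2 * (z / 2) ^ κ := by rw [← Real.rpow_add pV]; norm_num
        _ ≤ _ := by gcongr; linarith
    have e : |σ m| ≤ C2 * (1 + w) ^ o27 := by simp only [hσ, hlw]; exact x
    have y2 : |σ m| * z ≤ C2 * (2 * z ^ κ * (1 + w) ^ (-p)) := (mul_le_mul_of_nonneg_right e hz0.le).trans (by rw [mul_assoc]; exact mul_le_mul_of_nonneg_left y1 hC2.le)
    have y3 := mul_le_mul_of_nonneg_left y2 hwm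
    have y4 : 0 ≤ C1 * z ^ κ * (wt m * (1 + w) ^ (-p)) := pV
    linarith
lemma gam_lo : (0.5768 : ℝ) ≤ eulerMascheroniConstant := by
  have hm : Monotone (fun k : ℕ => (harmonic (k + 1) : ℝ) - Real.log ((k:ℝ) + 1) - 1 / (2 * ((k:ℝ) + 1))) := by
    refine monotone_nat_of_le_succ fun k => ?_
    have hk : o0 < (k:ℝ) + 1 := pV
    have h1 : Real.log (((k:ℝ) + 2) / (k + 1)) ≤ (((k:ℝ) + 2) / (k + 1) - (((k:ℝ) + 2) / (k + 1))⁻¹) / 2 := by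
      rw [← Real.sinh_log pV]
      exact Real.self_le_sinh_iff.2 (Real.log_nonneg (by rw [le_div_iff₀ hk]; linarith))
    rw [Real.log_div pV hk.ne'] at h1
    rw [harmonic_succ (k + 1)]
    push_cast
    have e1 : ((k:ℝ) + 1 + 1) = k + 2 := by ring
    rw [e1]
    have h2 : (((k:ℝ) + 2) / (k + 1) - (((k:ℝ) + 2) / (k + 1))⁻¹) / 2 = ((k:ℝ) + 2)⁻¹ + 1 / (2 * (k + 1)) - 1 / (2 * (k + 2)) := by
      field_simp; ring
    linarith
  have ht : Tendsto (fun k : ℕ => (harmonic (k + 1) : ℝ) - Real.log ((k:ℝ) + 1) - 1 / (2 * ((k:ℝ) + 1))) atTop (𝓝 eulerMascheroniConstant) := by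
    have h1 := (Real.tendsto_harmonic_sub_log.comp (tendsto_add_atTop_nat 1)).sub ((tendsto_one_div_add_atTop_nhds_zero_nat (𝕜 := ℝ)).mul_const (1/2))
    simp only [zero_mul, sub_zero] at h1
    refine h1.congr fun k => ?_
    simp only [Function.comp]
    push_cast
    field_simp
  have := hm.ge_of_tendsto ht 15
  simp only [harmonic, Finset.sum_range_succ, Finset.sum_range_zero] at this
  norm_num at this
  have h16 : Real.log 16 = 4 * Real.log 2 := by rw [show (16:ℝ) = 2 ^ 4 by norm_num, Real.log_pow]; norm_num
  rw [h16] at this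
  linarith [Real.log_two_lt_d9]
lemma gam_hi : eulerMascheroniConstant ≤ (0.5775 : ℝ) := by
  have hm : Antitone (fun k : ℕ => (harmonic k : ℝ) - Real.log ((k:ℝ) + 1 / 2)) := by
    refine antitone_nat_of_succ_le fun k => ?_
    have hk : o0 < (k:ℝ) + 1 / 2 := pV
    have h1 := Real.le_log_one_add_of_nonneg (x := 1 / ((k:ℝ) + 1 / 2)) pV
    rw [show 1 + 1 / ((k:ℝ) + 1 / 2) = ((k:ℝ) + 3 / 2) / (k + 1 / 2) by field_simp; ring, Real.log_div pV hk.ne'] at h1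
    rw [harmonic_succ k]
    push_cast
    have e1 : ((k:ℝ) + 1 + 1 / 2) = k + 3 / 2 := by ring
    rw [e1]
    have h2 : 2 * (1 / ((k:ℝ) + 1 / 2)) / (1 / ((k:ℝ) + 1 / 2) + 2) = ((k:ℝ) + 1)⁻¹ := by
      field_simp; ring
    linarith
  have ht : Tendsto (fun k : ℕ => (harmonic k : ℝ) - Real.log ((k:ℝ) + 1 / 2)) atTop (𝓝 eulerMascheroniConstant) := by
    refine tendsto_of_tendsto_of_tendsto_of_le_of_le' Real.tendsto_harmonic_sub_log_add_one Real.tendsto_harmonic_sub_log ?_ ?_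
    · filter_upwards with k
      have : Real.log ((k:ℝ) + 1 / 2) ≤ Real.log ((k:ℝ) + 1) := Real.log_le_log pV lI
      linarith
    · filter_upwards [eventually_gt_atTop 0] with k hk
      have hk' : o0 < k := by exact_mod_cast hk
      have : Real.log (k:ℝ) ≤ Real.log ((k:ℝ) + 1 / 2) := Real.log_le_log hk' lI
      linarith
  have := hm.le_of_tendsto ht 16
  simp only [harmonic, Finset.sum_range_succ, Finset.sum_range_zero] at this
  norm_num at this
  have h16 : Real.log (33 / 2) = 4 * Real.log 2 + Real.log (1 + 1 / 32) := by
    rw [show (33 / 2:ℝ) = 2 ^ 4 * (1 + 1 / 32) by norm_num, Real.log_mul nN nN, Real.log_pow]; norm_num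
  have h1 := Real.le_log_one_add_of_nonneg (x := 1 / 32) pV
  rw [h16] at this
  norm_num at h1 this
  linarith [Real.log_two_gt_d9]
lemma c_lo : (0.3149 : ℝ) ≤ Real.exp (-2 * eulerMascheroniConstant) := by
  have h1 : Real.exp (-1.155) ≤ Real.exp (-2 * eulerMascheroniConstant) := Real.exp_le_exp.2 (by linarith [gam_hi])
  refine le_trans ?_ h1
  rw [Real.exp_neg, show (1.155:ℝ) = 1 + 0.155 by norm_num, Real.exp_add, le_inv_comm₀ nN pV]
  have h2 := Real.exp_bound' (x := 0.155) nN nN (n := 4) nN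
  have h3 := Real.exp_one_lt_d9
  norm_num [Finset.sum_range_succ, Nat.factorial] at h2
  refine (mul_le_mul h3.le (by norm_num; exact h2) (Real.exp_pos _).le nN).trans nN
lemma c_hi : Real.exp (-2 * eulerMascheroniConstant) ≤ (0.3156 : ℝ) := by
  have h1 : Real.exp (-2 * eulerMascheroniConstant) ≤ Real.exp (-1.1536) := Real.exp_le_exp.2 (by linarith [gam_lo])
  refine le_trans h1 ?_
  rw [Real.exp_neg, show (1.1536:ℝ) = 1 + 0.1536 by norm_num, Real.exp_add, inv_le_comm₀ pV nN]
  have h2 := Real.sum_le_exp_of_nonneg (x := 0.1536) nN 4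
  have h3 := Real.exp_one_gt_d9
  norm_num [Finset.sum_range_succ, Nat.factorial] at h2
  have h4 : (1.166:ℝ) ≤ Real.exp 0.1536 := by norm_num; linarith
  exact le_trans nN (mul_le_mul h3.le h4 nN (Real.exp_pos _).le)
variable {ξ : ℝ → ℝ} {c : ℝ}
lemma lin2 {f : ℝ → ℝ} {a b p q r s : ℝ} (hab : a ≤ b) (hf : IntervalIntegrable f volume a b)
    (hb : ∀ u, a ≤ u → u ≤ b → f u ≤ (p - q * (u - a)) * (r - s * (u - a))) :
    ∫ u in a..b, f u ≤ p * r * (b - a) - (p * s + q * r) * (b - a) ^ 2 / 2 + q * s * (b - a) ^ 3 / 3 := by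
  have h1 := intervalIntegral.integral_mono_on hab hf (Continuous.intervalIntegrable fP a b) (fun u hu => hb u hu.1 hu.2)
  refine h1.trans (le_of_eq ?_)
  have hd : ∀ u, HasDerivAt (fun u : ℝ => p * r * (u - a) - (p * s + q * r) * (u - a) ^ 2 / 2 + q * s * (u - a) ^ 3 / 3) ((p - q * (u - a)) * (r - s * (u - a))) u := by
    intro u
    have e := (hasDerivAt_id u).sub_const a
    have := ((e.const_mul (p * r)).fun_sub (((e.fun_pow 2).const_mul (p * s + q * r)).div_const 2)).fun_add (((e.fun_pow 3).const_mul (q * s)).div_const 3)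
    refine this.congr_deriv ?_
    simp; ring
  rw [intervalIntegral.integral_eq_sub_of_hasDerivAt (fun u _ => hd u) (Continuous.intervalIntegrable fP a b)]
  simp
structure KC (ξ : ℝ → ℝ) (c : ℝ) : Prop extends KX ξ c where
  cl : 0.3149 ≤ c
  ch : c ≤ 0.3156
lemma k12_hi (h : KC ξ c) {u : ℝ} (h1 : 1 ≤ u) (h2 : u ≤ 2) : u * kap ξ c u ≤ 2 - 0.3149 * (u * (u + 2)) := by
  rw [kap, h.eq12 h1 h2, mul_sub, mul_div_cancel₀ _ lI]
  nlinarith [mul_le_mul_of_nonneg_right h.cl (show 0 ≤ u * (u + 2) by positivity)]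
lemma k12_lo (h : KC ξ c) {u : ℝ} (h1 : 1 ≤ u) (h2 : u ≤ 2) : 2 - 0.3156 * (u * (u + 2)) ≤ u * kap ξ c u := by
  rw [kap, h.eq12 h1 h2, mul_sub, mul_div_cancel₀ _ lI]
  nlinarith [mul_le_mul_of_nonneg_right h.ch (show 0 ≤ u * (u + 2) by positivity)]
lemma k23_hi (h : KC ξ c) {u : ℝ} (h1 : 2 ≤ u) (h2 : u ≤ 3) : (u + 1) * (u * kap ξ c u) ≤ 4.7726 * (u + 1) + 8 * (u - 3) - 0.3149 * (u * (u + 2) * (u + 1)) := by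
  rw [kap, h.eq23 h1 h2, mul_sub, mul_div_cancel₀ _ lI]
  have e : Real.log (u - 1) = Real.log 2 - Real.log (1 + (3 - u) / (u - 1)) := by
    rw [← Real.log_div nN (by have : 0 ≤ (3 - u) / (u - 1) := div_nonneg lI lI
                              linarith)]
    congr 1
    have : u - 1 ≠ 0 := lI
    rw [eq_div_iff (by have : 0 ≤ (3 - u) / (u - 1) := div_nonneg lI lI
                       linarith)]
    field_simp; ring
  have h3 := Real.le_log_one_add_of_nonneg (x := (3 - u) / (u - 1)) (div_nonneg lI lI)
  have e2 : 2 * ((3 - u) / (u - 1)) / ((3 - u) / (u - 1) + 2) = 2 * (3 - u) / (u + 1) := by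
    have : u - 1 ≠ 0 := lI
    have : u + 1 ≠ 0 := lI
    have e3 : (3 - u) / (u - 1) + 2 = (u + 1) / (u - 1) := by field_simp; ring
    rw [e3]; field_simp
  rw [e2, div_le_iff₀ lI] at h3
  have h4 := mul_le_mul_of_nonneg_right h.cl (show 0 ≤ u * (u + 2) * (u + 1) by positivity)
  have h5 := mul_le_mul_of_nonneg_right Real.log_two_lt_d9.le (show 0 ≤ u + 1 by linarith)
  rw [e]
  nlinarith
lemma k23_lo (h : KC ξ c) {u : ℝ} (h1 : 2 ≤ u) (h2 : u ≤ 3) : 2 * u + 8 * (u - 2) - 0.3156 * (u * (u + 2) * u) ≤ u * (u * kap ξ c u) := by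
  have e : u * kap ξ c u = 2 + 4 * Real.log (u - 1) - u * (c * (u + 2)) := by
    rw [kap, h.eq23 h1 h2, mul_sub, mul_div_cancel₀ _ lI]
  rw [e]
  have h3 := Real.le_log_one_add_of_nonneg (x := u - 2) lI
  rw [show u - 2 + 2 = u by ring, show 1 + (u - 2) = u - 1 by ring, div_le_iff₀ lI] at h3
  have h4 := mul_le_mul_of_nonneg_right h.ch (show 0 ≤ u * (u + 2) * u by positivity)
  nlinarith
lemma k12_abs (h : KC ξ c) {a b p q : ℝ} (ha : 1 ≤ a) (hb : b ≤ 2) {u : ℝ} (h1 : a ≤ u) (h2 : u ≤ b)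
    (e1 : 2 - 0.3149 * (u * (u + 2)) ≤ u * (p - q * (u - a))) (e2 : 0.3156 * (u * (u + 2)) - 2 ≤ u * (p - q * (u - a))) :
    |kap ξ c u| ≤ p - q * (u - a) := by
  have h3 := k12_hi h (by linarith : 1 ≤ u) lI
  have h4 := k12_lo h (by linarith : 1 ≤ u) lI
  have hu : 0 < u := lI
  rw [abs_le]
  constructor
  · exact le_of_mul_le_mul_left lI hu
  · exact le_of_mul_le_mul_left lI hu
lemma k23_le (h : KC ξ c) {a b p q : ℝ} (ha : 2 ≤ a) (hb : b ≤ 3) {u : ℝ} (h1 : a ≤ u) (h2 : u ≤ b)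
    (e1 : 4.7726 * (u + 1) + 8 * (u - 3) - 0.3149 * (u * (u + 2) * (u + 1)) ≤ (u + 1) * (u * (p - q * (u - a)))) :
    kap ξ c u ≤ p - q * (u - a) := by
  have h3 := k23_hi h (by linarith : 2 ≤ u) lI
  have hu : 0 < u := lI
  exact le_of_mul_le_mul_left (le_of_mul_le_mul_left (h3.trans e1) lI) hu
lemma k23_ge (h : KC ξ c) {a b p q : ℝ} (ha : 2 ≤ a) (hb : b ≤ 3) {u : ℝ} (h1 : a ≤ u) (h2 : u ≤ b)
    (e1 : 0.3156 * (u * (u + 2) * u) - (2 * u + 8 * (u - 2)) ≤ u * (u * (p - q * (u - a)))) :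
    - kap ξ c u ≤ p - q * (u - a) := by
  have h3 := k23_lo h (by linarith : 2 ≤ u) lI
  have hu : 0 < u := lI
  exact le_of_mul_le_mul_left (le_of_mul_le_mul_left (show u * (u * -kap ξ c u) ≤ _ by linarith) hu) hu
lemma n1 (h : KC ξ c) {u : ℝ} (h1 : 1 ≤ u) (h2 : u ≤ 1.25) : |kap ξ c u| ≤ 1.06 - 1.9 * (u - 1) :=
  k12_abs h (b := 1.25) le_rfl nN h1 h2 (by nlinarith) (by nlinarith)
lemma n2 (h : KC ξ c) {u : ℝ} (h1 : 1.25 ≤ u) (h2 : u ≤ 1.5) : |kap ξ c u| ≤ 0.585 - 1.4 * (u - 1.25) :=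
  k12_abs h (b := 1.5) nN nN h1 h2 (by nlinarith) (by nlinarith)
lemma n3 (h : KC ξ c) {u : ℝ} (h1 : 1.5 ≤ u) (h2 : u ≤ 1.75) : |kap ξ c u| ≤ 0.237 - 0.75 * (u - 1.5) :=
  k12_abs h (b := 1.75) nN nN h1 h2 (by nlinarith) (by nlinarith)
lemma n4 (h : KC ξ c) {u : ℝ} (h1 : 1.75 ≤ u) (h2 : u ≤ 2) : |kap ξ c u| ≤ 0.054 - (-0.87) * (u - 1.75) :=
  k12_abs h (b := 2) nN nN h1 h2 (by nlinarith) (by nlinarith)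
lemma n5 (h : KC ξ c) {u : ℝ} (h1 : 2 ≤ u) (h2 : u ≤ 2.2) : kap ξ c u ≤ -0.06 :=
  (k23_le h (b := 2.2) (p := -0.06) (q := 0) nN nN h1 h2 (by nlinarith [mul_nonneg (sub_nonneg.2 h1) (sub_nonneg.2 h2), mul_nonneg (mul_nonneg (sub_nonneg.2 h1) (sub_nonneg.2 h2)) (by linarith : 0 ≤ u)])).trans nN
lemma n6 (h : KC ξ c) {u : ℝ} (h1 : 2 ≤ u) (h2 : u ≤ 2.2) : -kap ξ c u ≤ 0.264 - 0.85 * (u - 2) :=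
  k23_ge h (b := 2.2) nN nN h1 h2 (by nlinarith [mul_nonneg (sub_nonneg.2 h1) (sub_nonneg.2 h2), mul_nonneg (mul_nonneg (sub_nonneg.2 h1) (sub_nonneg.2 h2)) (by linarith : 0 ≤ u)])
lemma n7 (h : KC ξ c) {u : ℝ} (h1 : 2.2 ≤ u) (h2 : u ≤ 2.4) : -kap ξ c u ≤ 0.098 - 0.41 * (u - 2.2) :=
  k23_ge h (b := 2.4) nN nN h1 h2 (by nlinarith [mul_nonneg (sub_nonneg.2 h1) (sub_nonneg.2 h2), mul_nonneg (mul_nonneg (sub_nonneg.2 h1) (sub_nonneg.2 h2)) (by linarith : 0 ≤ u)])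
lemma n8 (h : KC ξ c) {u : ℝ} (h1 : 2.2 ≤ u) (h2 : u ≤ 2.4) : kap ξ c u ≤ 0.098 - 0.41 * (u - 2.2) :=
  k23_le h (b := 2.4) nN nN h1 h2 (by nlinarith [mul_nonneg (sub_nonneg.2 h1) (sub_nonneg.2 h2), mul_nonneg (mul_nonneg (sub_nonneg.2 h1) (sub_nonneg.2 h2)) (by linarith : 0 ≤ u)])
lemma n9 (h : KC ξ c) {u : ℝ} (h1 : 2.2 ≤ u) (h2 : u ≤ 2.35) : kap ξ c u ≤ 0.001 :=
  (k23_le h (b := 2.35) (p := 0.001) (q := 0) nN nN h1 h2 (by nlinarith [mul_nonneg (sub_nonneg.2 h1) (sub_nonneg.2 h2), mul_nonneg (mul_nonneg (sub_nonneg.2 h1) (sub_nonneg.2 h2)) (by linarith : 0 ≤ u)])).trans nN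
lemma n10 (h : KC ξ c) {u : ℝ} (h1 : 2.35 ≤ u) (h2 : u ≤ 3) : kap ξ c u ≤ 0.05 :=
  (k23_le h (b := 3) (p := 0.05) (q := 0) nN nN h1 h2 (by nlinarith [mul_nonneg (sub_nonneg.2 h1) (sub_nonneg.2 h2), sq_nonneg (u - 2.68), mul_nonneg (sq_nonneg (u - 2.68)) (by linarith : 0 ≤ u)])).trans nN
lemma n11 (h : KC ξ c) {u : ℝ} (h1 : 2.4 ≤ u) (h2 : u ≤ 3) : -kap ξ c u ≤ 0.025 :=
  (k23_ge h (b := 3) (p := 0.025) (q := 0) nN nN h1 h2 (by nlinarith [mul_nonneg (sub_nonneg.2 h1) (sub_nonneg.2 h2), mul_nonneg (mul_nonneg (sub_nonneg.2 h1) (sub_nonneg.2 h2)) (by linarith : 0 ≤ u)])).trans nN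
variable {ξ : ℝ → ℝ} {c : ℝ}
def W1 (u : ℝ) : ℝ := (1 + 0.1672 * ((u - 1) / (u + 1))) / (u + 1)
def W2 (u : ℝ) : ℝ := W1 u + 0.5836 / u
lemma W1_nn {u : ℝ} (hu : 1 ≤ u) : 0 ≤ W1 u := by
  have : 0 ≤ (u - 1) / (u + 1) := div_nonneg lI lI
  exact div_nonneg lI lI
lemma W1_le {u : ℝ} (h1 : 1 ≤ u) (h2 : u ≤ 2) : W1 u ≤ 0.5 - 0.148 * (u - 1) := by
  rw [W1, div_le_iff₀ lI]
  have : (u - 1) / (u + 1) * (u + 1) = u - 1 := div_mul_cancel₀ _ lI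
  refine le_of_mul_le_mul_right (a := u + 1) ?_ lI
  nlinarith [mul_nonneg (sub_nonneg.2 h1) (sub_nonneg.2 h2), mul_nonneg (mul_nonneg (sub_nonneg.2 h1) (sub_nonneg.2 h2)) (by linarith : 0 ≤ u)]
lemma W2_nn {u : ℝ} (hu : 1 ≤ u) : 0 ≤ W2 u := add_nonneg (W1_nn hu) (div_nonneg nN lI)
lemma W2_le {a u : ℝ} (h0 : 2 ≤ a) (h1 : a ≤ u) (h2 : u ≤ a + 1) : W2 u ≤ (1 + 0.1672 * (a / (a + 2))) / (a + 1) + 0.5836 / a := by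
  rw [W2, W1]
  have h3 : (u - 1) / (u + 1) ≤ a / (a + 2) := by
    rw [div_le_div_iff₀ lI lI]; linarith
  have h4 : 0 ≤ (u - 1) / (u + 1) := div_nonneg lI lI
  refine add_le_add (div_le_div₀ pV lI lI lI) (div_le_div_of_nonneg_left nN lI h1)
lemma W2_tail {u : ℝ} (hu : 5 ≤ u) : W2 u * (u + 2) ≤ 2.18 := by
  rw [W2, W1]
  have h3 : (u - 1) / (u + 1) ≤ 1 := by rw [div_le_one lI]; linarith
  have h5 : (1 + 0.1672 * ((u - 1) / (u + 1))) / (u + 1) ≤ 1.1672 / (u + 1) := div_le_div_of_nonneg_right lI lI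
  have h6 : 1.1672 / (u + 1) * (u + 2) ≤ 1.1672 * (7 / 6) := by
    rw [div_mul_eq_mul_div, div_le_iff₀ lI]; linarith
  have h7 : 0.5836 / u * (u + 2) ≤ 0.5836 * (7 / 5) := by
    rw [div_mul_eq_mul_div, div_le_iff₀ lI]; linarith
  have := mul_le_mul_of_nonneg_right h5 (show 0 ≤ u + 2 by linarith)
  rw [add_mul]; linarith
lemma W1_co {a b : ℝ} (ha : 1 ≤ a) (hb : 1 ≤ b) : ContinuousOn W1 (Set.uIcc a b) := by
  intro u hu
  have : 1 ≤ u := (le_min ha hb).trans hu.1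
  have h1 : u + 1 ≠ 0 := lI
  unfold W1
  exact ContinuousAt.continuousWithinAt (by fun_prop (disch := assumption))
lemma iv_co {a b : ℝ} (ha : 1 ≤ a) (hb : 1 ≤ b) : ContinuousOn (fun u : ℝ => 0.5836 / u) (Set.uIcc a b) := by
  intro u hu
  have : 1 ≤ u := (le_min ha hb).trans hu.1
  have h1 : u ≠ 0 := lI
  exact ContinuousAt.continuousWithinAt (by fun_prop (disch := assumption))
lemma KX.kW_ii (h : KX ξ c) {a b : ℝ} (ha : 1 ≤ a) (hb : 1 ≤ b) : IntervalIntegrable (fun u => |kap ξ c u| * W1 u) volume a b :=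
  (h.k_ii a b).abs.mul_continuousOn (W1_co ha hb)
lemma KX.kv_ii (h : KX ξ c) {a b : ℝ} (ha : 1 ≤ a) (hb : 1 ≤ b) : IntervalIntegrable (fun u => |kap ξ c u| * (0.5836 / u)) volume a b :=
  (h.k_ii a b).abs.mul_continuousOn (iv_co ha hb)
lemma KX.kW2_ii (h : KX ξ c) {a b : ℝ} (ha : 1 ≤ a) (hb : 1 ≤ b) : IntervalIntegrable (fun u => |kap ξ c u| * W2 u) volume a b :=
  (h.k_ii a b).abs.mul_continuousOn ((W1_co ha hb).add (iv_co ha hb))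
lemma I1_le (h : KC ξ c) : ∫ u in o1..2, |kap ξ c u| * W1 u ≤ 0.176 := by
  have key : ∀ {a b p q : ℝ}, 1 ≤ a → a ≤ b → b ≤ 2 → (∀ u, a ≤ u → u ≤ b → |kap ξ c u| ≤ p - q * (u - a)) →
      ∫ u in a..b, |kap ξ c u| * W1 u ≤ p * (0.5 - 0.148 * (a - 1)) * (b - a) - (p * 0.148 + q * (0.5 - 0.148 * (a - 1))) * (b - a) ^ 2 / 2 + q * 0.148 * (b - a) ^ 3 / 3 := by
    intro a b p q ha hab hb hk
    refine lin2 hab (h.kW_ii ha (ha.trans hab)) fun u h1 h2 => ?_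
    have hw := W1_le (ha.trans h1) (h2.trans hb)
    refine mul_le_mul (hk u h1 h2) lI (W1_nn (ha.trans h1)) ((abs_nonneg _).trans (hk u h1 h2))
  have k1 := key (a := 1) (b := 1.25) nN nN nN (fun u => n1 h)
  have k2 := key (a := 1.25) (b := 1.5) nN nN nN (fun u => n2 h)
  have k3 := key (a := 1.5) (b := 1.75) nN nN nN (fun u => n3 h)
  have k4 := key (a := 1.75) (b := 2) nN nN nN (fun u => n4 h)
  rw [← intervalIntegral.integral_add_adjacent_intervals (h.kW_ii nN nN) (h.kW_ii (a := 1.25) nN nN),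
    ← intervalIntegral.integral_add_adjacent_intervals (a := 1.25) (h.kW_ii nN nN) (h.kW_ii (a := 1.5) nN nN),
    ← intervalIntegral.integral_add_adjacent_intervals (a := 1.5) (h.kW_ii nN nN) (h.kW_ii (a := 1.75) nN nN)]
  norm_num at k1 k2 k3 k4 ⊢
  linarith
lemma n12 (h : KC ξ c) {u : ℝ} (h1 : 2 ≤ u) (h2 : u ≤ 2.2) : |kap ξ c u| ≤ 0.264 - 0.85 * (u - 2) :=
  abs_le.2 ⟨by linarith [n6 h h1 h2], by linarith [n5 h h1 h2]⟩
lemma n13 (h : KC ξ c) {u : ℝ} (h1 : 2.2 ≤ u) (h2 : u ≤ 2.4) : |kap ξ c u| ≤ 0.098 - 0.41 * (u - 2.2) :=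
  abs_le.2 ⟨by linarith [n7 h h1 h2], by linarith [n8 h h1 h2]⟩
lemma n14 (h : KC ξ c) {u : ℝ} (h1 : 2.4 ≤ u) (h2 : u ≤ 3) : |kap ξ c u| ≤ 0.05 :=
  abs_le.2 ⟨by linarith [n11 h h1 h2], by linarith [n10 h lI h2]⟩
lemma three {f : ℝ → ℝ} {M : ℝ} (hf : ∀ a b, IntervalIntegrable f volume a b) (h1 : ∀ u, 2 ≤ u → u ≤ 2.2 → f u ≤ 0.264 - 0.85 * (u - 2))
    (h2 : ∀ u, 2.2 ≤ u → u ≤ 2.4 → f u ≤ 0.098 - 0.41 * (u - 2.2)) (h3 : ∀ u, 2.4 ≤ u → u ≤ 3 → f u ≤ M) :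
    ∫ u in o2..3, f u ≤ 0.0473 + 0.6 * M := by
  have k1 := lin2 (a := 2) (b := 2.2) (p := 0.264) (q := 0.85) (r := 1) (s := 0) nN (hf _ _) (fun u a b => by linarith [h1 u a b])
  have k2 := lin2 (a := 2.2) (b := 2.4) (p := 0.098) (q := 0.41) (r := 1) (s := 0) nN (hf _ _) (fun u a b => by linarith [h2 u a b])
  have k3 := lin2 (a := 2.4) (b := 3) (p := M) (q := 0) (r := 1) (s := 0) nN (hf _ _) (fun u a b => by linarith [h3 u a b])
  rw [← intervalIntegral.integral_add_adjacent_intervals (hf 2 2.2) (hf _ _), ← intervalIntegral.integral_add_adjacent_intervals (hf 2.2 2.4) (hf _ _)]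
  norm_num at k1 k2 k3 ⊢
  linarith
lemma I23 (h : KC ξ c) : ∫ u in o2..3, |kap ξ c u| ≤ 0.0773 :=
  (three (M := 0.05) (fun a b => (h.k_ii a b).abs) (fun u => n12 h) (fun u => n13 h) (fun u => n14 h)).trans nN
lemma I2w_lo (h : KC ξ c) {w : ℝ} (h1 : 2 ≤ w) (h2 : w ≤ 3) : -0.0625 ≤ ∫ u in o2..w, kap ξ c u := by
  have hii : ∀ a b, IntervalIntegrable (fun u => max (-kap ξ c u) 0) volume a b := fun a b => by
    have h0 : IntervalIntegrable (fun u => (|kap ξ c u| - kap ξ c u) / 2) volume a b := ((h.k_ii a b).abs.sub (h.k_ii a b)).div_const 2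
    refine h0.congr fun u _ => ?_
    rcases abs_cases (kap ξ c u) with ⟨e, h⟩ | ⟨e, h⟩
    · rw [e, max_eq_right lI]; ring
    · rw [e, max_eq_left lI]; ring
  have k := three (M := 0.025) hii (fun u a b => max_le (n6 h a b) lI) (fun u a b => max_le (n7 h a b) lI) (fun u a b => max_le (n11 h a b) nN)
  have k2 : ∫ u in o2..w, -kap ξ c u ≤ ∫ u in o2..w, max (-kap ξ c u) 0 :=
    intervalIntegral.integral_mono_on h1 (h.k_ii _ _).neg (hii _ _) fun u _ => le_max_left _ _
  have k3 : 0 ≤ ∫ u in w..3, max (-kap ξ c u) 0 := intervalIntegral.integral_nonneg h2 fun u _ => le_max_right _ _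
  have k4 := intervalIntegral.integral_add_adjacent_intervals (hii 2 w) (hii w 3)
  rw [intervalIntegral.integral_neg] at k2
  norm_num at k ⊢
  linarith
lemma I2w_hi (h : KC ξ c) {w : ℝ} (h1 : 2 ≤ w) (h2 : w ≤ 3) : ∫ u in o2..w, kap ξ c u ≤ 0.021 := by
  have cst : ∀ {a b M : ℝ}, a ≤ b → (∀ u, a ≤ u → u ≤ b → kap ξ c u ≤ M) → ∫ u in a..b, kap ξ c u ≤ M * (b - a) := by
    intro a b M hab hk
    have := lin2 (p := M) (q := 0) (r := 1) (s := 0) hab (h.k_ii a b) (fun u a b => by linarith [hk u a b])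
    linarith
  rcases le_total w 2.35 with hw | hw
  · have := cst (M := 0.001) h1 (fun u a b => by
      rcases le_total u 2.2 with hu | hu
      · linarith [n5 h a hu]
      · exact n9 h hu (b.trans hw))
    linarith
  · have k1 := cst (a := 2) (b := 2.2) nN (fun u a b => n5 h a b)
    have k2 := cst (a := 2.2) (b := 2.35) nN (fun u a b => n9 h a b)
    have k3 := cst (a := 2.35) (b := w) hw (fun u a b => n10 h a (b.trans h2))
    rw [← intervalIntegral.integral_add_adjacent_intervals (h.k_ii 2 2.2) (h.k_ii _ _), ← intervalIntegral.integral_add_adjacent_intervals (h.k_ii 2.2 2.35) (h.k_ii _ _)]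
    linarith
lemma KX.K1' (h : KX ξ c) {u v : ℝ} (hu : 1 ≤ u) (hv : 1 ≤ v) : v * kap ξ c v = u * kap ξ c u + 2 * ∫ t in (u - 1)..(v - 1), kap ξ c t := by
  rw [h.K1 hu, h.K1 hv, ← intervalIntegral.integral_add_adjacent_intervals (h.k_ii 0 (u - 1)) (h.k_ii (u - 1) (v - 1))]; ring
lemma k34 (h : KC ξ c) {u : ℝ} (h1 : 3 ≤ u) (h2 : u ≤ 4) : |u * kap ξ c u| ≤ 0.0912 := by
  have e := h.K1' (u := 3) (v := u) nN lI
  norm_num at e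
  have e3 : 3 * kap ξ c 3 = 2 + 4 * Real.log 2 - 15 * c := by
    rw [kap, h.eq23 nN le_rfl]; norm_num; ring
  have l := I2w_lo h (w := u - 1) lI lI
  have l' := I2w_hi h (w := u - 1) lI lI
  have := h.cl
  have := h.ch
  have := Real.log_two_lt_d9
  have := Real.log_two_gt_d9
  rw [e, e3, abs_le]
  constructor <;> linarith
lemma k34' (h : KC ξ c) {u : ℝ} (h1 : 3 ≤ u) (h2 : u ≤ 4) : |kap ξ c u| ≤ 0.0304 := by
  have := k34 h h1 h2
  rw [abs_mul, abs_of_pos lI] at this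
  have := mul_le_mul_of_nonneg_right h1 (abs_nonneg (kap ξ c u))
  linarith
lemma k45 (h : KC ξ c) {u : ℝ} (h1 : 4 ≤ u) (h2 : u ≤ 5) : |kap ξ c u| ≤ 0.038 := by
  have e := h.K1' (u := 4) (v := u) nN lI
  have h3 := k34 h (u := 4) nN nN
  have h4 : |∫ t in (4 - 1:ℝ)..(u - 1), kap ξ c t| ≤ 0.0304 := by
    have := intervalIntegral.norm_integral_le_of_norm_le_const (a := 4 - 1) (b := u - 1) (f := kap ξ c) (C := 0.0304) (fun t ht => by
      rw [Set.uIoc_of_le lI] at ht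
      exact k34' h (by linarith [ht.1]) (by linarith [ht.2]))
    rw [Real.norm_eq_abs, abs_of_nonneg (by linarith : 0 ≤ u - 1 - (4 - 1))] at this
    linarith
  have h5 : |u * kap ξ c u| ≤ 0.152 := by
    rw [e]
    rw [abs_le] at h3 h4 ⊢
    constructor <;> linarith
  rw [abs_mul, abs_of_pos lI] at h5
  have := mul_le_mul_of_nonneg_right h1 (abs_nonneg (kap ξ c u))
  linarith
lemma g_kap (u : ℝ) (hu : 0 ≤ u) : IsXi.g ξ u = c + kap ξ c u / (u + 2) := by
  rw [IsXi.g, kap]; field_simp; ring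
lemma gp45 (h : KC ξ c) {u : ℝ} (h1 : 5 - 1 < u) (h2 : u ≤ 5) : |deriv (IsXi.g ξ) u| ≤ 0.0053 := by
  rw [(h.g_deriv lI).deriv, g_kap (c := c) u lI, g_kap (c := c) (u - 1) lI, abs_mul, abs_neg]
  have q := IsXi.q_le (U := 4) (u := u) nN lI
  have a1 : |kap ξ c u / (u + 2)| ≤ 0.038 / 6 := by
    rw [abs_div, abs_of_pos (by linarith : 0 < u + 2)]
    exact div_le_div₀ nN (k45 h lI h2) nN lI
  have a2 : |kap ξ c (u - 1) / (u - 1 + 2)| ≤ 0.0304 / 5 := by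
    rw [abs_div, abs_of_pos (by linarith : 0 < u - 1 + 2)]
    exact div_le_div₀ nN (k34' h lI lI) nN lI
  have a3 : |c + kap ξ c u / (u + 2) - (c + kap ξ c (u - 1) / (u - 1 + 2))| ≤ 0.038 / 6 + 0.0304 / 5 := by
    rw [abs_le] at *
    constructor <;> linarith
  rw [abs_of_nonneg (div_nonneg lI (by nlinarith))]
  refine (mul_le_mul q a3 (abs_nonneg _) nN).trans nN
lemma k5 (h : KC ξ c) {u : ℝ} (hu : 5 ≤ u) : |kap ξ c u| ≤ 0.0106 * Real.exp (-(u - 5) / 2) * (u + 2) := by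
  have hd := fun v (hv : u ≤ v) => h.g_diff (a := 5) (K := 0.0053) nN (fun u a b => gp45 h a b) (u := u) lI hv
  have ht : Tendsto (IsXi.g ξ) atTop (𝓝 c) := by
    obtain ⟨K, hK, hk⟩ := h.k_bd
    have : Tendsto (fun v : ℝ => K / (v + 2)) atTop (𝓝 0) := Tendsto.const_div_atTop (tendsto_atTop_add_const_right _ _ tendsto_id) _
    rw [tendsto_iff_dist_tendsto_zero]
    refine squeeze_zero' (Eventually.of_forall fun _ => dist_nonneg) ?_ this
    filter_upwards [eventually_ge_atTop 0] with v hv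
    rw [g_kap (c := c) v hv, Real.dist_eq, add_sub_cancel_left, abs_div, abs_of_pos (by linarith : 0 < v + 2)]
    exact div_le_div_of_nonneg_right (hk v hv) lI
  have h1 : |c - IsXi.g ξ u| ≤ 2 * 0.0053 * Real.exp (-(u - 5) / 2) :=
    le_of_tendsto ((ht.sub_const _).abs) (by filter_upwards [eventually_ge_atTop u] with v hv using hd v hv)
  rw [g_kap (c := c) u lI, sub_add_cancel_left, abs_neg, abs_div, abs_of_pos (by linarith : 0 < u + 2), div_le_iff₀ lI] at h1
  norm_num at h1 ⊢
  linarith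
lemma I2_le (h : KC ξ c) {S : ℝ} (hS : 5 ≤ S) : ∫ u in o2..S, |kap ξ c u| * W2 u ≤ 0.1268 := by
  have cst : ∀ {a M : ℝ}, 2 ≤ a → ∫ u in a..(a+1), |kap ξ c u| ≤ M →
      ∫ u in a..(a+1), |kap ξ c u| * W2 u ≤ M * ((1 + 0.1672 * (a / (a + 2))) / (a + 1) + 0.5836 / a) := by
    intro a M ha hk
    have h1 := intervalIntegral.integral_mono_on (by linarith : a ≤ a + 1) (h.kW2_ii lI lI) ((h.k_ii a (a+1)).abs.mul_const ((1 + 0.1672 * (a / (a + 2))) / (a + 1) + 0.5836 / a))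
      (fun u hu => mul_le_mul_of_nonneg_left (W2_le ha hu.1 hu.2) (abs_nonneg _))
    rw [intervalIntegral.integral_mul_const] at h1
    exact h1.trans (mul_le_mul_of_nonneg_right hk pV)
  have c2 : ∀ {a M : ℝ}, (∀ u, a ≤ u → u ≤ a + 1 → |kap ξ c u| ≤ M) → ∫ u in a..(a+1), |kap ξ c u| ≤ M := by
    intro a M hk
    have := lin2 (p := M) (q := 0) (r := 1) (s := 0) (by linarith : a ≤ a + 1) (h.k_ii a (a+1)).abs (fun u a b => by linarith [hk u a b])
    linarith
  have j1 := cst (a := 2) (M := 0.0773) le_rfl (by have := I23 h; norm_num at this ⊢; exact this)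
  have j2 := cst (a := 3) (M := 0.0304) nN (c2 fun u a b => k34' h a lI)
  have j3 := cst (a := 4) (M := 0.038) nN (c2 fun u a b => k45 h a lI)
  have j4 : ∫ u in (5:ℝ)..S, |kap ξ c u| * W2 u ≤ 0.0463 := by
    have h1 := intervalIntegral.integral_mono_on hS (h.kW2_ii nN lI) (Continuous.intervalIntegrable fP 5 S : IntervalIntegrable (fun u => 0.0106 * 2.18 * Real.exp (-(u - 5) / 2)) volume 5 S) (fun u hu => by
      have := mul_le_mul_of_nonneg_right (k5 h hu.1) (W2_nn (by linarith [hu.1] : 1 ≤ u))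
      have t := mul_le_mul_of_nonneg_left (W2_tail hu.1) (by positivity : 0 ≤ 0.0106 * Real.exp (-(u - 5) / 2))
      linarith)
    have hd : ∀ u : ℝ, HasDerivAt (fun u : ℝ => 0.0106 * 2.18 * (-2 * Real.exp (-(u - 5) / 2))) (0.0106 * 2.18 * Real.exp (-(u - 5) / 2)) u := fun u => by
      have := ((((((hasDerivAt_id u).sub_const 5).fun_neg).div_const 2).exp).const_mul (-2)).const_mul (0.0106 * 2.18)
      refine this.congr_deriv ?_
      simp; ring
    rw [intervalIntegral.integral_eq_sub_of_hasDerivAt (fun u _ => hd u) (Continuous.intervalIntegrable fP _ _)] at h1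
    have := Real.exp_pos (-(S - 5) / 2)
    rw [show (-(5 - 5) / 2 : ℝ) = 0 by norm_num, Real.exp_zero] at h1
    linarith
  rw [← intervalIntegral.integral_add_adjacent_intervals (b := 3) (h.kW2_ii nN nN) (h.kW2_ii nN lI),
    ← intervalIntegral.integral_add_adjacent_intervals (a := 3) (b := 4) (h.kW2_ii nN nN) (h.kW2_ii nN lI),
    ← intervalIntegral.integral_add_adjacent_intervals (a := 4) (b := 5) (h.kW2_ii nN nN) (h.kW2_ii nN lI)]
  norm_num at j1 j2 j3 j4 ⊢
  linarith
lemma NumK (h : KC ξ c) {S : ℝ} (hS : 2 ≤ S) : (∫ u in o1..(S - 1), |kap ξ c u| * W1 u) + ∫ u in o2..S, |kap ξ c u| * (0.5836 / u) ≤ 0.303 := by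
  have i1 := I1_le h
  have i2 := I2_le h (S := S + 3) lI
  have e1 := intervalIntegral.integral_add_adjacent_intervals (h.kW_ii (a := 1) (b := S - 1) le_rfl lI) (h.kW_ii (b := S + 3) lI lI)
  have e2 := intervalIntegral.integral_add_adjacent_intervals (h.kW_ii (a := 1) (b := 2) le_rfl nN) (h.kW_ii (b := S + 3) lI lI)
  have e3 := intervalIntegral.integral_add_adjacent_intervals (h.kv_ii (a := 2) (b := S) nN lI) (h.kv_ii (b := S + 3) lI lI)
  have p1 : 0 ≤ ∫ u in (S-1)..(S + 3), |kap ξ c u| * W1 u := intervalIntegral.integral_nonneg lI fun u hu => mul_nonneg (abs_nonneg _) (W1_nn (by linarith [hu.1]))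
  have p2 : 0 ≤ ∫ u in S..(S + 3), |kap ξ c u| * (0.5836 / u) := intervalIntegral.integral_nonneg lI fun u hu => mul_nonneg (abs_nonneg _) (div_nonneg nN (by linarith [hu.1]))
  have e4 : ∫ u in o2..(S+3), |kap ξ c u| * W2 u = (∫ u in o2..(S+3), |kap ξ c u| * W1 u) + ∫ u in o2..(S+3), |kap ξ c u| * (0.5836 / u) := by
    rw [← intervalIntegral.integral_add (h.kW_ii nN lI) (h.kv_ii nN lI)]
    simp only [W2, mul_add]
  linarith
variable {ξ : ℝ → ℝ} {c δ : ℝ}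
def ww (ξ : ℝ → ℝ) (δ t : ℝ) : ℝ := ξ (t - 1) * t ^ (-δ - 1)
def jf (ξ : ℝ → ℝ) (c δ t : ℝ) : ℝ := kap ξ c (t - 1) * t ^ (-δ - 1)
def AA (δ : ℝ) : ℝ := δ * (1 - δ) / (1 + δ)
def ll (ξ : ℝ → ℝ) (δ s : ℝ) : ℝ := ξ (s - 1) - ξ s / (1 + δ) - AA δ * s ^ δ * (1 + ∫ t in o1..s, ww ξ δ t)
structure KD (ξ : ℝ → ℝ) (c δ : ℝ) : Prop extends KC ξ c where
  d1 : 0.713611 < δ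
  d2 : δ < 0.713614
  J : ∫ t in Set.Ioi o1, jf ξ c δ t = c / (1 - δ) - c / δ - 1
lemma KD.ww_ii (h : KD ξ c δ) (a b : ℝ) : IntervalIntegrable (ww ξ δ) volume a b := by
  have h1 : IntervalIntegrable (fun t => ξ (t - 1)) volume a b := by
    have := (h.xi_ii (a - 1) (b - 1)).comp_sub_right 1
    simpa using this
  refine h1.mono_fun ?_ (Eventually.of_forall fun t => ?_)
  · exact ((h.meas.comp (measurable_id.sub_const 1)).mul (measurable_id.pow_const _)).aestronglyMeasurable
  · simp only [ww, norm_mul]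
    rcases lt_or_ge (t - 1) 1 with ht | ht
    · rw [h.z _ ht]; simp
    · have : t ^ (-δ - 1) ≤ 1 := Real.rpow_le_one_of_one_le_of_nonpos lI (by linarith [h.d1])
      rw [Real.norm_of_nonneg (Real.rpow_nonneg (by linarith : 0 ≤ t) _)]
      exact mul_le_of_le_one_right (norm_nonneg _) this
lemma KD.ll_meas (h : KD ξ c δ) : Measurable (ll ξ δ) := by
  have h1 := (intervalIntegral.continuous_primitive h.ww_ii 1).measurable
  exact ((h.meas.comp (measurable_id.sub_const 1)).sub (h.meas.div_const _)).sub (((measurable_id.pow_const _).const_mul _).mul (h1.const_add 1))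
lemma KD.jf_bd (h : KD ξ c δ) : ∃ K : ℝ, 0 ≤ K ∧ ∀ t : ℝ, 1 ≤ t → |kap ξ c (t - 1)| ≤ K * Real.exp (-1/4 * t) := by
  obtain ⟨K, hK, hb⟩ := h.bd
  refine ⟨K * Real.exp (1/4), pV, fun t ht => (hb (t - 1) lI).trans (le_of_eq ?_)⟩
  rw [mul_assoc, ← Real.exp_add]; ring_nf
lemma KD.jf_le (h : KD ξ c δ) {t : ℝ} (ht : 1 ≤ t) : |jf ξ c δ t| ≤ |kap ξ c (t - 1)| := by
  rw [jf, abs_mul]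
  have : t ^ (-δ - 1) ≤ 1 := Real.rpow_le_one_of_one_le_of_nonpos lI (by linarith [h.d1])
  rw [abs_of_nonneg (Real.rpow_nonneg (by linarith : 0 ≤ t) _)]
  exact mul_le_of_le_one_right (abs_nonneg _) this
lemma KD.jf_meas (h : KD ξ c δ) : Measurable (jf ξ c δ) := (h.kmeas.comp (measurable_id.sub_const 1)).mul (measurable_id.pow_const _)
lemma KD.jf_int (h : KD ξ c δ) {s : ℝ} (hs : 1 ≤ s) : IntegrableOn (jf ξ c δ) (Set.Ioi s) := by
  obtain ⟨K, hK, hb⟩ := h.jf_bd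
  refine Integrable.mono' ((integrableOn_exp_mul_Ioi (show (-1/4:ℝ) < 0 by norm_num) s).const_mul K) h.jf_meas.aestronglyMeasurable ?_
  rw [ae_restrict_iff' measurableSet_Ioi]
  exact Eventually.of_forall fun t ht => (h.jf_le (hs.trans (le_of_lt ht))).trans (hb t (hs.trans (le_of_lt ht)))
lemma poly_int (h : KD ξ c δ) {s : ℝ} (hs : 1 ≤ s) : s ^ δ * ∫ t in o1..s, (t + 1) * t ^ (-δ - 1) = (s - s ^ δ) / (1 - δ) + (s ^ δ - 1) / δ := by
  have h0 : o0 ∉ Set.uIcc 1 s := by rw [Set.uIcc_of_le hs]; intro hh; linarith [hh.1]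
  have e : ∫ t in o1..s, (t + 1) * t ^ (-δ - 1) = ∫ t in o1..s, (t ^ (-δ) + t ^ (-δ - 1)) := by
    refine intervalIntegral.integral_congr fun t ht => ?_
    rw [Set.uIcc_of_le hs] at ht
    have ht0 : 0 < t := by linarith [ht.1]
    rw [Real.rpow_sub ht0, Real.rpow_one]; field_simp
  have hd1 := h.d1
  have hd2 := h.d2
  have hs0 : 0 < s := lI
  have i1 : ∀ r : ℝ, IntervalIntegrable (fun t : ℝ => t ^ r) volume 1 s := fun r => intervalIntegral.intervalIntegrable_rpow (Or.inr h0)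
  rw [e, intervalIntegral.integral_add (i1 _) (i1 _), integral_rpow (Or.inl lI), integral_rpow (Or.inr ⟨lI, h0⟩)]
  rw [Real.one_rpow, Real.one_rpow, show -δ + 1 = 1 - δ by ring, show -δ - 1 + 1 = -δ by ring, Real.rpow_sub hs0, Real.rpow_one, Real.rpow_neg hs0.le]
  have := Real.rpow_pos_of_pos hs0 δ
  have : 1 - δ ≠ 0 := lI
  have : δ ≠ 0 := lI
  field_simp
  ring
lemma KD.ll_tail (h : KD ξ c δ) {s : ℝ} (hs : 1 ≤ s) : ll ξ δ s = kap ξ c (s - 1) - kap ξ c s / (1 + δ) + AA δ * (s ^ δ * ∫ t in Set.Ioi s, jf ξ c δ t) := by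
  have e1 := intervalIntegral.integral_interval_add_Ioi (h.jf_int le_rfl) (h.jf_int hs)
  rw [h.J] at e1
  have h0 : o0 ∉ Set.uIcc 1 s := by rw [Set.uIcc_of_le hs]; intro hh; linarith [hh.1]
  have i2 : IntervalIntegrable (fun t : ℝ => (t + 1) * t ^ (-δ - 1)) volume 1 s :=
    (intervalIntegral.intervalIntegrable_rpow (Or.inr h0)).continuousOn_mul fP
  have e2 : ∫ t in o1..s, jf ξ c δ t = (∫ t in o1..s, ww ξ δ t) - c * ∫ t in o1..s, (t + 1) * t ^ (-δ - 1) := by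
    rw [← intervalIntegral.integral_const_mul, ← intervalIntegral.integral_sub (h.ww_ii _ _) (i2.const_mul c)]
    congr 1; funext t; simp only [jf, ww, kap]; ring
  have e3 := poly_int h hs
  have hd1 := h.d1
  have hd2 := h.d2
  have e4 : s ^ δ * ∫ t in Set.Ioi s, jf ξ c δ t = s ^ δ * (c / (1 - δ) - c / δ - 1) - s ^ δ * (∫ t in o1..s, ww ξ δ t) + c * ((s - s ^ δ) / (1 - δ) + (s ^ δ - 1) / δ) := by
    rw [← e3]; rw [← eq_sub_iff_add_eq'] at e1; rw [e1, e2]; ring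
  rw [e4, ll, kap, kap, AA]
  have : 1 - δ ≠ 0 := lI
  have : δ ≠ 0 := lI
  have : 1 + δ ≠ 0 := lI
  field_simp
  ring
lemma KD.ll12 (h : KD ξ c δ) {s : ℝ} (h1 : 1 ≤ s) (h2 : s < 2) : ll ξ δ s = -(2 / s / (1 + δ) + AA δ * s ^ δ) := by
  have : ∫ t in o1..s, ww ξ δ t = 0 := by
    rw [intervalIntegral.integral_congr (g := fun _ => 0)]
    · simp
    · intro t ht
      rw [Set.uIcc_of_le h1] at ht
      simp only [ww]
      rw [h.z _ (by linarith [ht.2])]; simp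
  rw [ll, this, h.z _ (by linarith : s - 1 < 1), h.eq12 h1 h2.le]; ring
lemma two_pow (h : KD ξ c δ) : o2 ^ δ ≤ 1.641 := by
  have h1 : o2 ^ δ ≤ 2 ^ (5/7:ℝ) := Real.rpow_le_rpow_of_exponent_le nN (by linarith [h.d2])
  refine h1.trans ?_
  rw [show (5/7:ℝ) = 5 * (1/7) by norm_num, Real.rpow_mul nN, one_div, Real.rpow_inv_le_iff_of_pos pV nN nN]
  norm_num
lemma KD.tail_bd (h : KD ξ c δ) : ∃ K : ℝ, 0 ≤ K ∧ ∀ s : ℝ, 1 ≤ s → s ^ δ * (∫ t in Set.Ioi s, |jf ξ c δ t|) ≤ K * Real.exp (-1/4 * s) := by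
  obtain ⟨K, hK, hb⟩ := h.jf_bd
  refine ⟨4 * K, pV, fun s hs => ?_⟩
  rw [← integral_const_mul]
  have h1 : ∫ t in Set.Ioi s, s ^ δ * |jf ξ c δ t| ≤ ∫ t in Set.Ioi s, K * Real.exp (-1/4 * t) := by
    refine setIntegral_mono_on ((h.jf_int hs).abs.const_mul _) ((integrableOn_exp_mul_Ioi (show (-1/4:ℝ) < 0 by norm_num) s).const_mul K) measurableSet_Ioi fun t ht => ?_
    have ht1 : s < t := ht
    have ht0 : 0 < t := lI
    rw [jf, abs_mul, abs_of_nonneg (Real.rpow_nonneg ht0.le _)]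
    have h2 : s ^ δ * t ^ (-δ - 1) ≤ 1 := by
      have h3 : s ^ δ ≤ t ^ δ := Real.rpow_le_rpow lI ht1.le (by linarith [h.d1])
      have h4 := mul_le_mul_of_nonneg_right h3 (Real.rpow_nonneg ht0.le (-δ - 1))
      rw [← Real.rpow_add ht0, show δ + (-δ - 1) = -1 by ring, Real.rpow_neg_one] at h4
      exact h4.trans (inv_le_one_of_one_le₀ lI)
    calc s ^ δ * (|kap ξ c (t - 1)| * t ^ (-δ - 1)) = |kap ξ c (t - 1)| * (s ^ δ * t ^ (-δ - 1)) := by ring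
      _ ≤ |kap ξ c (t - 1)| := mul_le_of_le_one_right (abs_nonneg _) h2
      _ ≤ _ := hb t lI
  refine h1.trans (le_of_eq ?_)
  rw [integral_const_mul, integral_exp_mul_Ioi nN]; ring
variable {ξ : ℝ → ℝ} {c δ : ℝ}
lemma KX.xs_ii (h : KX ξ c) (a b : ℝ) : IntervalIntegrable (fun s => ξ (s - 1)) volume a b := by
  have := (h.xi_ii (a - 1) (b - 1)).comp_sub_right 1
  simpa using this
lemma KX.ks_ii (h : KX ξ c) (a b : ℝ) : IntervalIntegrable (fun s => kap ξ c (s - 1)) volume a b := by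
  have := (h.k_ii (a - 1) (b - 1)).comp_sub_right 1
  simpa using this
lemma KD.ll_ii (h : KD ξ c δ) (a b : ℝ) : IntervalIntegrable (ll ξ δ) volume a b := by
  have h1 := intervalIntegral.continuous_primitive h.ww_ii 1
  have h2 : Continuous fun s : ℝ => s ^ δ := Real.continuous_rpow_const (by linarith [h.d1])
  exact ((h.xs_ii a b).sub ((h.xi_ii a b).div_const _)).sub (Continuous.intervalIntegrable fP a b)
lemma inv_co {a b : ℝ} (ha : 1 ≤ a) (hb : 1 ≤ b) : ContinuousOn (fun u : ℝ => u⁻¹) (Set.uIcc a b) := by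
  intro u hu
  have : 1 ≤ u := (le_min ha hb).trans hu.1
  exact (continuousAt_inv₀ lI).continuousWithinAt
lemma KD.lls_ii (h : KD ξ c δ) {a b : ℝ} (ha : 1 ≤ a) (hb : 1 ≤ b) : IntervalIntegrable (fun s => |ll ξ δ s| * s⁻¹) volume a b :=
  (h.ll_ii a b).abs.mul_continuousOn (inv_co ha hb)
lemma N12 (h : KD ξ c δ) : ∫ s in o1..2, |ll ξ δ s| * s⁻¹ ≤ 0.6909 := by
  have hd1 := h.d1
  have hd2 := h.d2
  have h0 : o0 ∉ Set.uIcc 1 2 := by rw [Set.uIcc_of_le nN]; intro hh; linarith [hh.1]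
  have i1 : ∀ r : ℝ, IntervalIntegrable (fun t : ℝ => t ^ r) volume 1 2 := fun r => intervalIntegral.intervalIntegrable_rpow (Or.inr h0)
  have hA : 0 ≤ AA δ := div_nonneg (mul_nonneg lI lI) lI
  have k := intervalIntegral.integral_mono_on_of_le_Ioo (by norm_num : o1 ≤ 2) (h.lls_ii le_rfl nN)
    (((i1 (-2)).const_mul (2 / (1 + δ))).add ((i1 (δ - 1)).const_mul (AA δ))) (fun s hs => by
      have hs0 : 0 < s := by linarith [hs.1]
      have hp := Real.rpow_pos_of_pos hs0 δ
      rw [h.ll12 hs.1.le hs.2, abs_neg, abs_of_nonneg pV]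
      refine le_of_eq ?_
      rw [Real.rpow_sub hs0, Real.rpow_one, show (-2:ℝ) = ((-2:ℤ):ℝ) by norm_num, Real.rpow_intCast, zpow_neg]
      have : 1 + δ ≠ 0 := lI
      field_simp)
  refine k.trans ?_
  rw [intervalIntegral.integral_add ((i1 _).const_mul _) ((i1 _).const_mul _), intervalIntegral.integral_const_mul, intervalIntegral.integral_const_mul,
    integral_rpow (Or.inr ⟨nN, h0⟩), integral_rpow (Or.inl lI)]
  have e : δ - 1 + 1 = δ := by ring
  have e2 : o2 ^ (-2 + 1 : ℝ) = 1 / 2 := by norm_num [Real.rpow_neg_one]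
  rw [e, e2, Real.one_rpow, Real.one_rpow, AA]
  have : 2 / (1 + δ) * ((1 / 2 - 1) / (-2 + 1)) + δ * (1 - δ) / (1 + δ) * ((2 ^ δ - 1) / δ) = (1 + (1 - δ) * (2 ^ δ - 1)) / (1 + δ) := by
    have : 1 + δ ≠ 0 := lI
    have : δ ≠ 0 := lI
    field_simp; ring
  rw [this, div_le_iff₀ lI]
  have := mul_le_mul_of_nonneg_left (two_pow h) (by linarith : 0 ≤ 1 - δ)
  nlinarith
lemma KD.jfa_ii (h : KD ξ c δ) {a b : ℝ} (ha : 1 ≤ a) (hb : 1 ≤ b) : IntervalIntegrable (fun s => |jf ξ c δ s|) volume a b := by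
  rw [intervalIntegrable_iff]
  refine ((h.jf_int le_rfl).mono_set ?_).abs
  intro s hs
  exact lt_of_le_of_lt (le_min ha hb) hs.1
lemma KD.ibp (h : KD ξ c δ) {S : ℝ} (hS : 2 ≤ S) :
    ∫ s in o2..S, (δ * s ^ (δ - 1) * (∫ t in Set.Ioi s, |jf ξ c δ t|)) ≤ S ^ δ * (∫ t in Set.Ioi S, |jf ξ c δ t|)
      + ∫ s in o2..S, |kap ξ c (s - 1)| * (s⁻¹ - 2 * s⁻¹ ^ 2) := by
  have hd1 := h.d1
  have hd2 := h.d2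
  have tl : ∀ s, 2 ≤ s → ∫ t in Set.Ioi s, |jf ξ c δ t| = (∫ t in Set.Ioi o2, |jf ξ c δ t|) - ∫ t in o2..s, |jf ξ c δ t| := fun s hs => by
    rw [← intervalIntegral.integral_interval_add_Ioi (a := 2) (b := s) (h.jf_int nN).abs (h.jf_int lI).abs]; ring
  generalize hJA : (∫ t in Set.Ioi o2, |jf ξ c δ t|) = JA at tl
  have hco : ContinuousOn (fun s => ∫ t in o2..s, |jf ξ c δ t|) (Set.Icc 2 S) := by
    have := intervalIntegral.continuousOn_primitive_interval (f := fun s => |jf ξ c δ s|) (μ := volume) (a := 2) (b := S)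
      ((intervalIntegrable_iff_integrableOn_Icc_of_le hS).1 (h.jfa_ii nN lI) |> fun hh => by rwa [Set.uIcc_of_le hS])
    rwa [Set.uIcc_of_le hS] at this
  have hpc : Continuous fun s : ℝ => s ^ δ := Real.continuous_rpow_const lI
  have h0 : o0 ∉ Set.uIcc 2 S := by rw [Set.uIcc_of_le hS]; intro hh; linarith [hh.1]
  have iA : IntervalIntegrable (fun s => δ * s ^ (δ - 1) * (JA - ∫ t in o2..s, |jf ξ c δ t|)) volume 2 S := by
    refine ((intervalIntegral.intervalIntegrable_rpow (Or.inr h0)).const_mul δ).mul_continuousOn ?_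
    rw [Set.uIcc_of_le hS]
    exact continuousOn_const.sub hco
  have iB : IntervalIntegrable (fun s => |kap ξ c (s - 1)| * s⁻¹) volume 2 S := (h.ks_ii 2 S).abs.mul_continuousOn (inv_co nN lI)
  have iC : IntervalIntegrable (fun s => |kap ξ c (s - 1)| * (2 * s⁻¹ ^ 2)) volume 2 S := (h.ks_ii 2 S).abs.mul_continuousOn (((inv_co nN lI).pow 2).const_mul 2)
  have k := intervalIntegral.integral_eq_sub_of_hasDerivAt_of_le hS (f := fun s => s ^ δ * (JA - ∫ t in o2..s, |jf ξ c δ t|))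
    (f' := fun s => δ * s ^ (δ - 1) * (JA - ∫ t in o2..s, |jf ξ c δ t|) - |kap ξ c (s - 1)| * s⁻¹)
    (hpc.continuousOn.mul (continuousOn_const.sub hco)) (fun s hs => by
      have hs0 : 0 < s := by linarith [hs.1]
      have c1 : ContinuousAt (fun s => |jf ξ c δ s|) s := by
        have c2 : ContinuousAt ξ (s - 1) := h.cont.continuousAt (Ici_mem_nhds (by linarith [hs.1]))
        have c3 : ContinuousAt (fun s : ℝ => ξ (s - 1)) s := ContinuousAt.comp (f := fun s : ℝ => s - 1) c2 fP
        have c4 : ContinuousAt (fun s : ℝ => s ^ (-δ - 1)) s := Real.continuousAt_rpow_const _ _ (Or.inl hs0.ne')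
        unfold jf kap
        exact ((c3.sub fP).mul c4).abs
      have d1 := intervalIntegral.integral_hasDerivAt_right (h.jfa_ii (a := 2) (b := s) nN (by linarith [hs.1]))
        (h.jf_meas.abs.stronglyMeasurable.stronglyMeasurableAtFilter) c1
      have d2 := (Real.hasDerivAt_rpow_const (x := s) (p := δ) (Or.inl hs0.ne')).fun_mul (d1.const_sub JA)
      refine d2.congr_deriv ?_
      have : s ^ δ * |jf ξ c δ s| = |kap ξ c (s - 1)| * s⁻¹ := by
        rw [jf, abs_mul, abs_of_nonneg (Real.rpow_nonneg hs0.le _), mul_left_comm, ← Real.rpow_add hs0, show δ + (-δ - 1) = -1 by ring, Real.rpow_neg_one]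
      rw [← this]; ring) (iA.sub iB)
  rw [intervalIntegral.integral_sub iA iB] at k
  have e1 : ∫ s in o2..S, (δ * s ^ (δ - 1) * (∫ t in Set.Ioi s, |jf ξ c δ t|)) = ∫ s in o2..S, δ * s ^ (δ - 1) * (JA - ∫ t in o2..s, |jf ξ c δ t|) := by
    refine intervalIntegral.integral_congr fun s hs => ?_
    rw [Set.uIcc_of_le hS] at hs
    rw [tl s hs.1]
  have e2 : ∫ s in o2..S, |kap ξ c (s - 1)| * (s⁻¹ - 2 * s⁻¹ ^ 2) = (∫ s in o2..S, |kap ξ c (s - 1)| * s⁻¹) - ∫ s in o2..S, |kap ξ c (s - 1)| * (2 * s⁻¹ ^ 2) := by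
    rw [← intervalIntegral.integral_sub iB iC]; simp only [mul_sub]
  have e3 : ∫ s in o2..S, |kap ξ c (s - 1)| * (2 * s⁻¹ ^ 2) ≤ 2 ^ δ * JA := by
    have m1 : ∫ s in o2..S, |kap ξ c (s - 1)| * (2 * s⁻¹ ^ 2) ≤ ∫ s in o2..S, 2 ^ δ * |jf ξ c δ s| := by
      refine intervalIntegral.integral_mono_on hS iC ((h.jfa_ii nN lI).const_mul _) fun s hs => ?_
      have hs0 : 0 < s := by linarith [hs.1]
      rw [jf, abs_mul, abs_of_nonneg (Real.rpow_nonneg hs0.le _), show 2 ^ δ * (|kap ξ c (s - 1)| * s ^ (-δ - 1)) = |kap ξ c (s - 1)| * (2 ^ δ * s ^ (-δ - 1)) by ring]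
      refine mul_le_mul_of_nonneg_left ?_ (abs_nonneg _)
      have q : (2 / s) ^ o1 ≤ (2 / s) ^ δ := Real.rpow_le_rpow_of_exponent_ge pV ((div_le_one hs0).2 hs.1) lI
      rw [Real.rpow_one, Real.div_rpow nN hs0.le] at q
      rw [Real.rpow_sub hs0, Real.rpow_neg hs0.le, Real.rpow_one]
      have := mul_le_mul_of_nonneg_right q (inv_pos.2 hs0).le
      calc 2 * s⁻¹ ^ 2 = 2 / s * s⁻¹ := by field_simp
        _ ≤ _ := this
        _ = _ := by field_simp
    rw [intervalIntegral.integral_const_mul] at m1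
    refine m1.trans (mul_le_mul_of_nonneg_left ?_ pV)
    have := tl S hS
    have : 0 ≤ ∫ t in Set.Ioi S, |jf ξ c δ t| := integral_nonneg fun _ => abs_nonneg _
    linarith
  rw [e1, e2, tl S hS]
  simp only [intervalIntegral.integral_same, sub_zero] at k
  linarith
lemma KD.N2S (h : KD ξ c δ) {S : ℝ} (hS : 2 ≤ S) :
    ∫ s in o2..S, |ll ξ δ s| * s⁻¹ ≤ 0.303 + 0.1672 * (S ^ δ * (∫ t in Set.Ioi S, |jf ξ c δ t|)) := by
  have hd1 := h.d1
  have hd2 := h.d2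
  have hA : 0 ≤ AA δ := div_nonneg (mul_nonneg lI lI) lI
  have hib := h.ibp hS
  have i0 : IntervalIntegrable (fun s => |kap ξ c (s - 1)| * s⁻¹) volume 2 S := (h.ks_ii 2 S).abs.mul_continuousOn (inv_co nN lI)
  have i1 : IntervalIntegrable (fun s => |kap ξ c (s - 1)| * (s⁻¹ - 2 * s⁻¹ ^ 2)) volume 2 S := (h.ks_ii 2 S).abs.mul_continuousOn ((inv_co nN lI).sub (((inv_co nN lI).pow 2).const_mul 2))
  have i2 : IntervalIntegrable (fun s => |kap ξ c s| * (0.5836 / s)) volume 2 S := h.kv_ii nN lI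
  have h0 : o0 ∉ Set.uIcc 2 S := by rw [Set.uIcc_of_le hS]; intro hh; linarith [hh.1]
  have i3 : IntervalIntegrable (fun s => (δ * s ^ (δ - 1) * (∫ t in Set.Ioi s, |jf ξ c δ t|))) volume 2 S := by
    refine ((intervalIntegral.intervalIntegrable_rpow (Or.inr h0)).const_mul δ).mul_continuousOn ?_
    have hJ : IntegrableOn (fun s => |jf ξ c δ s|) (Set.uIcc 2 S) := by
      rw [Set.uIcc_of_le hS]; exact (intervalIntegrable_iff_integrableOn_Icc_of_le hS).1 (h.jfa_ii nN lI)
    have := intervalIntegral.continuousOn_primitive_interval (μ := volume) (a := 2) (b := S) hJ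
    refine (continuousOn_const (c := ∫ t in Set.Ioi o2, |jf ξ c δ t|) |>.sub this).congr fun s hs => ?_
    rw [Set.uIcc_of_le hS] at hs
    rw [Pi.sub_apply, ← intervalIntegral.integral_interval_add_Ioi (a := 2) (b := s) (h.jf_int nN).abs (h.jf_int (by linarith [hs.1])).abs]; ring
  have hr : AA δ / δ ≤ 0.1672 := by
    rw [AA, div_div, div_le_iff₀ (by nlinarith)]; nlinarith
  have k := intervalIntegral.integral_mono_on hS (h.lls_ii nN lI) ((i0.add i2).add (i3.const_mul 0.1672)) (fun s hs => by
      have hs0 : 0 < s := by linarith [hs.1]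
      have hp := Real.rpow_pos_of_pos hs0 δ
      rw [h.ll_tail (by linarith [hs.1])]
      have a1 : |∫ t in Set.Ioi s, jf ξ c δ t| ≤ ∫ t in Set.Ioi s, |jf ξ c δ t| := abs_integral_le_integral_abs
      generalize (∫ t in Set.Ioi s, jf ξ c δ t) = X at a1
      generalize (∫ t in Set.Ioi s, |jf ξ c δ t|) = Y at a1
      have a2 : |kap ξ c (s - 1) - kap ξ c s / (1 + δ) + AA δ * (s ^ δ * X)| ≤ |kap ξ c (s - 1)| + |kap ξ c s| * 0.5836 + AA δ * (s ^ δ * Y) := by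
        refine (abs_add_le _ _).trans (add_le_add ((abs_sub _ _).trans (add_le_add le_rfl ?_)) ?_)
        · rw [abs_div, abs_of_pos (by linarith : 0 < 1 + δ), div_eq_mul_inv]
          refine mul_le_mul_of_nonneg_left ?_ (abs_nonneg _)
          rw [inv_le_comm₀ lI nN]; norm_num; linarith
        · rw [abs_mul, abs_mul, abs_of_nonneg hA, abs_of_pos hp]
          exact mul_le_mul_of_nonneg_left (mul_le_mul_of_nonneg_left a1 hp.le) hA
      have a3 := mul_le_mul_of_nonneg_right a2 (inv_pos.2 hs0).le
      refine a3.trans ?_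
      have hY : 0 ≤ Y := (abs_nonneg _).trans a1
      have a4 : AA δ * (s ^ δ * Y) * s⁻¹ ≤ 0.1672 * (δ * s ^ (δ - 1) * Y) := by
        have : AA δ * (s ^ δ * Y) * s⁻¹ = AA δ / δ * (δ * s ^ (δ - 1) * Y) := by
          rw [Real.rpow_sub hs0, Real.rpow_one]
          have : δ ≠ 0 := lI
          field_simp
        rw [this]
        have := Real.rpow_pos_of_pos hs0 (δ - 1)
        exact mul_le_mul_of_nonneg_right hr (mul_nonneg (mul_nonneg lI this.le) hY)
      calc _ = |kap ξ c (s - 1)| * s⁻¹ + |kap ξ c s| * (0.5836 / s) + AA δ * (s ^ δ * Y) * s⁻¹ := by ring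
        _ ≤ _ := lI)
  rw [intervalIntegral.integral_add (i0.add i2) (i3.const_mul _), intervalIntegral.integral_add i0 i2, intervalIntegral.integral_const_mul] at k
  have nk := NumK h.toKC hS
  have e : ∫ u in o1..(S - 1), |kap ξ c u| * W1 u = (∫ s in o2..S, |kap ξ c (s - 1)| * s⁻¹) + 0.1672 * ∫ s in o2..S, |kap ξ c (s - 1)| * (s⁻¹ - 2 * s⁻¹ ^ 2) := by
    rw [← intervalIntegral.integral_const_mul, ← intervalIntegral.integral_add i0 (i1.const_mul _)]
    have := intervalIntegral.integral_comp_sub_right (a := 2) (b := S) (fun u => |kap ξ c u| * W1 u) 1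
    rw [show o2 - 1 = 1 by norm_num] at this
    rw [← this]
    refine intervalIntegral.integral_congr fun s hs => ?_
    rw [Set.uIcc_of_le hS] at hs
    have hs0 : s ≠ 0 := by linarith [hs.1]
    simp only [W1, sub_add_cancel]
    field_simp
    ring
  linarith
lemma KD.Nlt (h : KD ξ c δ) {S : ℝ} (hS : 1 ≤ S) : ∫ s in o1..S, |ll ξ δ s| * s⁻¹ ≤ 0.995 := by
  obtain ⟨K, hK, hb⟩ := h.tail_bd
  have hmain : ∀ X : ℝ, max S 2 ≤ X → ∫ s in o1..S, |ll ξ δ s| * s⁻¹ ≤ 0.995 + 0.1672 * (K * Real.exp (-1/4 * X)) := by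
    intro X hX
    have hX1 := (le_max_left _ _).trans hX
    have hX2 := (le_max_right _ _).trans hX
    have e1 := intervalIntegral.integral_add_adjacent_intervals (h.lls_ii (a := 1) (b := S) le_rfl hS) (h.lls_ii (b := X) hS lI)
    have e2 := intervalIntegral.integral_add_adjacent_intervals (h.lls_ii (a := 1) (b := 2) le_rfl nN) (h.lls_ii (b := X) nN lI)
    have p : 0 ≤ ∫ s in S..X, |ll ξ δ s| * s⁻¹ := intervalIntegral.integral_nonneg hX1 fun s hs => mul_nonneg (abs_nonneg _) (inv_nonneg.2 (by linarith [hs.1]))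
    have := N12 h
    have := h.N2S hX2
    have := hb X lI
    linarith
  have ht : Tendsto (fun X : ℝ => 0.995 + 0.1672 * (K * Real.exp (-1/4 * X))) atTop (𝓝 (0.995 + 0.1672 * (K * 0))) := by
    refine (Tendsto.const_mul _ (Tendsto.const_mul _ ?_)).const_add _
    exact Real.tendsto_exp_atBot.comp (tendsto_id.const_mul_atTop_of_neg nN)
  rw [mul_zero, mul_zero, add_zero] at ht
  exact ge_of_tendsto ht ((eventually_ge_atTop _).mono hmain)
variable {ξ : ℝ → ℝ} {c δ : ℝ}
lemma bd_ii {f : ℝ → ℝ} (hf : Measurable f) {a b M : ℝ} (hab : a ≤ b) (hM : ∀ r, a < r → r ≤ b → |f r| ≤ M) : IntervalIntegrable f volume a b := by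
  rw [intervalIntegrable_iff_integrableOn_Ioc_of_le hab]
  refine Measure.integrableOn_of_bounded (M := M) sI hf.aestronglyMeasurable ?_
  rw [ae_restrict_iff' measurableSet_Ioc]
  exact Eventually.of_forall fun r hr => hM r hr.1 hr.2
lemma KX.xi_loc (h : KX ξ c) (X : ℝ) : ∃ K : ℝ, 0 ≤ K ∧ ∀ u, u ≤ X → |ξ u| ≤ K := by
  obtain ⟨K, hK, hb⟩ := h.xi_up
  refine ⟨K * |X|, pV, fun u hu => ?_⟩
  rcases lt_or_ge u 1 with h1 | h1
  · rw [h.z u h1]; simp; positivity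
  · rw [abs_of_nonneg (h.nonneg u)]
    exact (hb u h1).trans (mul_le_mul_of_nonneg_left (hu.trans (le_abs_self _)) hK.le)
lemma mul_subst (f : ℝ → ℝ) {x : ℝ} (hx : 1 ≤ x) : ∫ t in o1..x, f (x / t) * t⁻¹ = ∫ s in o1..x, f s * s⁻¹ := by
  have hx0 : 0 < x := lI
  have im : (fun t => x / t) '' Set.Icc 1 x = Set.Icc 1 x := by
    ext s; constructor
    · rintro ⟨t, ht, rfl⟩
      have ht0 : 0 < t := by linarith [ht.1]
      exact ⟨(one_le_div ht0).2 ht.2, div_le_self hx0.le ht.1⟩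
    · intro hs
      have hs0 : 0 < s := by linarith [hs.1]
      exact ⟨x / s, ⟨(one_le_div hs0).2 hs.2, div_le_self hx0.le hs.1⟩, by simp only; field_simp⟩
  have k := integral_image_eq_integral_abs_deriv_smul (s := Set.Icc 1 x) (f := fun t => x / t) (f' := fun t => -x / t ^ 2) measurableSet_Icc
    (fun t ht => by
      have ht0 : t ≠ 0 := by linarith [ht.1]
      have := ((hasDerivAt_const t x).div (hasDerivAt_id t) ht0).hasDerivWithinAt (s := Set.Icc 1 x)
      refine this.congr_deriv ?_
      simp) (fun t ht u hu hh => by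
      have ht0 : t ≠ 0 := by linarith [ht.1]
      have hu0 : u ≠ 0 := by linarith [hu.1]
      simp only at hh
      rw [div_eq_div_iff ht0 hu0] at hh
      exact (mul_left_cancel₀ hx0.ne' hh).symm) (fun s => f s * s⁻¹)
  rw [im] at k
  rw [intervalIntegral.integral_of_le hx, intervalIntegral.integral_of_le hx, ← integral_Icc_eq_integral_Ioc, ← integral_Icc_eq_integral_Ioc, k]
  refine setIntegral_congr_fun measurableSet_Icc fun t ht => ?_
  have ht0 : 0 < t := by linarith [ht.1]
  simp only [smul_eq_mul]
  rw [abs_div, abs_neg, abs_of_pos hx0, abs_of_pos pV]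
  field_simp
lemma KX.fub (h : KX ξ c) {G : ℝ → ℝ} (hGm : Measurable G) {M : ℝ} (hM : 0 ≤ M) (hG : ∀ r, 1 ≤ r → |G r| ≤ M * r) {q x : ℝ} (hq : q ≤ 0) (hx : 1 ≤ x) :
    IntervalIntegrable (fun r => r ^ q * ∫ t in o1..r, ξ (r / t - 1) / t * G t) volume 1 x ∧
    IntervalIntegrable (fun t => G t * t ^ q * ∫ s in o1..(x / t), ξ (s - 1) * s ^ q) volume 1 x ∧
    ∫ r in o1..x, r ^ q * (∫ t in o1..r, ξ (r / t - 1) / t * G t) = ∫ t in o1..x, G t * t ^ q * ∫ s in o1..(x / t), ξ (s - 1) * s ^ q := by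
  obtain ⟨K, hK, hb⟩ := h.xi_loc x
  have hm := h.meas
  set F : ℝ × ℝ → ℝ := fun p => p.1 ^ q * (ξ (p.1 / p.2 - 1) / p.2 * G p.2) with hF
  have hFm : Measurable F := by
    refine (measurable_fst.pow_const q).mul (((hm.comp ((measurable_fst.div measurable_snd).sub_const 1)).div measurable_snd).mul (hGm.comp measurable_snd))
  have hI : Integrable F ((volume.restrict (Set.Ioc 1 x)).prod (volume.restrict (Set.Ioc 1 x))) := by
    refine Integrable.of_bound (C := K * (M * x)) hFm.aestronglyMeasurable ?_
    rw [Measure.prod_restrict, ae_restrict_iff' (measurableSet_Ioc.prod measurableSet_Ioc)]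
    refine Eventually.of_forall fun p hp => ?_
    obtain ⟨⟨a1, a2⟩, b1, b2⟩ := hp
    have h1 : p.1 ^ q ≤ 1 := Real.rpow_le_one_of_one_le_of_nonpos a1.le hq
    have h0 : 0 ≤ p.1 ^ q := Real.rpow_nonneg lI _
    have hp0 : 0 < p.2 := lI
    have h2 : |ξ (p.1 / p.2 - 1) / p.2| ≤ K := by
      rw [abs_div, abs_of_pos hp0]
      refine (div_le_self (abs_nonneg _) b1.le).trans (hb _ ?_)
      have := div_le_self (by linarith : 0 ≤ p.1) b1.le
      linarith
    have h3 := (hG p.2 b1.le).trans (mul_le_mul_of_nonneg_left b2 hM)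
    rw [hF, Real.norm_eq_abs, abs_mul, abs_of_nonneg h0, abs_mul]
    exact (mul_le_of_le_one_left pV h1).trans (mul_le_mul h2 h3 (abs_nonneg _) hK)
  have inner : ∀ r ∈ Set.Ioc 1 x, r ^ q * (∫ t in o1..r, ξ (r / t - 1) / t * G t) = ∫ t in Set.Ioc 1 x, F (r, t) := by
    intro r hr
    rw [hF]; simp only
    rw [integral_const_mul, intervalIntegral.integral_of_le hr.1.le]
    congr 1
    symm
    refine setIntegral_eq_of_subset_of_forall_sdiff_eq_zero measurableSet_Ioc (Set.Ioc_subset_Ioc_right hr.2) fun t ht => ?_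
    have h1 : 1 < t := ht.1.1
    have h2 : r < t := by
      by_contra hc
      exact ht.2 ⟨h1, lI⟩
    rw [h.z _ (by rw [sub_lt_iff_lt_add, div_lt_iff₀ lI]; linarith)]; simp
  have outer : ∀ t ∈ Set.Ioc 1 x, ∫ r in Set.Ioc 1 x, F (r, t) = G t * t ^ q * ∫ s in o1..(x / t), ξ (s - 1) * s ^ q := by
    intro t ht
    have ht0 : 0 < t := by linarith [ht.1]
    have e1 : ∫ r in Set.Ioc 1 x, F (r, t) = ∫ r in Set.Ioc t x, F (r, t) := by
      refine setIntegral_eq_of_subset_of_forall_sdiff_eq_zero measurableSet_Ioc (Set.Ioc_subset_Ioc_left ht.1.le) fun r hr => ?_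
      have h2 : r ≤ t := by
        by_contra hc
        exact hr.2 ⟨lI, hr.1.2⟩
      rw [hF]; simp only
      rw [h.z _ (by rw [sub_lt_iff_lt_add, div_lt_iff₀ lI]; linarith)]; simp
    rw [e1, ← intervalIntegral.integral_of_le ht.2]
    have e2 := intervalIntegral.integral_comp_div (a := t) (b := x) (fun s => G t * t ^ q * t⁻¹ * (ξ (s - 1) * s ^ q)) ht0.ne'
    simp only [div_self ht0.ne', intervalIntegral.integral_const_mul, smul_eq_mul] at e2
    have e3 : ∫ r in t..x, F (r, t) = ∫ r in t..x, G t * t ^ q * t⁻¹ * (ξ (r / t - 1) * (r / t) ^ q) := by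
      refine intervalIntegral.integral_congr fun r hr => ?_
      rw [Set.uIcc_of_le ht.2] at hr
      have hp := Real.rpow_pos_of_pos ht0 q
      simp only [hF]
      rw [Real.div_rpow (by linarith [hr.1]) ht0.le]
      field_simp
    rw [e3, intervalIntegral.integral_const_mul, e2]
    field_simp
  refine ⟨?_, ?_, ?_⟩
  · rw [intervalIntegrable_iff_integrableOn_Ioc_of_le hx]
    exact (integrableOn_congr_fun inner measurableSet_Ioc).2 hI.integral_prod_left
  · rw [intervalIntegrable_iff_integrableOn_Ioc_of_le hx]
    exact (integrableOn_congr_fun outer measurableSet_Ioc).1 hI.integral_prod_right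
  · rw [intervalIntegral.integral_of_le hx, intervalIntegral.integral_of_le hx, setIntegral_congr_fun measurableSet_Ioc inner,
      ← setIntegral_congr_fun measurableSet_Ioc outer]
    exact integral_integral_swap hI
lemma KD.ll_bd (h : KD ξ c δ) : ∃ K : ℝ, 0 ≤ K ∧ ∀ s, 1 ≤ s → |ll ξ δ s| ≤ K := by
  obtain ⟨K1, hK1, h1⟩ := h.k_bd
  obtain ⟨K2, hK2, h2⟩ := h.tail_bd
  have hd1 := h.d1
  have hd2 := h.d2
  have hA : 0 ≤ AA δ := div_nonneg (mul_nonneg lI lI) lI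
  refine ⟨K1 + K1 + AA δ * K2, pV, fun s hs => ?_⟩
  rw [h.ll_tail hs]
  have hp := Real.rpow_pos_of_pos (by linarith : 0 < s) δ
  have a1 : |∫ t in Set.Ioi s, jf ξ c δ t| ≤ ∫ t in Set.Ioi s, |jf ξ c δ t| := abs_integral_le_integral_abs
  refine (abs_add_le _ _).trans (add_le_add ((abs_sub _ _).trans (add_le_add (h1 _ lI) ?_)) ?_)
  · rw [abs_div, abs_of_pos (by linarith : 0 < 1 + δ)]
    exact (div_le_self (abs_nonneg _) lI).trans (h1 _ lI)
  · rw [abs_mul, abs_mul, abs_of_nonneg hA, abs_of_pos hp]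
    refine mul_le_mul_of_nonneg_left ((mul_le_mul_of_nonneg_left a1 hp.le).trans ((h2 s hs).trans ?_)) hA
    exact mul_le_of_le_one_right hK2 (Real.exp_le_one_iff.2 lI)
variable {ξ : ℝ → ℝ} {c δ : ℝ}
def Er (ξ G : ℝ → ℝ) (α x : ℝ) : ℝ := G x + (∫ r in o1..x, ξ (x / r - 1) / r * G r) - α * x
lemma KX.Er_int (h : KX ξ c) {G : ℝ → ℝ} (hGm : Measurable G) {M : ℝ} (hM : 0 ≤ M) (hG : ∀ r, 1 ≤ r → |G r| ≤ M * r) {q x : ℝ} (hq : q ≤ 0) (hx : 1 ≤ x) (α : ℝ) :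
    IntervalIntegrable (fun r => r ^ q * Er ξ G α r) volume 1 x ∧
    IntervalIntegrable (fun t => G t * t ^ q * (1 + ∫ s in o1..(x / t), ξ (s - 1) * s ^ q)) volume 1 x ∧
    ∫ r in o1..x, r ^ q * Er ξ G α r = (∫ t in o1..x, G t * t ^ q * (1 + ∫ s in o1..(x / t), ξ (s - 1) * s ^ q)) - α * ∫ r in o1..x, r ^ (q + 1) := by
  obtain ⟨f1, f2, f3⟩ := h.fub hGm hM hG hq hx
  have h0 : o0 ∉ Set.uIcc 1 x := by rw [Set.uIcc_of_le hx]; intro hh; linarith [hh.1]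
  have i1 : IntervalIntegrable (fun t : ℝ => t ^ (q + 1)) volume 1 x := intervalIntegral.intervalIntegrable_rpow (Or.inr h0)
  have i2 : IntervalIntegrable (fun t : ℝ => G t * t ^ q) volume 1 x := by
    refine bd_ii (M := M * x) (hGm.mul (measurable_id.pow_const q)) hx fun r h1 h2 => ?_
    have a1 : r ^ q ≤ 1 := Real.rpow_le_one_of_one_le_of_nonpos h1.le hq
    change |G r * r ^ q| ≤ _
    rw [abs_mul, abs_of_nonneg (Real.rpow_nonneg (by linarith : 0 ≤ r) _)]
    exact (mul_le_of_le_one_right (abs_nonneg _) a1).trans ((hG r h1.le).trans (mul_le_mul_of_nonneg_left h2 hM))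
  have e1 : Set.EqOn (fun r => (G r * r ^ q + r ^ q * (∫ t in o1..r, ξ (r / t - 1) / t * G t)) - α * r ^ (q + 1)) (fun r => r ^ q * Er ξ G α r) (Set.uIcc 1 x) := by
    intro r hr
    rw [Set.uIcc_of_le hx] at hr
    simp only [Er]
    rw [Real.rpow_add_one (by linarith [hr.1])]; ring
  have e2 : (fun t => G t * t ^ q * (1 + ∫ s in o1..(x / t), ξ (s - 1) * s ^ q)) = fun t => G t * t ^ q + G t * t ^ q * ∫ s in o1..(x / t), ξ (s - 1) * s ^ q := by
    funext t; ring
  refine ⟨((i2.add f1).sub (i1.const_mul α)).congr fun r hr => e1 (Set.uIoc_subset_uIcc hr), ?_, ?_⟩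
  · rw [e2]; exact i2.add f2
  · rw [e2, ← intervalIntegral.integral_congr e1, intervalIntegral.integral_sub (i2.add f1) (i1.const_mul α), intervalIntegral.integral_add i2 f1,
      intervalIntegral.integral_add i2 f2, f3, intervalIntegral.integral_const_mul]
lemma KX.e1 (h : KX ξ c) {s : ℝ} (hs : 1 ≤ s) : ξ s = 2 * (s⁻¹ * (1 + ∫ u in o1..s, ξ (u - 1) * u ^ o0)) := by
  have e := h.e s hs
  have h1 : ∫ u in o1..s, ξ (u - 1) * u ^ o0 = ∫ t in o1..(s - 1), ξ t := by
    simp only [Real.rpow_zero, mul_one]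
    rw [intervalIntegral.integral_comp_sub_right (fun u => ξ u) 1]
    rcases le_total (s - 1) 1 with h2 | h2
    · rw [h.int_lt nN h2, h.int_lt le_rfl h2]
    · rw [← intervalIntegral.integral_add_adjacent_intervals (h.xi_ii _ 1) (h.xi_ii 1 _), h.int_lt nN le_rfl, zero_add]
  rw [h1]
  have : s ≠ 0 := lI
  field_simp
  linarith
lemma KD.inv1 (h : KD ξ c δ) {G : ℝ → ℝ} (hGm : Measurable G) {M : ℝ} (hM : 0 ≤ M) (hG : ∀ r, 1 ≤ r → |G r| ≤ M * r) (α : ℝ) {x : ℝ} (hx : 1 ≤ x) :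
    G x + (∫ t in o1..x, ll ξ δ (x / t) * t⁻¹ * G t) = Er ξ G α x - AA δ * (x ^ δ * ∫ r in o1..x, r ^ (-δ - 1) * Er ξ G α r)
      - 2 / (1 + δ) * (x⁻¹ * ∫ r in o1..x, r ^ o0 * Er ξ G α r) + α * δ / (1 + δ) * x ^ δ + α / (1 + δ) * x⁻¹ := by
  have hd1 := h.d1
  have hd2 := h.d2
  have hx0 : 0 < x := lI
  have h0 : o0 ∉ Set.uIcc 1 x := by rw [Set.uIcc_of_le hx]; intro hh; linarith [hh.1]
  obtain ⟨-, a2, a3⟩ := h.Er_int hGm hM hG (q := -δ - 1) lI hx α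
  obtain ⟨-, b2, b3⟩ := h.Er_int hGm hM hG (q := 0) le_rfl hx α
  have i0 : IntervalIntegrable (fun t => ξ (x / t - 1) / t * G t) volume 1 x := by
    obtain ⟨K, hK, hb⟩ := h.xi_loc x
    refine bd_ii (M := K * (M * x)) (((h.meas.comp ((measurable_const.div measurable_id).sub_const 1)).div measurable_id).mul hGm) hx fun t h1 h2 => ?_
    have ht0 : 0 < t := lI
    change |ξ (x / t - 1) / t * G t| ≤ _
    rw [abs_mul, abs_div, abs_of_pos ht0]
    refine mul_le_mul ((div_le_self (abs_nonneg _) h1.le).trans (hb _ ?_)) ((hG t h1.le).trans (mul_le_mul_of_nonneg_left h2 hM)) (abs_nonneg _) hK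
    have := div_le_self hx0.le h1.le
    linarith
  have e : ∫ t in o1..x, ll ξ δ (x / t) * t⁻¹ * G t = ∫ t in o1..x, (ξ (x / t - 1) / t * G t
      - AA δ * x ^ δ * (G t * t ^ (-δ - 1) * (1 + ∫ s in o1..(x / t), ξ (s - 1) * s ^ (-δ - 1))))
      - 2 / (1 + δ) * x⁻¹ * (G t * t ^ o0 * (1 + ∫ s in o1..(x / t), ξ (s - 1) * s ^ o0)) := by
    refine intervalIntegral.integral_congr fun t ht => ?_
    rw [Set.uIcc_of_le hx] at ht
    have ht0 : 0 < t := by linarith [ht.1]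
    have hp := Real.rpow_pos_of_pos ht0 δ
    simp only [ll]
    rw [h.e1 ((one_le_div ht0).2 ht.2), show (∫ t in o1..(x / t), ww ξ δ t) = ∫ s in o1..(x / t), ξ (s - 1) * s ^ (-δ - 1) from rfl]
    rw [Real.div_rpow hx0.le ht0.le, Real.rpow_sub ht0 (-δ) 1, Real.rpow_one, Real.rpow_neg ht0.le, Real.rpow_zero t]
    generalize (∫ s in o1..(x / t), ξ (s - 1) * s ^ (-δ - 1)) = X
    generalize (∫ s in o1..(x / t), ξ (s - 1) * s ^ o0) = Y
    have : 1 + δ ≠ 0 := lI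
    field_simp
    ring
  rw [e, intervalIntegral.integral_sub (i0.sub (a2.const_mul _)) (b2.const_mul _), intervalIntegral.integral_sub i0 (a2.const_mul _),
    intervalIntegral.integral_const_mul, intervalIntegral.integral_const_mul, a3, b3]
  rw [integral_rpow (Or.inl lI), integral_rpow (Or.inl lI), Er, AA]
  rw [show -δ - 1 + 1 + 1 = 1 - δ by ring, show o0 + 1 + 1 = 2 by norm_num, Real.rpow_sub hx0, Real.rpow_one, Real.one_rpow, Real.one_rpow, Real.rpow_two]
  have hp := Real.rpow_pos_of_pos hx0 δ
  have : 1 + δ ≠ 0 := lI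
  have : 1 - δ ≠ 0 := lI
  generalize (∫ t in o1..x, G t * t ^ (-δ - 1) * (1 + ∫ s in o1..(x / t), ξ (s - 1) * s ^ (-δ - 1))) = X
  generalize (∫ t in o1..x, G t * t ^ o0 * (1 + ∫ s in o1..(x / t), ξ (s - 1) * s ^ o0)) = Y
  generalize (∫ t in o1..x, ξ (x / t - 1) / t * G t) = Z
  field_simp
  ring
variable {ξ : ℝ → ℝ} {c δ : ℝ}
lemma tail_gen {f : ℝ → ℝ} {C p : ℝ} (hC : 0 ≤ C) (hp : p < 0) (hf : ∀ x, 1 ≤ x → IntervalIntegrable f volume 1 x) (hb : ∀ r, 1 ≤ r → |f r| ≤ C * r ^ (p - 1)) :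
    ∃ I : ℝ, ∀ x, 1 ≤ x → |I - ∫ r in o1..x, f r| ≤ C / (-p) * x ^ p := by
  have hi : ∀ x : ℝ, 1 ≤ x → IntegrableOn (fun r : ℝ => C * r ^ (p - 1)) (Set.Ioi x) := fun x hx =>
    (integrableOn_Ioi_rpow_of_lt lI lI).const_mul C
  have hI : IntegrableOn f (Set.Ioi 1) := by
    refine integrableOn_Ioi_of_intervalIntegral_norm_bounded (l := atTop) (b := fun x : ℝ => max 1 x) (∫ r in Set.Ioi o1, C * r ^ (p - 1)) 1 (fun x => ?_) (tendsto_atTop_mono (fun x => le_max_right _ _) tendsto_id) (Eventually.of_forall fun x => ?_)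
    · exact (intervalIntegrable_iff_integrableOn_Ioc_of_le (le_max_left _ _)).1 (hf _ (le_max_left _ _))
    · rw [intervalIntegral.integral_of_le (le_max_left _ _)]
      refine (setIntegral_mono_on ((intervalIntegrable_iff_integrableOn_Ioc_of_le (le_max_left _ _)).1 (hf _ (le_max_left _ _))).norm
        ((hi 1 le_rfl).mono_set Set.Ioc_subset_Ioi_self) measurableSet_Ioc fun r hr => hb r hr.1.le).trans ?_
      refine setIntegral_mono_set (hi 1 le_rfl) ?_ (Set.Ioc_subset_Ioi_self.eventuallyLE)
      rw [EventuallyLE, ae_restrict_iff' measurableSet_Ioi]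
      exact Eventually.of_forall fun r hr => mul_nonneg hC (Real.rpow_nonneg (le_of_lt (zero_lt_one.trans hr)) _)
  refine ⟨∫ r in Set.Ioi o1, f r, fun x hx => ?_⟩
  have hI2 : IntegrableOn f (Set.Ioi x) := hI.mono_set (Set.Ioi_subset_Ioi hx)
  rw [← intervalIntegral.integral_interval_add_Ioi hI hI2, add_sub_cancel_left]
  refine abs_integral_le_integral_abs.trans ((setIntegral_mono_on hI2.abs (hi x hx) measurableSet_Ioi fun r hr => hb r (hx.trans (le_of_lt hr))).trans (le_of_eq ?_))
  rw [integral_const_mul, integral_Ioi_rpow_of_lt lI lI, sub_add_cancel]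
  have : p ≠ 0 := hp.ne
  field_simp
lemma KD.inv2 (h : KD ξ c δ) {G : ℝ → ℝ} (hGm : Measurable G) {M : ℝ} (hM : 0 ≤ M) (hG : ∀ r, 1 ≤ r → |G r| ≤ M * r) {α C κ : ℝ} (hC : 0 ≤ C)
    (hκ : 0 ≤ κ) (hκ1 : κ ≤ 0.3) (hE : ∀ x, 1 ≤ x → |Er ξ G α x| ≤ C * x ^ κ) :
    ∃ ν C' : ℝ, 0 ≤ C' ∧ ∀ x, 1 ≤ x → |G x + (∫ t in o1..x, ll ξ δ (x / t) * t⁻¹ * G t) - ν * x ^ δ| ≤ C' * x ^ κ := by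
  have hd1 := h.d1
  have hd2 := h.d2
  have hA : 0 ≤ AA δ := div_nonneg (mul_nonneg lI lI) lI
  obtain ⟨I, hI⟩ := tail_gen (f := fun r => r ^ (-δ - 1) * Er ξ G α r) (C := C) (p := κ - δ) hC lI
    (fun x hx => (h.Er_int hGm hM hG (q := -δ - 1) lI hx α).1) (fun r hr => by
      have hr0 : 0 < r := lI
      rw [abs_mul, abs_of_pos (Real.rpow_pos_of_pos hr0 _), show κ - δ - 1 = (-δ - 1) + κ by ring, Real.rpow_add hr0]
      have := mul_le_mul_of_nonneg_left (hE r hr) (Real.rpow_nonneg hr0.le (-δ - 1))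
      linarith)
  refine ⟨α * δ / (1 + δ) - AA δ * I, C + AA δ * (C / (-(κ - δ))) + 2 / (1 + δ) * C + |α|, ?_, fun x hx => ?_⟩
  · have : 0 < -(κ - δ) := lI
    have : 0 < 1 + δ := lI
    positivity
  have hx0 : 0 < x := lI
  have hxk : 1 ≤ x ^ κ := Real.one_le_rpow hx hκ
  rw [h.inv1 hGm hM hG α hx]
  have t1 := hE x hx
  have t2 : |AA δ * (x ^ δ * (I - ∫ r in o1..x, r ^ (-δ - 1) * Er ξ G α r))| ≤ AA δ * (C / (-(κ - δ))) * x ^ κ := by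
    rw [abs_mul, abs_mul, abs_of_nonneg hA, abs_of_pos (Real.rpow_pos_of_pos hx0 δ), mul_assoc]
    refine mul_le_mul_of_nonneg_left ?_ hA
    have := mul_le_mul_of_nonneg_left (hI x hx) (Real.rpow_nonneg hx0.le δ)
    refine this.trans (le_of_eq ?_)
    rw [mul_left_comm, ← Real.rpow_add hx0]
    ring_nf
  have t3 : |2 / (1 + δ) * (x⁻¹ * ∫ r in o1..x, r ^ o0 * Er ξ G α r)| ≤ 2 / (1 + δ) * C * x ^ κ := by
    have hd : 0 < 1 + δ := lI
    rw [abs_mul, abs_mul, abs_of_pos (by positivity : 0 < 2 / (1 + δ)), abs_of_pos (inv_pos.2 hx0), mul_assoc]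
    refine mul_le_mul_of_nonneg_left ?_ pV
    have := intervalIntegral.norm_integral_le_of_norm_le_const (a := 1) (b := x) (f := fun r => r ^ o0 * Er ξ G α r) (C := C * x ^ κ) (fun r hr => by
      rw [Set.uIoc_of_le hx] at hr
      rw [Real.rpow_zero, one_mul, Real.norm_eq_abs]
      exact (hE r hr.1.le).trans (mul_le_mul_of_nonneg_left (Real.rpow_le_rpow (by linarith [hr.1]) hr.2 hκ) hC))
    rw [Real.norm_eq_abs, abs_of_nonneg (by linarith : 0 ≤ x - 1)] at this
    rw [inv_mul_le_iff₀ hx0]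
    have h1 : 0 ≤ C * x ^ κ := pV
    linarith
  have t4 : |α / (1 + δ) * x⁻¹| ≤ |α| * x ^ κ := by
    rw [abs_mul, abs_div, abs_of_pos (by linarith : 0 < 1 + δ), abs_of_pos (inv_pos.2 hx0)]
    refine mul_le_mul (div_le_self (abs_nonneg _) lI) ((inv_le_one_of_one_le₀ hx).trans hxk) (inv_pos.2 hx0).le (abs_nonneg _)
  rw [abs_le] at *
  constructor <;> linarith [t1.1, t1.2, t2.1, t2.2, t3.1, t3.2, t4.1, t4.2]
lemma KD.inv3 (h : KD ξ c δ) {G : ℝ → ℝ} (hGm : Measurable G) {M : ℝ} (hM : 0 ≤ M) (hG : ∀ r, 1 ≤ r → |G r| ≤ M * r) {α C κ : ℝ} (hC : 0 ≤ C)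
    (hκ : 0 ≤ κ) (hκ1 : κ ≤ 0.3) (hE : ∀ x, 1 ≤ x → |Er ξ G α x| ≤ C * x ^ κ) :
    ∃ ν C' : ℝ, 0 ≤ C' ∧ ∀ x, 1 ≤ x → |G x - ν * x ^ δ| ≤ C' * x ^ κ := by
  have hd1 := h.d1
  have hd2 := h.d2
  obtain ⟨ν0, C1, hC1, h1⟩ := h.inv2 hGm hM hG hC hκ hκ1 hE
  obtain ⟨Kl, hKl, hll⟩ := h.ll_bd
  have hlm := h.ll_meas
  have hp1 : ∀ s : ℝ, 1 ≤ s → s ^ (-δ) ≤ 1 := fun s hs => Real.rpow_le_one_of_one_le_of_nonpos hs lI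
  have li : ∀ x : ℝ, 1 ≤ x → IntervalIntegrable (fun s => ll ξ δ s * s ^ (-δ) * s⁻¹) volume 1 x := fun x hx => by
    refine ((h.ll_ii 1 x).mul_continuousOn ?_).mul_continuousOn (inv_co le_rfl hx)
    rw [Set.uIcc_of_le hx]
    intro s hs
    exact (Real.continuousAt_rpow_const _ _ (Or.inl (by linarith [hs.1]))).continuousWithinAt
  obtain ⟨L, hL⟩ := tail_gen (f := fun s => ll ξ δ s * s ^ (-δ) * s⁻¹) (C := Kl) (p := -δ) hKl lI li (fun s hs => by
      have hs0 : 0 < s := lI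
      rw [abs_mul, abs_mul, abs_of_pos (Real.rpow_pos_of_pos hs0 _), abs_of_pos (inv_pos.2 hs0), Real.rpow_sub hs0, Real.rpow_one, mul_assoc, ← div_eq_mul_inv]
      exact mul_le_mul_of_nonneg_right (hll s hs) pV)
  have hLb : ∀ x, 1 ≤ x → |∫ s in o1..x, ll ξ δ s * s ^ (-δ) * s⁻¹| ≤ 0.995 := fun x hx => by
    refine (intervalIntegral.abs_integral_le_integral_abs hx).trans (le_trans ?_ (h.Nlt hx))
    refine intervalIntegral.integral_mono_on hx (li x hx).abs (h.lls_ii le_rfl hx) fun s hs => ?_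
    have hs0 : 0 < s := by linarith [hs.1]
    rw [abs_mul, abs_mul, abs_of_pos (Real.rpow_pos_of_pos hs0 _), abs_of_pos (inv_pos.2 hs0)]
    exact mul_le_mul_of_nonneg_right (mul_le_of_le_one_right (abs_nonneg _) (hp1 s hs.1)) (inv_pos.2 hs0).le
  have hL1 : |L| ≤ 0.995 := by
    have ht : Tendsto (fun x : ℝ => 0.995 + Kl / (-(-δ)) * x ^ (-δ)) atTop (𝓝 (0.995 + Kl / (-(-δ)) * 0)) :=
      ((tendsto_rpow_neg_atTop lI).const_mul _).const_add _
    rw [mul_zero, add_zero] at ht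
    refine ge_of_tendsto ht ((eventually_ge_atTop 1).mono fun x hx => ?_)
    have a := hL x hx
    have b := hLb x hx
    rw [abs_le] at *
    constructor <;> linarith [a.1, a.2, b.1, b.2]
  have hL2 : 0 < 1 + L := by linarith [(abs_le.1 hL1).1]
  obtain ⟨ν, hν⟩ : ∃ ν, ν = ν0 / (1 + L) := ⟨_, rfl⟩
  have hν' : ν * (1 + L) = ν0 := by rw [hν]; field_simp
  obtain ⟨A, hA⟩ : ∃ A, A = C1 + |ν| * (Kl / (-(-δ))) := ⟨_, rfl⟩
  have hA0 : 0 ≤ A := by rw [hA, neg_neg]; have : 0 < δ := lI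
                         positivity
  have conv : ∀ x, 1 ≤ x → ∀ f : ℝ → ℝ, Measurable f → ∀ B, (∀ r, 1 ≤ r → r ≤ x → |f r| ≤ B) → IntervalIntegrable (fun t => ll ξ δ (x / t) * t⁻¹ * f t) volume 1 x := by
    intro x hx f hf B hB
    refine bd_ii (M := Kl * 1 * B) (((hlm.comp (measurable_const.div measurable_id)).mul measurable_inv).mul hf) hx fun t ht1 ht2 => ?_
    have ht0 : 0 < t := lI
    change |ll ξ δ (x / t) * t⁻¹ * f t| ≤ _
    rw [abs_mul, abs_mul, abs_of_pos (inv_pos.2 ht0)]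
    exact mul_le_mul (mul_le_mul (hll _ ((one_le_div ht0).2 ht2)) (inv_le_one_of_one_le₀ ht1.le) pV hKl) (hB t ht1.le ht2) (abs_nonneg _) pV
  have pm : Measurable fun t : ℝ => ν * t ^ δ := (measurable_id.pow_const _).const_mul ν
  have pb : ∀ x r : ℝ, 1 ≤ r → r ≤ x → |ν * r ^ δ| ≤ |ν| * x ^ δ := fun x r h1 h2 => by
    rw [abs_mul, abs_of_pos (Real.rpow_pos_of_pos lI _)]
    exact mul_le_mul_of_nonneg_left (Real.rpow_le_rpow lI h2 lI) (abs_nonneg _)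
  have gb : ∀ x r : ℝ, 1 ≤ r → r ≤ x → |G r| ≤ M * x := fun x r h1 h2 => (hG r h1).trans (mul_le_mul_of_nonneg_left h2 hM)
  have step : ∀ x, 1 ≤ x → |(G x - ν * x ^ δ) + ∫ t in o1..x, ll ξ δ (x / t) * t⁻¹ * (G t - ν * t ^ δ)| ≤ A * x ^ κ := by
    intro x hx
    have hx0 : 0 < x := lI
    have hxk : 1 ≤ x ^ κ := Real.one_le_rpow hx hκ
    have hxd := Real.rpow_pos_of_pos hx0 δ
    have e1 : ∫ t in o1..x, ll ξ δ (x / t) * t⁻¹ * (G t - ν * t ^ δ) = (∫ t in o1..x, ll ξ δ (x / t) * t⁻¹ * G t) - ν * x ^ δ * ∫ s in o1..x, ll ξ δ s * s ^ (-δ) * s⁻¹ := by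
      simp only [mul_sub]
      rw [intervalIntegral.integral_sub (conv x hx G hGm _ (gb x)) (conv x hx _ pm _ (pb x)), ← mul_subst (fun s => ll ξ δ s * s ^ (-δ)) hx, ← intervalIntegral.integral_const_mul]
      congr 1
      refine intervalIntegral.integral_congr fun t ht => ?_
      rw [Set.uIcc_of_le hx] at ht
      have ht0 : 0 < t := by linarith [ht.1]
      have := Real.rpow_pos_of_pos ht0 δ
      rw [Real.rpow_neg pV, Real.div_rpow hx0.le ht0.le]
      field_simp
    rw [e1]
    have a := h1 x hx
    have b : |ν * (x ^ δ * (L - ∫ s in o1..x, ll ξ δ s * s ^ (-δ) * s⁻¹))| ≤ |ν| * (Kl / (-(-δ))) := by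
      rw [abs_mul, abs_mul, abs_of_pos hxd]
      refine mul_le_mul_of_nonneg_left ?_ (abs_nonneg _)
      have := mul_le_mul_of_nonneg_left (hL x hx) hxd.le
      rw [mul_left_comm, ← Real.rpow_add hx0, add_neg_cancel, Real.rpow_zero, mul_one] at this
      exact this
    have b2 : |ν| * (Kl / (-(-δ))) ≤ |ν| * (Kl / (-(-δ))) * x ^ κ := le_mul_of_one_le_right ((abs_nonneg _).trans b) hxk
    rw [hA, ← hν'] at *
    rw [add_mul]
    rw [abs_le] at *
    constructor <;> linarith [a.1, a.2, b.1, b.2]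
  refine ⟨ν, A / (1 - 0.995), pV, fun Z hZ => ?_⟩
  have hZ0 : 0 < Z := lI
  have main := sup_contract (F := fun x => |G x - ν * x ^ δ| / x ^ κ) (s := Set.Icc 1 Z) (A := A) (q := 0.995) (M := M * Z + |ν| * Z ^ δ)
    hA0 nN nN pV ?_ ?_ Z ⟨hZ, le_rfl⟩
  · rwa [div_le_iff₀ (Real.rpow_pos_of_pos hZ0 _)] at main
  · intro x hx
    refine (div_le_self (abs_nonneg _) (Real.one_le_rpow hx.1 hκ)).trans ?_
    exact (abs_sub _ _).trans (add_le_add (gb Z x hx.1 hx.2) (pb Z x hx.1 hx.2))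
  · intro S hS hF x hx
    have hx0 : 0 < x := by linarith [hx.1]
    have hxk := Real.rpow_pos_of_pos hx0 κ
    have hF' : ∀ t, 1 ≤ t → t ≤ x → |G t - ν * t ^ δ| ≤ S * x ^ κ := fun t h1 h2 => by
      have := hF t ⟨h1, h2.trans hx.2⟩
      rw [div_le_iff₀ (Real.rpow_pos_of_pos lI _)] at this
      exact this.trans (mul_le_mul_of_nonneg_left (Real.rpow_le_rpow lI h2 hκ) hS)
    rw [div_le_iff₀ hxk]
    have s1 := step x hx.1
    have s2 : |∫ t in o1..x, ll ξ δ (x / t) * t⁻¹ * (G t - ν * t ^ δ)| ≤ 0.995 * (S * x ^ κ) := by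
      refine (intervalIntegral.abs_integral_le_integral_abs hx.1).trans ?_
      have i1 := conv x hx.1 _ (hGm.sub pm) _ hF'
      have i2 := conv x hx.1 (fun _ => S * x ^ κ) measurable_const _ (fun _ _ _ => le_rfl)
      have m : ∫ t in o1..x, |ll ξ δ (x / t) * t⁻¹ * (G t - ν * t ^ δ)| ≤ ∫ t in o1..x, |ll ξ δ (x / t)| * t⁻¹ * (S * x ^ κ) := by
        refine intervalIntegral.integral_mono_on hx.1 i1.abs (i2.abs.congr fun t ht => ?_) fun t ht => ?_
        · rw [Set.uIoc_of_le hx.1] at ht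
          have ht0 : 0 < t := by linarith [ht.1]
          rw [abs_mul, abs_mul, abs_of_pos (inv_pos.2 ht0), abs_of_nonneg (mul_nonneg hS hxk.le)]
        · have ht0 : 0 < t := by linarith [ht.1]
          rw [abs_mul, abs_mul, abs_of_pos (inv_pos.2 ht0)]
          exact mul_le_mul_of_nonneg_left (hF' t ht.1 ht.2) pV
      refine m.trans ?_
      rw [intervalIntegral.integral_mul_const, mul_subst (fun s => |ll ξ δ s|) hx.1]
      exact mul_le_mul_of_nonneg_right (h.Nlt hx.1) (mul_nonneg hS hxk.le)
    have := abs_sub ((G x - ν * x ^ δ) + ∫ t in o1..x, ll ξ δ (x / t) * t⁻¹ * (G t - ν * t ^ δ)) (∫ t in o1..x, ll ξ δ (x / t) * t⁻¹ * (G t - ν * t ^ δ))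
    rw [add_sub_cancel_right] at this
    linarith
variable {ξ : ℝ → ℝ} {c δ : ℝ} {θ : ℕ → ℝ}
lemma GG_meas (θ : ℕ → ℝ) : Measurable (GG θ) := (Real.measurable_exp.comp measurable_neg).mul (SM_meas _)
lemma GG_triv (hθ : ∀ n : ℕ, 1 ≤ n → ((max 2 n : ℕ) : ℝ) ≤ θ n) {z : ℝ} (hz : 0 ≤ z) : GG θ z ≤ 31 * (1 + z) := by
  have h1 := (abs_le.1 (Main0 hθ hz)).2
  have h2 : 0 ≤ ∑ m ∈ Finset.Icc 1 ⌊Real.exp z⌋₊, am θ m / m * mu (θ m) (z - Real.log m) :=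
    Finset.sum_nonneg fun m _ => mul_nonneg (div_nonneg (am_nonneg _ _) (Nat.cast_nonneg _)) (mu_nonneg _ _)
  have h3 := C0_bd.2
  have h4 : Real.exp (-z / 2) ≤ 1 := Real.exp_le_one_iff.2 lI
  linarith
lemma KD.asym (h : KD ξ c δ) (hθ : ∀ n : ℕ, 1 ≤ n → ((max 2 n : ℕ) : ℝ) ≤ θ n) {Kb : ℝ} (hKb : 0 ≤ Kb)
    (hD : ∀ m : ℕ, 1 ≤ m → Dat Kb (Real.log m) (θ m)) : ∃ ν C : ℝ, 0 ≤ C ∧ ∀ z, 1 ≤ z → |GG θ z - ν * z ^ δ| ≤ C := by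
  have hd1 := h.d1
  have hd2 := h.d2
  have hG : ∀ r, 1 ≤ r → |GG θ r| ≤ 62 * r := fun r hr => by
    rw [abs_of_nonneg (GG_nonneg θ r)]
    linarith [GG_triv hθ (by linarith : 0 ≤ r)]
  obtain ⟨α1, C1, hC1, e1⟩ := Renew h.toKX hθ hKb hD (β := 1) (κ := 0.3) (CG := 31) nN le_rfl nN nN nN nN nN
    (fun r hr => by rw [Real.rpow_one]; exact GG_triv hθ hr)
  obtain ⟨ν1, C2, hC2, e2⟩ := h.inv3 (GG_meas θ) nN hG hC1.le nN le_rfl e1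
  obtain ⟨α3, C3, hC3, e3⟩ := Renew h.toKX hθ hKb hD (β := δ) (κ := 0) (CG := 62 + |ν1| + C2) lI lI le_rfl nN lI lI pV
    (fun r hr => by
      have p1 : 1 ≤ (1 + r) ^ δ := Real.one_le_rpow lI lI
      rcases lt_or_ge r 1 with h1 | h1
      · have := GG_triv hθ hr
        have : 0 ≤ (|ν1| + C2) * (1 + r) ^ δ := pV
        linarith
      · have a := (abs_le.1 (e2 r h1)).2
        have b1 : r ^ δ ≤ (1 + r) ^ δ := Real.rpow_le_rpow hr lI lI
        have b2 : r ^ (0.3:ℝ) ≤ (1 + r) ^ δ := (Real.rpow_le_rpow_of_exponent_le h1 lI).trans b1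
        have c1 : ν1 * r ^ δ ≤ |ν1| * (1 + r) ^ δ := mul_le_mul (le_abs_self _) b1 pV (abs_nonneg _)
        have c2 := mul_le_mul_of_nonneg_left b2 hC2
        linarith)
  obtain ⟨ν, C, hC, e4⟩ := h.inv3 (GG_meas θ) nN hG hC3.le le_rfl nN e3
  exact ⟨ν, C, hC, fun z hz => by simpa using e4 z hz⟩
variable {ξ : ℝ → ℝ} {c δ : ℝ} {θ : ℕ → ℝ}
def Xm (w y z : ℝ) : ℝ := mu y (z - w) - Ay y * (z + C0)
lemma v_pow {v : ℝ} (hv : 1/2 ≤ v) : v ^ o72 ≤ 2 := by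
  have h1 : v ^ o72 ≤ (1/2:ℝ) ^ o72 := Real.rpow_le_rpow_of_nonpos nN hv nN
  have h2 : (1/2:ℝ) ^ o72 ≤ (1/2:ℝ) ^ (-1:ℝ) := Real.rpow_le_rpow_of_exponent_ge nN nN nN
  rw [Real.rpow_neg_one] at h2
  linarith [h1.trans h2, (by norm_num : ((1/2:ℝ))⁻¹ = 2)]
lemma PW (h : KX ξ c) {Kb : ℝ} (hKb : 0 ≤ Kb) : ∃ C k U : ℝ, 0 < C ∧ 0 < k ∧ 0 < U ∧ ∀ w y z : ℝ, Dat Kb w y → 0 ≤ z →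
    Ay y ≤ C * ((1 + w) ^ 2)⁻¹ ∧ |Xm w y z| ≤ C * (1 + w)⁻¹ ∧ |Xm w y z| ≤ C * ((1 + z) * ((1 + w) ^ 2)⁻¹) ∧
    -(C * ((1 + w) ^ o7 + (1 + z) / (2 + w + z) ^ 2)) ≤ Xm w y z ∧
    (U * (1 + w) ≤ z → k * (1 + w)⁻¹ - C * (1 + w) ^ o7 ≤ Xm w y z) := by
  obtain ⟨C3, hC3, h3⟩ := B3 h
  obtain ⟨K, hK, hk⟩ := h.k_bd
  obtain ⟨K', hK', hk'⟩ := h.bd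
  have hc := h.c0
  have hC0 := C0_bd
  obtain ⟨U0, hU0, hU1⟩ : ∃ U0 : ℝ, 2 ≤ U0 ∧ ∀ u, U0 ≤ u → |kap ξ c u| ≤ c / 2 := by
    have ht : Tendsto (fun u : ℝ => K' * Real.exp (-1/4 * u)) atTop (𝓝 (K' * 0)) :=
      (Real.tendsto_exp_atBot.comp (tendsto_id.const_mul_atTop_of_neg nN)).const_mul K'
    rw [mul_zero] at ht
    obtain ⟨N, hN⟩ := eventually_atTop.1 (ht.eventually (ge_mem_nhds (by positivity : o0 < c / 2)))
    refine ⟨max 2 N, le_max_left _ _, fun u hu => ?_⟩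
    have hu2 : 2 ≤ u := (le_max_left _ _).trans hu
    exact (hk' u lI).trans (le_trans (le_of_eq (by rw [show -u / 4 = -1/4 * u by ring])) (hN u ((le_max_right _ _).trans hu)))
  obtain ⟨CA, hCA⟩ : ∃ CA, CA = c + 2 * C3 := ⟨_, rfl⟩
  obtain ⟨E, hE⟩ : ∃ E, E = K + 2 * c + C3 * 3 := ⟨_, rfl⟩
  obtain ⟨D, hD⟩ : ∃ D, D = 4 ^ (1.72:ℝ) * (4 * C3 + 2 * CA) := ⟨_, rfl⟩
  obtain ⟨U, hU⟩ : ∃ U, U = 1 + U0 * (1 + Kb) := ⟨_, rfl⟩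
  have hCA0 : 0 < CA := by rw [hCA]; positivity
  have hE0 : 0 < E := by rw [hE]; positivity
  have hD0 : 0 < D := by rw [hD]; positivity
  have hUp : 0 < U := by rw [hU]; positivity
  obtain ⟨C, hC⟩ : ∃ C, C = 16 * CA * (2 + Kb) + 16 * CA * (2 + U) ^ 2 + 4 * E + D := ⟨_, rfl⟩
  refine ⟨C, c / 2 / (1 + Kb), U, by rw [hC]; positivity, pV, hUp, fun w y z d hz => ?_⟩
  have hw := d.w0
  have hs1 : 1 ≤ 1 + w := lI
  obtain ⟨s, hs⟩ : ∃ s, s = 1 + w := ⟨_, rfl⟩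
  have hv4 := d.v_ge
  have hv2 := log_two_le d.y2
  have hvw := d.vw
  have hwv := d.wv
  have hy0 : 0 < y := by linarith [d.y2]
  obtain ⟨b1, b2⟩ := h3 y d.y2
  have hmz : z - w ≤ Real.log y → mu y (z - w) = 0 := mu_zero hy0
  have hA0 := (Ay_bd y).1
  have hm0 := mu_nonneg y (z - w)
  obtain ⟨v, hv⟩ : ∃ v, v = Real.log y := ⟨_, rfl⟩
  rw [← hv] at hv4 hv2 hvw hwv b1 b2 hmz
  have hq : (1 + w) ^ oq ≤ 1 + w := by
    have := Real.rpow_le_rpow_of_exponent_le hs1 (by norm_num : oq ≤ 1)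
    rwa [Real.rpow_one] at this
  have hvs : v ≤ (1 + Kb) * s := by
    have := mul_le_mul_of_nonneg_left hq hKb
    rw [hs]; linarith
  have hv0 : 0 < v := lI
  have hvp := v_pow hv2
  rw [← hs] at hv4 hs1 hq ⊢
  have hs0 : 0 < s := lI
  have hAv : Ay y * v ^ 2 ≤ CA := by
    have := (abs_le.1 b1).2
    have := mul_le_mul_of_nonneg_left hvp hC3.le
    rw [hCA]; linarith
  have hA : Ay y * s ^ 2 ≤ 16 * CA := by
    have h1 : s ^ 2 ≤ 16 * v ^ 2 := by
      have := pow_le_pow_left₀ pV hv4 2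
      linarith [this, (by ring : (s / 4) ^ 2 = s ^ 2 / 16)]
    have := mul_le_mul_of_nonneg_left h1 hA0
    linarith
  have hAs : Ay y ≤ 16 * CA * (s ^ 2)⁻¹ := by rw [← div_eq_mul_inv, le_div_iff₀ pV]; exact hA
  have hwC : w + C0 ≤ s := by rw [hs]; linarith
  have p1 : |Xm w y z| ≤ (16 * CA * (2 + Kb) + 4 * E) * s⁻¹ ∧ |Xm w y z| ≤ (16 * CA * (2 + Kb) + 4 * E) * ((1 + z) * (s ^ 2)⁻¹) := by
    have hss : (s ^ 2)⁻¹ * s = s⁻¹ := by field_simp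
    rcases le_total (z - w) v with ht | ht
    · have e : |Xm w y z| = Ay y * (z + C0) := by
        rw [Xm, hmz ht, zero_sub, abs_neg, abs_of_nonneg (mul_nonneg hA0 lI)]
      rw [e]
      have hE4 : 0 ≤ 4 * E := pV
      constructor
      · have h1 : z + C0 ≤ (2 + Kb) * s := lI
        calc Ay y * (z + C0) ≤ 16 * CA * (s ^ 2)⁻¹ * ((2 + Kb) * s) := mul_le_mul hAs h1 lI pV
          _ = 16 * CA * (2 + Kb) * s⁻¹ := by rw [← hss]; ring
          _ ≤ _ := mul_le_mul_of_nonneg_right lI pV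
      · calc Ay y * (z + C0) ≤ 16 * CA * (s ^ 2)⁻¹ * (1 + z) := mul_le_mul hAs lI lI pV
          _ = 16 * CA * 1 * ((1 + z) * (s ^ 2)⁻¹) := by ring
          _ ≤ _ := by
            refine mul_le_mul_of_nonneg_right ?_ pV
            have := mul_le_mul_of_nonneg_left (by linarith : 1 ≤ 2 + Kb) (by positivity : 0 ≤ 16 * CA)
            linarith
    · have hb := b2 (z - w) ht
      have hkk := hk ((z - w) / v) (div_nonneg lI hv0.le)
      have hex : Real.exp (v - (z - w)) ≤ 1 := Real.exp_le_one_iff.2 lI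
      have e1 : |mu y (z - w) * v - Ay y * (z - w) * v| ≤ E := by
        have q1 := mul_le_mul_of_nonneg_left (add_le_add hvp hex) hC3.le
        rw [hE]
        rw [abs_le] at *
        constructor <;> linarith [hb.1, hb.2, hkk.1, hkk.2]
      have e2 : |mu y (z - w) - Ay y * (z - w)| ≤ 4 * E * s⁻¹ := by
        rw [← sub_mul, abs_mul, abs_of_pos hv0] at e1
        rw [← div_eq_mul_inv, le_div_iff₀ hs0]
        have := mul_le_mul_of_nonneg_left hv4 (abs_nonneg (mu y (z - w) - Ay y * (z - w)))
        linarith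
      have e3 : Ay y * (w + C0) ≤ 16 * CA * s⁻¹ := by
        calc Ay y * (w + C0) ≤ 16 * CA * (s ^ 2)⁻¹ * s := mul_le_mul hAs hwC lI pV
          _ = _ := by rw [mul_assoc, hss]
      have e4 : 0 ≤ Ay y * (w + C0) := mul_nonneg hA0 lI
      have e5 : |Xm w y z| ≤ (16 * CA * (2 + Kb) + 4 * E) * s⁻¹ := by
        have q : 0 ≤ 16 * CA * (1 + Kb) * s⁻¹ := pV
        rw [Xm]
        rw [abs_le] at *
        constructor <;> linarith [e2.1, e2.2]
      refine ⟨e5, e5.trans (mul_le_mul_of_nonneg_left ?_ pV)⟩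
      rw [← hss, mul_comm]
      exact mul_le_mul_of_nonneg_right lI pV
  have p4 : U * s ≤ z → c / 2 / (1 + Kb) * s⁻¹ - D * s ^ o7 ≤ Xm w y z := by
    intro hUz
    have hUs : U0 * v ≤ z - w := by
      have := mul_le_mul_of_nonneg_left hvs (by linarith : 0 ≤ U0)
      rw [hU] at hUz
      linarith
    have htv : v ≤ z - w := by
      have := mul_le_mul_of_nonneg_right hU0 hv0.le
      linarith
    have hb := (abs_le.1 (b2 (z - w) htv)).1
    have hkk := (abs_le.1 (hU1 ((z - w) / v) ((le_div_iff₀ hv0).2 hUs))).1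
    have hvq : v⁻¹ ≤ 2 * v ^ o72 := by
      have e : v⁻¹ = v ^ (-0.28:ℝ) * v ^ o72 := by rw [← Real.rpow_add hv0, ← Real.rpow_neg_one]; norm_num
      rw [e]
      refine mul_le_mul_of_nonneg_right ?_ pV
      have h1 : v ^ (-0.28:ℝ) ≤ (1/2:ℝ) ^ (-0.28:ℝ) := Real.rpow_le_rpow_of_nonpos nN hv2 nN
      have h2 : (1/2:ℝ) ^ (-0.28:ℝ) ≤ (1/2:ℝ) ^ (-1:ℝ) := Real.rpow_le_rpow_of_exponent_ge nN nN nN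
      rw [Real.rpow_neg_one] at h2
      linarith [h1.trans h2, (by norm_num : ((1/2:ℝ))⁻¹ = 2)]
    have hex : Real.exp (v - (z - w)) ≤ 2 * v ^ o72 := by
      refine le_trans ?_ hvq
      have h1 : v - (z - w) ≤ -v := by
        have := mul_le_mul_of_nonneg_right hU0 hv0.le
        linarith
      refine (Real.exp_le_exp.2 h1).trans ?_
      rw [Real.exp_neg]
      exact inv_anti₀ hv0 (by linarith [Real.add_one_le_exp v])
    have q1 := mul_le_mul_of_nonneg_left hex hC3.le
    have q2 := (abs_le.1 b1).2
    have q3 : Ay y * v ≤ CA * (2 * v ^ o72) := by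
      refine le_trans ?_ (mul_le_mul_of_nonneg_left hvq hCA0.le)
      rw [← div_eq_mul_inv, le_div_iff₀ hv0]
      linarith
    have q4 : Ay y * (w + C0) * v ≤ Ay y * v ^ 2 + Ay y * v := by
      have := mul_le_mul_of_nonneg_left (by linarith : w + C0 ≤ v + 1) (mul_nonneg hA0 hv0.le)
      linarith
    have q5 : c / 2 - (4 * C3 + 2 * CA) * v ^ o72 ≤ Xm w y z * v := by
      rw [Xm]; linarith
    have q6 : v ^ o7 ≤ 4 ^ (1.72:ℝ) * s ^ o7 := by
      have := rpow_quarter_le (x := w) hw (-1.72) nN (v := v) (by rw [← hs]; exact hv4)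
      rw [hs]; convert this using 3; norm_num
    have q7 : v ^ o72 = v ^ o7 * v := by
      rw [← Real.rpow_add_one hv0.ne']; norm_num
    have q8 : c / 2 * v⁻¹ - (4 * C3 + 2 * CA) * v ^ o7 ≤ Xm w y z := by
      refine le_of_mul_le_mul_right ?_ hv0
      rw [q7] at q5
      refine le_trans (le_of_eq ?_) q5
      field_simp
    have q9 : c / 2 / (1 + Kb) * s⁻¹ ≤ c / 2 * v⁻¹ := by
      rw [div_eq_mul_inv (c / 2), mul_assoc, ← mul_inv]
      exact mul_le_mul_of_nonneg_left (inv_anti₀ hv0 hvs) pV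
    have q10 : (4 * C3 + 2 * CA) * v ^ o7 ≤ D * s ^ o7 := by
      have := mul_le_mul_of_nonneg_left q6 (by positivity : 0 ≤ 4 * C3 + 2 * CA)
      rw [hD]; linarith
    linarith [q8, q9, q10]
  have z1 : 0 ≤ CA * (2 + Kb) := pV
  have z2 : 0 ≤ CA * (2 + U) ^ 2 := pV
  have hsp : 0 ≤ s ^ o7 := pV
  have hk0 : 0 ≤ c / 2 / (1 + Kb) * s⁻¹ := pV
  have hr : 0 ≤ (1 + z) / (2 + w + z) ^ 2 := pV
  have hDC : D * s ^ o7 ≤ C * s ^ o7 := mul_le_mul_of_nonneg_right (by rw [hC]; linarith) hsp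
  refine ⟨hAs.trans (mul_le_mul_of_nonneg_right ?_ pV), p1.1.trans (mul_le_mul_of_nonneg_right ?_ pV),
    p1.2.trans (mul_le_mul_of_nonneg_right ?_ pV), ?_, fun hUz => by linarith [p4 hUz]⟩
  · rw [hC]
    have := mul_nonneg hCA0.le hKb
    linarith
  · rw [hC]; linarith
  · rw [hC]; linarith
  have hC0' : 0 ≤ C := by rw [hC]; positivity
  rw [mul_add]
  rcases le_total (U * s) z with hUz | hUz
  · linarith [p4 hUz, mul_nonneg hC0' hr]
  · have g1 : 2 + w + z ≤ (2 + U) * s := lI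
    have g2 : (2 + w + z) ^ 2 ≤ (2 + U) ^ 2 * s ^ 2 := by
      rw [← mul_pow]; exact pow_le_pow_left₀ lI g1 2
    have g3 : (s ^ 2)⁻¹ ≤ (2 + U) ^ 2 * ((2 + w + z) ^ 2)⁻¹ := by
      rw [← div_eq_mul_inv, le_div_iff₀ pV, inv_mul_le_iff₀ pV]
      linarith
    have g4 : Ay y * (z + C0) ≤ 16 * CA * (2 + U) ^ 2 * ((1 + z) / (2 + w + z) ^ 2) := by
      calc Ay y * (z + C0) ≤ 16 * CA * (s ^ 2)⁻¹ * (1 + z) := mul_le_mul hAs lI lI pV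
        _ ≤ 16 * CA * ((2 + U) ^ 2 * ((2 + w + z) ^ 2)⁻¹) * (1 + z) :=
          mul_le_mul_of_nonneg_right (mul_le_mul_of_nonneg_left g3 pV) lI
        _ = _ := by rw [div_eq_mul_inv]; ring
    have g5 : 16 * CA * (2 + U) ^ 2 * ((1 + z) / (2 + w + z) ^ 2) ≤ C * ((1 + z) / (2 + w + z) ^ 2) :=
      mul_le_mul_of_nonneg_right (by rw [hC]; linarith) hr
    have g6 := mul_nonneg hC0' hsp
    rw [Xm]; linarith
variable {ξ : ℝ → ℝ} {c δ : ℝ} {θ : ℕ → ℝ}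
lemma pow_le_fac (m : ℕ) : m ^ m ≤ m.factorial * m.factorial := by
  have h1 : m.factorial = ∏ i ∈ Finset.range m, (i + 1) := (Finset.prod_range_add_one_eq_factorial m).symm
  have h2 : m.factorial = ∏ i ∈ Finset.range m, (m - 1 - i + 1) := by
    rw [h1]; exact (Finset.prod_range_reflect (fun i => i + 1) m).symm
  have h3 : m.factorial * m.factorial = ∏ i ∈ Finset.range m, ((i + 1) * (m - 1 - i + 1)) := by
    rw [Finset.prod_mul_distrib, ← h1, ← h2]
  rw [h3]
  calc m ^ m = ∏ _i ∈ Finset.range m, m := sI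
    _ ≤ _ := Finset.prod_le_prod' fun i hi => by
      have := Finset.mem_range.1 hi
      obtain ⟨k, rfl⟩ : ∃ k, m = i + 1 + k := ⟨m - (i + 1), oM⟩
      rw [show i + 1 + k - 1 - i + 1 = k + 1 by omega]
      nlinarith
lemma Ly_term {p : ℕ} (hp : p.Prime) : 0 ≤ Real.log p / ((p:ℝ) - 1) := by
  have : o2 ≤ p := by exact_mod_cast hp.two_le
  exact div_nonneg (Real.log_nonneg lI) lI
lemma Ly_lb {m : ℕ} {y : ℝ} (hm : 1 ≤ m) (hy : (m:ℝ) ≤ y) : Real.log m ≤ 2 * Ly y := by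
  have hm0 : o0 < m := by exact_mod_cast hm
  have h1 : Real.log (m.factorial : ℕ) ≤ m * Ly y := by
    rw [Real.log_nat_eq_sum_factorization, Ly, LS, Finset.mul_sum, Finsupp.sum]
    have hsub : m.factorial.factorization.support ⊆ Sy y := by
      intro p hp
      rw [Nat.support_factorization, Nat.mem_primeFactors] at hp
      rw [mem_Sy lI]
      refine ⟨hp.1, le_trans ?_ hy⟩
      exact_mod_cast (hp.1.dvd_factorial).1 hp.2.1
    have hpr : ∀ p ∈ Sy y, p.Prime := fun p hp => ((mem_Sy lI).1 hp).1
    refine (Finset.sum_le_sum fun p hp => ?_).trans (Finset.sum_le_sum_of_subset_of_nonneg hsub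
      fun p hp _ => mul_nonneg hm0.le (Ly_term (hpr p hp)))
    have pp := hpr p (hsub hp)
    have := Fact.mk pp
    have p2 : o2 ≤ p := by exact_mod_cast pp.two_le
    have e := sub_one_mul_padicValNat_factorial (p := p) m
    have e2 : (p - 1) * padicValNat p m.factorial ≤ m := by rw [e]; exact Nat.sub_le _ _
    have e3 : ((p:ℝ) - 1) * (padicValNat p m.factorial : ℝ) ≤ m := by
      have : (((p - 1) * padicValNat p m.factorial : ℕ) : ℝ) ≤ m := by exact_mod_cast e2
      rwa [Nat.cast_mul, Nat.cast_sub pp.one_le, Nat.cast_one] at this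
    rw [Nat.factorization_def _ pp, mul_div_assoc', le_div_iff₀ lI]
    have := mul_le_mul_of_nonneg_right e3 (Real.log_nonneg (by linarith : o1 ≤ p))
    linarith
  have h2 : (m:ℝ) * Real.log m ≤ 2 * Real.log (m.factorial : ℕ) := by
    have h3 : (m:ℝ) ^ m ≤ (m.factorial : ℝ) * (m.factorial : ℝ) := by exact_mod_cast pow_le_fac m
    have hf : o0 < (m.factorial : ℝ) := by exact_mod_cast m.factorial_pos
    have h4 := Real.log_le_log pV h3
    rw [Real.log_pow, Real.log_mul hf.ne' hf.ne'] at h4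
    linarith
  refine le_of_mul_le_mul_left ?_ hm0
  linarith
lemma Ly_pos {y : ℝ} (hy : 2 ≤ y) : 0 < Ly y := by
  have hpr : ∀ p ∈ Sy y, p.Prime := fun p hp => ((mem_Sy lI).1 hp).1
  rw [Ly, LS]
  refine Finset.sum_pos' (fun p hp => Ly_term (hpr p hp)) ⟨2, (mem_Sy (by linarith : 0 ≤ y)).2 ⟨Nat.prime_two, hy⟩, ?_⟩
  have := Real.log_pos (by norm_num : o1 < 2)
  norm_num [this]
lemma Ay_pos {y : ℝ} (hy : 2 ≤ y) : 0 < Ay y := by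
  rw [Ay, AS]
  refine Finset.prod_pos fun p hp => ?_
  have pp := ((mem_Sy lI).1 hp).1
  have p2 : o2 ≤ p := by exact_mod_cast pp.two_le
  have : (p:ℝ)⁻¹ ≤ 2⁻¹ := inv_anti₀ nN p2
  have : 0 < 1 - (p:ℝ)⁻¹ := lI
  positivity
variable {ξ : ℝ → ℝ} {c δ : ℝ} {θ : ℕ → ℝ}
lemma kbs {CG Z : ℝ} (hCG : 0 ≤ CG) (hG : ∀ r, 0 ≤ r → GG θ r ≤ CG) (hZ : 1 ≤ Z) (F : Finset ℕ) :
    ∑ m ∈ F, am θ m / m * (Z / (1 + Real.log m + Z) ^ 2) ≤ Real.exp 1 * (4 * CG) := by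
  obtain ⟨N, hN⟩ : ∃ N : ℕ, ∀ m ∈ F, m ≤ N := ⟨F.sup id, fun m hm => Finset.le_sup (f := id) hm⟩
  have hN1 : o0 < (N:ℝ) + 1 := pV
  obtain ⟨R, hR⟩ : ∃ R, R = 1 + Real.log (N + 1) := ⟨_, rfl⟩
  have hR1 : 1 ≤ R := by
    have := Real.log_nonneg (by linarith [(Nat.cast_nonneg N : o0 ≤ N)] : o1 ≤ (N:ℝ) + 1)
    linarith
  have hb := blk (θ := θ) (φ := fun w => Z / (1 + w + Z) ^ 2) (ψ := fun r => 4 * Z / (1 + max r 0 + Z) ^ 2)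
    (by
      refine Continuous.div fP fP fun r => ?_
      have := le_max_right r 0
      positivity) (fun r => pV)
    (fun w r h0 h1 h2 => by
      have hr : max r 0 = r := max_eq_left lI
      rw [hr, div_le_div_iff₀ pV (by have : 0 ≤ r := lI
                                     positivity)]
      have h3 : (1 + r + Z) ^ 2 ≤ (2 * (1 + w + Z)) ^ 2 := pow_le_pow_left₀ lI lI 2
      have := mul_le_mul_of_nonneg_left h3 (by linarith : 0 ≤ Z)
      linarith) hR1
  have hfl : ⌊Real.exp (R - 1)⌋₊ = N + 1 := by
    rw [hR, add_sub_cancel_left, Real.exp_log hN1, Nat.floor_add_one pV, Nat.floor_natCast]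
  rw [hfl] at hb
  have hwn : ∀ m : ℕ, 0 ≤ am θ m / m * (Z / (1 + Real.log m + Z) ^ 2) := fun m =>
    mul_nonneg (div_nonneg (am_nonneg _ _) (Nat.cast_nonneg _)) pV
  have hs : ∑ m ∈ F, am θ m / m * (Z / (1 + Real.log m + Z) ^ 2) ≤
      ∑ m ∈ Finset.Icc 1 (N + 1), am θ m / m * (Z / (1 + Real.log m + Z) ^ 2) := by
    have e : ∑ m ∈ F, am θ m / m * (Z / (1 + Real.log m + Z) ^ 2) = ∑ m ∈ F.filter (1 ≤ ·), am θ m / m * (Z / (1 + Real.log m + Z) ^ 2) := by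
      rw [Finset.sum_filter]
      refine Finset.sum_congr rfl fun m _ => ?_
      split_ifs with hm
      · rfl
      · rw [show m = 0 by omega]; simp
    rw [e]
    refine Finset.sum_le_sum_of_subset_of_nonneg (fun m hm => ?_) fun m _ _ => hwn m
    have := Finset.mem_filter.1 hm
    exact Finset.mem_Icc.2 ⟨this.2, by have := hN m this.1; omega⟩
  refine hs.trans (hb.trans (mul_le_mul_of_nonneg_left ?_ (Real.exp_pos _).le))
  have hdv : ∀ r ∈ Set.uIcc 0 R, HasDerivAt (fun r => -(4 * CG * Z) * (1 + r + Z)⁻¹) (4 * Z / (1 + r + Z) ^ 2 * CG) r := fun r hr => by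
    rw [Set.uIcc_of_le lI] at hr
    have h0 : 1 + r + Z ≠ 0 := by linarith [hr.1]
    have h1 : HasDerivAt (fun r : ℝ => 1 + r + Z) 1 r := ((hasDerivAt_id r).const_add 1).add_const Z
    refine ((h1.inv h0).const_mul _).congr_deriv ?_
    field_simp
  have hc : ContinuousOn (fun r => 4 * Z / (1 + r + Z) ^ 2 * CG) (Set.uIcc 0 R) := by
    refine ContinuousOn.mul (ContinuousOn.div fP fP fun r hr => ?_) continuousOn_const
    rw [Set.uIcc_of_le lI] at hr
    have := hr.1
    positivity
  have hi := intervalIntegral.integral_eq_sub_of_hasDerivAt hdv hc.intervalIntegrable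
  have hm : ∫ r in o0..R, (4 * Z / (1 + max r 0 + Z) ^ 2) * GG θ r ≤ ∫ r in o0..R, 4 * Z / (1 + r + Z) ^ 2 * CG := by
    refine intervalIntegral.integral_mono_on lI (GG_ii (by
      refine Continuous.div fP fP fun r => ?_
      have := le_max_right r 0
      positivity) 0 R) hc.intervalIntegrable fun r hr => ?_
    rw [max_eq_left hr.1]
    exact mul_le_mul_of_nonneg_left (hG r hr.1) pV
  refine hm.trans ?_
  rw [hi]
  have a1 : 0 ≤ 4 * CG * Z * (1 + R + Z)⁻¹ := pV
  have a2 : 4 * CG * Z * (1 + 0 + Z)⁻¹ ≤ 4 * CG := by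
    rw [← div_eq_mul_inv, div_le_iff₀ pV]
    have := mul_nonneg (by norm_num : o0 ≤ 4) hCG
    linarith
  linarith
lemma Xsum (hθ : ∀ n : ℕ, 1 ≤ n → ((max 2 n : ℕ) : ℝ) ≤ θ n) (hS : Summable fun m : ℕ => am θ m / m * Ay (θ m)) {z : ℝ} :
    HasSum (fun m : ℕ => am θ m / m * Xm (Real.log m) (θ m) z)
      (∑ m ∈ Finset.Icc 1 ⌊Real.exp z⌋₊, am θ m / m * mu (θ m) (z - Real.log m) - (∑' m : ℕ, am θ m / m * Ay (θ m)) * (z + C0)) := by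
  have h1 := (hasSum_ite_mem (Finset.Icc 1 ⌊Real.exp z⌋₊) fun m => am θ m / m * mu (θ m) (z - Real.log m)).sub (hS.hasSum.mul_right (z + C0))
  refine h1.congr_fun ?_
  intro m
  rw [Xm]
  split_ifs with hm
  · ring
  · rcases Nat.eq_zero_or_pos m with rfl | hp
    · simp
    · have h2 : ⌊Real.exp z⌋₊ < m := by
        by_contra hc
        exact hm (Finset.mem_Icc.2 ⟨hp, oM⟩)
      have h3 : z ≤ Real.log m := by
        rw [← Real.log_exp z]
        exact Real.log_le_log (Real.exp_pos _) (Nat.lt_of_floor_lt h2).le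
      have h4 : o2 ≤ θ m := le_trans (by exact_mod_cast le_max_left 2 m) (hθ m hp)
      rw [mu_zero lI (by linarith [Real.log_nonneg (by linarith : 1 ≤ θ m)])]
      ring
variable {ξ : ℝ → ℝ} {c δ : ℝ} {θ : ℕ → ℝ}
lemma inv_lim (A : ℝ) : Tendsto (fun z : ℝ => A * (1 + z)⁻¹) atTop (𝓝 0) := by
  have := (tendsto_inv_atTop_zero.comp (tendsto_atTop_add_const_left atTop o1 tendsto_id)).const_mul A
  rwa [mul_zero] at this
lemma no_bd (h : KX ξ c) (hθ : ∀ n : ℕ, 1 ≤ n → ((max 2 n : ℕ) : ℝ) ≤ θ n) {Kb : ℝ} (hKb : 0 ≤ Kb)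
    (hD : ∀ m : ℕ, 1 ≤ m → Dat Kb (Real.log m) (θ m)) {CG : ℝ} (hCG : 0 ≤ CG) (hG : ∀ r, 0 ≤ r → GG θ r ≤ CG) : False := by
  obtain ⟨C, k, U, hC, hk, hU, pw⟩ := PW h hKb
  obtain ⟨wt, hwt⟩ : ∃ wt : ℕ → ℝ, wt = fun m => am θ m / m := ⟨_, rfl⟩
  have hw0 : ∀ m, 0 ≤ wt m := fun m => by rw [hwt]; exact div_nonneg (am_nonneg _ _) (Nat.cast_nonneg _)
  have hwz : wt 0 = 0 := by rw [hwt]; simp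
  have mono : ∀ (m : ℕ) (X Y : ℝ), (1 ≤ m → X ≤ Y) → wt m * X ≤ wt m * Y := fun m X Y hXY => by
    rcases Nat.eq_zero_or_pos m with rfl | hm
    · rw [hwz, zero_mul, zero_mul]
    · exact mul_le_mul_of_nonneg_left (hXY hm) (hw0 m)
  have hl : ∀ m : ℕ, 0 ≤ Real.log m := fun m => Real.log_natCast_nonneg m
  have hGr : ∀ r, 0 ≤ r → GG θ r ≤ CG * (1 + r) ^ o0 := fun r hr => by rw [Real.rpow_zero, mul_one]; exact hG r hr
  have s1 : Summable fun m : ℕ => wt m * (1 + Real.log m) ^ o7 := by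
    rw [hwt]; exact wt_summable (p := 1.72) nN le_rfl hCG hGr
  have s2 : Summable fun m : ℕ => wt m * ((1 + Real.log m) ^ 2)⁻¹ := by
    have := wt_summable (θ := θ) (p := 2) nN le_rfl hCG hGr
    rw [hwt]
    refine this.congr fun m => ?_
    rw [Real.rpow_neg (by linarith [hl m]), Real.rpow_two]
  have sA : Summable fun m : ℕ => wt m * Ay (θ m) := by
    refine Summable.of_nonneg_of_le (fun m => mul_nonneg (hw0 m) (Ay_bd _).1) (fun m => ?_) (s2.mul_left C)
    rw [mul_left_comm]
    exact mono m _ _ fun hm => (pw _ _ 0 (hD m hm) le_rfl).1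
  obtain ⟨S, hS⟩ : ∃ S, S = ∑' m : ℕ, wt m * Ay (θ m) := ⟨_, rfl⟩
  obtain ⟨Φ, hΦ⟩ : ∃ Φ : ℝ → ℝ, Φ = fun z => ∑' m : ℕ, wt m * Xm (Real.log m) (θ m) z := ⟨_, rfl⟩
  have HS : ∀ z, 0 ≤ z → HasSum (fun m : ℕ => wt m * Xm (Real.log m) (θ m) z) (Φ z) ∧
      |Φ z + GG θ z - (1 - S) * (z + C0)| ≤ 30 * Real.exp (-z / 2) := fun z hz => by
    have h1 := Xsum hθ (by rw [hwt] at sA; exact sA) (z := z)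
    have h2 : Φ z = ∑' m : ℕ, am θ m / m * Xm (Real.log m) (θ m) z := by rw [hΦ, hwt]
    rw [h1.tsum_eq] at h2
    refine ⟨by rw [h2, hwt]; exact h1, ?_⟩
    refine le_trans (le_of_eq ?_) (Main0 hθ hz)
    rw [h2, hS, hwt]
    congr 1; ring
  have he1 : ∀ z : ℝ, 0 ≤ z → Real.exp (-z / 2) ≤ 1 := fun z hz => Real.exp_le_one_iff.2 lI
  have fb1 : ∀ (z : ℝ) (m : ℕ), 0 ≤ z → |wt m * Xm (Real.log m) (θ m) z| ≤ wt m * (C * (1 + Real.log m)⁻¹) := fun z m hz => by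
    rw [abs_mul, abs_of_nonneg (hw0 m)]
    exact mono m _ _ fun hm => (pw _ _ z (hD m hm) hz).2.1
  have fb2 : ∀ (z : ℝ) (m : ℕ), 0 ≤ z → |wt m * Xm (Real.log m) (θ m) z| ≤ wt m * (C * ((1 + z) * ((1 + Real.log m) ^ 2)⁻¹)) := fun z m hz => by
    rw [abs_mul, abs_of_nonneg (hw0 m)]
    exact mono m _ _ fun hm => (pw _ _ z (hD m hm) hz).2.2.1
  have S1 : 1 - S = 0 := by
    have t1 : Tendsto (fun z : ℝ => ∑' m : ℕ, wt m * Xm (Real.log m) (θ m) z * (1 + z)⁻¹) atTop (𝓝 (∑' _m : ℕ, o0)) := by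
      refine tendsto_tsum_of_dominated_convergence (s2.mul_left C) (fun m => ?_) ?_
      · refine squeeze_zero_norm' ?_ (inv_lim (wt m * (C * (1 + Real.log m)⁻¹)))
        filter_upwards [eventually_ge_atTop o0] with z hz
        rw [Real.norm_eq_abs, abs_mul, abs_of_nonneg (by positivity : 0 ≤ (1 + z)⁻¹)]
        exact mul_le_mul_of_nonneg_right (fb1 z m hz) pV
      · filter_upwards [eventually_ge_atTop o0] with z hz m
        rw [Real.norm_eq_abs, abs_mul, abs_of_nonneg (by positivity : 0 ≤ (1 + z)⁻¹), ← div_eq_mul_inv, div_le_iff₀ pV]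
        refine (fb2 z m hz).trans (le_of_eq (by ring))
    rw [tsum_zero] at t1
    have t2 : Tendsto (fun z : ℝ => (1 - S) - ∑' m : ℕ, wt m * Xm (Real.log m) (θ m) z * (1 + z)⁻¹) atTop (𝓝 0) := by
      refine squeeze_zero_norm' ?_ (inv_lim (|1 - S| + CG + 30))
      filter_upwards [eventually_ge_atTop o0] with z hz
      obtain ⟨a1, a2⟩ := HS z hz
      rw [Real.norm_eq_abs, tsum_mul_right, a1.tsum_eq, ← div_eq_mul_inv, ← div_eq_mul_inv, le_div_iff₀ pV]
      have hz1 : o0 < 1 + z := lI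
      nth_rw 2 [← abs_of_pos hz1]
      rw [← abs_mul, sub_mul, div_mul_cancel₀ _ hz1.ne']
      have b1 := abs_le.1 a2
      have b2 := he1 z hz
      have b3 := hG z hz
      have b4 := GG_nonneg θ z
      have b5 : |(1 - S) * (1 - C0)| ≤ |1 - S| := by
        rw [abs_mul]
        have := C0_bd
        exact mul_le_of_le_one_right (abs_nonneg _) (abs_le.2 ⟨lI, lI⟩)
      have b6 := abs_le.1 b5
      exact abs_le.2 ⟨by linarith [b6.1, b6.2, b1.1, b1.2], by linarith [b6.1, b6.2, b1.1, b1.2]⟩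
    have t3 := t2.add t1
    simp only [sub_add_cancel, add_zero] at t3
    exact tendsto_nhds_unique tendsto_const_nhds t3
  have Φb : ∀ z, 0 ≤ z → Φ z ≤ 30 * Real.exp (-z / 2) := fun z hz => by
    have := (abs_le.1 (HS z hz).2).2
    rw [S1, zero_mul] at this
    linarith [GG_nonneg θ z]
  have s3 : Summable fun m : ℕ => wt m * (C * (1 + Real.log m)⁻¹) := by
    suffices hs : Summable fun m : ℕ => k * (wt m * (1 + Real.log m)⁻¹) by
      refine (hs.mul_left (C / k)).congr fun m => ?_
      field_simp
    refine summable_of_sum_le (c := 30 + C * (∑' m : ℕ, wt m * (1 + Real.log m) ^ o7) + C * (Real.exp 1 * (4 * CG)))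
      (fun m => mul_nonneg hk.le (mul_nonneg (hw0 m) (by have := hl m; positivity))) fun F => ?_
    obtain ⟨z, hz⟩ : ∃ z : ℝ, z = ∑ m ∈ F, U * (1 + Real.log m) := ⟨_, rfl⟩
    have hp : ∀ m : ℕ, 0 ≤ U * (1 + Real.log m) := fun m => by have := hl m; positivity
    have hz0 : 0 ≤ z := by rw [hz]; exact Finset.sum_nonneg fun m _ => hp m
    have hzF : ∀ m ∈ F, U * (1 + Real.log m) ≤ z := fun m hm => by
      rw [hz]; exact Finset.single_le_sum (f := fun m : ℕ => U * (1 + Real.log m)) (fun m _ => hp m) hm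
    have kb : ∀ F : Finset ℕ, ∑ m ∈ F, wt m * ((1 + z) / (2 + Real.log m + z) ^ 2) ≤ Real.exp 1 * (4 * CG) := fun F => by
      have := kbs hCG hG (by linarith : 1 ≤ 1 + z) F
      rw [hwt]
      refine le_trans (le_of_eq (Finset.sum_congr rfl fun m _ => ?_)) this
      rw [show 2 + Real.log m + z = 1 + Real.log m + (1 + z) by ring]
    have kn : ∀ m : ℕ, 0 ≤ wt m * ((1 + z) / (2 + Real.log m + z) ^ 2) := fun m => mul_nonneg (hw0 m) pV
    have k1 : Summable fun m : ℕ => wt m * ((1 + z) / (2 + Real.log m + z) ^ 2) := summable_of_sum_le kn kb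
    have k2 := Real.tsum_le_of_sum_le kn kb
    have k3 := (((hasSum_ite_mem F fun m => k * (wt m * (1 + Real.log m)⁻¹)).sub (s1.hasSum.mul_left C)).sub (k1.hasSum.mul_left C))
    have k4 := hasSum_le (fun m => ?_) k3 (HS z hz0).1
    · have k5 := Φb z hz0
      have k6 := he1 z hz0
      have k7 := mul_le_mul_of_nonneg_left k2 hC.le
      linarith
    · rcases Nat.eq_zero_or_pos m with rfl | hm
      · simp [hwz]
      · obtain ⟨-, -, -, r1, r2⟩ := pw _ _ z (hD m hm) hz0
        have r3 := mul_le_mul_of_nonneg_left r1 (hw0 m)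
        have r4 := kn m
        have r5 := mul_nonneg hC.le r4
        split_ifs with hmF
        · have r6 := mul_le_mul_of_nonneg_left (r2 (hzF m hmF)) (hw0 m)
          linarith
        · linarith
  obtain ⟨C1, hC1, h1⟩ := B1'
  have tm : ∀ m : ℕ, Tendsto (fun z => wt m * Xm (Real.log m) (θ m) z) atTop (𝓝 (wt m * (Ay (θ m) * (2 * Ly (θ m) - Real.log m)))) := fun m => by
    rcases Nat.eq_zero_or_pos m with rfl | hm
    · simp [hwz]
    refine Tendsto.const_mul _ ?_
    have hy := (hD m hm).y2
    have hL : 0 < Real.log (θ m) := Real.log_pos lI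
    rw [tendsto_iff_norm_sub_tendsto_zero]
    have te : Tendsto (fun z : ℝ => C1 * (Real.log (θ m) + 1) ^ 12 * Real.exp (-((z - Real.log m) / Real.log (θ m)) / 4)) atTop (𝓝 (C1 * (Real.log (θ m) + 1) ^ 12 * 0)) := by
      refine Tendsto.const_mul _ (Real.tendsto_exp_atBot.comp ?_)
      have : Tendsto (fun z : ℝ => (z - Real.log m) / Real.log (θ m)) atTop atTop :=
        (tendsto_atTop_add_const_right atTop (-Real.log m) tendsto_id).atTop_div_const hL
      exact (tendsto_neg_atTop_atBot.comp this).atBot_div_const nN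
    rw [mul_zero] at te
    refine squeeze_zero' (Eventually.of_forall fun z => norm_nonneg _) ?_ te
    filter_upwards [eventually_ge_atTop (Real.log m)] with z hz
    refine le_trans (le_of_eq ?_) (h1 (θ m) (z - Real.log m) hy lI)
    rw [Real.norm_eq_abs, Xm]
    congr 1; ring
  obtain ⟨g, hg⟩ : ∃ g : ℕ → ℝ, g = fun m => wt m * (Ay (θ m) * (2 * Ly (θ m) - Real.log m)) := ⟨_, rfl⟩
  have tt : Tendsto Φ atTop (𝓝 (∑' m, g m)) := by
    rw [hΦ, hg]
    refine tendsto_tsum_of_dominated_convergence s3 tm ?_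
    filter_upwards [eventually_ge_atTop o0] with z hz m
    exact fb1 z m hz
  have gs : Summable g := by
    refine Summable.of_norm_bounded s3 fun m => ?_
    rw [hg]
    refine le_of_tendsto (tm m).norm ?_
    filter_upwards [eventually_ge_atTop o0] with z hz
    exact fb1 z m hz
  have g0 : ∀ m, 0 ≤ g m := fun m => by
    have := mono m 0 (Ay (θ m) * (2 * Ly (θ m) - Real.log m)) fun hm =>
      mul_nonneg (Ay_bd _).1 (by linarith [Ly_lb hm (le_trans (by exact_mod_cast le_max_right 2 m) (hθ m hm))])
    rw [hg]; linarith
  have g1 : 0 < g 1 := by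
    have hy := (hD 1 le_rfl).y2
    have e : wt 1 = 1 := by
      have : (1:ℕ) ∈ Bset θ := ⟨one_pos, fun p hp hd => absurd (Nat.dvd_one.1 hd) hp.ne_one⟩
      rw [hwt]; simp [am, this, tau]
    rw [hg]
    simp only [e, Nat.cast_one, Real.log_one, sub_zero, one_mul]
    exact mul_pos (Ay_pos hy) (by linarith [Ly_pos hy])
  have gp : 0 < ∑' m, g m := gs.tsum_pos g0 1 g1
  have te : Tendsto (fun z : ℝ => 30 * Real.exp (-z / 2)) atTop (𝓝 (30 * 0)) :=
    (Real.tendsto_exp_atBot.comp (tendsto_neg_atTop_atBot.atBot_div_const nN)).const_mul 30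
  have := le_of_tendsto_of_tendsto tt te (by
    filter_upwards [eventually_ge_atTop o0] with z hz
    exact Φb z hz)
  linarith
lemma KD.asym_pos (h : KD ξ c δ) (hθ : ∀ n : ℕ, 1 ≤ n → ((max 2 n : ℕ) : ℝ) ≤ θ n) {Kb : ℝ} (hKb : 0 ≤ Kb)
    (hD : ∀ m : ℕ, 1 ≤ m → Dat Kb (Real.log m) (θ m)) : ∃ ν C : ℝ, 0 < ν ∧ 0 ≤ C ∧ ∀ z, 0 ≤ z → |GG θ z - ν * z ^ δ| ≤ C := by
  obtain ⟨ν, C, hC, ha⟩ := h.asym hθ hKb hD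
  have hν : 0 < ν := by
    by_contra hn
    push Not at hn
    refine no_bd h.toKC.toKX hθ hKb hD (CG := C + 62) pV fun r hr => ?_
    rcases le_total 1 r with h1 | h1
    · have := (abs_le.1 (ha r h1)).2
      have : ν * r ^ δ ≤ 0 := mul_nonpos_of_nonpos_of_nonneg hn pV
      linarith
    · linarith [GG_triv hθ hr]
  refine ⟨ν, C + 62 + ν, hν, pV, fun z hz => ?_⟩
  rcases le_total 1 z with h1 | h1
  · linarith [ha z h1]
  · have := GG_triv hθ hz
    have := GG_nonneg θ z
    have e1 : z ^ δ ≤ 1 := Real.rpow_le_one hz h1 (by linarith [h.d1])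
    have e2 : 0 ≤ ν * z ^ δ := pV
    have e3 : ν * z ^ δ ≤ ν := mul_le_of_le_one_right hν.le e1
    exact abs_le.2 ⟨lI, lI⟩
variable {ξ : ℝ → ℝ} {c δ : ℝ} {θ : ℕ → ℝ}
lemma mk_dat {a K : ℝ} (ha : a < 1/4) (hθlow : ∀ n : ℕ, 1 ≤ n → ((max 2 n : ℕ) : ℝ) ≤ θ n)
    (hθhigh : ∀ n : ℕ, 1 ≤ n → θ n ≤ K * n * Real.exp ((Real.log n) ^ a)) :
    ∃ Kb : ℝ, 0 ≤ Kb ∧ ∀ m : ℕ, 1 ≤ m → Dat Kb (Real.log m) (θ m) := by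
  have lo2 : ∀ m : ℕ, 1 ≤ m → o2 ≤ θ m := fun m hm => le_trans (by exact_mod_cast le_max_left 2 m) (hθlow m hm)
  have hK : 0 < K := by
    have h1 := (lo2 1 le_rfl).trans (hθhigh 1 le_rfl)
    rw [Nat.cast_one, mul_one] at h1
    by_contra hn
    push Not at hn
    linarith [mul_nonpos_of_nonpos_of_nonneg hn (Real.exp_pos ((Real.log 1) ^ a)).le]
  obtain ⟨A, hA⟩ : ∃ A, A = 1 + (Real.log 2) ^ a := ⟨_, rfl⟩
  have hl2 : 0 < Real.log 2 := Real.log_pos nN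
  have hA1 : 0 ≤ (Real.log 2) ^ a := pV
  refine ⟨|Real.log K| + A, by rw [hA]; positivity, fun m hm => ?_⟩
  have hm0 : o0 < m := by exact_mod_cast hm
  have hw : 0 ≤ Real.log m := Real.log_natCast_nonneg m
  have hs : o1 ≤ (1 + Real.log m) ^ oq := Real.one_le_rpow lI nN
  have hwa : (Real.log m) ^ a ≤ A * (1 + Real.log m) ^ oq := by
    have hA2 : A * 1 ≤ A * (1 + Real.log m) ^ oq := mul_le_mul_of_nonneg_left hs lI
    rcases le_total 0 a with h0 | h0
    · have e1 : (Real.log m) ^ a ≤ (1 + Real.log m) ^ a := Real.rpow_le_rpow hw lI h0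
      have e2 : (1 + Real.log m) ^ a ≤ (1 + Real.log m) ^ oq := Real.rpow_le_rpow_of_exponent_le lI ha.le
      have e3 : 1 * (1 + Real.log m) ^ oq ≤ A * (1 + Real.log m) ^ oq := mul_le_mul_of_nonneg_right lI lI
      linarith
    · refine le_trans ?_ hA2
      rcases Nat.lt_or_ge m 2 with h2 | h2
      · rw [show m = 1 by omega, Nat.cast_one, Real.log_one]
        rcases h0.eq_or_lt with h3 | h3
        · rw [h3, Real.rpow_zero]; linarith
        · rw [Real.zero_rpow h3.ne]; linarith
      · have : Real.log 2 ≤ Real.log m := Real.log_le_log nN (by exact_mod_cast h2)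
        have := Real.rpow_le_rpow_of_nonpos hl2 this h0
        linarith
  refine ⟨hw, lo2 m hm, Real.log_le_log hm0 (le_trans (by exact_mod_cast le_max_right 2 m) (hθlow m hm)), ?_⟩
  have h1 := Real.log_le_log (by linarith [lo2 m hm]) (hθhigh m hm)
  rw [Real.log_mul pV (Real.exp_pos _).ne', Real.log_mul hK.ne' hm0.ne', Real.log_exp] at h1
  have h2 := le_abs_self (Real.log K)
  have h3 := mul_le_mul_of_nonneg_left hs (abs_nonneg (Real.log K))
  linarith
lemma mk_KD (hξ0 : ∀ u : ℝ, u < 1 → ξ u = 0)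
    (hξ : ∀ u : ℝ, 1 ≤ u → u * ξ u = 2 + 2 * ∫ t in o1..(u - 1), ξ t)
    (hδ1 : 0.713611 < δ) (hδ2 : δ < 0.713614) (hc : c = Real.exp (-2 * Real.eulerMascheroniConstant))
    (hδeq : 0 = 1 + (∫ v in Set.Ioi o0, (ξ v - (v + 2) * c) * (v + 1) ^ (-δ - 1)) + c / δ + c / (δ - 1)) : KD ξ c δ := by
  have hX : IsXi ξ := ⟨hξ0, hξ⟩
  obtain ⟨K, hK, hb⟩ := hX.bound δ hδ1 hδ2 c hc hδeq
  refine { z := hξ0, e := hξ, c0 := by rw [hc]; positivity, bd := ⟨K, hK, hb⟩, cl := by rw [hc]; exact c_lo, ch := by rw [hc]; exact c_hi, d1 := hδ1, d2 := hδ2, J := ?_ }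
  have e : ∫ t in Set.Ioi o1, jf ξ c δ t = ∫ v in Set.Ioi o0, (ξ v - (v + 2) * c) * (v + 1) ^ (-δ - 1) := by
    have := (measurePreserving_add_right volume o1).setIntegral_preimage_emb (MeasurableEquiv.addRight o1).measurableEmbedding (jf ξ c δ) (Set.Ioi 1)
    rw [← this, Set.preimage_add_const_Ioi, sub_self]
    refine setIntegral_congr_fun measurableSet_Ioi fun v _ => ?_
    simp only [jf, kap, add_sub_cancel_right]
    ring
  rw [e]
  have e3 : c / (δ - 1) = - (c / (1 - δ)) := by rw [← neg_sub, div_neg]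
  linarith
end PN
end XI
theorem thmgen (ξ : ℝ → ℝ)
    (hξ0 : ∀ u : ℝ, u < 1 → ξ u = 0)
    (hξ : ∀ u : ℝ, 1 ≤ u → u * ξ u = 2 + 2 * ∫ t in (1:ℝ)..(u - 1), ξ t)
    (δ : ℝ) (hδ1 : 0.713611 < δ) (hδ2 : δ < 0.713614)
    (hδeq : 0 = 1 + (∫ v in Set.Ioi (0:ℝ),
          (ξ v - (v + 2) * Real.exp (-2 * Real.eulerMascheroniConstant)) *
            (v + 1) ^ (-δ - 1)) +
        Real.exp (-2 * Real.eulerMascheroniConstant) / δ +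
        Real.exp (-2 * Real.eulerMascheroniConstant) / (δ - 1))
    (a : ℝ) (ha : a < (1 - δ) / (2 - δ))
    (θ : ℕ → ℝ) (K : ℝ)
    (hθlow : ∀ n : ℕ, 1 ≤ n → (max 2 n : ℕ) ≤ θ n)
    (hθhigh : ∀ n : ℕ, 1 ≤ n → θ n ≤ K * n * Real.exp ((Real.log n) ^ a)) :
    ∃ ν : ℝ, 0 < ν ∧ ∃ C : ℝ, ∀ x : ℝ, 2 ≤ x →
      |T θ x - ν * x * (Real.log x) ^ δ| ≤ C * x := by
  have h4 : a < 1/4 := ha.trans (by rw [div_lt_div_iff₀ (by linarith) (by norm_num)]; linarith)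
  obtain ⟨Kb, hKb, hD⟩ := PN.mk_dat h4 hθlow hθhigh
  obtain ⟨ν, C, hν, hC, hz⟩ := (PN.mk_KD hξ0 hξ hδ1 hδ2 rfl hδeq).asym_pos hθlow hKb hD
  refine ⟨ν, hν, C, fun x hx => ?_⟩
  have hx0 : 0 < x := by linarith
  have h1 := hz (Real.log x) (Real.log_nonneg (by linarith))
  have h2 := PN.T_eq θ (Real.log x)
  rw [Real.exp_log hx0] at h2
  rw [PN.GG, Real.exp_neg, Real.exp_log hx0, ← h2] at h1
  have e : T θ x - ν * x * (Real.log x) ^ δ = x * (x⁻¹ * T θ x - ν * (Real.log x) ^ δ) := by field_simp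
  rw [e, abs_mul, abs_of_pos hx0, mul_comm C]
  exact mul_le_mul_of_nonneg_left h1 hx0.le
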